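/- Let N ≥ 14 be an integer, let δ ∈ (0, 1/10), and fix real constants M₁, N₁, N₂, N₃, P⁰, P¹, P², P³. Then there exist ε₀ > 0 and C > 0, independent of m, such that for every m ∈ [0,1], every ε ∈ (0, ε₀), and all smooth initial data (u₀, v₀, u₁, v₁) supported in the closed unit ball B(0,1) ⊂ ℝ³ with ‖u₀‖_{H^{N+1}(ℝ³)} + ‖v₀‖_{H^{N+1}(ℝ³)} + ‖u₁‖_{H^N(ℝ³)} + ‖v₁‖_{H^N(ℝ³)} ≤ ε, there exist smooth functions u, v : [2, ∞) × ℝ³ → ℝ satisfying −□u + m²u = M₁ v³ + Σ_α P^α ∂_α(v²) and −□v + v = N₁ (∂_t u)² + N₂ u³ + N₃ u v on (2, ∞) × ℝ³, with (u, v)(2, ·) = (u₀, v₀) and (∂_t u, ∂_t v)(2, ·) = (u₁, v₁), and such that |u(t,x)| ≤ C/(t + m t^{3/2}) and |v(t,x)| ≤ C t^{−3/2+δ} for all t ≥ 2 and x ∈ ℝ³. -/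

import Mathlib

open MeasureTheory Real
noncomputable section

def pder (α : Fin 4) (φ : (Fin 4 → ℝ) → ℝ) (y : Fin 4 → ℝ) : ℝ :=
  fderiv ℝ φ y (Pi.single α 1)

def Lb (a : Fin 3) (φ : (Fin 4 → ℝ) → ℝ) (y : Fin 4 → ℝ) : ℝ :=
  y a.succ * pder 0 φ y + y 0 * pder a.succ φ y

def rotVF (a b : Fin 3) (φ : (Fin 4 → ℝ) → ℝ) (y : Fin 4 → ℝ) : ℝ :=
  y a.succ * pder b.succ φ y - y b.succ * pder a.succ φ y

def Box (φ : (Fin 4 → ℝ) → ℝ) (y : Fin 4 → ℝ) : ℝ :=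
  - pder 0 (pder 0 φ) y + ∑ a : Fin 3, pder a.succ (pder a.succ φ) y

inductive VF : Type
  | pd : Fin 4 → VF
  | boost : Fin 3 → VF
  | rot : Fin 3 → Fin 3 → VF
  deriving DecidableEq, Fintype

def VF.apply : VF → ((Fin 4 → ℝ) → ℝ) → ((Fin 4 → ℝ) → ℝ)
  | .pd α, φ => pder α φ
  | .boost a, φ => Lb a φ
  | .rot a b, φ => rotVF a b φ

def applyComp {n : ℕ} (Γ : Fin n → VF) (φ : (Fin 4 → ℝ) → ℝ) : (Fin 4 → ℝ) → ℝ :=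
  (List.ofFn Γ).foldr VF.apply φ

def spt (t : ℝ) (x : Fin 3 → ℝ) : Fin 4 → ℝ := Fin.cons t x
def rad (x : Fin 3 → ℝ) : ℝ := Real.sqrt (∑ i, x i ^ 2)
def L2normSq (g : (Fin 3 → ℝ) → ℝ) : ℝ := ∫ x : Fin 3 → ℝ, g x ^ 2
def L2norm (g : (Fin 3 → ℝ) → ℝ) : ℝ := Real.sqrt (L2normSq g)

def pderx (a : Fin 3) (g : (Fin 3 → ℝ) → ℝ) (x : Fin 3 → ℝ) : ℝ :=
  fderiv ℝ g x (Pi.single a 1)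
def pderxIter (k : Fin 3 → ℕ) (g : (Fin 3 → ℝ) → ℝ) : (Fin 3 → ℝ) → ℝ :=
  (pderx 0)^[k 0] ((pderx 1)^[k 1] ((pderx 2)^[k 2] g))
def sobNormSq (N : ℕ) (g : (Fin 3 → ℝ) → ℝ) : ℝ :=
  ∑ k ∈ Finset.univ.filter (fun k : Fin 3 → Fin (N+1) => ∑ i, (k i : ℕ) ≤ N),
    L2normSq (pderxIter (fun i => (k i : ℕ)) g)
def sobNorm (N : ℕ) (g : (Fin 3 → ℝ) → ℝ) : ℝ := Real.sqrt (sobNormSq N g)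

def hypPoint (s : ℝ) (x : Fin 3 → ℝ) : Fin 4 → ℝ := spt (Real.sqrt (s^2 + ∑ i, x i ^ 2)) x
def hypL2Sq (s : ℝ) (φ : (Fin 4 → ℝ) → ℝ) : ℝ := ∫ x : Fin 3 → ℝ, (φ (hypPoint s x))^2
def hypEnergy (μ s : ℝ) (φ : (Fin 4 → ℝ) → ℝ) : ℝ :=
  ∫ x : Fin 3 → ℝ,
    ((pder 0 φ (hypPoint s x))^2 + ∑ a : Fin 3, (pder a.succ φ (hypPoint s x))^2
      + 2 * ∑ a : Fin 3, (x a / hypPoint s x 0) * pder 0 φ (hypPoint s x) * pder a.succ φ (hypPoint s x)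
      + μ^2 * (φ (hypPoint s x))^2)

def flatEnergy (μ t : ℝ) (φ : (Fin 4 → ℝ) → ℝ) : ℝ :=
  (∑ α : Fin 4, L2normSq (fun x => pder α φ (spt t x))) + μ^2 * L2normSq (fun x => φ (spt t x))

def Xnorm (N : ℕ) (δ m : ℝ) (φ ψ : (Fin 4 → ℝ) → ℝ) : ℝ :=
  (⨆ t : {t : ℝ // 2 ≤ t}, ∑ n ∈ Finset.range (N+1), ∑ Γs : Fin n → VF,
    (flatEnergy 1 t (applyComp Γs φ) + (t : ℝ) ^ (-δ) * flatEnergy 1 t (applyComp Γs ψ)))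
  + (⨆ s : {s : ℝ // 2 ≤ s}, ∑ n ∈ Finset.range (N - 5 + 1), ∑ Γs : Fin n → VF,
    (Real.sqrt (hypEnergy m s (applyComp Γs φ))
      + (s : ℝ) ^ (-δ) * Real.sqrt (hypEnergy 1 s (applyComp Γs ψ))))

namespace WKG
open scoped ContDiff

section Jets
variable {E : Type} [NormedAddCommGroup E] [NormedSpace ℝ E] {ι : Type} [Fintype ι]

/-- The derivative of `f` along the vector field `X`. -/
def vf (X : E → E) (f : E → ℝ) (y : E) : ℝ := fderiv ℝ f y (X y)

/-- The sum of the functional `A` over all iterated derivatives of `f` of order at most `k`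
along the vector fields `X i`. -/
def jsum (X : ι → E → E) : ℕ → ((E → ℝ) → ℝ) → (E → ℝ) → ℝ
  | 0, A, f => A f
  | k + 1, A, f => A f + ∑ i, jsum X k A (vf (X i) f)

/-- The sum of the squares of the derivatives of order at most `k`, at the point `y`. -/
def jet (X : ι → E → E) (k : ℕ) (f : E → ℝ) (y : E) : ℝ := jsum X k (fun g => g y ^ 2) f

lemma vf_smooth {X : E → E} {f : E → ℝ} (hX : ContDiff ℝ ∞ X) (hf : ContDiff ℝ ∞ f) :
    ContDiff ℝ ∞ (vf X f) :=
  (hf.fderiv_right (by simp)).clm_apply hX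

lemma smooth_diff {f : E → ℝ} (hf : ContDiff ℝ ∞ f) (y : E) : DifferentiableAt ℝ f y :=
  (hf.differentiable (by simp)) y

lemma vf_add {X : E → E} {f g : E → ℝ} (hf : ContDiff ℝ ∞ f) (hg : ContDiff ℝ ∞ g) :
    vf X (fun y => f y + g y) = fun y => vf X f y + vf X g y := by
  funext y
  simp only [vf]
  rw [fderiv_fun_add (smooth_diff hf y) (smooth_diff hg y)]; rfl

lemma vf_sub {X : E → E} {f g : E → ℝ} (hf : ContDiff ℝ ∞ f) (hg : ContDiff ℝ ∞ g) :
    vf X (fun y => f y - g y) = fun y => vf X f y - vf X g y := by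
  funext y
  simp only [vf]
  rw [fderiv_fun_sub (smooth_diff hf y) (smooth_diff hg y)]; rfl

lemma vf_mul {X : E → E} {f g : E → ℝ} (hf : ContDiff ℝ ∞ f) (hg : ContDiff ℝ ∞ g) :
    vf X (fun y => f y * g y) = fun y => vf X f y * g y + f y * vf X g y := by
  funext y
  simp only [vf]
  rw [fderiv_fun_mul (smooth_diff hf y) (smooth_diff hg y)]
  simp; ring

lemma vf_const_mul {X : E → E} (c : ℝ) {f : E → ℝ} (hf : ContDiff ℝ ∞ f) :
    vf X (fun y => c * f y) = fun y => c * vf X f y := by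
  funext y
  simp only [vf]
  rw [fderiv_const_mul (smooth_diff hf y)]; rfl

lemma vf_sum {X : E → E} {κ : Type} {s : Finset κ} {f : κ → E → ℝ}
    (hf : ∀ i, ContDiff ℝ ∞ (f i)) :
    vf X (fun y => ∑ i ∈ s, f i y) = fun y => ∑ i ∈ s, vf X (f i) y := by
  funext y
  simp only [vf]
  rw [fderiv_fun_sum (fun i _ => smooth_diff (hf i) y)]
  simp

lemma vf_congr {X : E → E} {f g : E → ℝ} {U : Set E} (hU : IsOpen U) (h : Set.EqOn f g U) :
    Set.EqOn (vf X f) (vf X g) U := by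
  intro y hy
  have : f =ᶠ[nhds y] g := Filter.eventuallyEq_of_mem (hU.mem_nhds hy) h
  simp only [vf, this.fderiv_eq]

variable (X : ι → E → E)

lemma jsum_nonneg {A : (E → ℝ) → ℝ} (hA : ∀ f, 0 ≤ A f) (k : ℕ) (f : E → ℝ) :
    0 ≤ jsum X k A f := by
  induction k generalizing f with
  | zero => exact hA f
  | succ k ih => exact add_nonneg (hA f) (Finset.sum_nonneg fun i _ => ih _)

lemma jsum_base_le {A : (E → ℝ) → ℝ} (hA : ∀ f, 0 ≤ A f) (k : ℕ) (f : E → ℝ) :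
    A f ≤ jsum X k A f := by
  cases k with
  | zero => exact le_rfl
  | succ k =>
    exact le_add_of_nonneg_right (Finset.sum_nonneg fun i _ => jsum_nonneg X hA k _)

lemma jsum_vf_le {A : (E → ℝ) → ℝ} (hA : ∀ f, 0 ≤ A f) (k : ℕ) (f : E → ℝ) (i : ι) :
    jsum X k A (vf (X i) f) ≤ jsum X (k + 1) A f :=
  le_add_of_nonneg_of_le (hA f)
    (Finset.single_le_sum (f := fun i => jsum X k A (vf (X i) f))
      (fun _ _ => jsum_nonneg X hA k _) (Finset.mem_univ i))

lemma jsum_succ_le {A : (E → ℝ) → ℝ} (hA : ∀ f, 0 ≤ A f) (k : ℕ) (f : E → ℝ) :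
    jsum X k A f ≤ jsum X (k + 1) A f := by
  induction k generalizing f with
  | zero => exact jsum_base_le X hA 1 f
  | succ k ih => exact add_le_add le_rfl (Finset.sum_le_sum fun i _ => ih _)

lemma jsum_mono {A : (E → ℝ) → ℝ} (hA : ∀ f, 0 ≤ A f) {k l : ℕ} (h : k ≤ l) (f : E → ℝ) :
    jsum X k A f ≤ jsum X l A f :=
  monotone_nat_of_le_succ (f := fun k => jsum X k A f) (fun k => jsum_succ_le X hA k f) h

/-- A class of functions stable under all the derivations `X i`. -/
def Stable (C : (E → ℝ) → Prop) : Prop := ∀ f, C f → ∀ i, C (vf (X i) f)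

variable {X}

lemma jsum_le_jsum {C : (E → ℝ) → Prop} (hC : Stable X C) {A B : (E → ℝ) → ℝ}
    (h : ∀ f, C f → A f ≤ B f) (k : ℕ) {f : E → ℝ} (hf : C f) :
    jsum X k A f ≤ jsum X k B f := by
  induction k generalizing f with
  | zero => exact h f hf
  | succ k ih => exact add_le_add (h f hf) (Finset.sum_le_sum fun i _ => ih (hC f hf i))

lemma jsum_congr {C : (E → ℝ) → Prop} (hC : Stable X C) {A B : (E → ℝ) → ℝ}
    (h : ∀ f, C f → A f = B f) (k : ℕ) {f : E → ℝ} (hf : C f) :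
    jsum X k A f = jsum X k B f :=
  le_antisymm (jsum_le_jsum hC (fun f hf => (h f hf).le) k hf)
    (jsum_le_jsum hC (fun f hf => (h f hf).ge) k hf)

lemma jsum_const_mul (c : ℝ) (A : (E → ℝ) → ℝ) (k : ℕ) (f : E → ℝ) :
    jsum X k (fun g => c * A g) f = c * jsum X k A f := by
  induction k generalizing f with
  | zero => rfl
  | succ k ih => simp only [jsum, ih, mul_add, Finset.mul_sum]

lemma jsum_add (A B : (E → ℝ) → ℝ) (k : ℕ) (f : E → ℝ) :
    jsum X k (fun g => A g + B g) f = jsum X k A f + jsum X k B f := by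
  induction k generalizing f with
  | zero => rfl
  | succ k ih => simp only [jsum, ih, Finset.sum_add_distrib]; ring

lemma jsum_finset_sum {κ : Type} (s : Finset κ) (A : κ → (E → ℝ) → ℝ) (k : ℕ) (f : E → ℝ) :
    jsum X k (fun g => ∑ a ∈ s, A a g) f = ∑ a ∈ s, jsum X k (A a) f := by
  induction k generalizing f with
  | zero => rfl
  | succ k ih =>
    simp only [jsum, ih, Finset.sum_add_distrib]
    rw [Finset.sum_comm]

/-- Iterating the jet sums of orders `k` and `l` is controlled by the jet sum of order `k + l`. -/
lemma jsum_jsum_le {A : (E → ℝ) → ℝ} (hA : ∀ f, 0 ≤ A f) (k l : ℕ) (f : E → ℝ) :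
    jsum X k (fun g => jsum X l A g) f ≤ (k + 1) * jsum X (k + l) A f := by
  induction k generalizing f with
  | zero => simp [jsum]
  | succ k ih =>
    have h1 : jsum X l A f ≤ jsum X (k + 1 + l) A f := jsum_mono X hA (by omega) f
    have h2 : ∑ i, jsum X k (fun g => jsum X l A g) (vf (X i) f)
        ≤ (k + 1) * jsum X (k + 1 + l) A f := by
      calc ∑ i, jsum X k (fun g => jsum X l A g) (vf (X i) f)
          ≤ ∑ i, (k + 1) * jsum X (k + l) A (vf (X i) f) := Finset.sum_le_sum fun i _ => ih _
        _ = (k + 1) * ∑ i, jsum X (k + l) A (vf (X i) f) := by rw [Finset.mul_sum]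
        _ ≤ (k + 1) * jsum X (k + 1 + l) A f := by
            apply mul_le_mul_of_nonneg_left _ (by positivity)
            rw [show k + 1 + l = (k + l) + 1 by omega]
            exact le_add_of_nonneg_left (hA f)
    simp only [jsum]
    push_cast
    linarith

lemma jet_nonneg (k : ℕ) (f : E → ℝ) (y : E) : 0 ≤ jet X k f y :=
  jsum_nonneg X (fun _ => sq_nonneg _) k f

lemma jet_mono {k l : ℕ} (h : k ≤ l) (f : E → ℝ) (y : E) : jet X k f y ≤ jet X l f y :=
  jsum_mono X (fun _ => sq_nonneg _) h f

lemma sq_le_jet (k : ℕ) (f : E → ℝ) (y : E) : f y ^ 2 ≤ jet X k f y :=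
  jsum_base_le X (A := fun g => g y ^ 2) (fun _ => sq_nonneg _) k f

lemma jet_vf_le (k : ℕ) (f : E → ℝ) (y : E) (i : ι) :
    jet X k (vf (X i) f) y ≤ jet X (k + 1) f y :=
  jsum_vf_le X (fun _ => sq_nonneg _) k f i

lemma jet_zero (f : E → ℝ) (y : E) : jet X 0 f y = f y ^ 2 := rfl

lemma jet_succ (k : ℕ) (f : E → ℝ) (y : E) :
    jet X (k + 1) f y = f y ^ 2 + ∑ i, jet X k (vf (X i) f) y := rfl

lemma jet_congr {f g : E → ℝ} {U : Set E} (hU : IsOpen U) (h : Set.EqOn f g U) (k : ℕ) {y : E}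
    (hy : y ∈ U) : jet X k f y = jet X k g y := by
  induction k generalizing f g with
  | zero => simp [jet_zero, h hy]
  | succ k ih =>
    rw [jet_succ, jet_succ, h hy]
    congr 1
    exact Finset.sum_congr rfl fun i _ => ih (vf_congr hU h)

lemma jet_const_mul (hX : ∀ i, ContDiff ℝ ∞ (X i)) (c : ℝ) (k : ℕ) {f : E → ℝ}
    (hf : ContDiff ℝ ∞ f) (y : E) :
    jet X k (fun y => c * f y) y = c ^ 2 * jet X k f y := by
  induction k generalizing f with
  | zero => simp [jet_zero, mul_pow]
  | succ k ih =>
    simp only [jet_succ, vf_const_mul c hf, ih (vf_smooth (hX _) hf), mul_add, Finset.mul_sum,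
      mul_pow]

lemma jet_add_le (hX : ∀ i, ContDiff ℝ ∞ (X i)) (k : ℕ) {f g : E → ℝ}
    (hf : ContDiff ℝ ∞ f) (hg : ContDiff ℝ ∞ g) (y : E) :
    jet X k (fun y => f y + g y) y ≤ 2 * jet X k f y + 2 * jet X k g y := by
  induction k generalizing f g with
  | zero => simp only [jet_zero]; nlinarith [sq_nonneg (f y - g y)]
  | succ k ih =>
    simp only [jet_succ, vf_add hf hg]
    have h1 := Finset.sum_le_sum fun i (_ : i ∈ Finset.univ) =>
      ih (vf_smooth (hX i) hf) (vf_smooth (hX i) hg)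
    simp only [Finset.sum_add_distrib, ← Finset.mul_sum] at h1
    nlinarith [sq_nonneg (f y - g y)]

lemma jet_sum_le (hX : ∀ i, ContDiff ℝ ∞ (X i)) (k : ℕ) {n : ℕ} {f : Fin n → E → ℝ}
    (hf : ∀ a, ContDiff ℝ ∞ (f a)) (y : E) :
    jet X k (fun y => ∑ a, f a y) y ≤ n * ∑ a, jet X k (f a) y := by
  induction k generalizing f with
  | zero =>
    have := sq_sum_le_card_mul_sum_sq (s := Finset.univ) (f := fun a => f a y)
    simpa [jet_zero] using this
  | succ k ih =>
    have h0 := sq_sum_le_card_mul_sum_sq (s := Finset.univ) (f := fun a => f a y)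
    simp only [jet_succ, vf_sum hf]
    have h1 := Finset.sum_le_sum fun i (_ : i ∈ Finset.univ) =>
      ih (fun a => vf_smooth (hX i) (hf a))
    simp only [Finset.sum_add_distrib, ← Finset.mul_sum] at h1 ⊢
    rw [Finset.sum_comm] at h1
    simp only [Finset.card_univ, Fintype.card_fin] at h0
    linarith

/-- Leibniz estimate for jets. -/
lemma jet_mul_le_sum (hX : ∀ i, ContDiff ℝ ∞ (X i)) (k : ℕ) {f g : E → ℝ}
    (hf : ContDiff ℝ ∞ f) (hg : ContDiff ℝ ∞ g) (y : E) :
    jet X k (fun y => f y * g y) y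
      ≤ 5 ^ k * ∑ i ∈ Finset.range (k + 1), jet X i f y * jet X (k - i) g y := by
  induction k generalizing f g with
  | zero => simp [jet_zero, mul_pow]
  | succ k ih =>
    have hstep : ∀ i, jet X k (vf (X i) (fun y => f y * g y)) y
        ≤ 2 * 5 ^ k * (∑ j ∈ Finset.range (k + 1), jet X j (vf (X i) f) y * jet X (k - j) g y
          + ∑ j ∈ Finset.range (k + 1), jet X j f y * jet X (k - j) (vf (X i) g) y) := by
      intro i
      have hfi := vf_smooth (hX i) hf
      have hgi := vf_smooth (hX i) hg
      rw [vf_mul hf hg]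
      have h1 := jet_add_le hX k (hfi.mul hg) (hf.mul hgi) y
      have h2 := ih hfi hg
      have h3 := ih hf hgi
      linarith
    have hA : ∑ i, ∑ j ∈ Finset.range (k + 1), jet X j (vf (X i) f) y * jet X (k - j) g y
        ≤ ∑ j ∈ Finset.range (k + 2), jet X j f y * jet X (k + 1 - j) g y := by
      rw [Finset.sum_comm, Finset.sum_range_succ' _ (k + 1)]
      refine le_add_of_le_of_nonneg (Finset.sum_le_sum fun j _ => ?_)
        (mul_nonneg (jet_nonneg _ _ _) (jet_nonneg _ _ _))
      rw [← Finset.sum_mul, show k + 1 - (j + 1) = k - j by omega]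
      exact mul_le_mul_of_nonneg_right (le_add_of_nonneg_left (sq_nonneg _)) (jet_nonneg _ _ _)
    have hB : ∑ i, ∑ j ∈ Finset.range (k + 1), jet X j f y * jet X (k - j) (vf (X i) g) y
        ≤ ∑ j ∈ Finset.range (k + 2), jet X j f y * jet X (k + 1 - j) g y := by
      rw [Finset.sum_comm, Finset.sum_range_succ _ (k + 1)]
      refine le_add_of_le_of_nonneg (Finset.sum_le_sum fun j hj => ?_)
        (mul_nonneg (jet_nonneg _ _ _) (jet_nonneg _ _ _))
      have : j ≤ k := by simpa [Nat.lt_succ_iff] using hj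
      rw [← Finset.mul_sum, show k + 1 - j = (k - j) + 1 by omega]
      exact mul_le_mul_of_nonneg_left (le_add_of_nonneg_left (sq_nonneg _)) (jet_nonneg _ _ _)
    have h0 : (f y * g y) ^ 2 ≤ ∑ j ∈ Finset.range (k + 2), jet X j f y * jet X (k + 1 - j) g y := by
      have := Finset.single_le_sum (f := fun j => jet X j f y * jet X (k + 1 - j) g y)
        (s := Finset.range (k + 2))
        (fun j _ => mul_nonneg (jet_nonneg _ _ _) (jet_nonneg _ _ _))
        (Finset.mem_range.2 (show 0 < k + 2 by omega))
      refine le_trans ?_ this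
      rw [mul_pow]
      exact mul_le_mul (sq_le_jet _ _ _) (sq_le_jet _ _ _) (sq_nonneg _) (jet_nonneg _ _ _)
    have h1 := Finset.sum_le_sum fun i (_ : i ∈ Finset.univ) => hstep i
    rw [← Finset.mul_sum, Finset.sum_add_distrib] at h1
    rw [jet_succ]
    have h4 : (1 : ℝ) ≤ 5 ^ k := one_le_pow₀ (by norm_num)
    set S := ∑ j ∈ Finset.range (k + 2), jet X j f y * jet X (k + 1 - j) g y
    have hS : 0 ≤ S := le_trans (sq_nonneg _) h0
    nlinarith [mul_le_mul_of_nonneg_left hA (show (0 : ℝ) ≤ 2 * 5 ^ k by positivity),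
      mul_le_mul_of_nonneg_left hB (show (0 : ℝ) ≤ 2 * 5 ^ k by positivity),
      mul_le_mul_of_nonneg_right h4 hS, pow_succ (5 : ℝ) k]

/-- Crude product estimate for jets. -/
lemma jet_mul_le (hX : ∀ i, ContDiff ℝ ∞ (X i)) (k : ℕ) {f g : E → ℝ}
    (hf : ContDiff ℝ ∞ f) (hg : ContDiff ℝ ∞ g) (y : E) :
    jet X k (fun y => f y * g y) y ≤ 5 ^ k * (k + 1) * (jet X k f y * jet X k g y) := by
  refine (jet_mul_le_sum hX k hf hg y).trans ?_
  rw [mul_assoc ((5 : ℝ) ^ k)]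
  refine mul_le_mul_of_nonneg_left ?_ (pow_nonneg (by norm_num) k)
  calc _ ≤ ∑ i ∈ Finset.range (k + 1), jet X k f y * jet X k g y :=
        Finset.sum_le_sum fun i hi => mul_le_mul
          (jet_mono (by simp only [Finset.mem_range] at hi; omega) _ _) (jet_mono (by omega) _ _)
          (jet_nonneg _ _ _) (jet_nonneg _ _ _)
    _ = _ := by simp

/-- Tame product estimate for jets. -/
lemma jet_mul_tame (hX : ∀ i, ContDiff ℝ ∞ (X i)) (k : ℕ) {f g : E → ℝ}
    (hf : ContDiff ℝ ∞ f) (hg : ContDiff ℝ ∞ g) (y : E) :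
    jet X k (fun y => f y * g y) y ≤ 5 ^ k * (k + 1) *
      (jet X (k / 2) f y * jet X k g y + jet X k f y * jet X (k / 2) g y) := by
  refine (jet_mul_le_sum hX k hf hg y).trans ?_
  rw [mul_assoc ((5 : ℝ) ^ k)]
  refine mul_le_mul_of_nonneg_left ?_ (pow_nonneg (by norm_num) k)
  have hnn : ∀ i j, 0 ≤ jet X i f y * jet X j g y := fun i j =>
    mul_nonneg (jet_nonneg _ _ _) (jet_nonneg _ _ _)
  calc _ ≤ ∑ i ∈ Finset.range (k + 1),
        (jet X (k / 2) f y * jet X k g y + jet X k f y * jet X (k / 2) g y) := by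
        refine Finset.sum_le_sum fun i hi => ?_
        simp only [Finset.mem_range] at hi
        rcases le_or_gt i (k / 2) with h | h
        · refine le_add_of_le_of_nonneg (mul_le_mul (jet_mono h _ _) (jet_mono (by omega) _ _)
            (jet_nonneg _ _ _) (jet_nonneg _ _ _)) (hnn _ _)
        · refine le_add_of_nonneg_of_le (hnn _ _) (mul_le_mul (jet_mono (by omega) _ _)
            (jet_mono (by omega) _ _) (jet_nonneg _ _ _) (jet_nonneg _ _ _))
    _ = _ := by simp; ring

lemma jet_smooth (hX : ∀ i, ContDiff ℝ ∞ (X i)) (k : ℕ) {f : E → ℝ} (hf : ContDiff ℝ ∞ f) :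
    ContDiff ℝ ∞ (jet X k f) := by
  induction k generalizing f with
  | zero => exact hf.pow 2
  | succ k ih =>
    exact (hf.pow 2).add (ContDiff.sum fun i _ => ih (vf_smooth (hX i) hf))

lemma vf_sq_le {X : E → E} {f : E → ℝ} (hf : ContDiff ℝ ∞ f) (y : E) :
    |vf X (fun y => f y ^ 2) y| ≤ f y ^ 2 + vf X f y ^ 2 := by
  have : (fun y => f y ^ 2) = fun y => f y * f y := by funext y; ring
  rw [this, vf_mul hf hf, abs_le]
  constructor <;> nlinarith [sq_nonneg (f y + vf X f y), sq_nonneg (f y - vf X f y)]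

lemma vf_jet_le (hX : ∀ i, ContDiff ℝ ∞ (X i)) (k : ℕ) {f : E → ℝ} (hf : ContDiff ℝ ∞ f)
    (i : ι) (y : E) : |vf (X i) (jet X k f) y| ≤ (k + 1) * jet X (k + 1) f y := by
  have hbase : ∀ k, f y ^ 2 + vf (X i) f y ^ 2 ≤ jet X (k + 1) f y := fun k =>
    add_le_add le_rfl ((sq_le_jet k _ y).trans
      (Finset.single_le_sum (f := fun i => jet X k (vf (X i) f) y)
        (fun _ _ => jet_nonneg _ _ _) (Finset.mem_univ i)))
  induction k generalizing f with
  | zero =>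
    have := (vf_sq_le (X := X i) hf y).trans (hbase 0)
    rw [Nat.cast_zero, zero_add, one_mul]
    exact this
  | succ k ih =>
    have e : jet X (k + 1) f = fun y => f y ^ 2 + ∑ i, jet X k (vf (X i) f) y := rfl
    have hs : ∀ j, ContDiff ℝ ∞ (vf (X j) f) := fun j => vf_smooth (hX j) hf
    rw [e, vf_add (hf.pow 2) (ContDiff.sum fun j _ => jet_smooth hX k (hs j)),
      vf_sum fun j => jet_smooth hX k (hs j)]
    have h1 : |∑ j, vf (X i) (jet X k (vf (X j) f)) y| ≤ (k + 1) * jet X (k + 2) f y := by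
      refine (Finset.abs_sum_le_sum_abs _ _).trans ?_
      calc _ ≤ ∑ j, ((k : ℝ) + 1) * jet X (k + 1) (vf (X j) f) y :=
            Finset.sum_le_sum fun j _ => ih (hs j) fun k =>
              add_le_add le_rfl ((sq_le_jet k _ y).trans
                (Finset.single_le_sum (f := fun i => jet X k (vf (X i) (vf (X j) f)) y)
                  (fun _ _ => jet_nonneg _ _ _) (Finset.mem_univ i)))
        _ ≤ _ := by
          rw [← Finset.mul_sum]
          exact mul_le_mul_of_nonneg_left (le_add_of_nonneg_left (sq_nonneg _)) (by positivity)
    have h2 := (vf_sq_le (X := X i) hf y).trans (hbase (k + 1))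
    calc _ ≤ |vf (X i) (fun y => f y ^ 2) y| + |∑ j, vf (X i) (jet X k (vf (X j) f)) y| :=
          abs_add_le _ _
      _ ≤ _ := by push_cast; linarith

end Jets

section Sobolev

/-- The coordinate vector fields on space, rescaled by `τ`. -/
def scaledField (τ : (Fin 3 → ℝ) → ℝ) (a : Fin 3) (x : Fin 3 → ℝ) : Fin 3 → ℝ :=
  Pi.single a (τ x)

lemma vf_scaledField (τ : (Fin 3 → ℝ) → ℝ) (a : Fin 3) (f : (Fin 3 → ℝ) → ℝ) (x : Fin 3 → ℝ) :
    vf (scaledField τ a) f x = τ x * pderx a f x := by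
  have : scaledField τ a x = τ x • Pi.single a 1 := by
    simp [scaledField, ← Pi.single_smul]
  rw [vf, this, map_smul]; rfl

lemma scaledField_smooth {τ : (Fin 3 → ℝ) → ℝ} (hτ : ContDiff ℝ ∞ τ) (a : Fin 3) :
    ContDiff ℝ ∞ (scaledField τ a) :=
  (ContinuousLinearMap.single ℝ (fun _ : Fin 3 => ℝ) a).contDiff.comp hτ

lemma le_lintegral_update {h k : (Fin 3 → ℝ) → ℝ} (hh : ContDiff ℝ ∞ h)
    (hc : HasCompactSupport h) (a : Fin 3) (hk : ∀ x, |pderx a h x| ≤ k x) (x : Fin 3 → ℝ) :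
    ENNReal.ofReal (h x) ≤ ∫⁻ z, ENNReal.ofReal (k (Function.update x a z)) := by
  have hd : ∀ z, HasDerivAt (fun z => h (Function.update x a z))
      (pderx a h (Function.update x a z)) z := fun z =>
    (smooth_diff hh _).hasFDerivAt.comp_hasDerivAt z (hasDerivAt_update x a z)
  have h1 : ContDiff ℝ 1 (fun z => h (Function.update x a z)) :=
    (hh.of_le (by simp)).comp (contDiff_update 1 x a)
  have h2 : HasCompactSupport (fun z => h (Function.update x a z)) :=
    hc.comp_isClosedEmbedding (isClosedEmbedding_update x a)
  have h3 := h2.enorm_le_lintegral_Ici_deriv h1 (x a)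
  simp only [Function.update_eq_self] at h3
  calc ENNReal.ofReal (h x) ≤ ‖h x‖ₑ := by
        rw [← ofReal_norm]; exact ENNReal.ofReal_le_ofReal (le_abs_self _)
    _ ≤ _ := h3
    _ ≤ ∫⁻ z, ‖deriv (fun z => h (Function.update x a z)) z‖ₑ := setLIntegral_le_lintegral _ _
    _ ≤ _ := lintegral_mono fun z => by
        rw [(hd z).deriv, ← ofReal_norm]
        exact ENNReal.ofReal_le_ofReal (hk _)

lemma le_lintegral_of_chain {F : ℕ → (Fin 3 → ℝ) → ENNReal} (hF : ∀ n, Measurable (F n))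
    (h : ∀ n < 3, ∀ (a : Fin 3) x, F n x ≤ ∫⁻ z, F (n + 1) (Function.update x a z)) (x : Fin 3 → ℝ) :
    F 0 x ≤ ∫⁻ x, F 3 x := by
  have key : ∀ n < 3, ∀ (a : Fin 3), F n ≤ ∫⋯∫⁻_{a}, F (n + 1) ∂(fun _ => volume) :=
    fun n hn a x => by rw [lmarginal_singleton]; exact h n hn a x
  have e : (Finset.univ : Finset (Fin 3)) = {0} ∪ ({1} ∪ {2}) := by decide
  have : F 0 x ≤ (∫⋯∫⁻_Finset.univ, F 3 ∂(fun _ => (volume : Measure ℝ))) x := by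
    rw [e, lmarginal_union _ _ (hF 3) (by decide), lmarginal_union _ _ (hF 3) (by decide)]
    exact (key 0 (by simp) 0).trans (lmarginal_mono ((key 1 (by simp) 1).trans
      (lmarginal_mono (key 2 (by simp) 2)))) x
  rw [lmarginal_univ] at this
  exact this

lemma abs_vf_pow_le {τ : (Fin 3 → ℝ) → ℝ} {X : (Fin 3 → ℝ) → (Fin 3 → ℝ)}
    (hτ : ContDiff ℝ ∞ τ) (hτ0 : ∀ x, 0 < τ x) (hX : ∀ x, |vf X τ x| ≤ τ x) (p : ℕ)
    (x : Fin 3 → ℝ) : |vf X (fun x => τ x ^ p) x| ≤ p * τ x ^ p := by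
  have : vf X (fun x => τ x ^ p) x = p * τ x ^ (p - 1) * vf X τ x := by
    simp only [vf]
    rw [fderiv_fun_pow _ (smooth_diff hτ x)]
    simp
  rw [this, abs_mul, abs_of_nonneg (mul_nonneg p.cast_nonneg (pow_nonneg (hτ0 x).le _))]
  rcases p with _ | p
  · simp
  · rw [Nat.add_sub_cancel, pow_succ, ← mul_assoc]
    exact mul_le_mul_of_nonneg_left (hX x)
      (mul_nonneg (Nat.cast_nonneg _) (pow_nonneg (hτ0 x).le _))

/-- Weighted Sobolev inequality with respect to the rescaled coordinate fields. -/
lemma sobolev_scaled {τ W : (Fin 3 → ℝ) → ℝ} {q : (Fin 3 → ℝ) → ℝ} (hτ : ContDiff ℝ ∞ τ)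
    (hτ0 : ∀ x, 0 < τ x) (hτ1 : ∀ a x, |pderx a τ x| ≤ 1) (hW : ContDiff ℝ ∞ W)
    (hW0 : ∀ x, 0 ≤ W x) (hW1 : ∀ a x, |τ x * pderx a W x| ≤ 2 * W x)
    (hq : ContDiff ℝ ∞ q) (hc : HasCompactSupport q) (x : Fin 3 → ℝ) :
    τ x ^ 3 * W x * q x ^ 2 ≤ 6 ^ 3 * ∫ x, W x * jet (scaledField τ) 3 q x := by
  have hX := scaledField_smooth hτ
  have hXτ : ∀ a x, |vf (scaledField τ a) τ x| ≤ τ x := fun a x => by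
    rw [vf_scaledField, abs_mul, abs_of_pos (hτ0 x)]
    exact mul_le_of_le_one_right (hτ0 x).le (hτ1 a x)
  have hjc : ∀ k {q : (Fin 3 → ℝ) → ℝ}, HasCompactSupport q →
      HasCompactSupport (jet (scaledField τ) k q) := by
    intro k
    induction k with
    | zero =>
      intro q hc
      exact hc.comp_left (g := fun z : ℝ => z ^ 2) (by simp)
    | succ k ih =>
      intro q hc
      have h1 : ∀ a, HasCompactSupport (vf (scaledField τ a) q) := fun a => by
        refine (hc.fderiv ℝ).mono ?_
        intro x hx
        simp only [Function.mem_support, vf] at hx ⊢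
        exact fun h => hx (by rw [h]; rfl)
      have h2 : HasCompactSupport (fun x => q x ^ 2) :=
        hc.comp_left (g := fun z : ℝ => z ^ 2) (by simp)
      have e : jet (scaledField τ) (k + 1) q = fun x => q x ^ 2 +
        (jet (scaledField τ) k (vf (scaledField τ 0) q) x +
        jet (scaledField τ) k (vf (scaledField τ 1) q) x +
        jet (scaledField τ) k (vf (scaledField τ 2) q) x) := by
        funext x
        rw [jet_succ, Fin.sum_univ_three]
      rw [e]
      exact h2.add (((ih (h1 0)).add (ih (h1 1))).add (ih (h1 2)))
  let h : ℕ → (Fin 3 → ℝ) → ℝ := fun n x => τ x ^ (3 - n) * W x * jet (scaledField τ) n q x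
  have hs : ∀ n, ContDiff ℝ ∞ (h n) := fun n =>
    ((hτ.pow _).mul hW).mul (jet_smooth hX n hq)
  have hcs : ∀ n, HasCompactSupport (h n) := fun n => (hjc n hc).mul_left
  have hh0 : ∀ n x, 0 ≤ h n x := fun n x =>
    mul_nonneg (mul_nonneg (pow_nonneg (hτ0 x).le _) (hW0 x)) (jet_nonneg _ _ _)
  have hstep : ∀ n < 3, ∀ a x, |pderx a (h n) x| ≤ 6 * h (n + 1) x := by
    intro n hn a x
    have e : vf (scaledField τ a) (h n) x =
        (vf (scaledField τ a) (fun x => τ x ^ (3 - n)) x * W x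
          + τ x ^ (3 - n) * vf (scaledField τ a) W x) * jet (scaledField τ) n q x
        + τ x ^ (3 - n) * W x * vf (scaledField τ a) (jet (scaledField τ) n q) x := by
      simp only [h]
      rw [vf_mul ((hτ.pow _).mul hW) (jet_smooth hX n hq), vf_mul (hτ.pow _) hW]
    have b1 := abs_vf_pow_le hτ hτ0 (hXτ a) (3 - n) x
    have b2 : |vf (scaledField τ a) W x| ≤ 2 * W x := by rw [vf_scaledField]; exact hW1 a x
    have b3 := vf_jet_le hX n hq a x
    have b4 : jet (scaledField τ) n q x ≤ jet (scaledField τ) (n + 1) q x :=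
      jet_mono (Nat.le_succ n) _ _
    have p0 : 0 ≤ τ x ^ (3 - n) := pow_nonneg (hτ0 x).le _
    have j0 : 0 ≤ jet (scaledField τ) n q x := jet_nonneg _ _ _
    have j1 : 0 ≤ jet (scaledField τ) (n + 1) q x := jet_nonneg _ _ _
    have c1 : |vf (scaledField τ a) (fun x => τ x ^ (3 - n)) x * W x| ≤
        (3 - n : ℕ) * τ x ^ (3 - n) * W x := by
      rw [abs_mul, abs_of_nonneg (hW0 x)]
      exact mul_le_mul_of_nonneg_right b1 (hW0 x)
    have c2 : |τ x ^ (3 - n) * vf (scaledField τ a) W x| ≤ τ x ^ (3 - n) * (2 * W x) := by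
      rw [abs_mul, abs_of_nonneg p0]
      exact mul_le_mul_of_nonneg_left b2 p0
    have c3 : |τ x ^ (3 - n) * W x * vf (scaledField τ a) (jet (scaledField τ) n q) x| ≤
        τ x ^ (3 - n) * W x * ((n + 1) * jet (scaledField τ) (n + 1) q x) := by
      rw [abs_mul, abs_of_nonneg (mul_nonneg p0 (hW0 x))]
      exact mul_le_mul_of_nonneg_left b3 (mul_nonneg p0 (hW0 x))
    have c4 : |vf (scaledField τ a) (h n) x| ≤
        6 * (τ x ^ (3 - n) * W x * jet (scaledField τ) (n + 1) q x) := by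
      rw [e]
      refine (abs_add_le _ _).trans ?_
      rw [abs_mul _ (jet (scaledField τ) n q x), abs_of_nonneg j0]
      have c5 := mul_le_mul ((abs_add_le _ _).trans (add_le_add c1 c2)) b4 j0
        (add_nonneg (mul_nonneg (mul_nonneg (Nat.cast_nonneg _) p0) (hW0 x))
          (mul_nonneg p0 (mul_nonneg zero_le_two (hW0 x))))
      have : ((3 - n : ℕ) : ℝ) + n = 3 := by
        rw [← Nat.cast_add, Nat.sub_add_cancel hn.le]; norm_num
      refine (add_le_add c5 c3).trans (le_of_eq ?_)
      linear_combination (τ x ^ (3 - n) * W x * jet (scaledField τ) (n + 1) q x) * this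
    rw [vf_scaledField, abs_mul, abs_of_pos (hτ0 x), show 3 - n = (3 - (n + 1)) + 1 by omega,
      pow_succ] at c4
    refine le_of_mul_le_mul_left (c4.trans (le_of_eq ?_)) (hτ0 x)
    simp only [h]; ring
  have hchain := le_lintegral_of_chain (F := fun n x => ENNReal.ofReal (6 ^ n * h n x))
    (fun n => ((hs n).continuous.measurable.const_mul _).ennreal_ofReal) (fun n hn a x => by
      refine le_lintegral_update (h := fun x => 6 ^ n * h n x)
        (k := fun x => 6 ^ (n + 1) * h (n + 1) x) (contDiff_const.mul (hs n))
        ((hcs n).mul_left) a (fun x => ?_) x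
      have : pderx a (fun x => 6 ^ n * h n x) x = 6 ^ n * pderx a (h n) x := by
        simp only [pderx]
        rw [fderiv_const_mul (smooth_diff (hs n) x)]; rfl
      rw [this, abs_mul, abs_of_pos (by positivity : (0 : ℝ) < 6 ^ n), pow_succ, mul_assoc]
      exact mul_le_mul_of_nonneg_left (hstep n hn a x) (by positivity)) x
  have hInt : Integrable (fun x => 6 ^ 3 * h 3 x) :=
    ((hs 3).continuous.integrable_of_hasCompactSupport (hcs 3)).const_mul _
  rw [← ofReal_integral_eq_lintegral_ofReal hInt
    (Filter.Eventually.of_forall fun x => mul_nonneg (by positivity) (hh0 3 x))] at hchain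
  have h1 := (ENNReal.ofReal_le_ofReal_iff
    (integral_nonneg fun x => mul_nonneg (by positivity) (hh0 3 x))).1 hchain
  rw [integral_const_mul] at h1
  simpa [h, jet_zero] using h1

end Sobolev

abbrev Sp := Fin 3 → ℝ
abbrev St := Fin 4 → ℝ

/-- The spatial part of a spacetime point. -/
def xs (y : St) : Sp := fun a => y a.succ

/-- Smooth functions supported in the causal future and past of the unit ball at time `2`. -/
def Sm (f : St → ℝ) : Prop :=
  ContDiff ℝ ∞ f ∧ ∀ y, 1 + |y 0 - 2| < rad (xs y) → f y = 0

/-- The coordinate fields. -/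
def pd (α : Fin 4) (_ : St) : St := Pi.single α 1

/-- The spatial coordinate fields. -/
def dx (a : Fin 3) : St → St := pd a.succ

/-- The Lorentz boosts. -/
def bo (a : Fin 3) (y : St) : St := Pi.single 0 (y a.succ) + Pi.single a.succ (y 0)

/-- The coordinate fields together with the boosts. -/
def Zf : Fin 4 ⊕ Fin 3 → St → St := Sum.elim pd bo

lemma vf_pd (α : Fin 4) (f : St → ℝ) : vf (pd α) f = pder α f := rfl

lemma vf_bo (a : Fin 3) (f : St → ℝ) : vf (bo a) f = Lb a f := by
  funext y
  have : bo a y = y a.succ • Pi.single 0 1 + y 0 • Pi.single a.succ 1 := by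
    simp [bo, ← Pi.single_smul]
  rw [vf, this, map_add, map_smul, map_smul]; rfl

lemma pd_smooth (α : Fin 4) : ContDiff ℝ ∞ (pd α) := contDiff_const

lemma dx_smooth (a : Fin 3) : ContDiff ℝ ∞ (dx a) := contDiff_const

lemma bo_smooth (a : Fin 3) : ContDiff ℝ ∞ (bo a) :=
  ((ContinuousLinearMap.single ℝ (fun _ : Fin 4 => ℝ) 0).contDiff.comp
    (contDiff_apply ℝ ℝ a.succ)).add
    ((ContinuousLinearMap.single ℝ (fun _ : Fin 4 => ℝ) a.succ).contDiff.comp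
    (contDiff_apply ℝ ℝ 0))

lemma Zf_smooth : ∀ i, ContDiff ℝ ∞ (Zf i)
  | .inl α => pd_smooth α
  | .inr a => bo_smooth a

lemma xs_spt (t : ℝ) (x : Sp) : xs (spt t x) = x := rfl
lemma spt_zero (t : ℝ) (x : Sp) : spt t x 0 = t := rfl
lemma spt_xs (y : St) : spt (y 0) (xs y) = y := by
  funext i; refine Fin.cases rfl (fun a => rfl) i

lemma spt_smooth : ContDiff ℝ ∞ (fun p : ℝ × Sp => spt p.1 p.2) := by
  rw [contDiff_pi]
  intro i
  refine Fin.cases ?_ (fun a => ?_) i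
  · exact contDiff_fst
  · exact (contDiff_apply ℝ ℝ a).comp contDiff_snd

lemma spt_smooth_right (t : ℝ) : ContDiff ℝ ∞ (spt t) :=
  spt_smooth.comp (contDiff_const.prodMk contDiff_id)

lemma xs_smooth : ContDiff ℝ ∞ xs := by
  rw [contDiff_pi]; exact fun a => contDiff_apply ℝ ℝ a.succ

lemma rad_continuous : Continuous rad := by unfold rad; fun_prop

lemma rad_nonneg (x : Sp) : 0 ≤ rad x := Real.sqrt_nonneg _

lemma rad_sq (x : Sp) : rad x ^ 2 = ∑ i, x i ^ 2 :=
  Real.sq_sqrt (Finset.sum_nonneg fun _ _ => sq_nonneg _)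

lemma abs_le_rad (x : Sp) (a : Fin 3) : |x a| ≤ rad x := by
  refine Real.le_sqrt_of_sq_le ?_
  rw [sq_abs]
  exact Finset.single_le_sum (f := fun i => x i ^ 2) (fun _ _ => sq_nonneg _) (Finset.mem_univ a)

lemma isCompact_rad_le (R : ℝ) : IsCompact {x : Sp | rad x ≤ R} := by
  refine Metric.isCompact_of_isClosed_isBounded (isClosed_le rad_continuous continuous_const)
    ((Metric.isBounded_closedBall (x := (0 : Sp)) (r := R)).subset fun x hx => ?_)
  rw [Metric.mem_closedBall, dist_zero_right,
    pi_norm_le_iff_of_nonneg ((rad_nonneg x).trans hx)]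
  exact fun a => (abs_le_rad x a).trans hx

lemma hasCompactSupport_of_rad {f : Sp → ℝ} {R : ℝ} (h : ∀ x, R < rad x → f x = 0) :
    HasCompactSupport f :=
  HasCompactSupport.intro (isCompact_rad_le R) fun x hx => h x (not_le.1 hx)

namespace Sm
variable {f g : St → ℝ}

lemma supp (hf : Sm f) : ∀ y, 1 + |y 0 - 2| < rad (xs y) → f y = 0 := hf.2

lemma add (hf : Sm f) (hg : Sm g) : Sm (fun y => f y + g y) :=
  ⟨hf.1.add hg.1, fun y hy => by simp [hf.2 y hy, hg.2 y hy]⟩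

lemma sub (hf : Sm f) (hg : Sm g) : Sm (fun y => f y - g y) :=
  ⟨hf.1.sub hg.1, fun y hy => by simp [hf.2 y hy, hg.2 y hy]⟩

lemma smul (hf : Sm f) (hg : ContDiff ℝ ∞ g) : Sm (fun y => g y * f y) :=
  ⟨hg.mul hf.1, fun y hy => by simp [hf.2 y hy]⟩

lemma mul (hf : Sm f) (hg : Sm g) : Sm (fun y => f y * g y) := hg.smul hf.1

lemma const_mul (c : ℝ) (hf : Sm f) : Sm (fun y => c * f y) := hf.smul contDiff_const

lemma pow (hf : Sm f) {n : ℕ} (hn : n ≠ 0) : Sm (fun y => f y ^ n) :=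
  ⟨hf.1.pow n, fun y hy => by simp [hf.2 y hy, hn]⟩

lemma zero : Sm (fun _ => 0) := ⟨contDiff_const, fun _ _ => rfl⟩

lemma sum {ι : Type} {s : Finset ι} {f : ι → St → ℝ} (hf : ∀ i, Sm (f i)) :
    Sm (fun y => ∑ i ∈ s, f i y) :=
  ⟨ContDiff.sum fun i _ => (hf i).1, fun y hy => Finset.sum_eq_zero fun i _ => (hf i).2 y hy⟩

lemma vf {X : St → St} (hX : ContDiff ℝ ∞ X) (hf : Sm f) : Sm (WKG.vf X f) := by
  refine ⟨vf_smooth hX hf.1, fun y hy => ?_⟩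
  have hU : IsOpen {y : St | 1 + |y 0 - 2| < rad (xs y)} :=
    isOpen_lt (by fun_prop) (rad_continuous.comp xs_smooth.continuous)
  have := vf_congr (X := X) hU (f := f) (g := fun _ => 0) (fun y hy => hf.2 y hy) hy
  rw [this]
  simp [WKG.vf]

lemma pder (α : Fin 4) (hf : Sm f) : Sm (pder α f) := hf.vf (pd_smooth α)

lemma hcs (hf : Sm f) (t : ℝ) : HasCompactSupport (fun x => f (spt t x)) :=
  hasCompactSupport_of_rad (R := 1 + |t - 2|) fun x hx => hf.2 (spt t x) hx

lemma integrable (hf : Sm f) (t : ℝ) : Integrable (fun x => f (spt t x)) :=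
  (hf.1.comp (spt_smooth_right t)).continuous.integrable_of_hasCompactSupport (hf.hcs t)

end Sm

lemma stable_Sm {ι : Type} {X : ι → St → St} (hX : ∀ i, ContDiff ℝ ∞ (X i)) : Stable X Sm :=
  fun _ hf i => hf.vf (hX i)

lemma Sm.jet {ι : Type} [Fintype ι] {X : ι → St → St} (hX : ∀ i, ContDiff ℝ ∞ (X i)) (k : ℕ)
    {f : St → ℝ} (hf : Sm f) : Sm (jet X k f) := by
  refine ⟨jet_smooth hX k hf.1, fun y hy => ?_⟩
  induction k generalizing f with
  | zero => simp [jet_zero, hf.2 y hy]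
  | succ k ih => simp [jet_succ, hf.2 y hy, ih (hf.vf (hX _))]

section
variable {E E' : Type} [NormedAddCommGroup E] [NormedSpace ℝ E] [NormedAddCommGroup E']
  [NormedSpace ℝ E'] {ι κ : Type} [Fintype ι] [Fintype κ]

lemma vf_comp {φ : E → E'} (hφ : ContDiff ℝ ∞ φ) {X : E → E} {Y : E' → E'}
    (h : ∀ x, fderiv ℝ φ x (X x) = Y (φ x)) {f : E' → ℝ} (hf : ContDiff ℝ ∞ f) :
    vf X (fun x => f (φ x)) = fun x => vf Y f (φ x) := by
  funext x
  have := fderiv_comp x (smooth_diff hf (φ x)) ((hφ.differentiable (by simp)) x)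
  simp only [vf]
  change fderiv ℝ (f ∘ φ) x (X x) = _
  rw [this, ContinuousLinearMap.comp_apply, h]

/-- Jets along related vector fields. -/
lemma jet_comp {φ : E → E'} (hφ : ContDiff ℝ ∞ φ) {X : ι → E → E} {Y : ι → E' → E'}
    (hY : ∀ i, ContDiff ℝ ∞ (Y i)) (h : ∀ i x, fderiv ℝ φ x (X i x) = Y i (φ x)) (k : ℕ)
    {f : E' → ℝ} (hf : ContDiff ℝ ∞ f) (x : E) :
    jet X k (fun x => f (φ x)) x = jet Y k f (φ x) := by
  induction k generalizing f with
  | zero => rfl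
  | succ k ih =>
    simp only [jet_succ, vf_comp hφ (h _) hf, ih (vf_smooth (hY _) hf)]

lemma jsum_subfamily {X : ι → E → E} {Y : κ → E → E} {e : ι → κ} (he : Function.Injective e)
    (h : ∀ i, X i = Y (e i)) {A : (E → ℝ) → ℝ} (hA : ∀ f, 0 ≤ A f) (k : ℕ) (f : E → ℝ) :
    jsum X k A f ≤ jsum Y k A f := by
  induction k generalizing f with
  | zero => exact le_rfl
  | succ k ih =>
    refine add_le_add le_rfl ?_
    calc ∑ i, jsum X k A (vf (X i) f) ≤ ∑ i, jsum Y k A (vf (Y (e i)) f) :=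
          Finset.sum_le_sum fun i _ => by rw [h i]; exact ih _
      _ = ∑ j ∈ Finset.univ.map ⟨e, he⟩, jsum Y k A (vf (Y j) f) := by simp
      _ ≤ _ := Finset.sum_le_sum_of_subset_of_nonneg (Finset.subset_univ _)
          fun j _ _ => jsum_nonneg Y hA k _

end

/-- The time coordinate on the hyperboloid of radius `exp σ`. -/
def htime (σ : ℝ) (x : Sp) : ℝ := √(exp (2 * σ) + ∑ i, x i ^ 2)

/-- The parametrization of the hyperboloid of radius `exp σ`. -/
def hyp (σ : ℝ) (x : Sp) : St := spt (htime σ x) x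

lemma htime_pos (σ : ℝ) (x : Sp) : 0 < htime σ x :=
  Real.sqrt_pos.2 (add_pos_of_pos_of_nonneg (exp_pos _) (Finset.sum_nonneg fun _ _ => sq_nonneg _))

lemma htime_sq (σ : ℝ) (x : Sp) : htime σ x ^ 2 = exp (2 * σ) + ∑ i, x i ^ 2 :=
  Real.sq_sqrt (add_nonneg (exp_pos _).le (Finset.sum_nonneg fun _ _ => sq_nonneg _))

lemma htime_smooth : ContDiff ℝ ∞ (fun p : ℝ × Sp => htime p.1 p.2) := by
  unfold htime
  refine ContDiff.sqrt ?_ fun p => (add_pos_of_pos_of_nonneg (exp_pos _)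
    (Finset.sum_nonneg fun _ _ => sq_nonneg _)).ne'
  fun_prop

lemma hyp_smooth : ContDiff ℝ ∞ (fun p : ℝ × Sp => hyp p.1 p.2) :=
  spt_smooth.comp (htime_smooth.prodMk contDiff_snd)

lemma hyp_smooth_right (σ : ℝ) : ContDiff ℝ ∞ (hyp σ) :=
  hyp_smooth.comp (contDiff_const.prodMk contDiff_id)

lemma htime_smooth_right (σ : ℝ) : ContDiff ℝ ∞ (htime σ) :=
  htime_smooth.comp (contDiff_const.prodMk contDiff_id)

lemma pderx_htime (σ : ℝ) (a : Fin 3) (x : Sp) : pderx a (htime σ) x = x a / htime σ x := by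
  have h1 : pderx a (fun x => htime σ x * htime σ x) x = 2 * x a := by
    have : (fun x => htime σ x * htime σ x) = fun x => exp (2 * σ) + ∑ i, x i ^ 2 := by
      funext x; rw [← htime_sq]; ring
    rw [this, pderx, fderiv_const_add, fderiv_fun_sum (fun i _ => by fun_prop)]
    have hp : ∀ i : Fin 3, fderiv ℝ (fun x : Sp => x i) x =
        ContinuousLinearMap.proj (R := ℝ) (φ := fun _ : Fin 3 => ℝ) i :=
      fun i => (ContinuousLinearMap.proj (R := ℝ) (φ := fun _ : Fin 3 => ℝ) i).fderiv
    simp only [FunLike.coe_sum, Finset.sum_apply]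
    rw [Finset.sum_eq_single a]
    · rw [fderiv_fun_pow _ (by fun_prop), hp]; simp
    · intro b _ hb
      rw [fderiv_fun_pow _ (by fun_prop), hp]; simp [hb]
    · simp
  have h2 := smooth_diff (htime_smooth_right σ) x
  have h3 : pderx a (fun x => htime σ x * htime σ x) x = 2 * htime σ x * pderx a (htime σ) x := by
    simp only [pderx]
    rw [fderiv_fun_mul h2 h2]; simp; ring
  have := htime_pos σ x
  rw [eq_div_iff this.ne']
  linarith

lemma hyp_zero (σ : ℝ) (x : Sp) : hyp σ x 0 = htime σ x := rfl
lemma hyp_succ (σ : ℝ) (x : Sp) (a : Fin 3) : hyp σ x a.succ = x a := rfl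
lemma xs_hyp (σ : ℝ) (x : Sp) : xs (hyp σ x) = x := rfl

lemma rad_lt_htime (σ : ℝ) (x : Sp) : rad x < htime σ x :=
  Real.sqrt_lt_sqrt (Finset.sum_nonneg fun _ _ => sq_nonneg _) (lt_add_of_pos_left _ (exp_pos _))

lemma exp_le_htime (σ : ℝ) (x : Sp) : exp σ ≤ htime σ x := by
  refine Real.le_sqrt_of_sq_le ?_
  rw [← exp_nat_mul]
  exact le_add_of_nonneg_right (Finset.sum_nonneg fun _ _ => sq_nonneg _)

/-- On the support cone, the time on a hyperboloid is controlled by its radius. -/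
lemma htime_le_of_supp {σ : ℝ} {x : Sp} (h : rad x ≤ 1 + |htime σ x - 2|) (h2 : 2 ≤ htime σ x) :
    2 * htime σ x ≤ exp (2 * σ) + 1 := by
  rw [abs_of_nonneg (by linarith)] at h
  have := htime_sq σ x
  rw [← rad_sq] at this
  nlinarith [rad_nonneg x]

lemma rad_le_of_supp {σ : ℝ} {x : Sp} (h : rad x ≤ 1 + |htime σ x - 2|) :
    rad x ≤ 2 + exp (2 * σ) := by
  have h1 := rad_lt_htime σ x
  have h3 := exp_pos (2 * σ)
  rcases le_total 2 (htime σ x) with h2 | h2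
  · have := htime_le_of_supp h h2
    linarith
  · linarith

lemma Sm.hyp_zero {f : St → ℝ} (hf : Sm f) {σ : ℝ} {x : Sp} (h : 2 + exp (2 * σ) < rad x) :
    f (hyp σ x) = 0 :=
  hf.2 _ (lt_of_not_ge fun h' => absurd (rad_le_of_supp h') (not_le.2 h))

lemma Sm.hyp_hcs {f : St → ℝ} (hf : Sm f) (σ : ℝ) : HasCompactSupport (fun x => f (hyp σ x)) :=
  hasCompactSupport_of_rad fun _ hx => hf.hyp_zero hx

lemma Sm.hyp_integrable {f : St → ℝ} (hf : Sm f) (σ : ℝ) : Integrable (fun x => f (hyp σ x)) :=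
  (hf.1.comp (hyp_smooth_right σ)).continuous.integrable_of_hasCompactSupport (hf.hyp_hcs σ)

lemma Sm.hyp_integrable_mul {f : St → ℝ} (hf : Sm f) {g : Sp → ℝ} (hg : Continuous g) (σ : ℝ) :
    Integrable (fun x => g x * f (hyp σ x)) :=
  (hg.mul (hf.1.comp (hyp_smooth_right σ)).continuous).integrable_of_hasCompactSupport
    (hf.hyp_hcs σ).mul_left

/-- Flat Sobolev inequality. -/
lemma sup_flat {f : St → ℝ} (hf : Sm f) (y : St) :
    f y ^ 2 ≤ 216 * ∫ x, jet dx 3 f (spt (y 0) x) := by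
  have h := sobolev_scaled (τ := fun _ => 1) (W := fun _ => 1) (q := fun x => f (spt (y 0) x))
    contDiff_const (by simp) (by simp [pderx]) contDiff_const (by simp) (by simp [pderx])
    (hf.1.comp (spt_smooth_right _)) (hf.hcs _) (xs y)
  have e : ∀ x, jet (scaledField fun _ => 1) 3 (fun x => f (spt (y 0) x)) x =
      jet dx 3 f (spt (y 0) x) := by
    refine jet_comp (spt_smooth_right _) dx_smooth (fun a x => ?_) 3 hf.1
    have : HasFDerivAt (spt (y 0)) (ContinuousLinearMap.pi fun i : Fin 4 =>
        (Fin.cases 0 (fun b => ContinuousLinearMap.proj b) i : Sp →L[ℝ] ℝ)) x := by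
      rw [hasFDerivAt_pi]
      refine fun i => Fin.cases ?_ (fun b => ?_) i
      · exact hasFDerivAt_const _ _
      · exact (ContinuousLinearMap.proj (R := ℝ) (φ := fun _ : Fin 3 => ℝ) b).hasFDerivAt
    rw [this.fderiv]
    funext i
    refine Fin.cases ?_ (fun b => ?_) i
    · simp [dx, pd]
    · simp [dx, pd, scaledField, Pi.single_apply]
  simp only [e, spt_xs, one_pow, one_mul] at h
  linarith

/-- Weighted Sobolev inequality on hyperboloids. -/
lemma sup_hyp {f : St → ℝ} (hf : Sm f) {W : Sp → ℝ} {σ : ℝ} (hW : ContDiff ℝ ∞ W)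
    (hW0 : ∀ x, 0 ≤ W x) (hW1 : ∀ a x, |htime σ x * pderx a W x| ≤ 2 * W x) (x : Sp) :
    htime σ x ^ 3 * W x * f (hyp σ x) ^ 2 ≤ 216 * ∫ x, W x * jet Zf 3 f (hyp σ x) := by
  have hb : ∀ a x, |pderx a (htime σ) x| ≤ 1 := fun a x => by
    rw [pderx_htime, abs_div, abs_of_pos (htime_pos σ x), div_le_one (htime_pos σ x)]
    exact (abs_le_rad x a).trans (rad_lt_htime σ x).le
  have h := sobolev_scaled (htime_smooth_right σ) (htime_pos σ) hb hW hW0 hW1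
    (hf.1.comp (hyp_smooth_right σ)) (hf.hyp_hcs σ) x
  have e : ∀ x, jet (scaledField (htime σ)) 3 (fun x => f (hyp σ x)) x =
      jet bo 3 f (hyp σ x) := by
    refine jet_comp (hyp_smooth_right σ) bo_smooth (fun a x => ?_) 3 hf.1
    have h2 := (smooth_diff (htime_smooth_right σ) x).hasFDerivAt
    have : HasFDerivAt (hyp σ) (ContinuousLinearMap.pi fun i : Fin 4 =>
        (Fin.cases (fderiv ℝ (htime σ) x) (fun b => ContinuousLinearMap.proj b) i :
          Sp →L[ℝ] ℝ)) x := by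
      rw [hasFDerivAt_pi]
      refine fun i => Fin.cases ?_ (fun b => ?_) i
      · exact h2
      · exact (ContinuousLinearMap.proj (R := ℝ) (φ := fun _ : Fin 3 => ℝ) b).hasFDerivAt
    rw [this.fderiv]
    funext i
    refine Fin.cases ?_ (fun b => ?_) i
    · have h3 := vf_scaledField (htime σ) a (htime σ) x
      rw [pderx_htime, mul_div_cancel₀ _ (htime_pos σ x).ne'] at h3
      simpa [bo, hyp_succ, vf] using h3
    · simp [bo, scaledField, Pi.single_apply, hyp_zero]
  have e' : ∀ x, jet (scaledField (htime σ)) 3 (f ∘ hyp σ) x = jet bo 3 f (hyp σ x) := e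
  simp only [e'] at h
  refine h.trans ?_
  norm_num
  refine integral_mono ((hf.jet bo_smooth 3).hyp_integrable_mul hW.continuous σ)
    ((hf.jet Zf_smooth 3).hyp_integrable_mul hW.continuous σ) fun x => ?_
  exact mul_le_mul_of_nonneg_left (jsum_subfamily (X := bo) (Y := Zf) (e := Sum.inr)
    Sum.inr_injective (fun _ => rfl) (A := fun g => g (hyp σ x) ^ 2) (fun _ => sq_nonneg _) 3 f) (hW0 x)

lemma pder_continuous {f : St → ℝ} (hf : ContDiff ℝ 1 f) (α : Fin 4) : Continuous (pder α f) :=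
  (hf.continuous_fderiv (by simp)).clm_apply continuous_const

lemma hasDerivAt_spt {f : St → ℝ} (hf : Differentiable ℝ f) (s : ℝ) (x : Sp) :
    HasDerivAt (fun s => f (spt s x)) (pder 0 f (spt s x)) s := by
  have h1 : HasDerivAt (fun s => spt s x) (Pi.single 0 1) s := by
    rw [hasDerivAt_pi]
    refine fun i => Fin.cases ?_ (fun b => ?_) i
    · simpa [spt] using hasDerivAt_id' s
    · simpa [spt] using hasDerivAt_const s (x b)
  exact (hf _).hasFDerivAt.comp_hasDerivAt s h1

lemma hasFDerivAt_spt_right {f : St → ℝ} (hf : Differentiable ℝ f) (s : ℝ) (x : Sp) (a : Fin 3) :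
    pderx a (fun x => f (spt s x)) x = pder a.succ f (spt s x) := by
  have : HasFDerivAt (spt s) (ContinuousLinearMap.pi fun i : Fin 4 =>
      (Fin.cases 0 (fun b => ContinuousLinearMap.proj b) i : Sp →L[ℝ] ℝ)) x := by
    rw [hasFDerivAt_pi]
    refine fun i => Fin.cases ?_ (fun b => ?_) i
    · exact hasFDerivAt_const _ _
    · exact (ContinuousLinearMap.proj (R := ℝ) (φ := fun _ : Fin 3 => ℝ) b).hasFDerivAt
  have h2 := ((hf (spt s x)).hasFDerivAt.comp x this).fderiv
  rw [pderx]
  change fderiv ℝ (f ∘ spt s) x _ = _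
  rw [h2, ContinuousLinearMap.comp_apply, pder]
  congr 1
  funext i
  refine Fin.cases ?_ (fun b => ?_) i
  · simp
  · simp [Pi.single_apply]

lemma integral_pderx_eq_zero {f : Sp → ℝ} (hf : ContDiff ℝ 1 f) (hc : HasCompactSupport f)
    (a : Fin 3) : ∫ x, pderx a f x = 0 := by
  have h1 : Integrable (fun x => fderiv ℝ f x (Pi.single a 1)) := by
    refine ((hf.continuous_fderiv (by simp)).clm_apply
      continuous_const).integrable_of_hasCompactSupport ((hc.fderiv ℝ).mono ?_)
    intro x hx
    simp only [Function.mem_support] at hx ⊢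
    exact fun h => hx (by rw [h]; rfl)
  have := integral_mul_fderiv_eq_neg_fderiv_mul_of_integrable (μ := volume) (𝕜 := ℝ)
    (f := fun _ : Sp => (1 : ℝ)) (g := f) (v := Pi.single a 1) (by simp) (by simpa using h1)
    (by simpa using hf.continuous.integrable_of_hasCompactSupport hc) (by fun_prop)
    (fun x _ => hf.differentiable (by simp) x)
  simpa [pderx] using this

/-- Integrated form of a divergence identity. -/
lemma hasDerivAt_integral_flux {P R : St → ℝ} {Q : Fin 3 → St → ℝ} (hP : ContDiff ℝ 1 P)
    (hQ : ∀ a, ContDiff ℝ 1 (Q a)) {ρ : ℝ → ℝ} (hρ : Continuous ρ)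
    (hPs : ∀ s x, ρ s < rad x → P (spt s x) = 0)
    (hQs : ∀ a s x, ρ s < rad x → Q a (spt s x) = 0)
    (h : ∀ y, pder 0 P y + ∑ a, pder a.succ (Q a) y = R y) (s : ℝ) :
    HasDerivAt (fun s => ∫ x, P (spt s x)) (∫ x, R (spt s x)) s := by
  obtain ⟨M, hM⟩ := (isCompact_Icc (a := s - 1) (b := s + 1)).exists_bound_of_continuousOn
    hρ.continuousOn
  have hM' : ∀ s' ∈ Set.Icc (s - 1) (s + 1), ρ s' ≤ M := fun s' hs' =>
    (le_abs_self _).trans (hM s' hs')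
  have hcont : Continuous (fun p : ℝ × Sp => pder 0 P (spt p.1 p.2)) :=
    (pder_continuous hP 0).comp spt_smooth.continuous
  obtain ⟨B, hB⟩ := ((isCompact_Icc (a := s - 1) (b := s + 1)).prod
    (isCompact_rad_le M)).exists_bound_of_continuousOn hcont.continuousOn
  have hd := hP.differentiable (by simp)
  have hz : ∀ s' x, ρ s' < rad x → pder 0 P (spt s' x) = 0 := by
    intro s' x hx
    have h1 := hasDerivAt_spt hd s' x
    have h2 : (fun s => P (spt s x)) =ᶠ[nhds s'] fun _ => 0 := by
      filter_upwards [(hρ.tendsto s').eventually_lt_const hx] with t ht using hPs t x ht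
    exact h1.unique ((hasDerivAt_const s' (0 : ℝ)).congr_of_eventuallyEq h2)
  have hPc : ∀ s', Continuous (fun x => P (spt s' x)) := fun s' =>
    hP.continuous.comp (spt_smooth_right s').continuous
  have hP0c : Continuous (fun x => pder 0 P (spt s x)) :=
    (pder_continuous hP 0).comp (spt_smooth_right s).continuous
  have key := (hasDerivAt_integral_of_dominated_loc_of_deriv_le (μ := volume)
    (F := fun s x => P (spt s x)) (F' := fun s x => pder 0 P (spt s x)) (x₀ := s)
    (s := Set.Icc (s - 1) (s + 1)) (bound := fun x => {x | rad x ≤ M}.indicator (fun _ => B) x)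
    (Icc_mem_nhds (by linarith) (by linarith))
    (Filter.Eventually.of_forall fun s' => (hPc s').aestronglyMeasurable)
    ((hPc s).integrable_of_hasCompactSupport (hasCompactSupport_of_rad (hPs s)))
    hP0c.aestronglyMeasurable
    (Filter.Eventually.of_forall fun x s' hs' => ?_)
    ((integrable_indicator_iff (isCompact_rad_le M).measurableSet).2
      (integrableOn_const (isCompact_rad_le M).measure_lt_top.ne))
    (Filter.Eventually.of_forall fun x s' _ => hasDerivAt_spt hd s' x)).2
  · suffices e : ∫ x, R (spt s x) = ∫ x, pder 0 P (spt s x) by rw [e]; exact key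
    have hQd : ∀ a x, pderx a (fun x => Q a (spt s x)) x = pder a.succ (Q a) (spt s x) :=
      fun a x => hasFDerivAt_spt_right ((hQ a).differentiable (by simp)) s x a
    have hQe : ∀ a, (fun x => pder a.succ (Q a) (spt s x)) =
        fun x => pderx a (fun x => Q a (spt s x)) x := fun a => funext fun x => (hQd a x).symm
    have hQc : ∀ a, ContDiff ℝ 1 (fun x => Q a (spt s x)) := fun a =>
      (hQ a).comp ((spt_smooth_right s).of_le (by simp))
    have hQi : ∀ a, ∫ x, pder a.succ (Q a) (spt s x) = 0 := fun a => by
      rw [hQe]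
      exact integral_pderx_eq_zero (hQc a) (hasCompactSupport_of_rad (hQs a s)) a
    have hQint : ∀ a, Integrable (fun x => pder a.succ (Q a) (spt s x)) := fun a => by
      rw [hQe]
      refine (((hQc a).continuous_fderiv (by simp)).clm_apply
        continuous_const).integrable_of_hasCompactSupport
        (((hasCompactSupport_of_rad (hQs a s)).fderiv ℝ).mono ?_)
      intro x hx
      simp only [Function.mem_support] at hx ⊢
      exact fun h => hx (by rw [h]; rfl)
    have : (fun x => R (spt s x)) =
        fun x => pder 0 P (spt s x) + ∑ a, pder a.succ (Q a) (spt s x) :=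
      funext fun x => (h _).symm
    rw [this, integral_add (hP0c.integrable_of_hasCompactSupport (hasCompactSupport_of_rad (hz s)))
      (integrable_finsetSum _ fun a _ => hQint a), integral_finsetSum _ fun a _ => hQint a]
    simp [hQi]
  · by_cases hx : rad x ≤ M
    · simpa [hx] using hB (s', x) ⟨hs', hx⟩
    · rw [hz s' x ((hM' s' hs').trans_lt (not_le.1 hx))]
      simp [hx]

lemma pder_smooth {f : St → ℝ} (hf : ContDiff ℝ ∞ f) (α : Fin 4) : ContDiff ℝ ∞ (pder α f) :=
  vf_smooth (pd_smooth α) hf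

lemma pder_add {f g : St → ℝ} (hf : ContDiff ℝ ∞ f) (hg : ContDiff ℝ ∞ g) (α : Fin 4) :
    pder α (fun y => f y + g y) = fun y => pder α f y + pder α g y := vf_add (X := pd α) hf hg

lemma pder_sub {f g : St → ℝ} (hf : ContDiff ℝ ∞ f) (hg : ContDiff ℝ ∞ g) (α : Fin 4) :
    pder α (fun y => f y - g y) = fun y => pder α f y - pder α g y := vf_sub (X := pd α) hf hg

lemma pder_mul {f g : St → ℝ} (hf : ContDiff ℝ ∞ f) (hg : ContDiff ℝ ∞ g) (α : Fin 4) :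
    pder α (fun y => f y * g y) = fun y => pder α f y * g y + f y * pder α g y :=
  vf_mul (X := pd α) hf hg

lemma pder_sq {f : St → ℝ} (hf : ContDiff ℝ ∞ f) (α : Fin 4) :
    pder α (fun y => f y ^ 2) = fun y => 2 * f y * pder α f y := by
  have : (fun y => f y ^ 2) = fun y => f y * f y := by funext y; ring
  rw [this, pder_mul hf hf]
  funext y; ring

lemma pder_const_mul (c : ℝ) {f : St → ℝ} (hf : ContDiff ℝ ∞ f) (α : Fin 4) :
    pder α (fun y => c * f y) = fun y => c * pder α f y := vf_const_mul (X := pd α) c hf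

lemma pder_sum {κ : Type} {s : Finset κ} {f : κ → St → ℝ} (hf : ∀ i, ContDiff ℝ ∞ (f i))
    (α : Fin 4) : pder α (fun y => ∑ i ∈ s, f i y) = fun y => ∑ i ∈ s, pder α (f i) y :=
  vf_sum (X := pd α) hf

lemma pder_coord (α β : Fin 4) : pder α (fun y => y β) = fun _ => if β = α then 1 else 0 := by
  funext y
  have h : HasFDerivAt (fun y : St => y β)
      (ContinuousLinearMap.proj (R := ℝ) (φ := fun _ : Fin 4 => ℝ) β) y :=
    (ContinuousLinearMap.proj (R := ℝ) (φ := fun _ : Fin 4 => ℝ) β).hasFDerivAt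
  rw [pder, h.fderiv]
  simp [Pi.single_apply]

lemma pder_comm {f : St → ℝ} (hf : ContDiff ℝ ∞ f) (α β : Fin 4) :
    pder α (pder β f) = pder β (pder α f) := by
  funext y
  have hd : DifferentiableAt ℝ (fderiv ℝ f) y :=
    ((hf.fderiv_right (m := ∞) (by simp)).differentiable (by simp)) y
  have h : ∀ v w : St, fderiv ℝ (fun z => fderiv ℝ f z v) y w = fderiv ℝ (fderiv ℝ f) y w v := by
    intro v w
    rw [fderiv_clm_apply hd (differentiableAt_const v)]
    simp
  have hs : IsSymmSndFDerivAt ℝ f y := hf.contDiffAt.isSymmSndFDerivAt (by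
    simp only [minSmoothness_of_isRCLikeNormedField]
    exact WithTop.coe_le_coe.2 le_top)
  change fderiv ℝ (fun z => fderiv ℝ f z (Pi.single β 1)) y (Pi.single α 1) =
    fderiv ℝ (fun z => fderiv ℝ f z (Pi.single α 1)) y (Pi.single β 1)
  rw [h, h]
  exact hs _ _

/-- The Klein-Gordon operator of mass `m`. -/
def KG (m : ℝ) (f : St → ℝ) (y : St) : ℝ := -Box f y + m ^ 2 * f y

lemma Box_smooth {f : St → ℝ} (hf : ContDiff ℝ ∞ f) : ContDiff ℝ ∞ (Box f) :=
  (pder_smooth (pder_smooth hf 0) 0).neg.add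
    (ContDiff.sum fun a _ => pder_smooth (pder_smooth hf a.succ) a.succ)

lemma Sm.KG {f : St → ℝ} (hf : Sm f) (m : ℝ) : Sm (KG m f) := by
  refine ⟨(Box_smooth hf.1).neg.add (contDiff_const.mul hf.1), fun y hy => ?_⟩
  simp [WKG.KG, Box, hf.2 y hy, ((hf.pder _).pder _).2 y hy]

lemma KG_smooth {f : St → ℝ} (hf : ContDiff ℝ ∞ f) (m : ℝ) : ContDiff ℝ ∞ (KG m f) :=
  (Box_smooth hf).neg.add (contDiff_const.mul hf)

lemma pder_KG {f : St → ℝ} (hf : ContDiff ℝ ∞ f) (m : ℝ) (α : Fin 4) :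
    pder α (KG m f) = KG m (pder α f) := by
  have e : KG m f = fun y => (pder 0 (pder 0 f) y - ∑ a : Fin 3, pder a.succ (pder a.succ f) y)
      + m ^ 2 * f y := by funext y; simp [KG, Box]; ring
  have h2 := fun β => pder_smooth (pder_smooth hf β) β
  rw [e, pder_add ((h2 0).sub (ContDiff.sum fun a _ => h2 _)) (contDiff_const.mul hf),
    pder_sub (h2 0) (ContDiff.sum fun a _ => h2 _), pder_sum fun a => h2 _, pder_const_mul _ hf]
  have h3 : ∀ β, pder α (pder β (pder β f)) = pder β (pder β (pder α f)) := fun β => by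
    rw [pder_comm (pder_smooth hf β), pder_comm hf]
  funext y
  simp only [h3, KG, Box]
  ring

lemma pder_Lb {f : St → ℝ} (hf : ContDiff ℝ ∞ f) (a : Fin 3) (α : Fin 4) :
    pder α (Lb a f) = fun y => ((if a.succ = α then pder 0 f y else 0) +
      (if 0 = α then pder a.succ f y else 0)) + Lb a (pder α f) y := by
  have c : ∀ β : Fin 4, ContDiff ℝ ∞ (fun y : St => y β) := fun β => contDiff_apply ℝ ℝ β
  have e : Lb a f = fun y => y a.succ * pder 0 f y + y 0 * pder a.succ f y := rfl
  rw [e, pder_add ((c _).mul (pder_smooth hf _)) ((c _).mul (pder_smooth hf _)),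
    pder_mul (c _) (pder_smooth hf _), pder_mul (c _) (pder_smooth hf _), pder_coord, pder_coord,
    pder_comm hf α 0, pder_comm hf α a.succ]
  funext y
  simp only [Lb, ite_mul, one_mul, zero_mul]
  ring

lemma Lb_smooth {f : St → ℝ} (hf : ContDiff ℝ ∞ f) (a : Fin 3) : ContDiff ℝ ∞ (Lb a f) := by
  rw [← vf_bo]; exact vf_smooth (bo_smooth a) hf

lemma Lb_KG {f : St → ℝ} (hf : ContDiff ℝ ∞ f) (m : ℝ) (a : Fin 3) :
    Lb a (KG m f) = KG m (Lb a f) := by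
  have hs : ∀ α, ContDiff ℝ ∞ (pder α f) := fun α => pder_smooth hf α
  have hz : ContDiff ℝ ∞ (fun _ : St => (0 : ℝ)) := contDiff_const
  have hpz : ∀ α, pder α (fun _ => (0 : ℝ)) = fun _ => 0 := fun α => by funext; simp [pder]
  have key : ∀ α, pder α (pder α (Lb a f)) = fun y =>
      2 * ((if a.succ = α then pder α (pder 0 f) y else 0) +
      (if 0 = α then pder α (pder a.succ f) y else 0)) + Lb a (pder α (pder α f)) y := by
    intro α
    rw [pder_Lb hf]
    split_ifs with h1 h2 h2
    · rw [← h2] at h1; exact absurd h1 (Fin.succ_ne_zero a)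
    · rw [pder_add ((hs 0).add hz) (Lb_smooth (hs α) a), pder_add (hs 0) hz, pder_Lb (hs α), hpz]
      funext y
      simp only [if_pos h1, if_neg h2]
      rw [pder_comm hf 0 α]; ring
    · rw [pder_add (hz.add (hs _)) (Lb_smooth (hs α) a), pder_add hz (hs _), pder_Lb (hs α), hpz]
      funext y
      simp only [if_neg h1, if_pos h2]
      rw [pder_comm hf a.succ α]; ring
    · rw [pder_add (hz.add hz) (Lb_smooth (hs α) a), pder_add hz hz, pder_Lb (hs α), hpz]
      funext y
      simp only [if_neg h1, if_neg h2]
      ring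
  have h4 : Lb a (KG m f) = fun y => (Lb a (pder 0 (pder 0 f)) y
      - ∑ b : Fin 3, Lb a (pder b.succ (pder b.succ f)) y) + m ^ 2 * Lb a f y := by
    have e : KG m f = fun y => (pder 0 (pder 0 f) y
      - ∑ a : Fin 3, pder a.succ (pder a.succ f) y) + m ^ 2 * f y := by
      funext y; simp [KG, Box]; ring
    have h2 := fun β => pder_smooth (pder_smooth hf β) β
    rw [e]
    simp only [← vf_bo]
    rw [vf_add ((h2 0).sub (ContDiff.sum fun a _ => h2 _)) (contDiff_const.mul hf),
      vf_sub (h2 0) (ContDiff.sum fun a _ => h2 _), vf_sum fun a => h2 _, vf_const_mul _ hf]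
  rw [h4]
  funext y
  simp only [KG, Box, key, Finset.sum_add_distrib]
  have h5 : ∑ b : Fin 3, 2 * ((if a.succ = b.succ then pder b.succ (pder 0 f) y else 0) +
      (if 0 = b.succ then pder b.succ (pder a.succ f) y else 0)) = 2 * pder a.succ (pder 0 f) y := by
    rw [← Finset.mul_sum]
    congr 1
    rw [Finset.sum_eq_single a]
    · rw [if_pos rfl, if_neg (Fin.succ_ne_zero a).symm, add_zero]
    · intro b _ hb
      rw [if_neg (fun h => hb (Fin.succ_injective _ h).symm), if_neg (Fin.succ_ne_zero b).symm,
        add_zero]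
    · simp
  rw [h5, pder_comm hf a.succ 0]
  simp
  ring

lemma vf_Zf_KG {f : St → ℝ} (hf : ContDiff ℝ ∞ f) (m : ℝ) :
    ∀ i, KG m (vf (Zf i) f) = vf (Zf i) (KG m f)
  | .inl α => (pder_KG hf m α).symm
  | .inr a => by
    change KG m (vf (bo a) f) = vf (bo a) (KG m f)
    rw [vf_bo, vf_bo, Lb_KG hf]

lemma vf_dx_KG {f : St → ℝ} (hf : ContDiff ℝ ∞ f) (m : ℝ) (a : Fin 3) :
    KG m (vf (dx a) f) = vf (dx a) (KG m f) := (pder_KG hf m a.succ).symm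

section
variable {E : Type} [NormedAddCommGroup E] [NormedSpace ℝ E] {ι : Type} [Fintype ι]

/-- Operators commuting with the fields can be moved through jet sums. -/
lemma jsum_comm_op {X : ι → E → E} {C : (E → ℝ) → Prop} (hC : Stable X C)
    {op : (E → ℝ) → E → ℝ} (h : ∀ f, C f → ∀ i, op (vf (X i) f) = vf (X i) (op f))
    (A : (E → ℝ) → ℝ) (k : ℕ) {f : E → ℝ} (hf : C f) :
    jsum X k (fun g => A (op g)) f = jsum X k A (op f) := by
  induction k generalizing f with
  | zero => rfl
  | succ k ih => simp only [jsum, ih (hC f hf _), h f hf]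

lemma jsum_integral {X : ι → E → E} {C : (E → ℝ) → Prop} (hC : Stable X C) {Ω : Type}
    [MeasurableSpace Ω] {μ : Measure Ω} {B : (E → ℝ) → Ω → ℝ}
    (h : ∀ f, C f → Integrable (B f) μ) (k : ℕ) {f : E → ℝ} (hf : C f) :
    Integrable (fun x => jsum X k (fun g => B g x) f) μ ∧
    jsum X k (fun g => ∫ x, B g x ∂μ) f = ∫ x, jsum X k (fun g => B g x) f ∂μ := by
  induction k generalizing f with
  | zero => exact ⟨h f hf, rfl⟩
  | succ k ih =>
    have h1 := integrable_finsetSum Finset.univ fun i _ => (ih (hC f hf i)).1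
    refine ⟨(h f hf).add h1, ?_⟩
    simp only [jsum]
    rw [integral_add (h f hf) h1, integral_finsetSum _ fun i _ => (ih (hC f hf i)).1]
    congr 1
    exact Finset.sum_congr rfl fun i _ => (ih (hC f hf i)).2

lemma jsum_hasDerivAt {X : ι → E → E} {C : (E → ℝ) → Prop} (hC : Stable X C)
    {A : (E → ℝ) → ℝ → ℝ} {A' : (E → ℝ) → ℝ → ℝ} {s : ℝ}
    (h : ∀ f, C f → HasDerivAt (A f) (A' f s) s) (k : ℕ) {f : E → ℝ} (hf : C f) :
    HasDerivAt (fun s => jsum X k (fun g => A g s) f) (jsum X k (fun g => A' g s) f) s := by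
  induction k generalizing f with
  | zero => exact h f hf
  | succ k ih =>
    exact (h f hf).add (HasDerivAt.fun_sum fun i _ => ih (hC f hf i))

end

/-- The flat energy density. -/
def en (f : St → ℝ) (y : St) : ℝ := f y ^ 2 + ∑ α, pder α f y ^ 2

lemma en_nonneg (f : St → ℝ) (y : St) : 0 ≤ en f y :=
  add_nonneg (sq_nonneg _) (Finset.sum_nonneg fun _ _ => sq_nonneg _)

lemma Sm.en {f : St → ℝ} (hf : Sm f) : Sm (en f) := by
  refine (hf.pow (n := 2) two_ne_zero).add (Sm.sum fun α => ?_)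
  exact (hf.pder α).pow two_ne_zero

lemma flat_deriv {f : St → ℝ} (hf : Sm f) (m t : ℝ) :
    HasDerivAt (fun t => ∫ x, en f (spt t x)) (∫ x, (fun y => 2 * (pder 0 f y * KG m f y) +
      2 * (1 - m ^ 2) * (pder 0 f y * f y)) (spt t x)) t := by
  have hs := fun α => pder_smooth hf.1 α
  have h1 : ∀ a : Fin 3, Sm (fun y => -2 * (pder 0 f y * pder a.succ f y)) := fun a =>
    ((hf.pder 0).mul (hf.pder a.succ)).const_mul _
  refine hasDerivAt_integral_flux (P := WKG.en f) (R := fun y => 2 * (pder 0 f y * KG m f y) +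
      2 * (1 - m ^ 2) * (pder 0 f y * f y))
    (Q := fun a y => -2 * (pder 0 f y * pder a.succ f y)) (ρ := fun t => 1 + |t - 2|)
    (hf.en.1.of_le (by simp)) (fun a => (h1 a).1.of_le (by simp)) (by fun_prop)
    (fun s x hx => hf.en.2 _ hx) (fun a s x hx => (h1 a).2 _ hx) (fun y => ?_) t
  have e : pder 0 (WKG.en f) y = 2 * f y * pder 0 f y +
      ∑ α, 2 * pder α f y * pder 0 (pder α f) y := by
    unfold WKG.en
    rw [pder_add (hf.1.pow 2) (ContDiff.sum fun α _ => (hs α).pow 2), pder_sq hf.1,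
      pder_sum fun α => (hs α).pow 2]
    simp only [pder_sq (hs _)]
  rw [e]
  have e2 : ∀ a : Fin 3, pder a.succ (fun y => -2 * (pder 0 f y * pder a.succ f y)) y =
      -2 * (pder 0 (pder a.succ f) y * pder a.succ f y +
        pder 0 f y * pder a.succ (pder a.succ f) y) := fun a => by
    rw [pder_const_mul _ ((hs 0).mul (hs _)), pder_mul (hs 0) (hs _), pder_comm hf.1 a.succ 0]
  simp only [e2, Fin.sum_univ_succ (n := 3), KG, Box]
  simp only [Fin.sum_univ_three]
  ring

/-- The flat energy of order `k`. -/
def QE (k : ℕ) (t : ℝ) (f : St → ℝ) : ℝ := jsum dx k (fun g => ∫ x, en g (spt t x)) f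

lemma Sm.flat_integrable {f : St → ℝ} (hf : Sm f) (t : ℝ) : Integrable (fun x => f (spt t x)) :=
  hf.integrable t

lemma QE_nonneg (k : ℕ) (t : ℝ) (f : St → ℝ) : 0 ≤ QE k t f :=
  jsum_nonneg (X := dx) (fun g => integral_nonneg fun x => en_nonneg g (spt t x)) k f

lemma integral_jet_flat {f : St → ℝ} (hf : Sm f) (k : ℕ) (t : ℝ) :
    ∫ x, jet dx k f (spt t x) = jsum dx k (fun g => ∫ x, g (spt t x) ^ 2) f :=
  ((jsum_integral (stable_Sm dx_smooth) (B := fun g x => g (spt t x) ^ 2)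
    (fun _ hg => (hg.pow two_ne_zero).integrable t) k hf).2).symm

lemma QE_eq {f : St → ℝ} (hf : Sm f) (k : ℕ) (t : ℝ) :
    QE k t f = (∫ x, jet dx k f (spt t x)) + ∑ α, ∫ x, jet dx k (pder α f) (spt t x) := by
  have h1 : ∀ g, Sm g → (∫ x, en g (spt t x)) =
      (∫ x, g (spt t x) ^ 2) + ∑ α, ∫ x, (pder α g) (spt t x) ^ 2 := fun g hg => by
    have h2 : ∀ α, Integrable (fun x => pder α g (spt t x) ^ 2) := fun α =>
      ((hg.pder α).pow two_ne_zero).integrable t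
    simp only [en]
    rw [integral_add ((hg.pow two_ne_zero).integrable t) (integrable_finsetSum _ fun α _ => h2 α),
      integral_finsetSum _ fun α _ => h2 α]
  rw [QE, jsum_congr (stable_Sm dx_smooth) h1 k hf, jsum_add, jsum_finset_sum,
    integral_jet_flat hf]
  congr 1
  refine Finset.sum_congr rfl fun α _ => ?_
  rw [integral_jet_flat (hf.pder α)]
  exact jsum_comm_op (stable_Sm dx_smooth) (op := pder α)
    (fun g hg a => (pder_comm hg.1 α a.succ)) (fun g => ∫ x, g (spt t x) ^ 2) k hf

lemma QE_deriv {f : St → ℝ} (hf : Sm f) {m : ℝ} (hm : m ∈ Set.Icc (0 : ℝ) 1) (k : ℕ) (t : ℝ) :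
    ∃ D, HasDerivAt (fun t => QE k t f) D t ∧
      |D| ≤ 2 * QE k t f + ∫ x, jet dx k (KG m f) (spt t x) := by
  refine ⟨_, jsum_hasDerivAt (stable_Sm dx_smooth) (A' := fun g t => ∫ x, (fun y =>
    2 * (pder 0 g y * KG m g y) + 2 * (1 - m ^ 2) * (pder 0 g y * g y)) (spt t x))
    (fun g hg => flat_deriv hg m t) k hf, ?_⟩
  set A' : (St → ℝ) → ℝ := fun g => ∫ x, (fun y =>
    2 * (pder 0 g y * KG m g y) + 2 * (1 - m ^ 2) * (pder 0 g y * g y)) (spt t x) with hA'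
  have hm2 : 0 ≤ 1 - m ^ 2 ∧ 1 - m ^ 2 ≤ 1 := ⟨by nlinarith [hm.1, hm.2], by nlinarith [hm.1]⟩
  have hb : ∀ g, Sm g → |A' g| ≤ 2 * (∫ x, en g (spt t x)) + ∫ x, (KG m g) (spt t x) ^ 2 := by
    intro g hg
    rw [← integral_const_mul, ← integral_add (hg.en.integrable t |>.const_mul 2)
      (((hg.KG m).pow two_ne_zero).integrable t)]
    refine (abs_integral_le_integral_abs).trans (integral_mono_of_nonneg
      (Filter.Eventually.of_forall fun x => abs_nonneg _) ((hg.en.integrable t |>.const_mul 2).add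
      (((hg.KG m).pow two_ne_zero).integrable t)) (Filter.Eventually.of_forall fun x => ?_))
    simp only [en, Fin.sum_univ_succ (n := 3)]
    have h3 : 0 ≤ ∑ a : Fin 3, pder a.succ g (spt t x) ^ 2 :=
      Finset.sum_nonneg fun _ _ => sq_nonneg _
    set p := pder 0 g (spt t x)
    set q := g (spt t x)
    set F := KG m g (spt t x)
    have h4 : 2 * (p * q) ≤ p ^ 2 + q ^ 2 := by nlinarith [sq_nonneg (p - q)]
    have h5 : -(p ^ 2 + q ^ 2) ≤ 2 * (p * q) := by nlinarith [sq_nonneg (p + q)]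
    have h6 : 2 * (p * F) ≤ p ^ 2 + F ^ 2 := by nlinarith [sq_nonneg (p - F)]
    have h7 : -(p ^ 2 + F ^ 2) ≤ 2 * (p * F) := by nlinarith [sq_nonneg (p + F)]
    have h8 : 0 ≤ p ^ 2 + q ^ 2 := by positivity
    rw [abs_le]
    constructor <;> nlinarith [mul_le_mul_of_nonneg_left h4 hm2.1,
      mul_le_mul_of_nonneg_left h5 hm2.1, mul_nonneg (sub_nonneg.2 hm2.2) h8]
  have hR : jsum dx k (fun g => 2 * (∫ x, en g (spt t x)) + ∫ x, (KG m g) (spt t x) ^ 2) f =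
      2 * QE k t f + ∫ x, jet dx k (KG m f) (spt t x) := by
    rw [jsum_add, jsum_const_mul, integral_jet_flat (hf.KG m)]
    congr 1
    exact jsum_comm_op (stable_Sm dx_smooth) (op := KG m)
      (fun g hg a => vf_dx_KG hg.1 m a) (fun g => ∫ x, g (spt t x) ^ 2) k hf
  rw [← hR, abs_le']
  refine ⟨jsum_le_jsum (stable_Sm dx_smooth) (fun g hg => (le_abs_self _).trans (hb g hg)) k hf, ?_⟩
  rw [neg_eq_neg_one_mul, ← jsum_const_mul]
  exact jsum_le_jsum (stable_Sm dx_smooth)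
    (fun g hg => by rw [← neg_eq_neg_one_mul]; exact (neg_le_abs _).trans (hb g hg)) k hf

lemma gronwall_exp {f f' : ℝ → ℝ} {T a b l : ℝ} (hd : ∀ t ∈ Set.Icc 0 T, HasDerivAt f (f' t) t)
    (h : ∀ t ∈ Set.Icc 0 T, f' t ≤ a * f t + b * exp (l * t)) (hl : a < l) (hb : 0 ≤ b)
    (h0 : 0 ≤ f 0) {t : ℝ} (ht : t ∈ Set.Icc 0 T) : f t ≤ (f 0 + b / (l - a)) * exp (l * t) := by
  have hla : 0 < l - a := sub_pos.2 hl
  let H : ℝ → ℝ := fun t => exp (-a * t) * f t - b / (l - a) * exp ((l - a) * t)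
  have hH : ∀ t ∈ Set.Icc 0 T, HasDerivAt H (exp (-a * t) * (-a) * f t + exp (-a * t) * f' t -
      b / (l - a) * (exp ((l - a) * t) * (l - a))) t := by
    intro t ht
    have h1 : HasDerivAt (fun t => exp (-a * t)) (exp (-a * t) * (-a)) t := by
      simpa using ((hasDerivAt_id t).const_mul (-a)).exp
    have h2 : HasDerivAt (fun t => exp ((l - a) * t)) (exp ((l - a) * t) * (l - a)) t := by
      simpa using ((hasDerivAt_id t).const_mul (l - a)).exp
    exact (h1.mul (hd t ht)).sub (h2.const_mul _)
  have hanti : AntitoneOn H (Set.Icc 0 T) := by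
    refine antitoneOn_of_deriv_nonpos (convex_Icc 0 T)
      (fun t ht => (hH t ht).continuousAt.continuousWithinAt)
      (fun t ht => (hH t (interior_subset ht)).differentiableAt.differentiableWithinAt) ?_
    intro t ht
    have ht' := interior_subset ht
    rw [(hH t ht').deriv]
    have e : exp ((l - a) * t) = exp (-a * t) * exp (l * t) := by rw [← exp_add]; ring_nf
    have e2 : b / (l - a) * (exp ((l - a) * t) * (l - a)) = b * exp ((l - a) * t) := by
      field_simp
    rw [e2, e]
    nlinarith [h t ht', exp_pos (-a * t)]
  have h1 := hanti ⟨le_rfl, ht.1.trans ht.2⟩ ht ht.1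
  simp only [H, mul_zero, exp_zero, one_mul, mul_one] at h1
  have e : exp ((l - a) * t) = exp (-a * t) * exp (l * t) := by rw [← exp_add]; ring_nf
  have e3 : exp (a * t) * exp (-a * t) = 1 := by rw [← exp_add]; simp
  have h2 : exp (a * t) ≤ exp (l * t) := exp_le_exp.2 (mul_le_mul_of_nonneg_right hl.le ht.1)
  have h3 : 0 ≤ b / (l - a) := div_nonneg hb hla.le
  have h4 : f t ≤ exp (a * t) * (f 0 - b / (l - a)) + b / (l - a) * exp (l * t) := by
    have := mul_le_mul_of_nonneg_left h1 (exp_pos (a * t)).le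
    rw [e] at this
    have e4 : exp (a * t) * (exp (-a * t) * f t - b / (l - a) * (exp (-a * t) * exp (l * t))) =
      f t - b / (l - a) * exp (l * t) := by
      linear_combination (f t - b / (l - a) * exp (l * t)) * e3
    linarith
  nlinarith [mul_le_mul_of_nonneg_right h2 h0, mul_nonneg (exp_pos (a * t)).le h3]

lemma gronwall_decay {f f' : ℝ → ℝ} {s T k b c : ℝ} (hs : 0 ≤ s)
    (hd : ∀ t ∈ Set.Icc s T, HasDerivAt f (f' t) t)
    (h : ∀ t ∈ Set.Icc s T, f' t ≤ k * exp (-c * t) * f t + b * exp (-c * t)) (hc : 0 < c)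
    (hk : 0 ≤ k) (hb : 0 ≤ b) (h0 : 0 ≤ f s) {t : ℝ} (ht : t ∈ Set.Icc s T) :
    f t ≤ exp (k / c) * (f s + b / c) := by
  let φ : ℝ → ℝ := fun t => k / c * exp (-c * t)
  have hexp : ∀ t, HasDerivAt (fun t => exp (-c * t)) (exp (-c * t) * (-c)) t := fun t => by
    simpa using ((hasDerivAt_id t).const_mul (-c)).exp
  have hφ : ∀ t, HasDerivAt φ (-(k * exp (-c * t))) t := fun t => by
    have := (hexp t).const_mul (k / c)
    rwa [show k / c * (exp (-c * t) * -c) = -(k * exp (-c * t)) by field_simp] at this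
  let K : ℝ := exp (k / c) * b / c
  let H : ℝ → ℝ := fun t => exp (φ t) * f t + K * exp (-c * t)
  have hH : ∀ t ∈ Set.Icc s T, HasDerivAt H (exp (φ t) * (-(k * exp (-c * t))) * f t +
      exp (φ t) * f' t + K * (exp (-c * t) * (-c))) t := fun t ht =>
    ((hφ t).exp.mul (hd t ht)).add ((hexp t).const_mul K)
  have hφ1 : ∀ t ∈ Set.Icc s T, 0 ≤ φ t ∧ φ t ≤ k / c := fun t ht => by
    have h1 : exp (-c * t) ≤ 1 := by
      rw [exp_le_one_iff]; nlinarith [ht.1]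
    exact ⟨by positivity, mul_le_of_le_one_right (by positivity) h1⟩
  have hanti : AntitoneOn H (Set.Icc s T) := by
    refine antitoneOn_of_deriv_nonpos (convex_Icc s T)
      (fun t ht => (hH t ht).continuousAt.continuousWithinAt)
      (fun t ht => (hH t (interior_subset ht)).differentiableAt.differentiableWithinAt) ?_
    intro t ht
    have ht' := interior_subset ht
    rw [(hH t ht').deriv]
    have e2 : K * (exp (-c * t) * (-c)) = - (exp (k / c) * (b * exp (-c * t))) := by
      simp only [K]; field_simp
    have h5 : exp (φ t) * (b * exp (-c * t)) ≤ exp (k / c) * (b * exp (-c * t)) :=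
      mul_le_mul_of_nonneg_right (exp_le_exp.2 (hφ1 t ht').2) (by positivity)
    rw [e2]
    nlinarith [mul_le_mul_of_nonneg_left (h t ht') (exp_pos (φ t)).le]
  have h1 := hanti ⟨le_rfl, ht.1.trans ht.2⟩ ht ht.1
  simp only [H] at h1
  have hK : 0 ≤ K := by positivity
  have h2 : exp (-c * s) ≤ 1 := by rw [exp_le_one_iff]; nlinarith
  have hst : s ∈ Set.Icc s T := ⟨le_rfl, ht.1.trans ht.2⟩
  have h3 : exp (φ s) * f s ≤ exp (k / c) * f s :=
    mul_le_mul_of_nonneg_right (exp_le_exp.2 (hφ1 s hst).2) h0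
  have h6 : exp (φ t) * f t ≤ exp (k / c) * (f s + b / c) := by
    have : exp (k / c) * (f s + b / c) = exp (k / c) * f s + K := by simp only [K]; ring
    nlinarith [exp_pos (-c * t), mul_nonneg hK (exp_pos (-c * t)).le]
  by_cases hf : f t ≤ 0
  · exact hf.trans (by positivity)
  · have h7 : 1 ≤ exp (φ t) := one_le_exp (hφ1 t ht).1
    nlinarith

/-- The flat energy estimate. -/
lemma flat_energy {f : St → ℝ} (hf : Sm f) {m : ℝ} (hm : m ∈ Set.Icc (0 : ℝ) 1) (k : ℕ)
    {a b B l : ℝ} (hB : 0 ≤ B) (hl : 2 < l)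
    (h : ∀ t ∈ Set.Icc a b, ∫ x, jet dx k (KG m f) (spt t x) ≤ B * exp (l * |t - 2|))
    (h2 : (2 : ℝ) ∈ Set.Icc a b) {t : ℝ} (ht : t ∈ Set.Icc a b) :
    QE k t f ≤ (QE k 2 f + B / (l - 2)) * exp (l * |t - 2|) := by
  choose D hD hDb using fun t => QE_deriv hf hm k t
  have hDb' := fun t => abs_le'.1 (hDb t)
  rcases le_total 2 t with h3 | h3
  · have := gronwall_exp (f := fun s => QE k (2 + s) f) (f' := fun s => D (2 + s)) (T := b - 2)
      (a := 2) (b := B) (l := l) (fun s _ => (hD (2 + s)).comp_const_add 2 s) (fun s hs => ?_) hl hB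
      (QE_nonneg _ _ _) (t := t - 2) ⟨by linarith, by linarith [ht.2]⟩
    · simpa [abs_of_nonneg (sub_nonneg.2 h3)] using this
    · have h4 := h (2 + s) ⟨by linarith [hs.1, h2.1], by linarith [hs.2]⟩
      rw [add_sub_cancel_left, abs_of_nonneg hs.1] at h4
      linarith [(hDb' (2 + s)).1]
  · have := gronwall_exp (f := fun s => QE k (2 - s) f) (f' := fun s => -D (2 - s)) (T := 2 - a)
      (a := 2) (b := B) (l := l) (fun s _ => (hD (2 - s)).comp_const_sub 2 s) (fun s hs => ?_) hl hB
      (QE_nonneg _ _ _) (t := 2 - t) ⟨by linarith, by linarith [ht.1]⟩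
    · simpa [abs_of_nonpos (sub_nonpos.2 h3)] using this
    · have h4 := h (2 - s) ⟨by linarith [hs.2], by linarith [hs.1, h2.2]⟩
      rw [show 2 - s - 2 = -s by ring, abs_neg, abs_of_nonneg hs.1] at h4
      linarith [(hDb' (2 - s)).2]

/-- The time function of the hyperboloidal parametrization, as a function on spacetime. -/
def hT (y : St) : ℝ := htime (y 0) (xs y)

/-- The hyperboloidal parametrization. -/
def hP (y : St) : St := hyp (y 0) (xs y)

lemma hT_smooth : ContDiff ℝ ∞ hT :=
  htime_smooth.comp ((contDiff_apply ℝ ℝ (0 : Fin 4)).prodMk xs_smooth)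

lemma hP_smooth : ContDiff ℝ ∞ hP :=
  hyp_smooth.comp ((contDiff_apply ℝ ℝ (0 : Fin 4)).prodMk xs_smooth)

lemma hT_pos (y : St) : 0 < hT y := htime_pos _ _

lemma coord_smooth (α : Fin 4) : ContDiff ℝ ∞ (fun y : St => y α) := contDiff_apply ℝ ℝ α

lemma pder_exp (α : Fin 4) (y : St) :
    pder α (fun y => exp (2 * y 0)) y = if α = 0 then 2 * exp (2 * y 0) else 0 := by
  have h : HasFDerivAt (fun y : St => exp (2 * y 0)) _ y :=
    (((ContinuousLinearMap.proj (R := ℝ) (φ := fun _ : Fin 4 => ℝ) 0).hasFDerivAt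
      (x := y)).const_mul 2).exp
  rw [pder, h.fderiv]
  simp [Pi.single_apply, eq_comm]
  split_ifs <;> ring

lemma pder_hT (α : Fin 4) (y : St) :
    pder α hT y = (if α = 0 then exp (2 * y 0) else y α) / hT y := by
  have e : (fun y => hT y * hT y) = fun y => exp (2 * y 0) + ∑ a : Fin 3, y a.succ ^ 2 := by
    funext y
    rw [← pow_two]
    exact htime_sq (y 0) (xs y)
  have h1 : pder α (fun y => hT y * hT y) y = 2 * hT y * pder α hT y := by
    rw [pder_mul hT_smooth hT_smooth]; ring
  rw [e, pder_add (by fun_prop) (ContDiff.sum fun a _ => (coord_smooth _).pow 2),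
    pder_sum fun a => (coord_smooth _).pow 2] at h1
  simp only [pder_sq (coord_smooth _), pder_coord, pder_exp] at h1
  have hp := hT_pos y
  rw [eq_div_iff hp.ne']
  refine Fin.cases (fun h1 => ?_) (fun a h1 => ?_) α h1
  · simp at h1 ⊢
    linarith
  · simp [Fin.succ_ne_zero, Fin.succ_inj] at h1 ⊢
    linarith

lemma fderiv_hP (y : St) (α : Fin 4) : fderiv ℝ hP y (Pi.single α 1) =
    (if α = 0 then (exp (2 * y 0) / hT y) • Pi.single 0 1
      else (y α / hT y) • Pi.single 0 1 + Pi.single α 1 : St) := by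
  have hd := (hP_smooth.differentiable (by simp)) y
  have h : ∀ i, fderiv ℝ hP y (Pi.single α 1) i = pder α (fun y => hP y i) y := fun i => by
    rw [pder]
    have := ((ContinuousLinearMap.proj (R := ℝ) (φ := fun _ : Fin 4 => ℝ) i).hasFDerivAt.comp y
      hd.hasFDerivAt).fderiv
    change _ = fderiv ℝ ((ContinuousLinearMap.proj (R := ℝ) (φ := fun _ : Fin 4 => ℝ) i) ∘ hP) y _
    rw [this]; rfl
  funext i
  rw [h]
  refine Fin.cases ?_ (fun b => ?_) i
  · change pder α hT y = _
    rw [pder_hT]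
    split_ifs with h0
    · simp
    · simp [Ne.symm h0]
  · change pder α (fun y => y b.succ) y = _
    rw [pder_coord]
    split_ifs with h1 h2 h2
    · subst h2; exact absurd h1 (Fin.succ_ne_zero b)
    · simp [h1, h2]
    · simp [Fin.succ_ne_zero]
    · simp [h1, Fin.succ_ne_zero]

lemma pder_comp_hP {f : St → ℝ} (hf : ContDiff ℝ ∞ f) (α : Fin 4) (y : St) :
    pder α (fun y => f (hP y)) y = if α = 0 then exp (2 * y 0) / hT y * pder 0 f (hP y)
      else y α / hT y * pder 0 f (hP y) + pder α f (hP y) := by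
  have h : pder α (fun y => f (hP y)) y = fderiv ℝ f (hP y) (fderiv ℝ hP y (Pi.single α 1)) := by
    rw [pder]
    change fderiv ℝ (f ∘ hP) y _ = _
    rw [fderiv_comp y (smooth_diff hf _) ((hP_smooth.differentiable (by simp)) y)]; rfl
  rw [h, fderiv_hP]
  split_ifs
  · rw [map_smul]; rfl
  · rw [map_add, map_smul]; rfl

lemma inv_hT_smooth : ContDiff ℝ ∞ (fun y => (hT y)⁻¹) := hT_smooth.inv fun y => (hT_pos y).ne'

lemma pder_inv_hT (α : Fin 4) (y : St) :
    pder α (fun y => (hT y)⁻¹) y = -(pder α hT y) / hT y ^ 2 := by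
  have h : pder α (fun y => hT y * (hT y)⁻¹) y = 0 := by
    simp [mul_inv_cancel₀ (hT_pos _).ne', pder]
  have hp := (hT_pos y).ne'
  rw [pder_mul hT_smooth inv_hT_smooth] at h
  field_simp at h ⊢
  linarith

/-- The divergence theorem between hyperboloids. -/
lemma hyp_flux {J : Fin 4 → St → ℝ} (hJ : ∀ α, Sm (J α)) (σ : ℝ) :
    HasDerivAt (fun σ => ∫ x, (J 0 (hyp σ x) - ∑ a : Fin 3, x a / htime σ x *
      J a.succ (hyp σ x))) (∫ x, exp (2 * σ) / htime σ x * ∑ α, pder α (J α) (hyp σ x)) σ := by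
  have hc : ∀ α, ContDiff ℝ ∞ (fun y => J α (hP y)) := fun α => (hJ α).1.comp hP_smooth
  have hw : ∀ a : Fin 3, ContDiff ℝ ∞ (fun y : St => y a.succ * (hT y)⁻¹) := fun a =>
    (coord_smooth _).mul inv_hT_smooth
  have he : ContDiff ℝ ∞ (fun y : St => exp (2 * y 0) * (hT y)⁻¹) :=
    ContDiff.mul (by fun_prop) inv_hT_smooth
  have h := hasDerivAt_integral_flux
    (P := fun y => J 0 (hP y) - ∑ a : Fin 3, (y a.succ * (hT y)⁻¹) * J a.succ (hP y))
    (Q := fun a y => (exp (2 * y 0) * (hT y)⁻¹) * J a.succ (hP y))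
    (R := fun y => exp (2 * y 0) * (hT y)⁻¹ * ∑ α, pder α (J α) (hP y))
    (ρ := fun σ => 2 + exp (2 * σ))
    (((hc 0).sub (ContDiff.sum fun a _ => (hw a).mul (hc a.succ))).of_le (by simp))
    (fun a => (he.mul (hc a.succ)).of_le (by simp)) (by fun_prop)
    (fun s x hx => ?_) (fun a s x hx => ?_) (fun y => ?_) σ
  · exact h
  · change J 0 (hyp s x) - ∑ a : Fin 3, _ * J a.succ (hyp s x) = 0
    simp [(hJ _).hyp_zero hx]
  · change _ * J a.succ (hyp s x) = 0
    simp [(hJ _).hyp_zero hx]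
  · rw [pder_sub (hc 0) (ContDiff.sum fun a _ => (hw a).mul (hc a.succ)),
      pder_sum fun a => (hw a).mul (hc a.succ)]
    have e1 : ∀ a : Fin 3, pder 0 (fun y : St => (y a.succ * (hT y)⁻¹) * J a.succ (hP y)) y =
        -(y a.succ * exp (2 * y 0)) / hT y ^ 3 * J a.succ (hP y) +
        y a.succ / hT y * (exp (2 * y 0) / hT y * pder 0 (J a.succ) (hP y)) := fun a => by
      rw [pder_mul (hw a) (hc _), pder_mul (coord_smooth _) inv_hT_smooth, pder_coord]
      simp only [pder_inv_hT, pder_hT, pder_comp_hP (hJ _).1, Fin.succ_ne_zero, if_true, if_false]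
      field_simp
      ring
    have e2 : ∀ a : Fin 3, pder a.succ (fun y : St => (exp (2 * y 0) * (hT y)⁻¹) *
        J a.succ (hP y)) y = -(y a.succ * exp (2 * y 0)) / hT y ^ 3 * J a.succ (hP y) +
        exp (2 * y 0) / hT y * (y a.succ / hT y * pder 0 (J a.succ) (hP y) +
          pder a.succ (J a.succ) (hP y)) := fun a => by
      rw [pder_mul he (hc _), pder_mul (by fun_prop) inv_hT_smooth]
      simp only [pder_inv_hT, pder_hT, pder_comp_hP (hJ _).1, pder_exp, Fin.succ_ne_zero, if_false]
      field_simp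
      ring
    simp only [e1, e2, pder_comp_hP (hJ _).1, if_true, Fin.sum_univ_succ (n := 3),
      Fin.sum_univ_three]
    have hp := (hT_pos y).ne'
    field_simp
    ring

/-- The energy density of the Klein-Gordon equation on hyperboloids. -/
def hd (m σ : ℝ) (f : St → ℝ) (x : Sp) : ℝ :=
  1 / 2 * (∑ α, pder α f (hyp σ x) ^ 2 + m ^ 2 * f (hyp σ x) ^ 2) +
    ∑ a : Fin 3, x a / htime σ x * (pder 0 f (hyp σ x) * pder a.succ f (hyp σ x))

lemma hd_eq (m σ : ℝ) (f : St → ℝ) (x : Sp) : hd m σ f x =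
    1 / 2 * ((exp σ / htime σ x) ^ 2 * pder 0 f (hyp σ x) ^ 2 +
      ∑ a : Fin 3, (pder a.succ f (hyp σ x) + x a / htime σ x * pder 0 f (hyp σ x)) ^ 2 +
      m ^ 2 * f (hyp σ x) ^ 2) := by
  have h1 : (exp σ / htime σ x) ^ 2 = 1 - ∑ a : Fin 3, (x a / htime σ x) ^ 2 := by
    have h2 := htime_sq σ x
    have h3 := (htime_pos σ x).ne'
    have h4 : exp σ ^ 2 = exp (2 * σ) := by rw [← exp_nat_mul]; norm_num
    simp only [div_pow, ← Finset.sum_div, h4]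
    field_simp
    linarith
  rw [h1, hd]
  simp only [Fin.sum_univ_succ (n := 3), Fin.sum_univ_three]
  ring

lemma ratio_sq_le (σ : ℝ) (x : Sp) (a : Fin 3) : (x a / htime σ x) ^ 2 ≤ 1 := by
  rw [sq_le_one_iff_abs_le_one, abs_div, abs_of_pos (htime_pos σ x), div_le_one (htime_pos σ x)]
  exact (abs_le_rad x a).trans (rad_lt_htime σ x).le

lemma exp_div_htime_le (σ : ℝ) (x : Sp) : exp σ / htime σ x ≤ 1 :=
  (div_le_one (htime_pos σ x)).2 (exp_le_htime σ x)

lemma hd_coercive (m σ : ℝ) (f : St → ℝ) (x : Sp) :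
    (exp σ / htime σ x) ^ 2 * ∑ α, pder α f (hyp σ x) ^ 2 + m ^ 2 * f (hyp σ x) ^ 2 ≤
      14 * hd m σ f x := by
  rw [hd_eq, Fin.sum_univ_succ (n := 3)]
  set w := (exp σ / htime σ x) ^ 2
  set p := pder 0 f (hyp σ x)
  have hw : w ≤ 1 := pow_le_one₀ (div_nonneg (exp_pos _).le (htime_pos _ _).le)
    (exp_div_htime_le σ x)
  have hw0 : 0 ≤ w := sq_nonneg _
  have h1 : ∀ a : Fin 3, w * pder a.succ f (hyp σ x) ^ 2 ≤
      2 * (pder a.succ f (hyp σ x) + x a / htime σ x * p) ^ 2 + 2 * (w * p ^ 2) := fun a => by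
    have h2 := ratio_sq_le σ x a
    set q := pder a.succ f (hyp σ x)
    set r := x a / htime σ x
    have h3 : q ^ 2 ≤ 2 * (q + r * p) ^ 2 + 2 * (r ^ 2 * p ^ 2) := by
      nlinarith [sq_nonneg (q + 2 * (r * p))]
    have h4 : r ^ 2 * p ^ 2 ≤ p ^ 2 := mul_le_of_le_one_left (sq_nonneg _) h2
    nlinarith [mul_le_mul_of_nonneg_left h3 hw0, mul_le_mul_of_nonneg_left h4 hw0,
      mul_nonneg (sub_nonneg.2 hw) (sq_nonneg (q + r * p))]
  have h2 := Finset.sum_le_sum fun a (_ : a ∈ Finset.univ) => h1 a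
  rw [Finset.sum_add_distrib, ← Finset.mul_sum, ← Finset.mul_sum] at h2
  simp only [Finset.sum_const, Finset.card_univ, Fintype.card_fin, nsmul_eq_mul] at h2
  have h3 : 0 ≤ ∑ a : Fin 3, (pder a.succ f (hyp σ x) + x a / htime σ x * p) ^ 2 :=
    Finset.sum_nonneg fun _ _ => sq_nonneg _
  have h4 : 0 ≤ m ^ 2 * f (hyp σ x) ^ 2 := by positivity
  push_cast at h2
  nlinarith [mul_nonneg hw0 (sq_nonneg p)]

lemma hd_nonneg (m σ : ℝ) (f : St → ℝ) (x : Sp) : 0 ≤ hd m σ f x := by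
  rw [hd_eq]; positivity

lemma hd_le (m σ : ℝ) (f : St → ℝ) (x : Sp) :
    hd m σ f x ≤ 2 * (∑ α, pder α f (hyp σ x) ^ 2 + m ^ 2 * f (hyp σ x) ^ 2) := by
  have h1 : ∀ a : Fin 3, x a / htime σ x * (pder 0 f (hyp σ x) * pder a.succ f (hyp σ x)) ≤
      1 / 2 * (pder 0 f (hyp σ x) ^ 2 + pder a.succ f (hyp σ x) ^ 2) := fun a => by
    have h2 := ratio_sq_le σ x a
    set r := x a / htime σ x
    set p := pder 0 f (hyp σ x)
    set q := pder a.succ f (hyp σ x)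
    nlinarith [sq_nonneg (r * p - q), mul_nonneg (sub_nonneg.2 h2) (sq_nonneg p)]
  have h2 := Finset.sum_le_sum fun a (_ : a ∈ Finset.univ) => h1 a
  rw [← Finset.mul_sum, Finset.sum_add_distrib] at h2
  simp only [Finset.sum_const, Finset.card_univ, Fintype.card_fin, nsmul_eq_mul] at h2
  push_cast at h2
  rw [hd, Fin.sum_univ_succ (n := 3)]
  have h3 : 0 ≤ ∑ a : Fin 3, pder a.succ f (hyp σ x) ^ 2 := Finset.sum_nonneg fun _ _ => sq_nonneg _
  have h4 : 0 ≤ m ^ 2 * f (hyp σ x) ^ 2 := by positivity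
  nlinarith [sq_nonneg (pder 0 f (hyp σ x))]

lemma hyp_int {f : St → ℝ} (hf : Sm f) (σ : ℝ) {g : Sp → ℝ} (hg : Continuous g) :
    Integrable (fun x => g x * f (hyp σ x)) := hf.hyp_integrable_mul hg σ

lemma ratio_continuous (σ : ℝ) (a : Fin 3) : Continuous (fun x : Sp => x a / htime σ x) :=
  (continuous_apply a).div (htime_smooth_right σ).continuous fun x => (htime_pos σ x).ne'

lemma expratio_continuous (σ : ℝ) : Continuous (fun x : Sp => exp σ / htime σ x) :=
  continuous_const.div (htime_smooth_right σ).continuous fun x => (htime_pos σ x).ne'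

lemma hd_integrable {f : St → ℝ} (hf : Sm f) (m σ : ℝ) : Integrable (hd m σ f) := by
  refine Integrable.add (Integrable.const_mul (Integrable.add
    (integrable_finsetSum _ fun α _ => ?_) (Integrable.const_mul ?_ _)) _)
    (integrable_finsetSum _ fun a _ => ?_)
  · exact ((hf.pder α).pow two_ne_zero).hyp_integrable σ
  · exact (hf.pow two_ne_zero).hyp_integrable σ
  · exact hyp_int ((hf.pder 0).mul (hf.pder a.succ)) σ (ratio_continuous σ a)

/-- The Klein-Gordon energy on hyperboloids. -/
def HE (m : ℝ) (k : ℕ) (σ : ℝ) (f : St → ℝ) : ℝ := jsum Zf k (fun g => ∫ x, hd m σ g x) f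

lemma HE_nonneg (m : ℝ) (k : ℕ) (σ : ℝ) (f : St → ℝ) : 0 ≤ HE m k σ f :=
  jsum_nonneg (X := Zf) (fun g => integral_nonneg fun x => hd_nonneg m σ g x) k f

lemma HE_base_deriv {f : St → ℝ} (hf : Sm f) (m σ : ℝ) :
    HasDerivAt (fun σ => ∫ x, hd m σ f x)
      (∫ x, exp (2 * σ) / htime σ x * (pder 0 f (hyp σ x) * KG m f (hyp σ x))) σ := by
  have hs := fun α => pder_smooth hf.1 α
  have hJ : ∀ α : Fin 4, Sm ((Fin.cons (fun y => 1 / 2 * (∑ α, pder α f y ^ 2 + m ^ 2 * f y ^ 2))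
      (fun a y => -1 * (pder 0 f y * pder a.succ f y)) : Fin 4 → St → ℝ) α) := by
    refine fun α => Fin.cases ?_ (fun a => ?_) α
    · exact Sm.const_mul _ ((Sm.sum fun α => (hf.pder α).pow two_ne_zero).add
        ((hf.pow two_ne_zero).const_mul _))
    · exact Sm.const_mul _ ((hf.pder 0).mul (hf.pder a.succ))
  have h := hyp_flux hJ σ
  simp only [Fin.cons_zero, Fin.cons_succ] at h
  have e : (fun σ => ∫ x, hd m σ f x) = fun σ => ∫ x, (1 / 2 * (∑ α, pder α f (hyp σ x) ^ 2 +
      m ^ 2 * f (hyp σ x) ^ 2) - ∑ a : Fin 3, x a / htime σ x *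
      (-1 * (pder 0 f (hyp σ x) * pder a.succ f (hyp σ x)))) := by
    funext σ
    refine integral_congr_ae (Filter.Eventually.of_forall fun x => ?_)
    simp [hd]
  rw [e]
  convert h using 1
  refine integral_congr_ae (Filter.Eventually.of_forall fun x => ?_)
  dsimp only
  congr 1
  set y := hyp σ x
  rw [Fin.sum_univ_succ]
  simp only [Fin.cons_zero, Fin.cons_succ]
  rw [pder_const_mul _ ((ContDiff.sum fun α _ => (hs α).pow 2).add
    (contDiff_const.mul (hf.1.pow 2))), pder_add (ContDiff.sum fun α _ => (hs α).pow 2)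
    (contDiff_const.mul (hf.1.pow 2)), pder_sum fun α => (hs α).pow 2,
    pder_const_mul _ (hf.1.pow 2), pder_sq hf.1]
  have e2 : ∀ a : Fin 3, pder a.succ (fun y => -1 * (pder 0 f y * pder a.succ f y)) y =
      -1 * (pder 0 (pder a.succ f) y * pder a.succ f y +
        pder 0 f y * pder a.succ (pder a.succ f) y) := fun a => by
    rw [pder_const_mul _ ((hs 0).mul (hs _)), pder_mul (hs 0) (hs _), pder_comm hf.1 a.succ 0]
  simp only [e2, pder_sq (hs _), Fin.sum_univ_succ (n := 3), KG, Box, Fin.sum_univ_three]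
  ring

lemma integral_jet_hyp {f : St → ℝ} (hf : Sm f) (k : ℕ) (σ : ℝ) {w : Sp → ℝ} (hw : Continuous w) :
    ∫ x, w x * jet Zf k f (hyp σ x) = jsum Zf k (fun g => ∫ x, w x * g (hyp σ x) ^ 2) f := by
  rw [(jsum_integral (stable_Sm Zf_smooth) (B := fun g x => w x * g (hyp σ x) ^ 2)
    (fun g hg => hyp_int (hg.pow two_ne_zero) σ hw) k hf).2]
  simp only [jsum_const_mul]; rfl

lemma HE_deriv {f : St → ℝ} (hf : Sm f) (m : ℝ) (k : ℕ) (σ : ℝ) : ∃ D,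
    HasDerivAt (fun σ => HE m k σ f) D σ ∧ ∀ κ : ℝ, 0 < κ →
      D ≤ κ * HE m k σ f + exp (2 * σ) / (2 * κ) * ∫ x, jet Zf k (KG m f) (hyp σ x) := by
  refine ⟨_, jsum_hasDerivAt (stable_Sm Zf_smooth) (A' := fun g σ => ∫ x, exp (2 * σ) / htime σ x *
    (pder 0 g (hyp σ x) * KG m g (hyp σ x))) (fun g hg => HE_base_deriv hg m σ) k hf,
    fun κ hκ => ?_⟩
  have hb : ∀ g, Sm g → ∫ x, exp (2 * σ) / htime σ x * (pder 0 g (hyp σ x) * KG m g (hyp σ x)) ≤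
      κ * (∫ x, hd m σ g x) + exp (2 * σ) / (2 * κ) * ∫ x, 1 * (KG m g) (hyp σ x) ^ 2 := by
    intro g hg
    rw [← integral_const_mul, ← integral_const_mul,
      ← integral_add ((hd_integrable hg m σ).const_mul _)
      ((hyp_int ((hg.KG m).pow two_ne_zero) σ continuous_const).const_mul _)]
    refine integral_mono (hyp_int ((hg.pder 0).mul (hg.KG m)) σ (continuous_const.div
      (htime_smooth_right σ).continuous fun x => (htime_pos σ x).ne'))
      (((hd_integrable hg m σ).const_mul _).add
      ((hyp_int ((hg.KG m).pow two_ne_zero) σ continuous_const).const_mul _)) fun x => ?_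
    have h1 : (exp σ / htime σ x * pder 0 g (hyp σ x)) ^ 2 ≤ 2 * hd m σ g x := by
      rw [hd_eq, mul_pow]
      have h3 : 0 ≤ ∑ a : Fin 3, (pder a.succ g (hyp σ x) + x a / htime σ x *
        pder 0 g (hyp σ x)) ^ 2 := Finset.sum_nonneg fun _ _ => sq_nonneg _
      have h4 : 0 ≤ m ^ 2 * g (hyp σ x) ^ 2 := by positivity
      linarith
    have h4 : exp (2 * σ) = exp σ ^ 2 := by rw [← exp_nat_mul]; norm_num
    have e : exp (2 * σ) / htime σ x * (pder 0 g (hyp σ x) * KG m g (hyp σ x)) =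
      exp σ * ((exp σ / htime σ x * pder 0 g (hyp σ x)) * KG m g (hyp σ x)) := by
      rw [h4]; ring
    dsimp only
    rw [e, h4]
    set p := exp σ / htime σ x * pder 0 g (hyp σ x)
    set F := KG m g (hyp σ x)
    have h5 : exp σ * (p * F) ≤ κ / 2 * p ^ 2 + exp σ ^ 2 / (2 * κ) * F ^ 2 := by
      have : κ / 2 * p ^ 2 + exp σ ^ 2 / (2 * κ) * F ^ 2 - exp σ * (p * F) =
          (κ * p - exp σ * F) ^ 2 / (2 * κ) := by field_simp; ring
      have h6 : 0 ≤ (κ * p - exp σ * F) ^ 2 / (2 * κ) := by positivity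
      linarith
    nlinarith
  refine (jsum_le_jsum (stable_Sm Zf_smooth) hb k hf).trans (le_of_eq ?_)
  rw [jsum_add, jsum_const_mul, jsum_const_mul, HE]
  congr 2
  have := integral_jet_hyp (hf.KG m) k σ (w := fun _ => 1) continuous_const
  simp only [one_mul] at this ⊢
  rw [this]
  exact jsum_comm_op (stable_Sm Zf_smooth) (op := KG m)
    (fun g hg a => vf_Zf_KG hg.1 m a) (fun g => ∫ x, g (hyp σ x) ^ 2) k hf

/-- Commutation of the fields with partial derivatives inside jets. -/
lemma jet_pder_le (k : ℕ) : ∃ C : ℝ, 0 ≤ C ∧ ∀ f : St → ℝ, ContDiff ℝ ∞ f → ∀ y,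
    ∑ α, jet Zf k (pder α f) y ≤ C * jsum Zf k (fun g => ∑ β, pder β g y ^ 2) f := by
  have hA : ∀ (y : St) (g : St → ℝ), 0 ≤ ∑ β, pder β g y ^ 2 := fun y g =>
    Finset.sum_nonneg fun _ _ => sq_nonneg _
  induction k with
  | zero => exact ⟨1, zero_le_one, fun f _ y => by simp [jet_zero, jsum]⟩
  | succ k ih =>
    obtain ⟨C, hC, h⟩ := ih
    refine ⟨1 + 2 * C + 12 * C, by positivity, fun f hf y => ?_⟩
    have hsp := fun α => pder_smooth hf α
    have hZs : ∀ i, ContDiff ℝ ∞ (vf (Zf i) f) := fun i => vf_smooth (Zf_smooth i) hf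
    have hc : ∀ α i, jet Zf k (vf (Zf i) (pder α f)) y ≤ 2 * jet Zf k (pder α (vf (Zf i) f)) y +
        (match i with
          | .inl _ => 0
          | .inr a => 2 * ((if a.succ = α then jet Zf k (pder 0 f) y else 0) +
            if 0 = α then jet Zf k (pder a.succ f) y else 0)) := by
      rintro α (β | a)
      · change jet Zf k (pder β (pder α f)) y ≤ 2 * jet Zf k (pder α (pder β f)) y + 0
        rw [pder_comm hf β α]
        linarith [jet_nonneg (X := Zf) k (pder α (pder β f)) y]
      · change jet Zf k (vf (bo a) (pder α f)) y ≤ 2 * jet Zf k (pder α (vf (bo a) f)) y +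
          2 * ((if a.succ = α then jet Zf k (pder 0 f) y else 0) +
            if 0 = α then jet Zf k (pder a.succ f) y else 0)
        have hL := pder_smooth (Lb_smooth hf a) α
        rw [vf_bo, vf_bo]
        have key : ∀ β, Lb a (pder α f) = (fun y => pder α (Lb a f) y + (-1) * pder β f y) →
            jet Zf k (Lb a (pder α f)) y ≤ 2 * jet Zf k (pder α (Lb a f)) y +
              2 * jet Zf k (pder β f) y := fun β e => by
          rw [e]
          refine (jet_add_le Zf_smooth k hL (contDiff_const.mul (hsp β)) y).trans ?_
          rw [jet_const_mul Zf_smooth _ k (hsp β)]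
          linarith
        have e0 := pder_Lb hf a α
        by_cases h1 : a.succ = α
        · have h2 : ¬ (0 : Fin 4) = α := by rw [← h1]; exact (Fin.succ_ne_zero a).symm
          simp only [if_pos h1, if_neg h2, add_zero] at e0 ⊢
          exact key 0 (by rw [e0]; funext y; ring)
        · by_cases h2 : (0 : Fin 4) = α
          · simp only [if_neg h1, if_pos h2, zero_add] at e0 ⊢
            exact key a.succ (by rw [e0]; funext y; ring)
          · simp only [if_neg h1, if_neg h2, zero_add] at e0 ⊢
            rw [e0]
            linarith [jet_nonneg (X := Zf) k (Lb a (pder α f)) y]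
    have hsum : ∑ α, ∑ i, jet Zf k (vf (Zf i) (pder α f)) y ≤
        2 * C * ∑ i, jsum Zf k (fun g => ∑ β, pder β g y ^ 2) (vf (Zf i) f) +
        12 * ∑ β, jet Zf k (pder β f) y := by
      rw [Finset.sum_comm, Fintype.sum_sum_type]
      rw [Fintype.sum_sum_type, mul_add]
      have t1 : ∀ β : Fin 4, ∑ α, jet Zf k (vf (Zf (.inl β)) (pder α f)) y ≤
          2 * C * jsum Zf k (fun g => ∑ β, pder β g y ^ 2) (vf (Zf (.inl β)) f) := fun β => by
        refine (Finset.sum_le_sum fun α _ => hc α (.inl β)).trans ?_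
        simp only [add_zero]
        rw [← Finset.mul_sum, mul_assoc]
        exact mul_le_mul_of_nonneg_left (h _ (hZs _) y) zero_le_two
      have t2 : ∀ a : Fin 3, ∑ α, jet Zf k (vf (Zf (.inr a)) (pder α f)) y ≤
          2 * C * jsum Zf k (fun g => ∑ β, pder β g y ^ 2) (vf (Zf (.inr a)) f) +
          4 * ∑ β, jet Zf k (pder β f) y := fun a => by
        refine (Finset.sum_le_sum fun α _ => hc α (.inr a)).trans ?_
        rw [Finset.sum_add_distrib, ← Finset.mul_sum, ← Finset.mul_sum, Finset.sum_add_distrib]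
        simp only [Finset.sum_ite_eq, Finset.mem_univ, if_true]
        have h5 := mul_le_mul_of_nonneg_left (h _ (hZs (.inr a)) y) zero_le_two
        have h6 : ∀ β, jet Zf k (pder β f) y ≤ ∑ β, jet Zf k (pder β f) y := fun β =>
          Finset.single_le_sum (fun β _ => jet_nonneg k (pder β f) y) (Finset.mem_univ β)
        linarith [h6 0, h6 a.succ]
      have s1 := Finset.sum_le_sum fun β (_ : β ∈ Finset.univ) => t1 β
      have s2 := Finset.sum_le_sum fun a (_ : a ∈ Finset.univ) => t2 a
      rw [← Finset.mul_sum] at s1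
      rw [Finset.sum_add_distrib, ← Finset.mul_sum] at s2
      simp only [Finset.sum_const, Finset.card_univ, Fintype.card_fin, nsmul_eq_mul] at s2
      push_cast at s2
      linarith
    have h7 := h f hf y
    simp only [jet_succ, Finset.sum_add_distrib]
    simp only [jsum]
    set A0 := ∑ β, pder β f y ^ 2
    set S := ∑ i, jsum Zf k (fun g => ∑ β, pder β g y ^ 2) (vf (Zf i) f)
    have hA0 : 0 ≤ A0 := hA y f
    have hS : 0 ≤ S := Finset.sum_nonneg fun i _ => jsum_nonneg (X := Zf) (hA y) _ _
    have h8 : jsum Zf k (fun g => ∑ β, pder β g y ^ 2) f ≤ A0 + S :=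
      jsum_succ_le (X := Zf) (hA y) k f
    nlinarith [mul_le_mul_of_nonneg_left h8 hC, mul_nonneg hC hA0, mul_nonneg hC hS]

/-- Coercivity of the hyperboloidal energy. -/
lemma HE_coercive (k : ℕ) : ∃ C : ℝ, 0 ≤ C ∧ ∀ f : St → ℝ, Sm f → ∀ m σ : ℝ,
    (∑ α, ∫ x, (exp σ / htime σ x) ^ 2 * jet Zf k (pder α f) (hyp σ x)) +
      m ^ 2 * ∫ x, jet Zf k f (hyp σ x) ≤ C * HE m k σ f := by
  obtain ⟨C, hC, h⟩ := jet_pder_le k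
  refine ⟨14 * (C + 1), by positivity, fun f hf m σ => ?_⟩
  have hw : Continuous fun x : Sp => (exp σ / htime σ x) ^ 2 := (expratio_continuous σ).pow 2
  have hi1 : ∀ α, Integrable fun x => (exp σ / htime σ x) ^ 2 * jet Zf k (pder α f) (hyp σ x) :=
    fun α => hyp_int ((hf.pder α).jet Zf_smooth k) σ hw
  have hi2 : Integrable fun x => m ^ 2 * jet Zf k f (hyp σ x) :=
    ((hf.jet Zf_smooth k).hyp_integrable σ).const_mul _
  have hi3 := jsum_integral (stable_Sm Zf_smooth) (B := fun g x => hd m σ g x)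
    (fun g hg => hd_integrable hg m σ) k hf
  rw [HE, hi3.2, ← integral_finsetSum _ fun α _ => hi1 α, ← integral_const_mul,
    ← integral_add (integrable_finsetSum _ fun α _ => hi1 α) hi2, ← integral_const_mul]
  refine integral_mono ((integrable_finsetSum _ fun α _ => hi1 α).add hi2) (hi3.1.const_mul _)
    fun x => ?_
  dsimp only
  rw [← Finset.mul_sum]
  have h1 := mul_le_mul_of_nonneg_left (h f hf.1 (hyp σ x)) (sq_nonneg (exp σ / htime σ x))
  have h2 : jsum Zf k (fun g => (exp σ / htime σ x) ^ 2 * (∑ β, pder β g (hyp σ x) ^ 2) +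
      m ^ 2 * g (hyp σ x) ^ 2) f ≤ jsum Zf k (fun g => 14 * hd m σ g x) f :=
    jsum_le_jsum (stable_Sm Zf_smooth) (fun g _ => hd_coercive m σ g x) k hf
  rw [jsum_add, jsum_const_mul, jsum_const_mul, jsum_const_mul] at h2
  change _ + m ^ 2 * jet Zf k f (hyp σ x) ≤ _ at h2
  have h3 : 0 ≤ jsum Zf k (fun g => ∑ β, pder β g (hyp σ x) ^ 2) f :=
    jsum_nonneg (X := Zf) (fun g => Finset.sum_nonneg fun _ _ => sq_nonneg _) k f
  have h4 : 0 ≤ m ^ 2 * jet Zf k f (hyp σ x) := mul_nonneg (sq_nonneg _) (jet_nonneg _ _ _)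
  have h5 := mul_nonneg (sq_nonneg (exp σ / htime σ x)) h3
  nlinarith [mul_nonneg hC h4, mul_le_mul_of_nonneg_left h2 hC]

/-- Upper bound of the hyperboloidal energy by jets. -/
lemma HE_le {f : St → ℝ} (hf : Sm f) {m : ℝ} (hm : m ∈ Set.Icc (0 : ℝ) 1) (k : ℕ) (σ : ℝ) :
    HE m k σ f ≤ 2 * (k + 1) * ∫ x, jet Zf (k + 1) f (hyp σ x) := by
  have hi3 := jsum_integral (stable_Sm Zf_smooth) (B := fun g x => hd m σ g x)
    (fun g hg => hd_integrable hg m σ) k hf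
  rw [HE, hi3.2, ← integral_const_mul]
  refine integral_mono hi3.1 (((hf.jet Zf_smooth _).hyp_integrable σ).const_mul _) fun x => ?_
  have h1 : jsum Zf k (fun g => hd m σ g x) f ≤ jsum Zf k (fun g => 2 * jet Zf 1 g (hyp σ x)) f :=
    jsum_le_jsum (stable_Sm Zf_smooth) (fun g hg => by
      refine (hd_le m σ g x).trans (mul_le_mul_of_nonneg_left ?_ zero_le_two)
      have h2 : m ^ 2 ≤ 1 := pow_le_one₀ hm.1 hm.2
      have h3 : m ^ 2 * g (hyp σ x) ^ 2 ≤ g (hyp σ x) ^ 2 :=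
        mul_le_of_le_one_left (sq_nonneg _) h2
      rw [jet_succ, Fintype.sum_sum_type]
      simp only [jet_zero]
      have h4 : 0 ≤ ∑ a : Fin 3, vf (Zf (.inr a)) g (hyp σ x) ^ 2 :=
        Finset.sum_nonneg fun _ _ => sq_nonneg _
      change _ ≤ _ + (∑ α, pder α g (hyp σ x) ^ 2 + _)
      linarith) k hf
  rw [jsum_const_mul] at h1
  have h2 := jsum_jsum_le (X := Zf) (A := fun g => g (hyp σ x) ^ 2) (fun g => sq_nonneg _) k 1 f
  change jsum Zf k (fun g => jet Zf 1 g (hyp σ x)) f ≤ (k + 1) * jet Zf (k + 1) f (hyp σ x) at h2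
  dsimp only
  linarith

/-- The scaling derivative. -/
def Sc (f : St → ℝ) (y : St) : ℝ := ∑ α, y α * pder α f y

lemma Sc_smooth {f : St → ℝ} (hf : ContDiff ℝ ∞ f) : ContDiff ℝ ∞ (Sc f) :=
  ContDiff.sum fun α _ => (coord_smooth α).mul (pder_smooth hf α)

lemma pder_Sc {f : St → ℝ} (hf : ContDiff ℝ ∞ f) (α : Fin 4) :
    pder α (Sc f) = fun y => Sc (pder α f) y + pder α f y := by
  have e : Sc f = fun y => ∑ β, y β * pder β f y := rfl
  rw [e, pder_sum fun β => (coord_smooth β).mul (pder_smooth hf β)]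
  funext y
  have : ∀ β, pder α (fun y => y β * pder β f y) y =
      (if β = α then pder β f y else 0) + y β * pder β (pder α f) y := fun β => by
    rw [pder_mul (coord_smooth β) (pder_smooth hf β), pder_coord, pder_comm hf α β]
    simp only [ite_mul, one_mul, zero_mul]
  simp only [this, Finset.sum_add_distrib, Finset.sum_ite_eq', Finset.mem_univ, if_true, Sc]
  ring

lemma Lb_Sc {f : St → ℝ} (hf : ContDiff ℝ ∞ f) (a : Fin 3) : Lb a (Sc f) = Sc (Lb a f) := by
  funext y
  have h1 : Lb a (Sc f) y = y a.succ * (Sc (pder 0 f) y + pder 0 f y) +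
      y 0 * (Sc (pder a.succ f) y + pder a.succ f y) := by
    rw [Lb, pder_Sc hf, pder_Sc hf]
  have h2 : ∀ α, y α * pder α (Lb a f) y = (if a.succ = α then y α * pder 0 f y else 0) +
      (if 0 = α then y α * pder a.succ f y else 0) + (y a.succ * (y α * pder α (pder 0 f) y) +
        y 0 * (y α * pder α (pder a.succ f) y)) := fun α => by
    rw [pder_Lb hf]
    simp only [Lb]
    rw [pder_comm hf 0 α, pder_comm hf a.succ α]
    split_ifs <;> ring
  rw [h1]
  simp only [Sc, h2, Finset.sum_add_distrib, Finset.sum_ite_eq, Finset.mem_univ, if_true,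
    ← Finset.mul_sum]
  ring

/-- The weighted energy of the transport equation on hyperboloids. -/
def TE (k : ℕ) (σ : ℝ) (f : St → ℝ) : ℝ :=
  jsum Zf k (fun g => exp (3 * σ) * ∫ x, htime σ x ^ 2 * g (hyp σ x) ^ 2) f

lemma TE_eq {f : St → ℝ} (hf : Sm f) (k : ℕ) (σ : ℝ) :
    TE k σ f = exp (3 * σ) * ∫ x, htime σ x ^ 2 * jet Zf k f (hyp σ x) := by
  rw [TE, jsum_const_mul, integral_jet_hyp (w := fun x => htime σ x ^ 2) hf k σ
    ((htime_smooth_right σ).continuous.pow 2)]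

lemma TE_nonneg (k : ℕ) (σ : ℝ) (f : St → ℝ) : 0 ≤ TE k σ f :=
  jsum_nonneg (X := Zf) (fun g => mul_nonneg (exp_pos _).le
    (integral_nonneg fun x => by positivity)) k f

lemma transport_flux {f : St → ℝ} (hf : Sm f) (σ : ℝ) :
    HasDerivAt (fun σ => ∫ x, exp (2 * σ) * (htime σ x ^ 2 * f (hyp σ x) ^ 2))
      (∫ x, exp (2 * σ) * (htime σ x ^ 2 * (7 * f (hyp σ x) ^ 2 +
        2 * (f (hyp σ x) * Sc f (hyp σ x))))) σ := by
  have hJ : ∀ α : Fin 4, Sm (fun y => (y α * y 0 ^ 3) * f y ^ 2) := fun α =>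
    (hf.pow two_ne_zero).smul ((coord_smooth α).mul ((coord_smooth 0).pow 3))
  have h := hyp_flux hJ σ
  have e : (fun σ => ∫ x, exp (2 * σ) * (htime σ x ^ 2 * f (hyp σ x) ^ 2)) = fun σ => ∫ x,
      ((hyp σ x 0 * hyp σ x 0 ^ 3) * f (hyp σ x) ^ 2 - ∑ a : Fin 3, x a / htime σ x *
      ((hyp σ x a.succ * hyp σ x 0 ^ 3) * f (hyp σ x) ^ 2)) := by
    funext σ
    refine integral_congr_ae (Filter.Eventually.of_forall fun x => ?_)
    have h2 := htime_sq σ x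
    have h3 := (htime_pos σ x).ne'
    have h4 : exp (2 * σ) = htime σ x ^ 2 - ∑ i, x i ^ 2 := by linarith
    simp only [hyp_zero, hyp_succ, h4, Fin.sum_univ_three]
    field_simp
  rw [e]
  convert h using 1
  refine integral_congr_ae (Filter.Eventually.of_forall fun x => ?_)
  dsimp only
  have e2 : ∀ α y, pder α (fun y => (y α * y 0 ^ 3) * f y ^ 2) y =
      (y 0 ^ 3 + y α * (if 0 = α then 3 * y 0 ^ 2 else 0)) * f y ^ 2 +
      (y α * y 0 ^ 3) * (2 * f y * pder α f y) := fun α y => by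
    have e3 : (fun y : St => y 0 ^ 3) = fun y => y 0 ^ 2 * y 0 := by funext y; ring
    rw [pder_mul ((coord_smooth α).mul ((coord_smooth 0).pow 3)) (hf.1.pow 2), pder_sq hf.1,
      pder_mul (coord_smooth α) ((coord_smooth 0).pow 3), pder_coord, e3,
      pder_mul ((coord_smooth 0).pow 2) (coord_smooth 0), pder_sq (coord_smooth 0), pder_coord]
    simp only [if_true]
    split_ifs <;> ring
  have h3 := (htime_pos σ x).ne'
  simp only [e2, Sc, Fin.sum_univ_succ (n := 3), Fin.sum_univ_three, hyp_zero]
  simp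
  field_simp
  ring

lemma TE_base_deriv {f F : St → ℝ} (hf : Sm f) (hF : Sm F) {c : ℝ} (hc : 4 ≤ c)
    (h : ∀ y, 3 / 2 < y 0 → Sc f y + c * f y = F y) {σ : ℝ} (hσ : 3 / 2 < exp σ) :
    ∃ D, HasDerivAt (fun σ => exp (3 * σ) * ∫ x, htime σ x ^ 2 * f (hyp σ x) ^ 2) D σ ∧
      ∀ κ : ℝ, 0 < κ → D ≤ κ * (exp (3 * σ) * ∫ x, htime σ x ^ 2 * f (hyp σ x) ^ 2) +
        exp (3 * σ) / κ * ∫ x, htime σ x ^ 2 * F (hyp σ x) ^ 2 := by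
  have hw : Continuous fun x : Sp => htime σ x ^ 2 := (htime_smooth_right σ).continuous.pow 2
  have e0 : (fun σ => exp (3 * σ) * ∫ x, htime σ x ^ 2 * f (hyp σ x) ^ 2) = fun σ => exp σ *
      ∫ x, exp (2 * σ) * (htime σ x ^ 2 * f (hyp σ x) ^ 2) := by
    funext σ
    rw [integral_const_mul, ← mul_assoc, ← exp_add]
    ring_nf
  have hd := (Real.hasDerivAt_exp σ).mul (transport_flux hf σ)
  rw [e0]
  refine ⟨_, hd, fun κ hκ => ?_⟩
  have e1 : exp (3 * σ) = exp σ * exp (2 * σ) := by rw [← exp_add]; ring_nf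
  have hif : Integrable fun x => htime σ x ^ 2 * f (hyp σ x) ^ 2 :=
    hyp_int (hf.pow two_ne_zero) σ hw
  have hiF : Integrable fun x => htime σ x ^ 2 * F (hyp σ x) ^ 2 :=
    hyp_int (hF.pow two_ne_zero) σ hw
  have hfs : Sm (fun y => f y * Sc f y) := by
    simpa only [mul_comm] using hf.smul (Sc_smooth hf.1)
  have key : ∫ x, (htime σ x ^ 2 * (7 * f (hyp σ x) ^ 2 + 2 * (f (hyp σ x) * Sc f (hyp σ x)))) ≤
      (κ - 1) * (∫ x, htime σ x ^ 2 * f (hyp σ x) ^ 2) +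
      1 / κ * ∫ x, htime σ x ^ 2 * F (hyp σ x) ^ 2 := by
    rw [← integral_const_mul, ← integral_const_mul, ← integral_add (hif.const_mul _)
      (hiF.const_mul _)]
    refine integral_mono (hyp_int (((hf.pow two_ne_zero).const_mul 7).add
      (hfs.const_mul 2)) σ hw)
      ((hif.const_mul _).add (hiF.const_mul _)) fun x => ?_
    · have hy : Sc f (hyp σ x) = F (hyp σ x) - c * f (hyp σ x) := by
        have := h (hyp σ x) (hσ.trans_le (exp_le_htime σ x))
        linarith
      dsimp only
      rw [hy]
      set p := f (hyp σ x)
      set q := F (hyp σ x)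
      have h1 : 2 * (p * q) ≤ κ * p ^ 2 + 1 / κ * q ^ 2 := by
        have : κ * p ^ 2 + 1 / κ * q ^ 2 - 2 * (p * q) = (κ * p - q) ^ 2 / κ := by
          field_simp; ring
        have h6 : 0 ≤ (κ * p - q) ^ 2 / κ := by positivity
        linarith
      have h2 : 7 * p ^ 2 + 2 * (p * (q - c * p)) ≤ (κ - 1) * p ^ 2 + 1 / κ * q ^ 2 := by
        nlinarith [mul_nonneg (sub_nonneg.2 hc) (sq_nonneg p)]
      nlinarith [mul_le_mul_of_nonneg_left h2 (sq_nonneg (htime σ x))]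
  rw [integral_const_mul, integral_const_mul]
  have h5 := mul_le_mul_of_nonneg_left key (mul_pos (exp_pos σ) (exp_pos (2 * σ))).le
  rw [e1] at *
  have e6 : exp σ * exp (2 * σ) / κ = exp σ * exp (2 * σ) * (1 / κ) := by ring
  rw [e6]
  nlinarith

lemma TE_deriv (k : ℕ) : ∀ {f F : St → ℝ}, Sm f → Sm F → ∀ {c : ℝ}, 4 ≤ c →
    (∀ y, 3 / 2 < y 0 → Sc f y + c * f y = F y) → ∀ {σ : ℝ}, 3 / 2 < exp σ →
    ∃ D, HasDerivAt (fun σ => TE k σ f) D σ ∧ ∀ κ : ℝ, 0 < κ →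
      D ≤ κ * TE k σ f + exp (3 * σ) / κ * ∫ x, htime σ x ^ 2 * jet Zf k F (hyp σ x) := by
  induction k with
  | zero =>
    intro f F hf hF c hc h σ hσ
    exact TE_base_deriv hf hF hc h hσ
  | succ k ih =>
    intro f F hf hF c hc h σ hσ
    obtain ⟨D0, hD0, h0⟩ := TE_base_deriv hf hF hc h hσ
    have hU : IsOpen {y : St | 3 / 2 < y 0} := isOpen_lt continuous_const (by fun_prop)
    have hs := Sc_smooth hf.1
    have step : ∀ i, ∃ c' : ℝ, 4 ≤ c' ∧ ∀ y : St, 3 / 2 < y 0 →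
        Sc (vf (Zf i) f) y + c' * vf (Zf i) f y = vf (Zf i) F y := by
      have e : ∀ i, ∀ y : St, 3 / 2 < y 0 →
          vf (Zf i) (Sc f) y + c * vf (Zf i) f y = vf (Zf i) F y := fun i y hy => by
        rw [← vf_congr hU (X := Zf i) (fun y hy => h y hy) hy, vf_add hs (contDiff_const.mul hf.1),
          vf_const_mul _ hf.1]
      rintro (α | a)
      · refine ⟨c + 1, by linarith, fun y hy => ?_⟩
        rw [← e (.inl α) y hy]
        change Sc (pder α f) y + (c + 1) * pder α f y = pder α (Sc f) y + c * pder α f y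
        rw [pder_Sc hf.1]
        ring
      · refine ⟨c, hc, fun y hy => ?_⟩
        rw [← e (.inr a) y hy]
        change Sc (vf (bo a) f) y + c * vf (bo a) f y = vf (bo a) (Sc f) y + c * vf (bo a) f y
        rw [vf_bo, vf_bo, Lb_Sc hf.1]
    choose c' hc' hstep using step
    choose D hD hDb using fun i => ih (hf.vf (Zf_smooth i)) (hF.vf (Zf_smooth i)) (hc' i)
      (hstep i) hσ
    refine ⟨D0 + ∑ i, D i, hD0.add (HasDerivAt.fun_sum fun i _ => hD i), fun κ hκ => ?_⟩
    have h1 := add_le_add (h0 κ hκ) (Finset.sum_le_sum fun i (_ : i ∈ Finset.univ) => hDb i κ hκ)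
    refine h1.trans (le_of_eq ?_)
    have hw : Continuous fun x : Sp => htime σ x ^ 2 := (htime_smooth_right σ).continuous.pow 2
    have e2 : ∫ x, htime σ x ^ 2 * jet Zf (k + 1) F (hyp σ x) =
        (∫ x, htime σ x ^ 2 * F (hyp σ x) ^ 2) +
        ∑ i, ∫ x, htime σ x ^ 2 * jet Zf k (vf (Zf i) F) (hyp σ x) := by
      simp only [jet_succ, mul_add, Finset.mul_sum]
      have hi : ∀ i, Integrable fun x => htime σ x ^ 2 * jet Zf k (vf (Zf i) F) (hyp σ x) :=
        fun i => hyp_int ((hF.vf (Zf_smooth i)).jet Zf_smooth k) σ hw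
      rw [integral_add (hyp_int (hF.pow two_ne_zero) σ hw) (integrable_finsetSum _ fun i _ => hi i),
        integral_finsetSum _ fun i _ => hi i]
    have e3 : TE (k + 1) σ f = exp (3 * σ) * (∫ x, htime σ x ^ 2 * f (hyp σ x) ^ 2) +
        ∑ i, TE k σ (vf (Zf i) f) := rfl
    rw [e2, e3, Finset.sum_add_distrib, ← Finset.mul_sum, ← Finset.mul_sum]
    ring

/-- Jets of the coordinate functions. -/
lemma jet_coord_le (k : ℕ) (α : Fin 4) (y : St) :
    jet Zf k (fun y => y α) y ≤ 8 ^ k * (1 + ∑ β, y β ^ 2) := by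
  have hz : ∀ i, vf (Zf i) (fun _ => (0 : ℝ)) = fun _ => 0 := fun i => by funext; simp [vf]
  have ho : ∀ i, vf (Zf i) (fun _ => (1 : ℝ)) = fun _ => 0 := fun i => by funext; simp [vf]
  have hS : 0 ≤ ∑ β, y β ^ 2 := Finset.sum_nonneg fun _ _ => sq_nonneg _
  suffices H : ∀ f : St → ℝ, (f = (fun _ => 0) ∨ f = (fun _ => 1) ∨ ∃ β, f = fun y => y β) →
      jet Zf k f y ≤ 8 ^ k * (1 + ∑ β, y β ^ 2) from H _ (.inr (.inr ⟨α, rfl⟩))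
  have hb : ∀ f : St → ℝ, (f = (fun _ => 0) ∨ f = (fun _ => 1) ∨ ∃ β, f = fun y => y β) →
      f y ^ 2 ≤ 1 + ∑ β, y β ^ 2 := by
    rintro f (rfl | rfl | ⟨β, rfl⟩)
    · simpa using by linarith
    · simpa using hS
    · linarith [Finset.single_le_sum (fun β _ => sq_nonneg (y β)) (Finset.mem_univ β)]
  induction k with
  | zero => simpa [jet_zero] using hb
  | succ k ih =>
    intro f hf
    have hv : ∀ i, jet Zf k (vf (Zf i) f) y ≤ 8 ^ k * (1 + ∑ β, y β ^ 2) := by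
      intro i
      refine ih _ ?_
      rcases hf with rfl | rfl | ⟨β, rfl⟩
      · exact .inl (hz i)
      · exact .inl (ho i)
      · rcases i with γ | a
        · have : vf (Zf (.inl γ)) (fun y => y β) = fun _ => if β = γ then 1 else 0 :=
            pder_coord γ β
          rw [this]
          split_ifs
          · exact .inr (.inl rfl)
          · exact .inl rfl
        · have : vf (Zf (.inr a)) (fun y => y β) = fun y => y a.succ *
              (if β = 0 then 1 else 0) + y 0 * (if β = a.succ then 1 else 0) := by
            change vf (bo a) _ = _
            rw [vf_bo]
            funext y
            rw [Lb, pder_coord, pder_coord]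
          rw [this]
          by_cases h0 : β = 0
          · subst h0
            exact .inr (.inr ⟨a.succ, by simp [Ne.symm (Fin.succ_ne_zero a)]⟩)
          · by_cases h1 : β = a.succ
            · exact .inr (.inr ⟨0, by simp [h1, Fin.succ_ne_zero]⟩)
            · exact .inl (by simp [h0, h1])
    rw [jet_succ]
    refine (add_le_add (hb f hf) (Finset.sum_le_sum fun i _ => hv i)).trans ?_
    simp only [Finset.sum_const, Finset.card_univ, Fintype.card_sum, Fintype.card_fin, nsmul_eq_mul]
    have h8 : (1 : ℝ) ≤ 8 ^ k := one_le_pow₀ (by norm_num)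
    rw [pow_succ]
    push_cast
    nlinarith

section ParametricIntegral

variable {P : Type} [NormedAddCommGroup P] [NormedSpace ℝ P] [FiniteDimensional ℝ P]

lemma hasFDerivAt_param_integral {V : Type} [NormedAddCommGroup V] [NormedSpace ℝ V]
    [CompleteSpace V] {G : P × ℝ → V} (hG : ContDiff ℝ 1 G) (a b : ℝ) (p : P) :
    HasFDerivAt (fun p => ∫ θ in a..b, G (p, θ))
      (∫ θ in a..b, (fderiv ℝ G (p, θ)).comp (ContinuousLinearMap.inl ℝ P ℝ)) p := by
  have : ProperSpace P := FiniteDimensional.proper ℝ P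
  have hd : Continuous fun q : P × ℝ =>
      (fderiv ℝ G q).comp (ContinuousLinearMap.inl ℝ P ℝ) :=
    (hG.continuous_fderiv one_ne_zero).clm_comp continuous_const
  obtain ⟨C, hC⟩ := ((isCompact_closedBall p 1).prod (isCompact_uIcc (a := a) (b := b))).exists_bound_of_continuousOn
    hd.continuousOn
  refine intervalIntegral.hasFDerivAt_integral_of_dominated_of_fderiv_le
    (F := fun p θ => G (p, θ)) (bound := fun _ => C)
    (F' := fun p θ => (fderiv ℝ G (p, θ)).comp (ContinuousLinearMap.inl ℝ P ℝ))
    (Metric.ball_mem_nhds p one_pos) ?_ ?_ ?_ ?_ ?_ ?_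
  · exact Filter.Eventually.of_forall fun q =>
      (hG.continuous.comp (by fun_prop : Continuous fun θ : ℝ => (q, θ))).aestronglyMeasurable
  · exact (hG.continuous.comp (by fun_prop : Continuous fun θ : ℝ => (p, θ))).intervalIntegrable _ _
  · exact (hd.comp (by fun_prop : Continuous fun θ : ℝ => (p, θ))).aestronglyMeasurable
  · refine Filter.Eventually.of_forall fun θ hθ q hq => hC (q, θ) ⟨Metric.ball_subset_closedBall hq,
      Set.uIoc_subset_uIcc hθ⟩
  · exact intervalIntegrable_const
  · refine Filter.Eventually.of_forall fun θ _ q _ => ?_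
    have h1 : HasFDerivAt G (fderiv ℝ G (q, θ)) (q, θ) :=
      (hG.differentiable one_ne_zero _).hasFDerivAt
    exact h1.comp q (hasFDerivAt_prodMk_left q θ)

lemma contDiff_param_integral {V : Type} [NormedAddCommGroup V] [NormedSpace ℝ V]
    [CompleteSpace V] {G : P × ℝ → V} (hG : ContDiff ℝ ∞ G) (a b : ℝ) :
    ContDiff ℝ ∞ fun p => ∫ θ in a..b, G (p, θ) := by
  refine contDiff_infty.2 fun n => ?_
  induction n generalizing V with
  | zero =>
    refine contDiff_zero.2 (continuous_iff_continuousAt.2 fun p => ?_)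
    exact (hasFDerivAt_param_integral (hG.of_le (by simp)) a b p).continuousAt
  | succ n ih =>
    have h1 := hasFDerivAt_param_integral (hG.of_le (m := 1) (by simp)) a b
    rw [show ((n + 1 : ℕ) : WithTop ℕ∞) = (n : WithTop ℕ∞) + 1 by simp]
    refine contDiff_succ_iff_fderiv.2 ⟨fun p => (h1 p).differentiableAt, by simp, ?_⟩
    rw [funext fun p => (h1 p).fderiv]
    exact ih ((hG.fderiv_right (m := ∞) (by simp)).clm_comp contDiff_const)

lemma fderiv_param_integral {G : P × ℝ → ℝ} (hG : ContDiff ℝ ∞ G) (a b : ℝ) (p v : P) :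
    fderiv ℝ (fun p => ∫ θ in a..b, G (p, θ)) p v =
      ∫ θ in a..b, fderiv ℝ G (p, θ) (v, 0) := by
  rw [(hasFDerivAt_param_integral (hG.of_le (by simp)) a b p).fderiv]
  have hi : IntervalIntegrable (fun θ => (fderiv ℝ G (p, θ)).comp
      (ContinuousLinearMap.inl ℝ P ℝ)) volume a b := by
    refine Continuous.intervalIntegrable ?_ _ _
    exact ((hG.continuous_fderiv (by simp)).comp
      (by fun_prop : Continuous fun θ : ℝ => (p, θ))).clm_comp continuous_const
  rw [ContinuousLinearMap.intervalIntegral_apply hi]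
  rfl

lemma smooth_param_primitive {G : P × ℝ → ℝ} (hG : ContDiff ℝ ∞ G) {b : P → ℝ}
    (hb : ContDiff ℝ ∞ b) : ContDiff ℝ ∞ fun p => ∫ θ in (0:ℝ)..b p, G (p, θ) := by
  have e : (fun p => ∫ θ in (0:ℝ)..b p, G (p, θ)) =
      fun p => b p * ∫ θ in (0:ℝ)..1, G (p, b p * θ) := by
    funext p
    have := intervalIntegral.mul_integral_comp_mul_left (f := fun θ => G (p, θ)) (a := 0)
      (b := 1) (c := b p)
    simp only [mul_zero, mul_one] at this
    exact this.symm
  rw [e]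
  exact hb.mul (contDiff_param_integral (G := fun q : P × ℝ => G (q.1, b q.1 * q.2))
    (hG.comp (contDiff_fst.prodMk ((hb.comp contDiff_fst).mul contDiff_snd))) 0 1)

lemma fderiv_param_primitive {G : P × ℝ → ℝ} (hG : ContDiff ℝ ∞ G) {b : P → ℝ}
    (hb : ContDiff ℝ ∞ b) (p v : P) :
    fderiv ℝ (fun p => ∫ θ in (0:ℝ)..b p, G (p, θ)) p v =
      fderiv ℝ b p v * G (p, b p) + ∫ θ in (0:ℝ)..b p, fderiv ℝ G (p, θ) (v, 0) := by
  let I : P × ℝ → ℝ := fun q => ∫ θ in (0:ℝ)..q.2, G (q.1, θ)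
  have hI : ContDiff ℝ ∞ I := smooth_param_primitive
    (G := fun q : (P × ℝ) × ℝ => G (q.1.1, q.2))
    (hG.comp ((contDiff_fst.comp contDiff_fst).prodMk contDiff_snd)) contDiff_snd
  have hId : HasFDerivAt I (fderiv ℝ I (p, b p)) (p, b p) :=
    (hI.differentiable (by simp) _).hasFDerivAt
  have h1 : HasFDerivAt (fun p => I (p, b p))
      ((fderiv ℝ I (p, b p)).comp ((ContinuousLinearMap.id ℝ P).prod (fderiv ℝ b p))) p :=
    HasFDerivAt.comp (g := I) (f := fun p => (p, b p)) p hId ((hasFDerivAt_id p).prodMk (hb.differentiable (by simp) p).hasFDerivAt)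
  have e1 : fderiv ℝ I (p, b p) (v, 0) = ∫ θ in (0:ℝ)..b p, fderiv ℝ G (p, θ) (v, 0) := by
    rw [← fderiv_param_integral hG 0 (b p) p v]
    have := HasFDerivAt.comp (g := I) (f := fun p' => (p', b p)) p hId
      (hasFDerivAt_prodMk_left p (b p))
    have h2 := this.fderiv
    change fderiv ℝ (fun p' => ∫ θ in (0:ℝ)..b p, G (p', θ)) p = _ at h2
    rw [h2]
    rfl
  have e2 : fderiv ℝ I (p, b p) (0, 1) = G (p, b p) := by
    have h3 : HasDerivAt (fun s : ℝ => I (p, s)) (fderiv ℝ I (p, b p) (0, 1)) (b p) := by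
      have := HasFDerivAt.comp (g := I) (f := fun s : ℝ => (p, s)) (b p) hId
        (hasFDerivAt_prodMk_right p (b p))
      have h := this.hasDerivAt
      simp only [ContinuousLinearMap.comp_apply, ContinuousLinearMap.inr_apply] at h
      exact h
    have hc : Continuous fun θ : ℝ => G (p, θ) :=
      hG.continuous.comp (by fun_prop : Continuous fun θ : ℝ => (p, θ))
    exact h3.unique (intervalIntegral.integral_hasDerivAt_right (hc.intervalIntegrable _ _)
      (hc.stronglyMeasurableAtFilter _ _) hc.continuousAt)
  have h4 : fderiv ℝ (fun p => ∫ θ in (0:ℝ)..b p, G (p, θ)) p v =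
      fderiv ℝ I (p, b p) (v, fderiv ℝ b p v) := by
    change fderiv ℝ (fun p => I (p, b p)) p v = _
    rw [h1.fderiv]
    rfl
  have h5 : ((v, fderiv ℝ b p v) : P × ℝ) = (v, 0) + fderiv ℝ b p v • (0, 1) := by simp
  rw [h4, h5, map_add, map_smul, e1, e2, smul_eq_mul]
  ring

end ParametricIntegral

lemma fderiv_eq_sum_pder {f : St → ℝ} (y v : St) :
    fderiv ℝ f y v = ∑ α, v α * pder α f y := by
  have : v = ∑ α, v α • (Pi.single α (1 : ℝ) : St) := by
    ext i; simp [Finset.sum_apply, Pi.single_apply]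
  conv_lhs => rw [this]
  simp only [map_sum, map_smul, smul_eq_mul, pder]

/-- Radial derivative and coordinate derivatives of a function of a radius and a base point. -/
def dr (f : ℝ × St → ℝ) (p : ℝ × St) : ℝ := fderiv ℝ f p (1, 0)

def dy (α : Fin 4) (f : ℝ × St → ℝ) (p : ℝ × St) : ℝ := fderiv ℝ f p (0, Pi.single α 1)

lemma dr_smooth {f : ℝ × St → ℝ} (hf : ContDiff ℝ ∞ f) : ContDiff ℝ ∞ (dr f) :=
  (hf.fderiv_right (m := ∞) (by simp)).clm_apply contDiff_const

lemma dy_smooth {f : ℝ × St → ℝ} (hf : ContDiff ℝ ∞ f) (α : Fin 4) : ContDiff ℝ ∞ (dy α f) :=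
  (hf.fderiv_right (m := ∞) (by simp)).clm_apply contDiff_const

/-- Point of the unit sphere with polar angle `q.1` and azimuth `q.2`. -/
def om (q : ℝ × ℝ) : St := ![0, sin q.1 * cos q.2, sin q.1 * sin q.2, cos q.1]

lemma om_smooth : ContDiff ℝ ∞ om := by
  refine contDiff_pi.2 fun i => ?_
  fin_cases i
  · exact contDiff_const
  · exact (contDiff_sin.comp contDiff_fst).mul (contDiff_cos.comp contDiff_snd)
  · exact (contDiff_sin.comp contDiff_fst).mul (contDiff_sin.comp contDiff_snd)
  · exact contDiff_cos.comp contDiff_fst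

/-- Weighted spherical integrals. -/
def sph (w : ℝ × ℝ → ℝ) (F : St → ℝ) (p : ℝ × St) : ℝ :=
  ∫ α in (0:ℝ)..π, ∫ θ in (0:ℝ)..(2 * π), w (α, θ) * F (p.2 + p.1 • om (α, θ))

def sphInt (w : ℝ × ℝ → ℝ) (F : St → ℝ) (q : ((ℝ × St) × ℝ) × ℝ) : ℝ :=
  w (q.1.2, q.2) * F (q.1.1.2 + q.1.1.1 • om (q.1.2, q.2))

lemma sphInt_smooth {w : ℝ × ℝ → ℝ} (hw : ContDiff ℝ ∞ w) {F : St → ℝ} (hF : ContDiff ℝ ∞ F) :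
    ContDiff ℝ ∞ (sphInt w F) := by
  have h1 : ContDiff ℝ ∞ fun q : ((ℝ × St) × ℝ) × ℝ => (q.1.2, q.2) := by fun_prop
  have h2 : ContDiff ℝ ∞ fun q : ((ℝ × St) × ℝ) × ℝ => q.1.1.2 := by fun_prop
  have h3 : ContDiff ℝ ∞ fun q : ((ℝ × St) × ℝ) × ℝ => q.1.1.1 := by fun_prop
  exact (hw.comp h1).mul (hF.comp (h2.add (h3.smul (om_smooth.comp h1))))

lemma sph_smooth {w : ℝ × ℝ → ℝ} (hw : ContDiff ℝ ∞ w) {F : St → ℝ} (hF : ContDiff ℝ ∞ F) :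
    ContDiff ℝ ∞ (sph w F) :=
  contDiff_param_integral (G := fun q : (ℝ × St) × ℝ => ∫ θ in (0:ℝ)..(2 * π), sphInt w F (q, θ))
    (contDiff_param_integral (sphInt_smooth hw hF) 0 (2 * π)) 0 π

lemma sph_int_outer {w : ℝ × ℝ → ℝ} (hw : ContDiff ℝ ∞ w) {F : St → ℝ} (hF : ContDiff ℝ ∞ F)
    (p : ℝ × St) : IntervalIntegrable
      (fun α => ∫ θ in (0:ℝ)..(2 * π), w (α, θ) * F (p.2 + p.1 • om (α, θ))) volume 0 π :=
  ((contDiff_param_integral (sphInt_smooth hw hF) 0 (2 * π)).continuous.comp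
    (by fun_prop : Continuous fun α : ℝ => (p, α))).intervalIntegrable _ _

lemma sph_int_inner {w : ℝ × ℝ → ℝ} (hw : ContDiff ℝ ∞ w) {F : St → ℝ} (hF : ContDiff ℝ ∞ F)
    (p : ℝ × St) (α : ℝ) : IntervalIntegrable
      (fun θ => w (α, θ) * F (p.2 + p.1 • om (α, θ))) volume 0 (2 * π) :=
  ((sphInt_smooth hw hF).continuous.comp
    (by fun_prop : Continuous fun θ : ℝ => ((p, α), θ))).intervalIntegrable _ _

lemma sph_fderiv {w : ℝ × ℝ → ℝ} (hw : ContDiff ℝ ∞ w) {F : St → ℝ} (hF : ContDiff ℝ ∞ F)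
    (p v : ℝ × St) : fderiv ℝ (sph w F) p v = ∫ α in (0:ℝ)..π, ∫ θ in (0:ℝ)..(2 * π),
      w (α, θ) * fderiv ℝ F (p.2 + p.1 • om (α, θ)) (v.2 + v.1 • om (α, θ)) := by
  have h := sphInt_smooth hw hF
  have h1 := fderiv_param_integral (G := fun q : (ℝ × St) × ℝ =>
    ∫ θ in (0:ℝ)..(2 * π), sphInt w F (q, θ)) (contDiff_param_integral h 0 (2 * π)) 0 π p v
  refine h1.trans (intervalIntegral.integral_congr fun α _ => ?_)
  refine (fderiv_param_integral h 0 (2 * π) (p, α) (v, 0)).trans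
    (intervalIntegral.integral_congr fun θ _ => ?_)
  have h2 : HasFDerivAt (sphInt w F) (fderiv ℝ (sphInt w F) ((p, α), θ)) ((p, α), θ) :=
    (h.differentiable (by simp) _).hasFDerivAt
  have h3 : HasFDerivAt (fun p : ℝ × St => (((p, α), θ) : ((ℝ × St) × ℝ) × ℝ))
      ((ContinuousLinearMap.inl ℝ ((ℝ × St) × ℝ) ℝ).comp
        (ContinuousLinearMap.inl ℝ (ℝ × St) ℝ)) p :=
    HasFDerivAt.comp (g := fun q : (ℝ × St) × ℝ => (q, θ)) (f := fun p : ℝ × St => (p, α)) p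
      (hasFDerivAt_prodMk_left (p, α) θ) (hasFDerivAt_prodMk_left p α)
  have h4 := HasFDerivAt.comp p h2 h3
  have h5 : HasFDerivAt (fun p : ℝ × St => p.2 + p.1 • om (α, θ))
      (ContinuousLinearMap.snd ℝ ℝ St + (ContinuousLinearMap.fst ℝ ℝ St).smulRight (om (α, θ))) p :=
    (hasFDerivAt_snd).add ((hasFDerivAt_fst).smul_const _)
  have h6 := ((hF.differentiable (by simp) (p.2 + p.1 • om (α, θ))).hasFDerivAt.comp p
    h5).const_mul (w (α, θ))
  have h7 := congrArg (fun L : (ℝ × St) →L[ℝ] ℝ => L v) (h4.unique h6)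
  simpa [mul_add] using h7

lemma dy_sph {w : ℝ × ℝ → ℝ} (hw : ContDiff ℝ ∞ w) {F : St → ℝ} (hF : ContDiff ℝ ∞ F)
    (α : Fin 4) : dy α (sph w F) = sph w (pder α F) := by
  funext p
  rw [dy, sph_fderiv hw hF]
  simp only [zero_smul, add_zero]
  rfl

lemma dr_sph {w : ℝ × ℝ → ℝ} (hw : ContDiff ℝ ∞ w) {F : St → ℝ} (hF : ContDiff ℝ ∞ F) :
    dr (sph w F) = fun p => ∑ α, sph (fun q => w q * om q α) (pder α F) p := by
  funext p
  have hwo : ∀ α, ContDiff ℝ ∞ fun q => w q * om q α := fun α =>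
    hw.mul ((contDiff_pi.1 om_smooth) α)
  rw [dr, sph_fderiv hw hF]
  simp only [sph]
  rw [← intervalIntegral.integral_finsetSum fun β _ => sph_int_outer (hwo β) (pder_smooth hF β) p]
  refine intervalIntegral.integral_congr fun α _ => ?_
  rw [← intervalIntegral.integral_finsetSum fun β _ => sph_int_inner (hwo β) (pder_smooth hF β) p α]
  refine intervalIntegral.integral_congr fun θ _ => ?_
  simp only [zero_add, one_smul, fderiv_eq_sum_pder, Finset.mul_sum]
  exact Finset.sum_congr rfl fun β _ => by ring

lemma hasDerivAt_comp_curve {f : St → ℝ} (hf : ContDiff ℝ ∞ f) {c : ℝ → St} {c' : St} {s : ℝ}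
    (hc : HasDerivAt c c' s) :
    HasDerivAt (fun s => f (c s)) (∑ α, c' α * pder α f (c s)) s := by
  rw [← fderiv_eq_sum_pder]
  exact (hf.differentiable (by simp) (c s)).hasFDerivAt.comp_hasDerivAt s hc

lemma om_deriv_polar (α θ : ℝ) : HasDerivAt (fun α => om (α, θ))
    ![0, cos α * cos θ, cos α * sin θ, -sin α] α := by
  refine hasDerivAt_pi.2 fun i => ?_
  fin_cases i
  · exact hasDerivAt_const _ _
  · exact (hasDerivAt_sin α).mul_const (cos θ)
  · exact (hasDerivAt_sin α).mul_const (sin θ)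
  · exact hasDerivAt_cos α

lemma om_deriv_azimuth (α θ : ℝ) : HasDerivAt (fun θ => om (α, θ))
    ![0, sin α * -sin θ, sin α * cos θ, 0] θ := by
  refine hasDerivAt_pi.2 fun i => ?_
  fin_cases i
  · exact hasDerivAt_const _ _
  · exact (hasDerivAt_cos θ).const_mul (sin α)
  · exact (hasDerivAt_sin θ).const_mul (sin α)
  · exact hasDerivAt_const θ (cos α)

/-- The unnormalised spherical integral. -/
def sphM (F : St → ℝ) : ℝ × St → ℝ := sph (fun q => sin q.1) F

lemma sin_fst_smooth : ContDiff ℝ ∞ fun q : ℝ × ℝ => sin q.1 := contDiff_sin.comp contDiff_fst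

lemma sphM_smooth {F : St → ℝ} (hF : ContDiff ℝ ∞ F) : ContDiff ℝ ∞ (sphM F) :=
  sph_smooth sin_fst_smooth hF

lemma integral_polar_deriv {L : ℝ × ℝ → ℝ} (hL : ContDiff ℝ ∞ L) (h0 : ∀ θ, L (0, θ) = 0)
    (h1 : ∀ θ, L (π, θ) = 0) {D : ℝ → ℝ → ℝ}
    (hD : ∀ α θ, HasDerivAt (fun α => L (α, θ)) (D α θ) α) :
    ∫ α in (0:ℝ)..π, ∫ θ in (0:ℝ)..(2 * π), D α θ = 0 := by
  have e : ∀ α, HasDerivAt (fun α => ∫ θ in (0:ℝ)..(2 * π), L (α, θ))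
      (∫ θ in (0:ℝ)..(2 * π), D α θ) α := fun α => by
    have h : HasDerivAt (fun α => ∫ θ in (0:ℝ)..(2 * π), L (α, θ))
        (fderiv ℝ (fun α => ∫ θ in (0:ℝ)..(2 * π), L (α, θ)) α 1) α :=
      ((contDiff_param_integral hL 0 (2 * π)).differentiable
        (by simp) α).hasFDerivAt.hasDerivAt
    rw [fderiv_param_integral hL 0 (2 * π) α 1] at h
    refine h.congr_deriv ?_
    symm
    refine intervalIntegral.integral_congr fun θ _ => ?_
    have h3 : HasFDerivAt (fun α : ℝ => L (α, θ))
        ((fderiv ℝ L (α, θ)).comp (ContinuousLinearMap.inl ℝ ℝ ℝ)) α :=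
      HasFDerivAt.comp (g := L) (f := fun α : ℝ => (α, θ)) α
        (hL.differentiable (by simp) (α, θ)).hasFDerivAt (hasFDerivAt_prodMk_left α θ)
    exact (hD α θ).unique h3.hasDerivAt
  rw [intervalIntegral.integral_eq_sub_of_hasDerivAt (fun α _ => e α)]
  · simp [h0, h1]
  · refine Continuous.intervalIntegrable ?_ _ _
    have hs := contDiff_param_integral hL 0 (2 * π)
    rw [← funext fun α => (e α).deriv]
    exact (hs.continuous_deriv (by simp))

lemma sph_lin {ι : Type} [Fintype ι] {w : ι → ℝ × ℝ → ℝ} (hw : ∀ i, ContDiff ℝ ∞ (w i))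
    {F : ι → St → ℝ} (hF : ∀ i, ContDiff ℝ ∞ (F i)) (c : ι → ℝ) (p : ℝ × St) :
    (∀ α, IntervalIntegrable (fun θ => ∑ i, c i * (w i (α, θ) * F i (p.2 + p.1 • om (α, θ))))
      volume 0 (2 * π)) ∧
    ∑ i, c i * sph (w i) (F i) p = ∫ α in (0:ℝ)..π, ∫ θ in (0:ℝ)..(2 * π),
      ∑ i, c i * (w i (α, θ) * F i (p.2 + p.1 • om (α, θ))) := by
  have h1 := fun α i => (sph_int_inner (hw i) (hF i) p α).const_mul (c i)
  have h2 := fun i => (sph_int_outer (hw i) (hF i) p).const_mul (c i)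
  refine ⟨fun α => ?_, ?_⟩
  · simpa only [Finset.sum_fn] using IntervalIntegrable.sum Finset.univ fun i _ => h1 α i
  · simp only [sph, ← intervalIntegral.integral_const_mul]
    rw [← intervalIntegral.integral_finsetSum fun i _ => by
      simpa only [← intervalIntegral.integral_const_mul] using h2 i]
    refine intervalIntegral.integral_congr fun α _ => ?_
    exact (intervalIntegral.integral_finsetSum fun i _ => h1 α i).symm

lemma dr_sum {ι : Type} [Fintype ι] {f : ι → ℝ × St → ℝ} (hf : ∀ i, ContDiff ℝ ∞ (f i)) :
    dr (fun p => ∑ i, f i p) = fun p => ∑ i, dr (f i) p := by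
  funext p
  rw [dr, fderiv_fun_sum fun i _ => (hf i).differentiable (by simp) p]
  simp [dr]

lemma sphM_darboux {F : St → ℝ} (hF : ContDiff ℝ ∞ F) (p : ℝ × St) :
    p.1 ^ 2 * dr (dr (sphM F)) p + 2 * p.1 * dr (sphM F) p =
      p.1 ^ 2 * ∑ a : Fin 3, dy a.succ (dy a.succ (sphM F)) p := by
  have ho : ∀ α, ContDiff ℝ ∞ fun q => om q α := fun α => contDiff_pi.1 om_smooth α
  have hF1 := fun α => pder_smooth hF α
  have hF2 := fun α β => pder_smooth (hF1 α) β
  have e1 : dr (sphM F) = fun p => ∑ α, sph (fun q => sin q.1 * om q α) (pder α F) p :=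
    dr_sph sin_fst_smooth hF
  have e2 : dr (dr (sphM F)) p = ∑ α, ∑ β,
      sph (fun q => sin q.1 * om q α * om q β) (pder β (pder α F)) p := by
    rw [e1, dr_sum fun α => sph_smooth (sin_fst_smooth.mul (ho α)) (hF1 α)]
    exact Finset.sum_congr rfl fun α _ =>
      congrFun (dr_sph (sin_fst_smooth.mul (ho α)) (hF1 α)) p
  have e3 : ∀ a : Fin 3, dy a.succ (dy a.succ (sphM F)) p =
      sph (fun q => sin q.1) (pder a.succ (pder a.succ F)) p := fun a => by
    rw [sphM, dy_sph sin_fst_smooth hF, dy_sph sin_fst_smooth (hF1 _)]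
  let w : (Fin 4 × Fin 4) ⊕ Fin 4 ⊕ Fin 3 → ℝ × ℝ → ℝ := Sum.elim
    (fun i q => sin q.1 * om q i.1 * om q i.2)
    (Sum.elim (fun α q => sin q.1 * om q α) (fun _ q => sin q.1))
  let G : (Fin 4 × Fin 4) ⊕ Fin 4 ⊕ Fin 3 → St → ℝ := Sum.elim
    (fun i => pder i.2 (pder i.1 F))
    (Sum.elim (fun α => pder α F) (fun a => pder a.succ (pder a.succ F)))
  let c : (Fin 4 × Fin 4) ⊕ Fin 4 ⊕ Fin 3 → ℝ := Sum.elim (fun _ => p.1 ^ 2)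
    (Sum.elim (fun _ => 2 * p.1) (fun _ => -p.1 ^ 2))
  have hw : ∀ i, ContDiff ℝ ∞ (w i) := by
    rintro (i | i | i)
    · exact (sin_fst_smooth.mul (ho _)).mul (ho _)
    · exact sin_fst_smooth.mul (ho _)
    · exact sin_fst_smooth
  have hG : ∀ i, ContDiff ℝ ∞ (G i) := by
    rintro (i | i | i)
    · exact hF2 _ _
    · exact hF1 _
    · exact hF2 _ _
  obtain ⟨hi, hs⟩ := sph_lin hw hG c p
  set E : ℝ → ℝ → ℝ := fun α θ =>
    ∑ i, c i * (w i (α, θ) * G i (p.2 + p.1 • om (α, θ))) with hE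
  suffices h0 : ∫ α in (0:ℝ)..π, ∫ θ in (0:ℝ)..(2 * π), E α θ = 0 by
    rw [h0, Fintype.sum_sum_type, Fintype.sum_sum_type, Fintype.sum_prod_type] at hs
    simp only [c, w, G, Sum.elim_inl, Sum.elim_inr, ← Finset.mul_sum] at hs
    rw [e2, e1]
    simp only [e3]
    linarith
  have hpt : ContDiff ℝ ∞ fun q : ℝ × ℝ => p.2 + p.1 • om q :=
    contDiff_const.add (om_smooth.const_smul p.1)
  have dpol : ∀ {f : St → ℝ}, ContDiff ℝ ∞ f → ∀ α θ,
      HasDerivAt (fun α => f (p.2 + p.1 • om (α, θ))) (p.1 * (cos α * cos θ *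
        pder 1 f (p.2 + p.1 • om (α, θ)) + cos α * sin θ * pder 2 f (p.2 + p.1 • om (α, θ)) -
        sin α * pder 3 f (p.2 + p.1 • om (α, θ)))) α := fun hf α θ => by
    refine (hasDerivAt_comp_curve (c := fun α => p.2 + p.1 • om (α, θ)) hf
      (((om_deriv_polar α θ).const_smul p.1).const_add p.2)).congr_deriv ?_
    simp [Fin.sum_univ_four]
    ring
  have dazi : ∀ {f : St → ℝ}, ContDiff ℝ ∞ f → ∀ α θ,
      HasDerivAt (fun θ => f (p.2 + p.1 • om (α, θ))) (p.1 * (sin α * cos θ *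
        pder 2 f (p.2 + p.1 • om (α, θ)) - sin α * sin θ *
        pder 1 f (p.2 + p.1 • om (α, θ)))) θ := fun hf α θ => by
    refine (hasDerivAt_comp_curve (c := fun θ => p.2 + p.1 • om (α, θ)) hf
      (((om_deriv_azimuth α θ).const_smul p.1).const_add p.2)).congr_deriv ?_
    simp [Fin.sum_univ_four]
    ring
  let K : ℝ × ℝ → ℝ := fun q => p.1 * (cos q.2 * pder 2 F (p.2 + p.1 • om q) -
    sin q.2 * pder 1 F (p.2 + p.1 • om q))
  have hcos : ContDiff ℝ ∞ fun q : ℝ × ℝ => cos q.2 := contDiff_cos.comp contDiff_snd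
  have hsin : ContDiff ℝ ∞ fun q : ℝ × ℝ => sin q.2 := contDiff_sin.comp contDiff_snd
  have hcos1 : ContDiff ℝ ∞ fun q : ℝ × ℝ => cos q.1 := contDiff_cos.comp contDiff_fst
  have hK : ContDiff ℝ ∞ K := contDiff_const.mul
    ((hcos.mul ((hF1 2).comp hpt)).sub (hsin.mul ((hF1 1).comp hpt)))
  have hKd : ∀ α θ, HasDerivAt (fun θ => K (α, θ)) _ θ := fun α θ =>
    (((hasDerivAt_cos θ).mul (dazi (hF1 2) α θ)).sub
      ((hasDerivAt_sin θ).mul (dazi (hF1 1) α θ))).const_mul p.1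
  have hKi : ∀ α, IntervalIntegrable (deriv fun θ => K (α, θ)) volume 0 (2 * π) := fun α =>
    ((hK.comp (contDiff_prodMk_right α)).continuous_deriv (by simp)).intervalIntegrable _ _
  have hK0 : ∀ α, ∫ θ in (0:ℝ)..(2 * π), deriv (fun θ => K (α, θ)) θ = 0 := fun α => by
    rw [intervalIntegral.integral_deriv_eq_sub (fun θ _ => (hKd α θ).differentiableAt) (hKi α)]
    simp [K, om]
  let L : ℝ × ℝ → ℝ := fun q => sin q.1 * (p.1 * (cos q.1 * cos q.2 *
        pder 1 F (p.2 + p.1 • om q) + cos q.1 * sin q.2 * pder 2 F (p.2 + p.1 • om q) -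
        sin q.1 * pder 3 F (p.2 + p.1 • om q)))
  have hL : ContDiff ℝ ∞ L := sin_fst_smooth.mul (contDiff_const.mul
    ((((hcos1.mul hcos).mul ((hF1 1).comp hpt)).add ((hcos1.mul hsin).mul
      ((hF1 2).comp hpt))).sub (sin_fst_smooth.mul ((hF1 3).comp hpt))))
  have hLd : ∀ α θ, HasDerivAt (fun α => L (α, θ)) (-E α θ - deriv (fun θ => K (α, θ)) θ) α := by
    intro α θ
    have h := (hasDerivAt_sin α).mul ((((((hasDerivAt_cos α).mul_const (cos θ)).mul
      (dpol (hF1 1) α θ)).add (((hasDerivAt_cos α).mul_const (sin θ)).mul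
      (dpol (hF1 2) α θ))).sub ((hasDerivAt_sin α).mul (dpol (hF1 3) α θ))).const_mul p.1)
    refine h.congr_deriv ?_
    rw [(hKd α θ).deriv, hE]
    simp only [Fintype.sum_sum_type, Fintype.sum_prod_type, c, w, G, Sum.elim_inl, Sum.elim_inr]
    simp only [Fin.sum_univ_four, Fin.sum_univ_three]
    simp only [show ((0 : Fin 3).succ : Fin 4) = 1 from rfl,
      show ((1 : Fin 3).succ : Fin 4) = 2 from rfl, show ((2 : Fin 3).succ : Fin 4) = 3 from rfl]
    have o0 : om (α, θ) 0 = 0 := rfl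
    have o1 : om (α, θ) 1 = sin α * cos θ := rfl
    have o2 : om (α, θ) 2 = sin α * sin θ := rfl
    have o3 : om (α, θ) 3 = cos α := rfl
    simp only [pder_comm hF 1 2, pder_comm hF 1 3, pder_comm hF 2 3]
    simp only [o0, o1, o2, o3, Pi.sub_apply, Pi.add_apply, Pi.mul_apply]
    set y := p.2 + p.1 • om (α, θ)
    have s1 := sin_sq_add_cos_sq α
    have s2 := sin_sq_add_cos_sq θ
    linear_combination (p.1 * cos θ * pder 1 F y + p.1 * sin θ * pder 2 F y + p.1 ^ 2 * sin α *
      (cos θ ^ 2 * pder 1 (pder 1 F) y + sin θ ^ 2 * pder 2 (pder 2 F) y + 2 * cos θ * sin θ *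
      pder 2 (pder 1 F) y + pder 3 (pder 3 F) y)) * s1 + (p.1 ^ 2 * sin α *
      (pder 1 (pder 1 F) y + pder 2 (pder 2 F) y)) * s2
  have h0 := integral_polar_deriv hL (fun θ => by simp [L]) (fun θ => by simp [L]) hLd
  have h1 : ∀ α, ∫ θ in (0:ℝ)..(2 * π), (-E α θ - deriv (fun θ => K (α, θ)) θ) =
      -∫ θ in (0:ℝ)..(2 * π), E α θ := fun α => by
    have hn : IntervalIntegrable (fun θ => -E α θ) volume 0 (2 * π) := (hi α).neg
    rw [intervalIntegral.integral_sub hn (hKi α), hK0, intervalIntegral.integral_neg, sub_zero]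
  simp only [h1, intervalIntegral.integral_neg, neg_eq_zero] at h0
  exact h0

lemma hasDerivAt_integral_param {L : ℝ × ℝ → ℝ} (hL : ContDiff ℝ ∞ L) {D : ℝ → ℝ → ℝ}
    (hD : ∀ α θ, HasDerivAt (fun α => L (α, θ)) (D α θ) α) (a b α : ℝ) :
    HasDerivAt (fun α => ∫ θ in a..b, L (α, θ)) (∫ θ in a..b, D α θ) α := by
  have h : HasDerivAt (fun α => ∫ θ in a..b, L (α, θ))
      (fderiv ℝ (fun α => ∫ θ in a..b, L (α, θ)) α 1) α :=
    ((contDiff_param_integral hL a b).differentiable (by simp) α).hasFDerivAt.hasDerivAt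
  rw [fderiv_param_integral hL a b α 1] at h
  refine h.congr_deriv (intervalIntegral.integral_congr fun θ _ => ?_)
  have h3 : HasFDerivAt (fun α : ℝ => L (α, θ))
      ((fderiv ℝ L (α, θ)).comp (ContinuousLinearMap.inl ℝ ℝ ℝ)) α :=
    HasFDerivAt.comp (g := L) (f := fun α : ℝ => (α, θ)) α
      (hL.differentiable (by simp) (α, θ)).hasFDerivAt (hasFDerivAt_prodMk_left α θ)
  exact h3.hasDerivAt.unique (hD α θ)

lemma fderiv_eq_of_line {E : Type} [NormedAddCommGroup E] [NormedSpace ℝ E] {G : E → ℝ} {q v : E}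
    {d : ℝ} (hG : DifferentiableAt ℝ G q) {c : ℝ → E} {s : ℝ} (hc : HasDerivAt c v s)
    (hq : c s = q) (h : HasDerivAt (fun t => G (c t)) d s) : fderiv ℝ G q v = d := by
  subst hq
  exact (hG.hasFDerivAt.comp_hasDerivAt s hc).unique h

/-- The integrand of the mass kernel. -/
def kc (m : ℝ) (r ρ θ : ℝ) : ℝ := exp (m * ρ * cos θ) * cos (m * r * sin θ)

def ks (m : ℝ) (r ρ θ : ℝ) : ℝ := exp (m * ρ * cos θ) * sin (m * r * sin θ)

/-- The mass kernel of the Klein-Gordon propagator. -/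
def kk (m : ℝ) (q : ℝ × ℝ) : ℝ := (2 * π)⁻¹ * ∫ θ in (0:ℝ)..(2 * π), kc m q.1 q.2 θ

lemma kk_smooth (m : ℝ) : ContDiff ℝ ∞ (kk m) := by
  refine contDiff_const.mul (contDiff_param_integral
    (G := fun p : (ℝ × ℝ) × ℝ => kc m p.1.1 p.1.2 p.2) ?_ 0 (2 * π))
  unfold kc
  fun_prop

lemma kc_hasDeriv_fst (m r ρ θ : ℝ) :
    HasDerivAt (fun r => kc m r ρ θ) (-(m * sin θ) * ks m r ρ θ) r := by
  have h := ((((hasDerivAt_id r).const_mul m).mul_const (sin θ)).cos).const_mul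
    (exp (m * ρ * cos θ))
  refine h.congr_deriv ?_
  simp only [ks, id_eq]; ring

lemma ks_hasDeriv_fst (m r ρ θ : ℝ) :
    HasDerivAt (fun r => ks m r ρ θ) ((m * sin θ) * kc m r ρ θ) r := by
  have h := ((((hasDerivAt_id r).const_mul m).mul_const (sin θ)).sin).const_mul
    (exp (m * ρ * cos θ))
  refine h.congr_deriv ?_
  simp only [kc, id_eq]; ring

lemma kc_hasDeriv_snd (m r ρ θ : ℝ) :
    HasDerivAt (fun ρ => kc m r ρ θ) ((m * cos θ) * kc m r ρ θ) ρ := by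
  have h := ((((hasDerivAt_id ρ).const_mul m).mul_const (cos θ)).exp).mul_const
    (cos (m * r * sin θ))
  refine h.congr_deriv ?_
  simp only [kc, id_eq]; ring

/-- First order partial derivatives of functions on the plane. -/
def d1 (k : ℝ × ℝ → ℝ) (q : ℝ × ℝ) : ℝ := fderiv ℝ k q (1, 0)

def d2 (k : ℝ × ℝ → ℝ) (q : ℝ × ℝ) : ℝ := fderiv ℝ k q (0, 1)

lemma d1_smooth {k : ℝ × ℝ → ℝ} (hk : ContDiff ℝ ∞ k) : ContDiff ℝ ∞ (d1 k) :=
  (hk.fderiv_right (m := ∞) (by simp)).clm_apply contDiff_const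

lemma d2_smooth {k : ℝ × ℝ → ℝ} (hk : ContDiff ℝ ∞ k) : ContDiff ℝ ∞ (d2 k) :=
  (hk.fderiv_right (m := ∞) (by simp)).clm_apply contDiff_const

lemma d1_eq {k : ℝ × ℝ → ℝ} (hk : ContDiff ℝ ∞ k) {r ρ d : ℝ}
    (h : HasDerivAt (fun r => k (r, ρ)) d r) : d1 k (r, ρ) = d :=
  fderiv_eq_of_line (hk.differentiable (by simp) _) (c := fun r => (r, ρ))
    ((hasDerivAt_id r).prodMk (hasDerivAt_const r ρ)) rfl h

lemma d2_eq {k : ℝ × ℝ → ℝ} (hk : ContDiff ℝ ∞ k) {r ρ d : ℝ}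
    (h : HasDerivAt (fun ρ => k (r, ρ)) d ρ) : d2 k (r, ρ) = d :=
  fderiv_eq_of_line (hk.differentiable (by simp) _) (c := fun ρ => (r, ρ))
    ((hasDerivAt_const ρ r).prodMk (hasDerivAt_id ρ)) rfl h

lemma d1_kk (m : ℝ) : d1 (kk m) = fun q =>
    (2 * π)⁻¹ * ∫ θ in (0:ℝ)..(2 * π), -(m * sin θ) * ks m q.1 q.2 θ := by
  funext ⟨r, ρ⟩
  refine d1_eq (kk_smooth m) ((hasDerivAt_integral_param (L := fun q => kc m q.1 ρ q.2) ?_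
    (fun α θ => kc_hasDeriv_fst m α ρ θ) 0 (2 * π) r).const_mul _)
  unfold kc; fun_prop

lemma d2_kk (m : ℝ) : d2 (kk m) = fun q =>
    (2 * π)⁻¹ * ∫ θ in (0:ℝ)..(2 * π), (m * cos θ) * kc m q.1 q.2 θ := by
  funext ⟨r, ρ⟩
  refine d2_eq (kk_smooth m) ((hasDerivAt_integral_param (L := fun q => kc m r q.1 q.2) ?_
    (fun α θ => kc_hasDeriv_snd m r α θ) 0 (2 * π) ρ).const_mul _)
  unfold kc; fun_prop

lemma kk_wave (m : ℝ) (q : ℝ × ℝ) :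
    d1 (d1 (kk m)) q - d2 (d2 (kk m)) q = -m ^ 2 * kk m q := by
  obtain ⟨r, ρ⟩ := q
  have h1 : d1 (d1 (kk m)) (r, ρ) =
      (2 * π)⁻¹ * ∫ θ in (0:ℝ)..(2 * π), -(m * sin θ) * ((m * sin θ) * kc m r ρ θ) := by
    refine d1_eq (d1_smooth (kk_smooth m)) ?_
    rw [d1_kk]
    refine (hasDerivAt_integral_param (L := fun q => -(m * sin q.2) * ks m q.1 ρ q.2) ?_
      (fun α θ => (ks_hasDeriv_fst m α ρ θ).const_mul (-(m * sin θ))) 0 (2 * π) r).const_mul _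
    unfold ks; fun_prop
  have h2 : d2 (d2 (kk m)) (r, ρ) =
      (2 * π)⁻¹ * ∫ θ in (0:ℝ)..(2 * π), (m * cos θ) * ((m * cos θ) * kc m r ρ θ) := by
    refine d2_eq (d2_smooth (kk_smooth m)) ?_
    rw [d2_kk]
    refine (hasDerivAt_integral_param (L := fun q => (m * cos q.2) * kc m r q.1 q.2) ?_
      (fun α θ => (kc_hasDeriv_snd m r α θ).const_mul (m * cos θ)) 0 (2 * π) ρ).const_mul _
    unfold kc; fun_prop
  have hc : Continuous fun θ => kc m r ρ θ := by unfold kc; fun_prop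
  rw [h1, h2, kk, ← mul_sub, ← intervalIntegral.integral_sub
    (Continuous.intervalIntegrable (by fun_prop) _ _)
    (Continuous.intervalIntegrable (by fun_prop) _ _), mul_left_comm (-m ^ 2),
    ← intervalIntegral.integral_const_mul (-m ^ 2)]
  congr 1
  refine intervalIntegral.integral_congr fun θ _ => ?_
  simp only []
  linear_combination (-m ^ 2 * kc m r ρ θ) * sin_sq_add_cos_sq θ

lemma integral_periodic_deriv {f f' : ℝ → ℝ} (h : ∀ θ, HasDerivAt f (f' θ) θ) (hc : Continuous f')
    (hp : f (2 * π) = f 0) : ∫ θ in (0:ℝ)..(2 * π), f' θ = 0 := by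
  rw [intervalIntegral.integral_eq_sub_of_hasDerivAt (fun θ _ => h θ)
    (hc.intervalIntegrable _ _), hp, sub_self]

lemma d2_kk_axis (m r : ℝ) : d2 (kk m) (r, 0) = 0 := by
  rw [d2_kk]
  rcases eq_or_ne r 0 with rfl | hr
  · simp [kc]
  have h : ∀ θ, HasDerivAt (fun θ => r⁻¹ * sin (m * r * sin θ)) (m * cos θ * kc m r 0 θ) θ :=
    fun θ => by
      refine ((((hasDerivAt_sin θ).const_mul (m * r)).sin).const_mul r⁻¹).congr_deriv ?_
      simp only [kc, mul_zero, zero_mul, exp_zero, one_mul]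
      field_simp
  have := integral_periodic_deriv h (by unfold kc; fun_prop) (by simp)
  simp [this]

lemma kk_diag_deriv (m r : ℝ) : d1 (kk m) (r, r) + d2 (kk m) (r, r) = 0 := by
  have hc : Continuous fun θ => kc m r r θ := by unfold kc; fun_prop
  have hs : Continuous fun θ => ks m r r θ := by unfold ks; fun_prop
  rw [d1_kk, d2_kk]
  simp only []
  rw [← mul_add, ← intervalIntegral.integral_add
    (Continuous.intervalIntegrable (by fun_prop) _ _)
    (Continuous.intervalIntegrable (by fun_prop) _ _)]
  rcases eq_or_ne r 0 with rfl | hr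
  · simp [kc, ks]
  have h : ∀ θ, HasDerivAt (fun θ => r⁻¹ * ks m r r θ)
      (-(m * sin θ) * ks m r r θ + m * cos θ * kc m r r θ) θ := fun θ => by
    have h1 := (((hasDerivAt_cos θ).const_mul (m * r)).exp).mul
      (((hasDerivAt_sin θ).const_mul (m * r)).sin)
    refine (h1.const_mul r⁻¹).congr_deriv ?_
    simp only [kc, ks]
    field_simp
  rw [integral_periodic_deriv h (by fun_prop) (by simp [ks]), mul_zero]

lemma kk_diag (m r : ℝ) : kk m (r, r) = 1 := by
  have hd : ∀ r, HasDerivAt (fun r => kk m (r, r)) 0 r := fun r => by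
    have h := HasFDerivAt.comp_hasDerivAt (l := kk m) (f := fun r : ℝ => (r, r)) r
      ((kk_smooth m).differentiable (by simp) (r, r)).hasFDerivAt
      ((hasDerivAt_id r).prodMk (hasDerivAt_id r))
    refine h.congr_deriv ?_
    rw [show ((1:ℝ), (1:ℝ)) = (1, 0) + (0, 1) by simp, map_add]
    exact kk_diag_deriv m r
  have h0 : kk m (0, 0) = 1 := by
    have : π ≠ 0 := pi_ne_zero
    simp [kk, kc]
    field_simp
  rw [← h0]
  exact is_const_of_deriv_eq_zero (fun r => (hd r).differentiableAt) (fun r => (hd r).deriv) r 0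

/-! Spherical means solve the wave equation in the radius. -/

lemma dr_dy_comm {f : ℝ × St → ℝ} (hf : ContDiff ℝ ∞ f) (α : Fin 4) :
    dr (dy α f) = dy α (dr f) := by
  funext p
  have hd : DifferentiableAt ℝ (fderiv ℝ f) p :=
    (hf.fderiv_right (m := ∞) (by simp)).differentiable (by simp) p
  have h := (hf.contDiffAt (x := p)).isSymmSndFDerivAt (by
    simp only [minSmoothness_of_isRCLikeNormedField]
    exact WithTop.coe_le_coe.2 le_top)
  have e : ∀ v w, fderiv ℝ (fun q => fderiv ℝ f q w) p v = fderiv ℝ (fderiv ℝ f) p v w :=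
    fun v w => by
      rw [fderiv_clm_apply hd (differentiableAt_const w)]
      simp
  exact (e _ _).trans ((h.eq _ _).trans (e _ _).symm)

lemma dr_eq {f : ℝ × St → ℝ} (hf : ContDiff ℝ ∞ f) {r d : ℝ} {y : St}
    (h : HasDerivAt (fun r => f (r, y)) d r) : dr f (r, y) = d :=
  fderiv_eq_of_line (hf.differentiable (by simp) _) (c := fun r => (r, y))
    ((hasDerivAt_id r).prodMk (hasDerivAt_const r y)) rfl h

lemma hasDerivAt_dr {f : ℝ × St → ℝ} (hf : ContDiff ℝ ∞ f) (r : ℝ) (y : St) :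
    HasDerivAt (fun r => f (r, y)) (dr f (r, y)) r :=
  HasFDerivAt.comp_hasDerivAt (l := f) (f := fun r : ℝ => (r, y)) r
    (hf.differentiable (by simp) (r, y)).hasFDerivAt
    ((hasDerivAt_id r).prodMk (hasDerivAt_const r y))

lemma dy_eq_pder {f : ℝ × St → ℝ} (hf : ContDiff ℝ ∞ f) (α : Fin 4) (r : ℝ) (y : St) :
    dy α f (r, y) = pder α (fun y => f (r, y)) y := by
  have h := HasFDerivAt.comp (g := f) (f := fun y : St => (r, y)) y
    (hf.differentiable (by simp) (r, y)).hasFDerivAt (hasFDerivAt_prodMk_right r y)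
  have h2 : fderiv ℝ (fun y => f (r, y)) y = _ := h.fderiv
  rw [pder, h2]
  simp [dy]

lemma pder_line {f : St → ℝ} (hf : ContDiff ℝ ∞ f) (α : Fin 4) (y : St) :
    HasDerivAt (fun s : ℝ => f (y + s • Pi.single α 1)) (pder α f y) 0 := by
  have h := hasDerivAt_comp_curve hf (s := (0:ℝ)) (c := fun s : ℝ => y + s • Pi.single α 1)
    (((hasDerivAt_id (0:ℝ)).smul_const (Pi.single α (1:ℝ) : St)).const_add y)
  refine h.congr_deriv ?_
  rw [← fderiv_eq_sum_pder]
  simp [pder]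

/-- Radius times the spherical mean. -/
def sW (F : St → ℝ) (p : ℝ × St) : ℝ := (4 * π)⁻¹ * (p.1 * sphM F p)

lemma sW_smooth {F : St → ℝ} (hF : ContDiff ℝ ∞ F) : ContDiff ℝ ∞ (sW F) :=
  contDiff_const.mul (contDiff_fst.mul (sphM_smooth hF))

lemma dr_sW {F : St → ℝ} (hF : ContDiff ℝ ∞ F) :
    dr (sW F) = fun p => (4 * π)⁻¹ * (sphM F p + p.1 * dr (sphM F) p) := by
  funext ⟨r, y⟩
  refine dr_eq (sW_smooth hF) ((((hasDerivAt_id r).mul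
    (hasDerivAt_dr (sphM_smooth hF) r y)).const_mul (4 * π)⁻¹).congr_deriv ?_)
  simp

lemma dr_dr_sW {F : St → ℝ} (hF : ContDiff ℝ ∞ F) (p : ℝ × St) : dr (dr (sW F)) p =
    (4 * π)⁻¹ * (2 * dr (sphM F) p + p.1 * dr (dr (sphM F)) p) := by
  obtain ⟨r, y⟩ := p
  have hM := sphM_smooth hF
  refine dr_eq (dr_smooth (sW_smooth hF)) ?_
  rw [dr_sW hF]
  refine (((hasDerivAt_dr hM r y).add ((hasDerivAt_id r).mul
    (hasDerivAt_dr (dr_smooth hM) r y))).const_mul (4 * π)⁻¹).congr_deriv ?_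
  simp only [id_eq]; ring

lemma dy_const_mul_fst {f : ℝ × St → ℝ} (hf : ContDiff ℝ ∞ f) (c : ℝ) (α : Fin 4) :
    dy α (fun p => c * (p.1 * f p)) = fun p => c * (p.1 * dy α f p) := by
  funext ⟨r, y⟩
  rw [dy_eq_pder (contDiff_const.mul (contDiff_fst.mul hf)), dy_eq_pder hf]
  have hs : ContDiff ℝ ∞ fun y => f (r, y) := hf.comp (contDiff_const.prodMk contDiff_id)
  simp only []
  rw [pder_const_mul c (contDiff_const.mul hs), pder_const_mul r hs]

lemma sW_wave_mul {F : St → ℝ} (hF : ContDiff ℝ ∞ F) (p : ℝ × St) :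
    p.1 * dr (dr (sW F)) p = p.1 * ∑ a : Fin 3, dy a.succ (dy a.succ (sW F)) p := by
  have hM := sphM_smooth hF
  have h : ∀ a : Fin 3, dy a.succ (dy a.succ (sW F)) p =
      (4 * π)⁻¹ * (p.1 * dy a.succ (dy a.succ (sphM F)) p) := fun a => by
    have e : dy a.succ (sW F) = fun p => (4 * π)⁻¹ * (p.1 * dy a.succ (sphM F) p) :=
      dy_const_mul_fst hM _ _
    rw [e, dy_const_mul_fst (dy_smooth hM _)]
  simp only [h, ← Finset.mul_sum, dr_dr_sW hF]
  linear_combination (4 * π)⁻¹ * sphM_darboux hF p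

lemma sW_wave {F : St → ℝ} (hF : ContDiff ℝ ∞ F) (p : ℝ × St) :
    dr (dr (sW F)) p = ∑ a : Fin 3, dy a.succ (dy a.succ (sW F)) p := by
  have hW := sW_smooth hF
  obtain ⟨r, y⟩ := p
  have c1 : Continuous fun r => dr (dr (sW F)) (r, y) :=
    (dr_smooth (dr_smooth hW)).continuous.comp (by fun_prop)
  have c2 : Continuous fun r => ∑ a : Fin 3, dy a.succ (dy a.succ (sW F)) (r, y) :=
    continuous_finsetSum _ fun a _ =>
      (dy_smooth (dy_smooth hW _) _).continuous.comp (by fun_prop)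
  refine congrFun (Continuous.ext_on (dense_compl_singleton (0:ℝ)) c1 c2 fun r hr => ?_) r
  exact mul_left_cancel₀ hr (sW_wave_mul hF (r, y))

/-- The radial derivative of radius times the spherical mean. -/
def sV (F : St → ℝ) : ℝ × St → ℝ := dr (sW F)

lemma sV_smooth {F : St → ℝ} (hF : ContDiff ℝ ∞ F) : ContDiff ℝ ∞ (sV F) :=
  dr_smooth (sW_smooth hF)

lemma sV_wave {F : St → ℝ} (hF : ContDiff ℝ ∞ F) (p : ℝ × St) :
    dr (dr (sV F)) p = ∑ a : Fin 3, dy a.succ (dy a.succ (sV F)) p := by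
  have hW := sW_smooth hF
  rw [sV, show dr (dr (sW F)) = fun p => ∑ a : Fin 3, dy a.succ (dy a.succ (sW F)) p from
    funext (sW_wave hF), dr_sum fun a => dy_smooth (dy_smooth hW _) _]
  refine Finset.sum_congr rfl fun a _ => ?_
  rw [dr_dy_comm (dy_smooth hW _), dr_dy_comm hW]

lemma sV_zero {F : St → ℝ} (hF : ContDiff ℝ ∞ F) (y : St) : sV F (0, y) = F y := by
  rw [sV, dr_sW hF]
  have : sphM F (0, y) = 4 * π * F y := by
    simp [sphM, sph]
    ring
  simp only [this, zero_mul, add_zero]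
  have := pi_ne_zero
  field_simp

lemma dr_sV_zero {F : St → ℝ} (hF : ContDiff ℝ ∞ F) (y : St) : dr (sV F) (0, y) = 0 := by
  have hM := sphM_smooth hF
  have e : ∀ α, dy α (sW F) = fun p => (4 * π)⁻¹ * (p.1 * dy α (sphM F) p) :=
    fun α => dy_const_mul_fst hM _ _
  rw [sV, sW_wave hF]
  refine Finset.sum_eq_zero fun a _ => ?_
  rw [e, dy_const_mul_fst (dy_smooth hM _)]
  simp

/-! Volterra integrals against a kernel. -/

def prim (k : ℝ × ℝ → ℝ) (V : ℝ × St → ℝ) (p : ℝ × St) : ℝ :=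
  ∫ ρ in (0:ℝ)..p.1, k (p.1, ρ) * V (ρ, p.2)

def primG (k : ℝ × ℝ → ℝ) (V : ℝ × St → ℝ) (q : (ℝ × St) × ℝ) : ℝ :=
  k (q.1.1, q.2) * V (q.2, q.1.2)

lemma primG_smooth {k : ℝ × ℝ → ℝ} (hk : ContDiff ℝ ∞ k) {V : ℝ × St → ℝ}
    (hV : ContDiff ℝ ∞ V) : ContDiff ℝ ∞ (primG k V) :=
  (hk.comp (by fun_prop : ContDiff ℝ ∞ fun q : (ℝ × St) × ℝ => (q.1.1, q.2))).mul
    (hV.comp (by fun_prop : ContDiff ℝ ∞ fun q : (ℝ × St) × ℝ => (q.2, q.1.2)))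

lemma prim_smooth {k : ℝ × ℝ → ℝ} (hk : ContDiff ℝ ∞ k) {V : ℝ × St → ℝ}
    (hV : ContDiff ℝ ∞ V) : ContDiff ℝ ∞ (prim k V) :=
  smooth_param_primitive (primG_smooth hk hV) contDiff_fst

lemma hasDerivAt_d1 {k : ℝ × ℝ → ℝ} (hk : ContDiff ℝ ∞ k) (r ρ : ℝ) :
    HasDerivAt (fun r => k (r, ρ)) (d1 k (r, ρ)) r :=
  HasFDerivAt.comp_hasDerivAt (l := k) (f := fun r : ℝ => (r, ρ)) r
    (hk.differentiable (by simp) (r, ρ)).hasFDerivAt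
    ((hasDerivAt_id r).prodMk (hasDerivAt_const r ρ))

lemma hasDerivAt_d2 {k : ℝ × ℝ → ℝ} (hk : ContDiff ℝ ∞ k) (r ρ : ℝ) :
    HasDerivAt (fun ρ => k (r, ρ)) (d2 k (r, ρ)) ρ :=
  HasFDerivAt.comp_hasDerivAt (l := k) (f := fun ρ : ℝ => (r, ρ)) ρ
    (hk.differentiable (by simp) (r, ρ)).hasFDerivAt
    ((hasDerivAt_const ρ r).prodMk (hasDerivAt_id ρ))

lemma dr_prim {k : ℝ × ℝ → ℝ} (hk : ContDiff ℝ ∞ k) {V : ℝ × St → ℝ}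
    (hV : ContDiff ℝ ∞ V) :
    dr (prim k V) = fun p => k (p.1, p.1) * V p + prim (d1 k) V p := by
  funext ⟨r, y⟩
  have h := fderiv_param_primitive (primG_smooth hk hV) (b := Prod.fst) contDiff_fst (r, y) (1, 0)
  rw [fderiv_fst] at h
  refine h.trans ?_
  simp only [ContinuousLinearMap.coe_fst', one_mul, prim, primG]
  congr 1
  refine intervalIntegral.integral_congr fun ρ _ => ?_
  exact fderiv_eq_of_line ((primG_smooth hk hV).differentiable (by simp) _)
    (c := fun s => ((s, y), ρ))
    (((hasDerivAt_id r).prodMk (hasDerivAt_const r y)).prodMk (hasDerivAt_const r ρ)) rfl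
    ((hasDerivAt_d1 hk r ρ).mul_const (V (ρ, y)))

lemma dy_prim {k : ℝ × ℝ → ℝ} (hk : ContDiff ℝ ∞ k) {V : ℝ × St → ℝ}
    (hV : ContDiff ℝ ∞ V) (α : Fin 4) : dy α (prim k V) = prim k (dy α V) := by
  funext ⟨r, y⟩
  have h := fderiv_param_primitive (primG_smooth hk hV) (b := Prod.fst) contDiff_fst (r, y)
    (0, Pi.single α 1)
  rw [fderiv_fst] at h
  refine h.trans ?_
  simp only [ContinuousLinearMap.coe_fst', zero_mul, zero_add, prim]
  refine intervalIntegral.integral_congr fun ρ _ => ?_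
  have hs : ContDiff ℝ ∞ fun y => V (ρ, y) := hV.comp (contDiff_const.prodMk contDiff_id)
  simp only [dy_eq_pder hV]
  refine fderiv_eq_of_line ((primG_smooth hk hV).differentiable (by simp) _) (s := 0)
    (c := fun s : ℝ => ((r, y + s • Pi.single α 1), ρ))
    (((hasDerivAt_const 0 r).prodMk ?_).prodMk (hasDerivAt_const 0 ρ)) (by simp)
    ((pder_line hs α y).const_mul (k (r, ρ)))
  simpa using ((hasDerivAt_id (0:ℝ)).smul_const (Pi.single α (1:ℝ) : St)).const_add y

/-- Radial profile of the Klein-Gordon propagator. -/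
def sH (m : ℝ) (F : St → ℝ) : ℝ × St → ℝ := prim (kk m) (sV F)

lemma sH_smooth (m : ℝ) {F : St → ℝ} (hF : ContDiff ℝ ∞ F) : ContDiff ℝ ∞ (sH m F) :=
  prim_smooth (kk_smooth m) (sV_smooth hF)

lemma dr_sH (m : ℝ) {F : St → ℝ} (hF : ContDiff ℝ ∞ F) :
    dr (sH m F) = fun p => sV F p + prim (d1 (kk m)) (sV F) p := by
  rw [sH, dr_prim (kk_smooth m) (sV_smooth hF)]
  simp [kk_diag]

lemma sH_zero (m : ℝ) (F : St → ℝ) (y : St) : sH m F (0, y) = 0 := by simp [sH, prim]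

lemma dr_sH_zero (m : ℝ) {F : St → ℝ} (hF : ContDiff ℝ ∞ F) (y : St) :
    dr (sH m F) (0, y) = F y := by
  rw [dr_sH m hF]
  simp [prim, sV_zero hF]

lemma integral_by_parts_twice {k : ℝ × ℝ → ℝ} (hk : ContDiff ℝ ∞ k) {V : ℝ × St → ℝ}
    (hV : ContDiff ℝ ∞ V) (p : ℝ × St) :
    prim k (dr (dr V)) p - prim (d2 (d2 k)) V p =
      (k (p.1, p.1) * dr V p - d2 k (p.1, p.1) * V p) -
      (k (p.1, 0) * dr V (0, p.2) - d2 k (p.1, 0) * V (0, p.2)) := by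
  obtain ⟨r, y⟩ := p
  have hV1 := dr_smooth hV
  have hk2 := d2_smooth hk
  have ck : ∀ {k : ℝ × ℝ → ℝ}, ContDiff ℝ ∞ k → Continuous fun ρ => k (r, ρ) :=
    fun hk => hk.continuous.comp (by fun_prop)
  have cV : ∀ {V : ℝ × St → ℝ}, ContDiff ℝ ∞ V → Continuous fun ρ => V (ρ, y) :=
    fun hV => hV.continuous.comp (by fun_prop)
  have h : ∀ ρ, HasDerivAt (fun ρ => k (r, ρ) * dr V (ρ, y) - d2 k (r, ρ) * V (ρ, y))
      (k (r, ρ) * dr (dr V) (ρ, y) - d2 (d2 k) (r, ρ) * V (ρ, y)) ρ := fun ρ => by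
    refine (((hasDerivAt_d2 hk r ρ).mul (hasDerivAt_dr hV1 ρ y)).sub
      ((hasDerivAt_d2 hk2 r ρ).mul (hasDerivAt_dr hV ρ y))).congr_deriv ?_
    ring
  have i1 : Continuous fun ρ => k (r, ρ) * dr (dr V) (ρ, y) :=
    (ck hk).mul (cV (dr_smooth hV1))
  have i2 : Continuous fun ρ => d2 (d2 k) (r, ρ) * V (ρ, y) :=
    (ck (d2_smooth hk2)).mul (cV hV)
  simp only [prim]
  rw [← intervalIntegral.integral_sub (i1.intervalIntegrable _ _) (i2.intervalIntegrable _ _),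
    intervalIntegral.integral_eq_sub_of_hasDerivAt (fun ρ _ => h ρ)
    ((i1.sub i2).intervalIntegrable _ _)]

lemma sH_wave (m : ℝ) {F : St → ℝ} (hF : ContDiff ℝ ∞ F) (p : ℝ × St) :
    dr (dr (sH m F)) p - ∑ a : Fin 3, dy a.succ (dy a.succ (sH m F)) p = -m ^ 2 * sH m F p := by
  have hk := kk_smooth m
  have hV := sV_smooth hF
  have h1 : dr (dr (sH m F)) p = dr (sV F) p + (d1 (kk m) (p.1, p.1) * sV F p +
      prim (d1 (d1 (kk m))) (sV F) p) := by
    rw [dr_sH m hF]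
    obtain ⟨r, y⟩ := p
    have hp := prim_smooth (d1_smooth hk) hV
    have h2 := hasDerivAt_dr hp r y
    rw [dr_prim (d1_smooth hk) hV] at h2
    exact dr_eq (hV.add hp) ((hasDerivAt_dr hV r y).add h2)
  have hi : ∀ {k : ℝ × ℝ → ℝ} {V : ℝ × St → ℝ}, ContDiff ℝ ∞ k → ContDiff ℝ ∞ V →
      IntervalIntegrable (fun ρ => k (p.1, ρ) * V (ρ, p.2)) volume 0 p.1 := fun hk hV =>
    Continuous.intervalIntegrable ((hk.continuous.comp (by fun_prop)).mul
      (hV.continuous.comp (by fun_prop))) _ _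
  have h2 : ∑ a : Fin 3, dy a.succ (dy a.succ (sH m F)) p = prim (kk m) (dr (dr (sV F))) p := by
    simp only [sH, dy_prim hk hV, dy_prim hk (dy_smooth hV _)]
    simp only [prim, sV_wave hF, Finset.mul_sum]
    rw [intervalIntegral.integral_finsetSum]
    exact fun a _ => hi hk (dy_smooth (dy_smooth hV _) _)
  have h3 := integral_by_parts_twice hk hV p
  have h4 : prim (d1 (d1 (kk m))) (sV F) p - prim (d2 (d2 (kk m))) (sV F) p =
      -m ^ 2 * sH m F p := by
    simp only [prim, sH]
    rw [← intervalIntegral.integral_sub (hi (d1_smooth (d1_smooth hk)) hV)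
      (hi (d2_smooth (d2_smooth hk)) hV), ← intervalIntegral.integral_const_mul]
    refine intervalIntegral.integral_congr fun ρ _ => ?_
    linear_combination sV F (ρ, p.2) * kk_wave m (p.1, ρ)
  rw [kk_diag, dr_sV_zero hF, d2_kk_axis] at h3
  rw [h1, h2]
  linear_combination h4 - h3 + sV F p * kk_diag_deriv m p.1

/-- Duhamel integral of a radial profile along vertical lines. -/
def duh (H : ℝ × St → ℝ) (y : St) : ℝ :=
  ∫ ρ in (0:ℝ)..(y 0 - 2), H (ρ, y - ρ • Pi.single 0 1)

lemma duhG_smooth {H : ℝ × St → ℝ} (hH : ContDiff ℝ ∞ H) :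
    ContDiff ℝ ∞ fun q : St × ℝ => H (q.2, q.1 - q.2 • (Pi.single 0 1 : St)) :=
  hH.comp (contDiff_snd.prodMk (contDiff_fst.sub (contDiff_snd.smul contDiff_const)))

lemma lapse_smooth : ContDiff ℝ ∞ fun y : St => y 0 - 2 := (coord_smooth 0).sub contDiff_const

lemma duh_smooth {H : ℝ × St → ℝ} (hH : ContDiff ℝ ∞ H) : ContDiff ℝ ∞ (duh H) :=
  smooth_param_primitive (duhG_smooth hH) lapse_smooth

lemma fderiv_lapse (y : St) (α : Fin 4) :
    fderiv ℝ (fun y : St => y 0 - 2) y (Pi.single α 1) = if α = 0 then 1 else 0 := by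
  rw [fderiv_sub_const]
  have := congrFun (pder_coord α 0) y
  simp only [pder] at this
  rw [this]
  simp only [eq_comm]

lemma pder_duh_aux {H : ℝ × St → ℝ} (hH : ContDiff ℝ ∞ H) (α : Fin 4) (y : St) :
    pder α (duh H) y = (if α = 0 then 1 else 0) * H (y 0 - 2, y - (y 0 - 2) • Pi.single 0 1) +
      duh (dy α H) y := by
  have h := fderiv_param_primitive (duhG_smooth hH) lapse_smooth y (Pi.single α 1)
  rw [fderiv_lapse] at h
  refine h.trans ?_
  congr 1
  refine intervalIntegral.integral_congr fun ρ _ => ?_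
  have hs : ContDiff ℝ ∞ fun y => H (ρ, y) := hH.comp (contDiff_const.prodMk contDiff_id)
  simp only [dy_eq_pder hH]
  refine fderiv_eq_of_line ((duhG_smooth hH).differentiable (by simp) _) (s := 0)
    (c := fun s : ℝ => (y + s • Pi.single α 1, ρ))
    ((?_ : HasDerivAt (fun s : ℝ => y + s • (Pi.single α 1 : St)) (Pi.single α 1) 0).prodMk
      (hasDerivAt_const 0 ρ)) (by simp) ?_
  · simpa using ((hasDerivAt_id (0:ℝ)).smul_const (Pi.single α (1:ℝ) : St)).const_add y
  · refine (pder_line hs α (y - ρ • Pi.single 0 1)).congr_of_eventuallyEq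
      (Filter.Eventually.of_forall fun s => ?_)
    simp only []
    congr 2
    abel

lemma pder_succ_duh {H : ℝ × St → ℝ} (hH : ContDiff ℝ ∞ H) (a : Fin 3) :
    pder a.succ (duh H) = duh (dy a.succ H) := by
  funext y
  simp [pder_duh_aux hH, Fin.succ_ne_zero]

lemma pder_zero_duh {H : ℝ × St → ℝ} (hH : ContDiff ℝ ∞ H) :
    pder 0 (duh H) = fun y => H (0, y) + duh (dr H) y := by
  funext y
  rw [pder_duh_aux hH, if_pos rfl, one_mul]
  let c : ℝ → ℝ × St := fun ρ => (ρ, y - ρ • Pi.single 0 1)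
  have hc : ∀ ρ, HasDerivAt c (1, -Pi.single 0 1) ρ := fun ρ => by
    refine (hasDerivAt_id ρ).prodMk ?_
    simpa using ((hasDerivAt_id ρ).smul_const (Pi.single 0 (1:ℝ) : St)).const_sub y
  have h : ∀ ρ, HasDerivAt (fun ρ => H (c ρ)) (dr H (c ρ) - dy 0 H (c ρ)) ρ := fun ρ => by
    refine (HasFDerivAt.comp_hasDerivAt (l := H) (f := c) ρ
      (hH.differentiable (by simp) (c ρ)).hasFDerivAt (hc ρ)).congr_deriv ?_
    rw [show ((1 : ℝ), -(Pi.single 0 1 : St)) = (1, 0) - (0, Pi.single 0 1) by simp, map_sub]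
    rfl
  have hcc : Continuous c := by fun_prop
  have i1 : Continuous fun ρ => dr H (c ρ) := (dr_smooth hH).continuous.comp hcc
  have i2 : Continuous fun ρ => dy 0 H (c ρ) := (dy_smooth hH 0).continuous.comp hcc
  have h2 := intervalIntegral.integral_eq_sub_of_hasDerivAt (a := 0) (b := y 0 - 2)
    (fun ρ _ => h ρ) ((i1.sub i2).intervalIntegrable _ _)
  rw [intervalIntegral.integral_sub (i1.intervalIntegrable _ _) (i2.intervalIntegrable _ _)] at h2
  have h3 : c 0 = (0, y) := by simp [c]
  rw [h3] at h2
  simp only [duh]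
  linarith

/-- The solution of the inhomogeneous Klein-Gordon equation with vanishing data at time `2`. -/
def kgs (m : ℝ) (F : St → ℝ) : St → ℝ := duh (sH m F)

lemma kgs_smooth (m : ℝ) {F : St → ℝ} (hF : ContDiff ℝ ∞ F) : ContDiff ℝ ∞ (kgs m F) :=
  duh_smooth (sH_smooth m hF)

lemma pder_zero_kgs (m : ℝ) {F : St → ℝ} (hF : ContDiff ℝ ∞ F) :
    pder 0 (kgs m F) = duh (dr (sH m F)) := by
  rw [kgs, pder_zero_duh (sH_smooth m hF)]
  simp [sH_zero]

lemma KG_kgs (m : ℝ) {F : St → ℝ} (hF : ContDiff ℝ ∞ F) : KG m (kgs m F) = F := by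
  funext y
  have hH := sH_smooth m hF
  have h1 : pder 0 (pder 0 (kgs m F)) y = F y + duh (dr (dr (sH m F))) y := by
    rw [pder_zero_kgs m hF, pder_zero_duh (dr_smooth hH)]
    simp [dr_sH_zero m hF]
  have h2 : ∀ a : Fin 3, pder a.succ (pder a.succ (kgs m F)) y =
      duh (dy a.succ (dy a.succ (sH m F))) y := fun a => by
    rw [kgs, pder_succ_duh hH, pder_succ_duh (dy_smooth hH _)]
  have hi : ∀ {H : ℝ × St → ℝ}, ContDiff ℝ ∞ H → IntervalIntegrable
      (fun ρ => H (ρ, y - ρ • Pi.single 0 1)) volume 0 (y 0 - 2) := fun hH =>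
    Continuous.intervalIntegrable (hH.continuous.comp (by fun_prop)) _ _
  have h3 : duh (dr (dr (sH m F))) y - ∑ a : Fin 3, duh (dy a.succ (dy a.succ (sH m F))) y =
      -m ^ 2 * kgs m F y := by
    simp only [duh, kgs]
    rw [← intervalIntegral.integral_finsetSum fun a _ => hi (dy_smooth (dy_smooth hH _) _),
      ← intervalIntegral.integral_sub (hi (dr_smooth (dr_smooth hH))),
      ← intervalIntegral.integral_const_mul]
    · exact intervalIntegral.integral_congr fun ρ _ => sH_wave m hF _
    · refine Continuous.intervalIntegrable (continuous_finsetSum _ fun a _ => ?_) _ _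
      exact (dy_smooth (dy_smooth hH _) _).continuous.comp (by fun_prop)
  rw [KG, Box, h1]
  simp only [h2]
  linarith

lemma duh_base {H : ℝ × St → ℝ} {y : St} (hy : y 0 = 2) : duh H y = 0 := by simp [duh, hy]

/-! Domain of dependence. -/

lemma rad_eq_norm (x : Sp) : rad x = ‖WithLp.toLp 2 x‖ := by
  simp [rad, EuclideanSpace.norm_eq]

lemma rad_xs_om (q : ℝ × ℝ) : rad (xs (om q)) = 1 := by
  rw [rad, Real.sqrt_eq_one]
  simp only [Fin.sum_univ_three, xs, om]
  simp
  linear_combination (sin q.1 ^ 2) * sin_sq_add_cos_sq q.2 + sin_sq_add_cos_sq q.1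

lemma rad_sub_le (x z : Sp) (r : ℝ) : rad x - |r| * rad z ≤ rad (x + r • z) := by
  simp only [rad_eq_norm, WithLp.toLp_add, WithLp.toLp_smul]
  have h := norm_sub_le (WithLp.toLp 2 x + r • WithLp.toLp 2 z) (r • WithLp.toLp 2 z)
  rw [add_sub_cancel_right, norm_smul, Real.norm_eq_abs] at h
  linarith

/-- The set of spheres that avoid the influence region of the unit ball. -/
def farS : Set (ℝ × St) := {p | 1 + |p.2 0 - 2| + |p.1| < rad (xs p.2)}

lemma farS_open : IsOpen farS := by
  have h : Continuous fun p : ℝ × St => rad (xs p.2) := rad_continuous.comp (by unfold xs; fun_prop)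
  exact isOpen_lt (by fun_prop) h

lemma sphM_far {F : St → ℝ} (hF : Sm F) {p : ℝ × St} (hp : p ∈ farS) : sphM F p = 0 := by
  have : ∀ q, F (p.2 + p.1 • om q) = 0 := fun q => hF.2 _ (by
    have h := rad_sub_le (xs p.2) (xs (om q)) p.1
    have e : xs (p.2 + p.1 • om q) = xs p.2 + p.1 • xs (om q) := rfl
    have e0 : (p.2 + p.1 • om q) 0 = p.2 0 := by simp [om]
    rw [rad_xs_om] at h
    rw [e, e0]
    have hp' : 1 + |p.2 0 - 2| + |p.1| < rad (xs p.2) := hp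
    linarith)
  simp [sphM, sph, this]

lemma sV_far {F : St → ℝ} (hF : Sm F) {p : ℝ × St} (hp : p ∈ farS) : sV F p = 0 := by
  have : sW F =ᶠ[nhds p] fun _ => 0 := by
    filter_upwards [farS_open.mem_nhds hp] with q hq
    simp [sW, sphM_far hF hq]
  simp [sV, dr, this.fderiv_eq]

lemma sH_far (m : ℝ) {F : St → ℝ} (hF : Sm F) {p : ℝ × St} (hp : p ∈ farS) : sH m F p = 0 := by
  have hp' : 1 + |p.2 0 - 2| + |p.1| < rad (xs p.2) := hp
  refine intervalIntegral.integral_zero_ae (Filter.Eventually.of_forall fun ρ hρ => ?_)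
  have h : |ρ| ≤ |p.1| := by
    have := Set.abs_sub_left_of_mem_uIcc (Set.uIoc_subset_uIcc hρ)
    simpa using this
  rw [sV_far hF (p := (ρ, p.2)) (by
    change 1 + |p.2 0 - 2| + |ρ| < rad (xs p.2)
    linarith), mul_zero]

lemma Sm.kgs {F : St → ℝ} (hF : Sm F) (m : ℝ) : Sm (kgs m F) := by
  refine ⟨kgs_smooth m hF.1, fun y hy => ?_⟩
  refine intervalIntegral.integral_zero_ae (Filter.Eventually.of_forall fun ρ hρ => ?_)
  refine sH_far m hF ?_
  have e : xs (y - ρ • Pi.single 0 1) = xs y := by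
    funext a; simp [xs]
  have h : |y 0 - ρ - 2| + |ρ| = |y 0 - 2| := by
    rcases Set.mem_uIcc.1 (Set.uIoc_subset_uIcc hρ) with h | h
    · rw [abs_of_nonneg (by linarith), abs_of_nonneg h.1, abs_of_nonneg (by linarith)]; ring
    · rw [abs_of_nonpos (by linarith), abs_of_nonpos h.2, abs_of_nonpos (by linarith)]; ring
  change 1 + |(y - ρ • (Pi.single 0 1 : St)) 0 - 2| + |ρ| < rad (xs (y - ρ • Pi.single 0 1))
  rw [e]
  simp only [Pi.sub_apply, Pi.smul_apply, Pi.single_eq_same, smul_eq_mul, mul_one]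
  linarith

lemma KG_add (m : ℝ) {f g : St → ℝ} (hf : ContDiff ℝ ∞ f) (hg : ContDiff ℝ ∞ g) :
    KG m (fun y => f y + g y) = fun y => KG m f y + KG m g y := by
  funext y
  have hp : ∀ α, pder α (pder α fun y => f y + g y) = fun y =>
      pder α (pder α f) y + pder α (pder α g) y := fun α => by
    rw [pder_add hf hg, pder_add (pder_smooth hf α) (pder_smooth hg α)]
  simp only [KG, Box, hp, Finset.sum_add_distrib]
  ring

lemma KG_const_mul (m c : ℝ) {f : St → ℝ} (hf : ContDiff ℝ ∞ f) :
    KG m (fun y => c * f y) = fun y => c * KG m f y := by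
  funext y
  have hp : ∀ α, pder α (pder α fun y => c * f y) = fun y => c * pder α (pder α f) y :=
    fun α => by
      rw [pder_const_mul c hf, pder_const_mul c (pder_smooth hf α)]
  simp only [KG, Box, hp, ← Finset.mul_sum]
  ring

/-- Smooth data supported in the closed unit ball. -/
def Dt (f : Sp → ℝ) : Prop := ContDiff ℝ ∞ f ∧ ∀ x, 1 < rad x → f x = 0

/-- Extension of a function of position to spacetime, constant in time. -/
def lift (f : Sp → ℝ) (y : St) : ℝ := f (xs y)

lemma Sm.lift {f : Sp → ℝ} (hf : Dt f) : Sm (lift f) :=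
  ⟨hf.1.comp xs_smooth, fun y hy => hf.2 _ (by linarith [abs_nonneg (y 0 - 2)])⟩

lemma pder_zero_lift {f : Sp → ℝ} (hf : ContDiff ℝ ∞ f) : pder 0 (lift f) = fun _ => 0 := by
  funext y
  refine fderiv_eq_of_line ((hf.comp xs_smooth).differentiable (by simp) _) (s := 0)
    (c := fun s : ℝ => y + s • Pi.single 0 1) (by
      simpa using ((hasDerivAt_id (0:ℝ)).smul_const (Pi.single 0 (1:ℝ) : St)).const_add y)
    (by simp) ?_
  have : (fun s : ℝ => lift f (y + s • Pi.single 0 1)) = fun _ => f (xs y) := by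
    funext s
    simp only [lift]
    congr 1
    funext a
    simp [xs]
  rw [this]
  exact hasDerivAt_const _ _

theorem exists_solution (m : ℝ) {F : St → ℝ} (hF : Sm F) {f0 f1 : Sp → ℝ} (h0 : Dt f0)
    (h1 : Dt f1) : ∃ φ : St → ℝ, Sm φ ∧ KG m φ = F ∧ (∀ x, φ (spt 2 x) = f0 x) ∧
      ∀ x, pder 0 φ (spt 2 x) = f1 x := by
  have hl : Sm fun y => (y 0 - 2) * lift f1 y :=
    (Sm.lift h1).smul lapse_smooth
  have hφ0 : Sm fun y => lift f0 y + (y 0 - 2) * lift f1 y := (Sm.lift h0).add hl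
  set φ0 : St → ℝ := fun y => lift f0 y + (y 0 - 2) * lift f1 y with hdef
  have hG : Sm fun y => F y - KG m φ0 y := hF.sub (hφ0.KG m)
  have hψ := hG.kgs m
  have dφ : pder 0 φ0 = fun y => lift f1 y := by
    rw [hdef, pder_add (Sm.lift h0).1 hl.1, pder_mul lapse_smooth (Sm.lift h1).1,
      pder_zero_lift h0.1, pder_zero_lift h1.1]
    funext y
    have : pder 0 (fun y : St => y 0 - 2) y = 1 := by
      rw [pder, fderiv_lapse, if_pos rfl]
    simp [this]
  refine ⟨fun y => φ0 y + kgs m (fun y => F y - KG m φ0 y) y, hφ0.add hψ, ?_, fun x => ?_,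
    fun x => ?_⟩
  · rw [KG_add m hφ0.1 hψ.1, KG_kgs m hG.1]
    funext y
    ring
  · have : (spt 2 x) 0 = 2 := rfl
    simp [hdef, kgs, duh_base this, lift, xs_spt, this]
  · have : (spt 2 x) 0 = 2 := rfl
    rw [pder_add hφ0.1 hψ.1, dφ, pder_zero_kgs m hG.1]
    simp [duh_base this, lift, xs_spt]

lemma Sc_eq_fderiv (f : St → ℝ) (y : St) : Sc f y = fderiv ℝ f y y :=
  (fderiv_eq_sum_pder y y).symm

lemma Sc_add {f g : St → ℝ} (hf : ContDiff ℝ ∞ f) (hg : ContDiff ℝ ∞ g) (y : St) :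
    Sc (fun y => f y + g y) y = Sc f y + Sc g y := by
  simp only [Sc, fun α => pder_add hf hg α, mul_add, Finset.sum_add_distrib]

lemma Sm.Sc {f : St → ℝ} (hf : Sm f) : Sm (Sc f) :=
  Sm.sum (s := Finset.univ) fun α => (hf.pder α).smul (coord_smooth α)

/-- A smooth positive function equal to the identity on `[5/4, ∞)`. -/
def posId (t : ℝ) : ℝ := smoothTransition (4 * t - 4) * (t - 1) + 1

lemma posId_smooth : ContDiff ℝ ∞ posId := by
  unfold posId
  exact ((smoothTransition.contDiff.comp (by fun_prop)).mul (by fun_prop)).add contDiff_const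

lemma posId_eq {t : ℝ} (ht : 5 / 4 ≤ t) : posId t = t := by
  rw [posId, smoothTransition.one_of_one_le (by linarith)]; ring

lemma posId_pos (t : ℝ) : 0 < posId t := by
  rcases le_or_gt t 1 with h | h
  · rw [posId, smoothTransition.zero_of_nonpos (by linarith)]; norm_num
  · have := mul_nonneg (smoothTransition.nonneg (4 * t - 4)) (sub_nonneg.2 h.le)
    rw [posId]; linarith

/-- The integral along rays from the plane of time `2`, up to sign. -/
def rayI (F : St → ℝ) (y : St) : ℝ :=
  ∫ θ in (0:ℝ)..(2 / posId (y 0) - 1), (1 + θ) ^ 3 * F ((1 + θ) • y)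

lemma rayI_smooth {F : St → ℝ} (hF : ContDiff ℝ ∞ F) : ContDiff ℝ ∞ (rayI F) := by
  refine smooth_param_primitive (G := fun q : St × ℝ => (1 + q.2) ^ 3 * F ((1 + q.2) • q.1))
    ?_ ((contDiff_const.div (posId_smooth.comp (coord_smooth 0))
      fun y => (posId_pos _).ne').sub contDiff_const)
  exact ContDiff.mul (by fun_prop) (hF.comp (by fun_prop))

lemma rayI_scale (F : St → ℝ) {y : St} {s : ℝ} (hs : 0 < s) (hy : 5 / 4 ≤ s * y 0) :
    rayI F (s • y) = -(s⁻¹ ^ 4 * ∫ μ in (2 / y 0)..s, μ ^ 3 * F (μ • y)) := by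
  have h0 : y 0 ≠ 0 := fun h => by rw [h] at hy; norm_num at hy
  have e1 : (s • y) 0 = s * y 0 := rfl
  have h := intervalIntegral.integral_comp_mul_add (a := 0) (b := 2 / (s * y 0) - 1)
    (fun μ => s⁻¹ ^ 3 * (μ ^ 3 * F (μ • y))) hs.ne' s
  rw [rayI, e1, posId_eq hy, intervalIntegral.integral_symm s]
  have e : ∀ θ : ℝ, s⁻¹ ^ 3 * ((s * θ + s) ^ 3 * F ((s * θ + s) • y)) =
      (1 + θ) ^ 3 * F ((1 + θ) • s • y) := fun θ => by
    rw [smul_smul, show s * θ + s = (1 + θ) * s by ring]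
    field_simp
  simp only [e] at h
  rw [h, intervalIntegral.integral_const_mul, mul_zero, zero_add,
    show s * (2 / (s * y 0) - 1) + s = 2 / y 0 by field_simp; ring]
  simp only [smul_eq_mul]
  ring

lemma Sc_rayI {F : St → ℝ} (hF : ContDiff ℝ ∞ F) {y : St} (hy : 5 / 4 < y 0) :
    Sc (rayI F) y + 4 * rayI F y = -F y := by
  have hc : Continuous fun μ : ℝ => μ ^ 3 * F (μ • y) := by
    have := hF.continuous
    fun_prop
  have h1 : HasDerivAt (fun s : ℝ => ∫ μ in (2 / y 0)..s, μ ^ 3 * F (μ • y))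
      (1 ^ 3 * F ((1:ℝ) • y)) 1 :=
    intervalIntegral.integral_hasDerivAt_right (hc.intervalIntegrable _ _)
      (hc.stronglyMeasurableAtFilter _ _) hc.continuousAt
  have h2 : HasDerivAt (fun s : ℝ => s⁻¹ ^ 4) (-4) 1 := by
    refine ((hasDerivAt_inv one_ne_zero).pow 4).congr_deriv ?_
    norm_num
  have h3 := (h2.mul h1).neg
  have ev : (fun s : ℝ => rayI F (s • y)) =ᶠ[nhds 1]
      fun s => -(s⁻¹ ^ 4 * ∫ μ in (2 / y 0)..s, μ ^ 3 * F (μ • y)) := by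
    have c : Continuous fun s : ℝ => s * y 0 := by fun_prop
    filter_upwards [lt_mem_nhds (show (0:ℝ) < 1 by norm_num),
      (c.tendsto 1).eventually (lt_mem_nhds (show 5 / 4 < 1 * y 0 by linarith))] with s hs hs2
    exact rayI_scale F hs hs2.le
  have h4 := h3.congr_of_eventuallyEq ev
  have h5 := fderiv_eq_of_line ((rayI_smooth hF).differentiable (by simp) y)
    (c := fun s : ℝ => s • y) (s := 1) (v := y) (by
      simpa using (hasDerivAt_id (1:ℝ)).smul_const y) (one_smul ℝ y) h4
  have h6 := rayI_scale F (y := y) one_pos (by linarith)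
  rw [one_smul] at h6
  rw [Sc_eq_fderiv, h5, h6]
  simp

/-- The solution of the transport equation vanishing at time `2`. -/
def trs (F : St → ℝ) (y : St) : ℝ := -smoothTransition (4 * y 0 - 5) * rayI F y

lemma trs_smooth {F : St → ℝ} (hF : ContDiff ℝ ∞ F) : ContDiff ℝ ∞ (trs F) := by
  refine ContDiff.mul (ContDiff.neg (smoothTransition.contDiff.comp ?_)) (rayI_smooth hF)
  exact (contDiff_const.mul (coord_smooth 0)).sub contDiff_const

lemma trs_eventually (F : St → ℝ) {y : St} (hy : 3 / 2 < y 0) :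
    trs F =ᶠ[nhds y] fun y => -1 * rayI F y := by
  have h : {y : St | 3 / 2 < y 0} ∈ nhds y :=
    (isOpen_lt continuous_const (continuous_apply 0)).mem_nhds hy
  filter_upwards [h] with z hz
  have hz' : 3 / 2 < z 0 := hz
  rw [trs, smoothTransition.one_of_one_le (by linarith)]

lemma Sc_trs {F : St → ℝ} (hF : ContDiff ℝ ∞ F) {y : St} (hy : 3 / 2 < y 0) :
    Sc (trs F) y + 4 * trs F y = F y := by
  have h := trs_eventually F hy
  have h2 : Sc (trs F) y = -Sc (rayI F) y := by
    rw [Sc_eq_fderiv, h.fderiv_eq, Sc_eq_fderiv,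
      fderiv_const_mul ((rayI_smooth hF).differentiable (by simp) y)]
    simp
  rw [h2, h.eq_of_nhds]
  linarith [Sc_rayI hF (show 5 / 4 < y 0 by linarith)]

lemma rad_smul {c : ℝ} (hc : 0 ≤ c) (x : Sp) : rad (c • x) = c * rad x := by
  rw [rad_eq_norm, rad_eq_norm, WithLp.toLp_smul, norm_smul, norm_eq_abs, abs_of_nonneg hc]

lemma Sm.trs {F : St → ℝ} (hF : Sm F) : Sm (trs F) := by
  refine ⟨trs_smooth hF.1, fun y hy => ?_⟩
  rcases le_or_gt (y 0) (5 / 4) with h | h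
  · rw [WKG.trs, smoothTransition.zero_of_nonpos (by linarith)]; simp
  have : rayI F y = 0 := by
    refine intervalIntegral.integral_zero_ae (Filter.Eventually.of_forall fun θ hθ => ?_)
    rw [posId_eq h.le] at hθ
    have ht : 0 < y 0 := by linarith
    have key : 0 < 1 + θ ∧ 1 + |(1 + θ) * y 0 - 2| ≤ (1 + θ) * (1 + |y 0 - 2|) := by
      rcases Set.mem_uIcc.1 (Set.uIoc_subset_uIcc hθ) with h' | h'
      · have h2 : (1 + θ) * y 0 ≤ 2 := by
          rw [← le_div_iff₀ ht]; linarith [h'.2]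
        have h3 : y 0 ≤ 2 := by nlinarith [h'.1]
        refine ⟨by linarith [h'.1], ?_⟩
        rw [abs_of_nonpos (by linarith), abs_of_nonpos (by linarith)]
        nlinarith [h'.1]
      · have h2 : 2 ≤ (1 + θ) * y 0 := by
          rw [← div_le_iff₀ ht]; linarith [h'.1]
        have h3 : 2 ≤ y 0 := by nlinarith [h'.2]
        refine ⟨by
          have : 0 < 2 / y 0 := by positivity
          linarith [h'.1], ?_⟩
        rw [abs_of_nonneg (by linarith), abs_of_nonneg (by linarith)]
        nlinarith [h'.2]
    rw [hF.2 ((1 + θ) • y) ?_, mul_zero]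
    have e : xs ((1 + θ) • y) = (1 + θ) • xs y := rfl
    rw [e, rad_smul key.1.le]
    exact key.2.trans_lt (mul_lt_mul_of_pos_left hy key.1)
  rw [WKG.trs, this, mul_zero]

lemma trs_base (F : St → ℝ) {y : St} (hy : y 0 = 2) : trs F y = 0 := by
  simp [trs, rayI, hy, posId_eq (show (5:ℝ) / 4 ≤ 2 by norm_num)]

theorem exists_transport {F : St → ℝ} (hF : Sm F) {g2 : Sp → ℝ} (h2 : Dt g2) :
    ∃ g : St → ℝ, Sm g ∧ (∀ y, 3 / 2 < y 0 → Sc g y + 4 * g y = F y) ∧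
      ∀ x, g (spt 2 x) = g2 x := by
  have hl := Sm.lift h2
  have hG : Sm fun y => F y - (Sc (lift g2) y + 4 * lift g2 y) := hF.sub (hl.Sc.add (hl.const_mul 4))
  refine ⟨fun y => lift g2 y + trs (fun y => F y - (Sc (lift g2) y + 4 * lift g2 y)) y,
    hl.add hG.trs, fun y hy => ?_, fun x => ?_⟩
  · rw [Sc_add hl.1 hG.trs.1]
    linarith [Sc_trs hG.1 hy]
  · simp [trs_base _ (show (spt 2 x) 0 = 2 from rfl), lift, xs_spt]

/-- The coefficients of the nonlinearities. -/
structure Par where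
  M1 : ℝ
  N1 : ℝ
  N2 : ℝ
  N3 : ℝ
  P : Fin 4 → ℝ

/-- The source of the equation for `u`. -/
def Fu (p : Par) (v : St → ℝ) (y : St) : ℝ :=
  p.M1 * v y ^ 3 + ∑ α, p.P α * pder α (fun z => v z ^ 2) y

/-- The source of the equation for `v`. -/
def Fv (p : Par) (u v : St → ℝ) (y : St) : ℝ :=
  p.N1 * pder 0 u y ^ 2 + p.N2 * u y ^ 3 + p.N3 * u y * v y

lemma Sm.Fu {v : St → ℝ} (hv : Sm v) (p : Par) : Sm (Fu p v) :=
  ((hv.pow (by norm_num)).const_mul _).add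
    (Sm.sum fun α => ((hv.pow two_ne_zero).pder α).const_mul _)

lemma Sm.Fv {u v : St → ℝ} (hu : Sm u) (hv : Sm v) (p : Par) : Sm (Fv p u v) :=
  ((((hu.pder 0).pow two_ne_zero).const_mul _).add ((hu.pow (by norm_num)).const_mul _)).add
    ((hu.const_mul _).mul hv)

lemma Sm.dt {f : St → ℝ} (hf : Sm f) : Dt fun x => f (spt 2 x) :=
  ⟨hf.1.comp (spt_smooth_right 2), fun x hx => hf.2 _ (by simpa [xs_spt, spt_zero] using hx)⟩

/-- Initial data for the pair `(u, v)`. -/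
structure Dat where
  u0 : Sp → ℝ
  v0 : Sp → ℝ
  u1 : Sp → ℝ
  v1 : Sp → ℝ
  hu0 : Dt u0
  hv0 : Dt v0
  hu1 : Dt u1
  hv1 : Dt v1

/-- One step of the iteration: `u' = ∑ ∂_α w^α` and `v'` solve the linear equations whose sources
are built from `u` and `v`. -/
structure StepRel (p : Par) (m : ℝ) (d : Dat) (u v u' v' g : St → ℝ) (w : Fin 4 → St → ℝ) :
    Prop where
  smu : Sm u'
  smv : Sm v'
  smg : Sm g
  smw : ∀ α, Sm (w α)
  eqg : ∀ y, 3 / 2 < y 0 → Sc g y + 4 * g y = p.M1 * v y ^ 3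
  g2 : ∀ x, g (spt 2 x) = (d.u1 x - p.P 0 * v (spt 2 x) ^ 2) / 2
  eqw : ∀ α, KG m (w α) = fun y => p.P α * v y ^ 2 + y α * g y
  w2 : ∀ α x, w α (spt 2 x) = 0
  dw2 : ∀ α x, pder 0 (w α) (spt 2 x) = if α = 0 then d.u0 x else 0
  equ' : u' = fun y => ∑ α, pder α (w α) y
  eqv : KG 1 v' = Fv p u v
  v2 : ∀ x, v' (spt 2 x) = d.v0 x
  dv2 : ∀ x, pder 0 v' (spt 2 x) = d.v1 x

lemma exists_step (p : Par) (m : ℝ) (d : Dat) {u v : St → ℝ} (hu : Sm u) (hv : Sm v) :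
    ∃ u' v' g w, StepRel p m d u v u' v' g w := by
  have h2 : Dt fun x => (d.u1 x - p.P 0 * v (spt 2 x) ^ 2) / 2 :=
    ⟨(d.hu1.1.sub (contDiff_const.mul (hv.dt.1.pow 2))).div_const _, fun x hx => by
      simp [d.hu1.2 x hx, hv.dt.2 x hx]⟩
  obtain ⟨g, hg, hg1, hg2⟩ := exists_transport ((hv.pow (n := 3) (by norm_num)).const_mul p.M1) h2
  have hz : Dt fun _ => 0 := ⟨contDiff_const, fun _ _ => rfl⟩
  have hd (α : Fin 4) : Dt fun x => if α = 0 then d.u0 x else 0 := by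
    by_cases h : α = 0
    · simpa [h] using d.hu0
    · simpa [h] using hz
  have hG (α : Fin 4) : Sm fun y => p.P α * v y ^ 2 + y α * g y :=
    ((hv.pow two_ne_zero).const_mul _).add (hg.smul (coord_smooth α))
  choose w hw1 hw2 hw3 hw4 using fun α => exists_solution m (hG α) hz (hd α)
  obtain ⟨v', hv1, hv2, hv3, hv4⟩ := exists_solution 1 (hu.Fv hv p) d.hv0 d.hv1
  exact ⟨fun y => ∑ α, pder α (w α) y, v', g, w, Sm.sum fun α => (hw1 α).pder α, hv1, hg, hw1, hg1,
    hg2, hw2, hw3, hw4, rfl, hv2, hv3, hv4⟩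

lemma pder_succ_slice {f : St → ℝ} (hf : ContDiff ℝ ∞ f) {c : Sp → ℝ} {t : ℝ}
    (h : ∀ x, f (spt t x) = c x) (a : Fin 3) (x : Sp) : pder a.succ f (spt t x) = pderx a c x := by
  rw [← hasFDerivAt_spt_right (hf.differentiable (by simp)), funext h]

lemma pder_succ_slice_zero {f : St → ℝ} (hf : ContDiff ℝ ∞ f) {t : ℝ}
    (h : ∀ x, f (spt t x) = 0) (a : Fin 3) (x : Sp) : pder a.succ f (spt t x) = 0 := by
  rw [pder_succ_slice hf h]
  simp [pderx]

lemma KG_eq_zero_zero (m : ℝ) (f : St → ℝ) (y : St) : pder 0 (pder 0 f) y =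
    KG m f y + ∑ a : Fin 3, pder a.succ (pder a.succ f) y - m ^ 2 * f y := by
  simp only [KG, Box]; ring

lemma KG_sum (m : ℝ) {n : ℕ} {f : Fin n → St → ℝ} (hf : ∀ i, ContDiff ℝ ∞ (f i)) :
    KG m (fun y => ∑ i, f i y) = fun y => ∑ i, KG m (f i) y := by
  induction n with
  | zero =>
    have := KG_const_mul m 0 (contDiff_const (c := (0 : ℝ)) : ContDiff ℝ ∞ fun _ : St => (0 : ℝ))
    simpa using this
  | succ n ih =>
    simp only [Fin.sum_univ_succ]
    rw [KG_add m (hf 0) (ContDiff.sum fun i _ => hf i.succ), ih fun i => hf i.succ]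

namespace StepRel
variable {p : Par} {m : ℝ} {d : Dat} {u v u' v' g : St → ℝ} {w : Fin 4 → St → ℝ}

lemma equ (h : StepRel p m d u v u' v' g w) (hv : Sm v) {y : St} (hy : 3 / 2 < y 0) :
    KG m u' y = Fu p v y := by
  rw [h.equ', KG_sum m fun α => ((h.smw α).pder α).1]
  have e (α : Fin 4) : KG m (pder α (w α)) y =
      p.P α * pder α (fun z => v z ^ 2) y + (g y + y α * pder α g y) := by
    have hc : ContDiff ℝ ∞ fun y : St => y α * g y := (coord_smooth α).mul h.smg.1
    rw [← pder_KG (h.smw α).1, h.eqw α, pder_add (contDiff_const.mul (hv.1.pow 2)) hc,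
      pder_const_mul _ (hv.1.pow 2), pder_mul (coord_smooth α) h.smg.1, pder_coord]
    simp
  simp only [e, Finset.sum_add_distrib, Fu, ← h.eqg y hy, Sc]
  simp
  ring

lemma u2 (h : StepRel p m d u v u' v' g w) (x : Sp) : u' (spt 2 x) = d.u0 x := by
  rw [h.equ']
  simp only [Fin.sum_univ_succ (n := 3), h.dw2]
  simp [pder_succ_slice_zero (h.smw _).1 (h.w2 _)]

lemma du2 (h : StepRel p m d u v u' v' g w) (x : Sp) : pder 0 u' (spt 2 x) = d.u1 x := by
  rw [h.equ', pder_sum fun α => ((h.smw α).pder α).1]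
  simp only [Fin.sum_univ_succ (n := 3)]
  have e (a : Fin 3) : pder 0 (pder a.succ (w a.succ)) (spt 2 x) = 0 := by
    rw [pder_comm (h.smw _).1]
    refine pder_succ_slice_zero ((h.smw _).pder 0).1 (fun x => ?_) a x
    simp [h.dw2]
  have e2 (a : Fin 3) : pder a.succ (pder a.succ (w 0)) (spt 2 x) = 0 :=
    pder_succ_slice_zero ((h.smw _).pder _).1
      (fun x => pder_succ_slice_zero (h.smw _).1 (h.w2 _) a x) a x
  simp only [e, KG_eq_zero_zero m (w 0), e2, h.eqw, h.w2, h.g2, spt_zero]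
  simp
  ring

end StepRel

lemma jet_dx_le_pd (k : ℕ) (f : St → ℝ) (y : St) : jet dx k f y ≤ jet pd k f y :=
  jsum_subfamily (e := Fin.succ) (Fin.succ_injective 3) (fun _ => rfl)
    (A := fun g => g y ^ 2) (fun _ => sq_nonneg _) k f

lemma jet_pder_succ_le (k : ℕ) (f : St → ℝ) (y : St) (a : Fin 3) :
    jet dx k (pder a.succ f) y ≤ jet dx (k + 1) f y := jet_vf_le (X := dx) k f y a

lemma jet_pd_pder_le (k : ℕ) (f : St → ℝ) (y : St) (α : Fin 4) :
    jet pd k (pder α f) y ≤ jet pd (k + 1) f y := jet_vf_le (X := pd) k f y α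

/-- The jet of order `k - 1` along all coordinate fields, zero when `k = 0`. -/
def jetPred : ℕ → (St → ℝ) → St → ℝ
  | 0, _, _ => 0
  | k + 1, f, y => jet pd k f y

lemma jetPred_pder_le (k : ℕ) (f : St → ℝ) (y : St) (α : Fin 4) :
    jetPred k (pder α f) y ≤ jet pd k f y := by
  cases k with
  | zero => exact jet_nonneg 0 f y
  | succ k => exact jet_pd_pder_le k f y α

lemma jet_zero_zero_le (k : ℕ) {m : ℝ} (hm : m ∈ Set.Icc (0 : ℝ) 1) {f : St → ℝ}
    (hf : ContDiff ℝ ∞ f) (y : St) : jet dx k (pder 0 (pder 0 f)) y ≤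
      40 * (jet dx (k + 2) f y + jet dx k (KG m f) y) := by
  have e : pder 0 (pder 0 f) = fun y =>
      (KG m f y + ∑ a : Fin 3, pder a.succ (pder a.succ f) y) + -m ^ 2 * f y := by
    funext y
    rw [KG_eq_zero_zero m]; ring
  have h2 (a : Fin 3) : ContDiff ℝ ∞ (pder a.succ (pder a.succ f)) :=
    pder_smooth (pder_smooth hf _) _
  have hs : ContDiff ℝ ∞ fun y => ∑ a : Fin 3, pder a.succ (pder a.succ f) y :=
    ContDiff.sum fun a _ => h2 a
  have i1 := jet_add_le (X := dx) dx_smooth k ((KG_smooth hf m).add hs)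
    (contDiff_const (c := -m ^ 2) |>.mul hf) y
  have i2 := jet_add_le (X := dx) dx_smooth k (KG_smooth hf m) hs y
  have i3 := jet_sum_le (X := dx) dx_smooth k h2 y
  have i4 : ∑ a : Fin 3, jet dx k (pder a.succ (pder a.succ f)) y ≤ 3 * jet dx (k + 2) f y := by
    refine (Finset.sum_le_card_nsmul _ _ (jet dx (k + 2) f y) fun a _ =>
      (jet_pder_succ_le k _ y a).trans (jet_pder_succ_le (k + 1) _ y a)).trans (by simp)
  have i5 := jet_const_mul (X := dx) dx_smooth (-m ^ 2) k hf y
  have i6 : (-m ^ 2) ^ 2 * jet dx k f y ≤ 1 * jet dx (k + 2) f y := by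
    refine mul_le_mul ?_ (jet_mono (by omega) f y) (jet_nonneg _ _ _) zero_le_one
    have : m ^ 2 ≤ 1 := pow_le_one₀ hm.1 hm.2
    nlinarith [sq_nonneg m]
  rw [e]
  push_cast at i3
  have := jet_nonneg (X := dx) (k + 2) f y
  have := jet_nonneg (X := dx) k (KG m f) y
  linarith

/-- All derivatives of a function are controlled by its spatial ones, those of its first time
derivative, and the derivatives of its image under the Klein-Gordon operator. -/
lemma jet_pd_le (k : ℕ) : ∃ C : ℝ, 0 ≤ C ∧ ∀ m ∈ Set.Icc (0 : ℝ) 1, ∀ f : St → ℝ,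
    ContDiff ℝ ∞ f → ∀ y, jet pd (k + 1) f y ≤
      C * (jet dx (k + 1) f y + jet dx k (pder 0 f) y + jetPred k (KG m f) y) := by
  induction k with
  | zero =>
    refine ⟨1, zero_le_one, fun m hm f hf y => ?_⟩
    simp only [jet_succ, jet_zero, Fin.sum_univ_succ (n := 3), jetPred]
    refine le_of_eq ?_
    simp only [vf_pd, dx]
    ring
  | succ k ih =>
    obtain ⟨C, hC, ih⟩ := ih
    refine ⟨1 + 3 * C + 42 * C, by positivity, fun m hm f hf y => ?_⟩
    set A := jet dx (k + 2) f y + jet dx (k + 1) (pder 0 f) y + jet pd k (KG m f) y with hA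
    have p1 := jet_nonneg (X := dx) (k + 2) f y
    have p2 := jet_nonneg (X := dx) (k + 1) (pder 0 f) y
    have p3 := jet_nonneg (X := pd) k (KG m f) y
    have hs (a : Fin 3) : jet pd (k + 1) (pder a.succ f) y ≤ C * A := by
      refine (ih m hm _ (pder_smooth hf _) y).trans (mul_le_mul_of_nonneg_left ?_ hC)
      refine add_le_add (add_le_add (jet_pder_succ_le _ _ _ _) ?_) ?_
      · rw [pder_comm hf]
        exact jet_pder_succ_le _ _ _ _
      · rw [← pder_KG hf]
        exact jetPred_pder_le _ _ _ _
    have h0 : jet pd (k + 1) (pder 0 f) y ≤ C * (42 * A) := by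
      refine (ih m hm _ (pder_smooth hf _) y).trans (mul_le_mul_of_nonneg_left ?_ hC)
      have q1 := jet_zero_zero_le k hm hf y
      have q2 := jet_dx_le_pd k (KG m f) y
      have q3 := jetPred_pder_le k (KG m f) y 0
      rw [pder_KG hf] at q3
      linarith
    have h1 := sq_le_jet (X := dx) (k + 2) f y
    have h2 : ∑ a : Fin 3, jet pd (k + 1) (pder a.succ f) y ≤ 3 * (C * A) :=
      (Finset.sum_le_card_nsmul _ _ _ fun a _ => hs a).trans (by simp)
    rw [jet_succ, Fin.sum_univ_succ]
    change f y ^ 2 + (jet pd (k + 1) (pder 0 f) y + ∑ a : Fin 3, jet pd (k + 1) (pder a.succ f) y)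
      ≤ (1 + 3 * C + 42 * C) * A
    linarith

/-- On bounded sets the derivatives along translations and boosts are controlled by the coordinate
derivatives. -/
lemma jet_Zf_le (k : ℕ) : ∃ C : ℝ, 0 ≤ C ∧ ∀ f : St → ℝ, ContDiff ℝ ∞ f → ∀ y,
    jet Zf k f y ≤ C * (1 + ∑ β, y β ^ 2) ^ k * jet pd k f y := by
  induction k with
  | zero => exact ⟨1, zero_le_one, fun f hf y => by simp [jet_zero]⟩
  | succ k ih =>
    obtain ⟨C, hC, ih⟩ := ih
    refine ⟨1 + 4 * C + 3 * (4 * (5 ^ k * (k + 1) * 8 ^ k * C)), by positivity, fun f hf y => ?_⟩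
    set R := 1 + ∑ β, y β ^ 2 with hR
    have hR1 : 1 ≤ R := le_add_of_nonneg_right (Finset.sum_nonneg fun _ _ => sq_nonneg _)
    have hRk : R ^ k ≤ R ^ (k + 1) := pow_le_pow_right₀ hR1 (Nat.le_succ k)
    have hRk1 : 1 ≤ R ^ (k + 1) := one_le_pow₀ hR1
    have hJ := jet_nonneg (X := pd) (k + 1) f y
    have h1 (α : Fin 4) : jet Zf k (pder α f) y ≤ C * R ^ k * jet pd (k + 1) f y :=
      (ih _ (pder_smooth hf α) y).trans
        (mul_le_mul_of_nonneg_left (jet_pd_pder_le _ _ _ _) (by positivity))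
    have h2 (α β : Fin 4) : jet Zf k (fun y => y α * pder β f y) y ≤
        5 ^ k * (k + 1) * 8 ^ k * C * R ^ (k + 1) * jet pd (k + 1) f y := by
      refine (jet_mul_le Zf_smooth k (coord_smooth α) (pder_smooth hf β) y).trans ?_
      calc _ ≤ 5 ^ k * (k + 1 : ℝ) * ((8 ^ k * R) * (C * R ^ k * jet pd (k + 1) f y)) := by
            refine mul_le_mul_of_nonneg_left ?_ (by positivity)
            exact mul_le_mul (jet_coord_le k α y) (h1 β) (jet_nonneg _ _ _) (by positivity)
        _ = _ := by ring
    have h3 (a : Fin 3) : jet Zf k (Lb a f) y ≤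
        4 * (5 ^ k * (k + 1) * 8 ^ k * C * R ^ (k + 1) * jet pd (k + 1) f y) := by
      refine (jet_add_le Zf_smooth k ((coord_smooth a.succ).mul (pder_smooth hf 0))
        ((coord_smooth 0).mul (pder_smooth hf a.succ)) y).trans ?_
      have := h2 a.succ 0
      have := h2 0 a.succ
      linarith
    have s1 := Finset.sum_le_card_nsmul Finset.univ _ _ fun (α : Fin 4) _ => h1 α
    have s2 := Finset.sum_le_card_nsmul Finset.univ _ _ fun (α : Fin 3) _ => h3 α
    have s0 : f y ^ 2 ≤ R ^ (k + 1) * jet pd (k + 1) f y :=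
      (sq_le_jet (X := pd) (k + 1) f y).trans (le_mul_of_one_le_left hJ hRk1)
    have s3 : C * R ^ k * jet pd (k + 1) f y ≤ C * R ^ (k + 1) * jet pd (k + 1) f y := by gcongr
    rw [jet_succ, Fintype.sum_sum_type]
    change f y ^ 2 + (∑ α, jet Zf k (pder α f) y + ∑ a, jet Zf k (vf (bo a) f) y) ≤ _
    simp only [vf_bo]
    simp only [Finset.card_univ, Fintype.card_fin, nsmul_eq_mul] at s1 s2
    push_cast at s1 s2
    linarith

/-- Sobolev embedding for spatial jets on flat slices. -/
lemma sup_flat_jet (k : ℕ) {f : St → ℝ} (hf : Sm f) (y : St) :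
    jet dx k f y ≤ 216 * (k + 1) * ∫ x, jet dx (k + 3) f (spt (y 0) x) := by
  have h1 : jet dx k f y ≤ jsum dx k (fun g => 216 * ∫ x, jet dx 3 g (spt (y 0) x)) f :=
    jsum_le_jsum (stable_Sm dx_smooth) (fun g hg => sup_flat hg y) k hf
  rw [jsum_const_mul] at h1
  have h2 := jsum_congr (stable_Sm dx_smooth) (fun g hg => integral_jet_flat hg 3 (y 0)) k hf
  rw [h2] at h1
  have h3 := jsum_jsum_le (X := dx) (A := fun g => ∫ x, g (spt (y 0) x) ^ 2)
    (fun g => integral_nonneg fun x => sq_nonneg _) k 3 f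
  rw [integral_jet_flat hf]
  nlinarith

lemma sup_QE (k : ℕ) {f : St → ℝ} (hf : Sm f) (y : St) :
    jet dx k f y + ∑ α, jet dx k (pder α f) y ≤ 216 * (k + 1) * QE (k + 3) (y 0) f := by
  rw [QE_eq hf, mul_add, Finset.mul_sum]
  exact add_le_add (sup_flat_jet k hf y)
    (Finset.sum_le_sum fun α _ => sup_flat_jet k (hf.pder α) y)

/-- The jets of `f` and of its first derivatives. -/
def J1 {ι : Type} [Fintype ι] (X : ι → St → St) (k : ℕ) (f : St → ℝ) (y : St) : ℝ :=
  jet X k f y + ∑ α, jet X k (pder α f) y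

lemma J1_nonneg {ι : Type} [Fintype ι] (X : ι → St → St) (k : ℕ) (f : St → ℝ) (y : St) :
    0 ≤ J1 X k f y :=
  add_nonneg (jet_nonneg _ _ _) (Finset.sum_nonneg fun _ _ => jet_nonneg _ _ _)

lemma jet_le_J1 {ι : Type} [Fintype ι] (X : ι → St → St) (k : ℕ) (f : St → ℝ) (y : St) :
    jet X k f y ≤ J1 X k f y :=
  le_add_of_nonneg_right (Finset.sum_nonneg fun _ _ => jet_nonneg _ _ _)

lemma jet_pder_le_J1 {ι : Type} [Fintype ι] (X : ι → St → St) (k : ℕ) (f : St → ℝ) (y : St)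
    (α : Fin 4) : jet X k (pder α f) y ≤ J1 X k f y :=
  le_add_of_nonneg_of_le (jet_nonneg _ _ _)
    (Finset.single_le_sum (f := fun α => jet X k (pder α f) y) (fun _ _ => jet_nonneg _ _ _)
      (Finset.mem_univ α))

lemma QE_eq_J1 {f : St → ℝ} (hf : Sm f) (k : ℕ) (t : ℝ) :
    QE k t f = ∫ x, J1 dx k f (spt t x) := by
  simp only [J1]
  rw [QE_eq hf, integral_add, integral_finsetSum]
  · exact fun α _ => ((hf.pder α).jet dx_smooth k).flat_integrable t
  · exact (hf.jet dx_smooth k).flat_integrable t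
  · exact integrable_finsetSum _ fun α _ => ((hf.pder α).jet dx_smooth k).flat_integrable t

lemma J1_pd_le (k : ℕ) (f : St → ℝ) (y : St) : J1 pd k f y ≤ 5 * jet pd (k + 1) f y := by
  have := Finset.sum_le_card_nsmul Finset.univ _ _ fun (α : Fin 4) _ => jet_pd_pder_le k f y α
  have h := jet_mono (X := pd) (Nat.le_succ k) f y
  simp only [Finset.card_univ, Fintype.card_fin, nsmul_eq_mul] at this
  push_cast at this
  simp only [J1]
  linarith

section Sources
variable {ι : Type} [Fintype ι] {X : ι → St → St}

lemma jet_cube_tame (hX : ∀ i, ContDiff ℝ ∞ (X i)) (k : ℕ) : ∃ C : ℝ, 0 ≤ C ∧ ∀ f : St → ℝ,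
    ContDiff ℝ ∞ f → ∀ y, jet X k (fun y => f y ^ 3) y ≤
      C * (jet X (k / 2) f y ^ 2 * jet X k f y) := by
  refine ⟨5 ^ k * (k + 1) * (2 * (5 ^ k * (k + 1)) + 5 ^ (k / 2) * ((k / 2 : ℕ) + 1)), by positivity,
    fun f hf y => ?_⟩
  have e : (fun y => f y ^ 3) = fun y => f y * (f y * f y) := by funext y; ring
  rw [e]
  refine (jet_mul_tame hX k hf (hf.mul hf) y).trans ?_
  have h1 := mul_le_mul_of_nonneg_left (jet_mul_tame hX k hf hf y) (jet_nonneg (X := X) (k / 2) f y)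
  have h2 := mul_le_mul_of_nonneg_left (jet_mul_le hX (k / 2) hf hf y) (jet_nonneg (X := X) k f y)
  refine (mul_le_mul_of_nonneg_left (add_le_add h1 h2) (by positivity)).trans (le_of_eq ?_)
  ring

lemma Fu_eq (p : Par) {v : St → ℝ} (hv : ContDiff ℝ ∞ v) : Fu p v = fun y =>
    p.M1 * v y ^ 3 + ∑ α, 2 * p.P α * (v y * pder α v y) := by
  funext y
  simp only [Fu, pder_sq hv]
  congr 1
  refine Finset.sum_congr rfl fun α _ => by ring

lemma jet_Fu_le (hX : ∀ i, ContDiff ℝ ∞ (X i)) (p : Par) (k : ℕ) : ∃ C : ℝ, 0 ≤ C ∧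
    ∀ v : St → ℝ, ContDiff ℝ ∞ v → ∀ y, jet X k (Fu p v) y ≤
      C * (jet X (k / 2) v y ^ 2 * jet X k v y + ∑ α, (jet X (k / 2) v y * jet X k (pder α v) y +
        jet X k v y * jet X (k / 2) (pder α v) y)) := by
  obtain ⟨C, hC, h3⟩ := jet_cube_tame hX k
  refine ⟨2 * p.M1 ^ 2 * C + ∑ α, 8 * (2 * p.P α) ^ 2 * (5 ^ k * (k + 1)), by positivity,
    fun v hv y => ?_⟩
  have hα (α : Fin 4) : ContDiff ℝ ∞ fun y => 2 * p.P α * (v y * pder α v y) :=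
    contDiff_const.mul (hv.mul (pder_smooth hv α))
  rw [Fu_eq p hv]
  refine (jet_add_le hX k (contDiff_const.mul (hv.pow 3)) (ContDiff.sum fun α _ => hα α) y).trans ?_
  have i1 := jet_sum_le hX k hα y
  have i2 (α : Fin 4) : jet X k (fun y => 2 * p.P α * (v y * pder α v y)) y ≤
      (2 * p.P α) ^ 2 * (5 ^ k * (k + 1) * (jet X (k / 2) v y * jet X k (pder α v) y +
        jet X k v y * jet X (k / 2) (pder α v) y)) := by
    rw [jet_const_mul hX _ k (hv.mul (pder_smooth hv α))]
    exact mul_le_mul_of_nonneg_left (jet_mul_tame hX k hv (pder_smooth hv α) y) (sq_nonneg _)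
  rw [jet_const_mul hX _ k (hv.pow 3)]
  have i3 := mul_le_mul_of_nonneg_left (h3 v hv y) (sq_nonneg p.M1)
  set S : Fin 4 → ℝ := fun α => jet X (k / 2) v y * jet X k (pder α v) y +
        jet X k v y * jet X (k / 2) (pder α v) y with hS
  have hSn (α : Fin 4) : 0 ≤ S α := add_nonneg (mul_nonneg (jet_nonneg _ _ _) (jet_nonneg _ _ _))
    (mul_nonneg (jet_nonneg _ _ _) (jet_nonneg _ _ _))
  set Q := jet X (k / 2) v y ^ 2 * jet X k v y with hQ
  have hQn : 0 ≤ Q := mul_nonneg (sq_nonneg _) (jet_nonneg _ _ _)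
  have i4 : ∑ α, jet X k (fun y => 2 * p.P α * (v y * pder α v y)) y ≤
      ∑ α, (2 * p.P α) ^ 2 * (5 ^ k * (k + 1)) * (Q + ∑ β, S β) := by
    refine Finset.sum_le_sum fun α _ => (i2 α).trans ?_
    rw [← mul_assoc]
    refine mul_le_mul_of_nonneg_left (le_add_of_nonneg_of_le hQn ?_) (by positivity)
    exact Finset.single_le_sum (f := S) (fun _ _ => hSn _) (Finset.mem_univ α)
  rw [← Finset.sum_mul] at i4
  have e : ∑ α, 8 * (2 * p.P α) ^ 2 * (5 ^ k * (k + 1 : ℝ)) =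
      8 * ∑ α, (2 * p.P α) ^ 2 * (5 ^ k * (k + 1 : ℝ)) := by
    rw [Finset.mul_sum]; exact Finset.sum_congr rfl fun _ _ => by ring
  have hSs : 0 ≤ ∑ β, S β := Finset.sum_nonneg fun _ _ => hSn _
  have : 0 ≤ 2 * p.M1 ^ 2 * C * ∑ β, S β := by positivity
  push_cast at i1
  rw [e]
  nlinarith

lemma jet_Fv_le (hX : ∀ i, ContDiff ℝ ∞ (X i)) (p : Par) (k : ℕ) : ∃ C : ℝ, 0 ≤ C ∧
    ∀ u v : St → ℝ, ContDiff ℝ ∞ u → ContDiff ℝ ∞ v → ∀ y, jet X k (Fv p u v) y ≤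
      C * (jet X (k / 2) (pder 0 u) y * jet X k (pder 0 u) y + jet X (k / 2) u y ^ 2 * jet X k u y +
        (jet X (k / 2) u y * jet X k v y + jet X k u y * jet X (k / 2) v y)) := by
  obtain ⟨C, hC, h3⟩ := jet_cube_tame hX k
  refine ⟨4 * p.N1 ^ 2 * (2 * (5 ^ k * (k + 1))) + 4 * p.N2 ^ 2 * C +
    2 * p.N3 ^ 2 * (5 ^ k * (k + 1)), by positivity, fun u v hu hv y => ?_⟩
  have hd := pder_smooth hu 0
  have e : Fv p u v = fun y => (p.N1 * (pder 0 u y * pder 0 u y) + p.N2 * u y ^ 3) +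
      p.N3 * (u y * v y) := by
    funext y; simp only [Fv]; ring
  rw [e]
  refine (jet_add_le hX k ((contDiff_const.mul (hd.mul hd)).add (contDiff_const.mul (hu.pow 3)))
    (contDiff_const.mul (hu.mul hv)) y).trans ?_
  have i0 := jet_add_le hX k (contDiff_const (c := p.N1).mul (hd.mul hd))
    (contDiff_const (c := p.N2).mul (hu.pow 3)) y
  rw [jet_const_mul hX _ k (hd.mul hd), jet_const_mul hX _ k (hu.pow 3)] at i0
  rw [jet_const_mul hX _ k (hu.mul hv)]
  have i1 := mul_le_mul_of_nonneg_left (jet_mul_tame hX k hd hd y) (sq_nonneg p.N1)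
  have i2 := mul_le_mul_of_nonneg_left (h3 u hu y) (sq_nonneg p.N2)
  have i3 := mul_le_mul_of_nonneg_left (jet_mul_tame hX k hu hv y) (sq_nonneg p.N3)
  have n1 := jet_nonneg (X := X) (k / 2) (pder 0 u) y
  have n2 := jet_nonneg (X := X) k (pder 0 u) y
  have n3 := jet_nonneg (X := X) (k / 2) u y
  have n4 := jet_nonneg (X := X) k u y
  have n5 := jet_nonneg (X := X) (k / 2) v y
  have n6 := jet_nonneg (X := X) k v y
  have a1 := mul_nonneg n1 n2
  have a2 := mul_nonneg (sq_nonneg (jet X (k / 2) u y)) n4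
  have a3 := add_nonneg (mul_nonneg n3 n6) (mul_nonneg n4 n5)
  set A1 := jet X (k / 2) (pder 0 u) y * jet X k (pder 0 u) y with hA1
  set A2 := jet X (k / 2) u y ^ 2 * jet X k u y with hA2
  set A3 := jet X (k / 2) u y * jet X k v y + jet X k u y * jet X (k / 2) v y with hA3
  have b1 : jet X k (pder 0 u) y * jet X (k / 2) (pder 0 u) y = A1 := mul_comm _ _
  rw [b1] at i1
  set c1 : ℝ := 5 ^ k * (k + 1) with hc1
  have hc : 0 ≤ c1 := by positivity
  have k1 : 0 ≤ 4 * p.N1 ^ 2 * (2 * c1) * (A2 + A3) := by positivity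
  have k2 : 0 ≤ 4 * p.N2 ^ 2 * C * (A1 + A3) := by positivity
  have k3 : 0 ≤ 2 * p.N3 ^ 2 * c1 * (A1 + A2) := by positivity
  linarith

/-- The tame estimate of both sources. -/
lemma jet_source_tame (hX : ∀ i, ContDiff ℝ ∞ (X i)) (p : Par) (k : ℕ) : ∃ C : ℝ, 0 ≤ C ∧
    ∀ u v : St → ℝ, ContDiff ℝ ∞ u → ContDiff ℝ ∞ v → ∀ y,
      jet X k (Fu p v) y + jet X k (Fv p u v) y ≤
        C * ((J1 X (k / 2) u y + J1 X (k / 2) v y) + (J1 X (k / 2) u y + J1 X (k / 2) v y) ^ 2) *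
          (J1 X k u y + J1 X k v y) := by
  obtain ⟨C, hC, h1⟩ := jet_Fu_le hX p k
  obtain ⟨D, hD, h2⟩ := jet_Fv_le hX p k
  refine ⟨8 * C + 3 * D, by positivity, fun u v hu hv y => ?_⟩
  refine (add_le_add (h1 v hv y) (h2 u v hu hv y)).trans ?_
  have n3 := J1_nonneg X (k / 2) u y
  have n4 := J1_nonneg X k u y
  have n5 := J1_nonneg X (k / 2) v y
  have n6 := J1_nonneg X k v y
  set s := J1 X (k / 2) u y + J1 X (k / 2) v y with hs
  set S := J1 X k u y + J1 X k v y with hS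
  have e1 : jet X (k / 2) v y ≤ s := (jet_le_J1 _ _ _ _).trans (by linarith)
  have e2 : jet X k v y ≤ S := (jet_le_J1 _ _ _ _).trans (by linarith)
  have e3 : jet X (k / 2) u y ≤ s := (jet_le_J1 _ _ _ _).trans (by linarith)
  have e4 : jet X k u y ≤ S := (jet_le_J1 _ _ _ _).trans (by linarith)
  have e5 (α) : jet X (k / 2) (pder α v) y ≤ s := (jet_pder_le_J1 _ _ _ _ _).trans (by linarith)
  have e6 (α) : jet X k (pder α v) y ≤ S := (jet_pder_le_J1 _ _ _ _ _).trans (by linarith)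
  have e7 (α) : jet X (k / 2) (pder α u) y ≤ s := (jet_pder_le_J1 _ _ _ _ _).trans (by linarith)
  have e8 (α) : jet X k (pder α u) y ≤ S := (jet_pder_le_J1 _ _ _ _ _).trans (by linarith)
  have hs0 : 0 ≤ s := add_nonneg n3 n5
  have hS0 : 0 ≤ S := add_nonneg n4 n6
  have mm {a b : ℝ} (ha : a ≤ s) (hb : b ≤ S) (h0 : 0 ≤ b) : a * b ≤ s * S :=
    mul_le_mul ha hb h0 hs0
  have m1 := mm e1 e2 (jet_nonneg _ _ _)
  have q1 : jet X (k / 2) v y ^ 2 * jet X k v y ≤ s ^ 2 * S :=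
    mul_le_mul (pow_le_pow_left₀ (jet_nonneg _ _ _) e1 2) e2 (jet_nonneg _ _ _) (sq_nonneg _)
  have q2 : jet X (k / 2) u y ^ 2 * jet X k u y ≤ s ^ 2 * S :=
    mul_le_mul (pow_le_pow_left₀ (jet_nonneg _ _ _) e3 2) e4 (jet_nonneg _ _ _) (sq_nonneg _)
  have q3 : ∑ α, (jet X (k / 2) v y * jet X k (pder α v) y +
      jet X k v y * jet X (k / 2) (pder α v) y) ≤ 4 * (2 * (s * S)) := by
    refine (Finset.sum_le_card_nsmul _ _ (2 * (s * S)) fun α _ => ?_).trans (by simp)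
    have := mm e1 (e6 α) (jet_nonneg _ _ _)
    have := mm (e5 α) e2 (jet_nonneg _ _ _)
    linarith
  have q4 := mm (e7 0) (e8 0) (jet_nonneg _ _ _)
  have q5 := mm e3 e2 (jet_nonneg _ _ _)
  have q6 := mm e1 e4 (jet_nonneg _ _ _)
  have z1 : 0 ≤ s * S := mul_nonneg hs0 hS0
  have z2 : 0 ≤ s ^ 2 * S := mul_nonneg (sq_nonneg _) hS0
  have r1 := mul_le_mul_of_nonneg_left (add_le_add q1 q3) hC
  have r2 := mul_le_mul_of_nonneg_left (add_le_add (add_le_add q4 q2) (add_le_add q5 q6)) hD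
  have w1 := mul_nonneg hC z1
  have w2 := mul_nonneg hC z2
  have w3 := mul_nonneg hD z1
  have w4 := mul_nonneg hD z2
  rw [mul_comm (jet X (k / 2) v y) (jet X k u y)] at r2
  nlinarith

end Sources

section Diff
variable {ι : Type} [Fintype ι] {X : ι → St → St}

lemma jet_quad_le (hX : ∀ i, ContDiff ℝ ∞ (X i)) (k : ℕ) {f g : St → ℝ} (hf : ContDiff ℝ ∞ f)
    (hg : ContDiff ℝ ∞ g) {y : St} {S : ℝ} (h1 : jet X k f y ≤ S) (h2 : jet X k g y ≤ S) :
    jet X k (fun y => f y * f y + (f y * g y + g y * g y)) y ≤ 10 * (5 ^ k * (k + 1) * S ^ 2) := by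
  have hm {a b : St → ℝ} (ha : ContDiff ℝ ∞ a) (hb : ContDiff ℝ ∞ b) (h1 : jet X k a y ≤ S)
      (h2 : jet X k b y ≤ S) : jet X k (fun y => a y * b y) y ≤ 5 ^ k * (k + 1) * S ^ 2 := by
    refine (jet_mul_le hX k ha hb y).trans (mul_le_mul_of_nonneg_left ?_ (by positivity))
    rw [sq]
    exact mul_le_mul h1 h2 (jet_nonneg _ _ _) ((jet_nonneg _ _ _).trans h1)
  have a1 := jet_add_le hX k (hf.mul hf) ((hf.mul hg).add (hg.mul hg)) y
  have a2 := jet_add_le hX k (hf.mul hg) (hg.mul hg) y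
  have := hm hf hf h1 h1
  have := hm hf hg h1 h2
  have := hm hg hg h2 h2
  linarith

/-- Lipschitz estimate for the sources. -/
lemma jet_source_diff (hX : ∀ i, ContDiff ℝ ∞ (X i)) (p : Par) (k : ℕ) : ∃ C : ℝ, 0 ≤ C ∧
    ∀ u v a b : St → ℝ, ContDiff ℝ ∞ u → ContDiff ℝ ∞ v → ContDiff ℝ ∞ a → ContDiff ℝ ∞ b →
      ∀ (y : St) (S : ℝ), J1 X k u y ≤ S → J1 X k v y ≤ S → J1 X k a y ≤ S → J1 X k b y ≤ S →
      jet X k (fun y => Fu p v y - Fu p b y) y + jet X k (fun y => Fv p u v y - Fv p a b y) y ≤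
        C * (S + S ^ 2) * (J1 X k (fun y => u y - a y) y + J1 X k (fun y => v y - b y) y) := by
  set c : ℝ := 5 ^ k * (k + 1) with hc
  have hc0 : 0 ≤ c := by positivity
  set Ps : ℝ := ∑ α, (2 * p.P α) ^ 2 with hPs
  have hPs0 : 0 ≤ Ps := Finset.sum_nonneg fun _ _ => sq_nonneg _
  refine ⟨2 * p.M1 ^ 2 * (c * (10 * c)) + 32 * Ps * c + 16 * p.N1 ^ 2 * c +
    4 * p.N2 ^ 2 * (c * (10 * c)) + 8 * p.N3 ^ 2 * c, by positivity,
    fun u v a b hu hv ha hb y S h1 h2 h3 h4 => ?_⟩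
  set D := fun y => u y - a y with hD
  set E := fun y => v y - b y with hE
  have sD : ContDiff ℝ ∞ D := hu.sub ha
  have sE : ContDiff ℝ ∞ E := hv.sub hb
  set T := J1 X k D y + J1 X k E y with hT
  have hD1 := J1_nonneg X k D y
  have hE1 := J1_nonneg X k E y
  have tD : jet X k D y ≤ T := (jet_le_J1 _ _ _ _).trans (by linarith)
  have tE : jet X k E y ≤ T := (jet_le_J1 _ _ _ _).trans (by linarith)
  have tDd (α) : jet X k (pder α D) y ≤ T := (jet_pder_le_J1 _ _ _ _ _).trans (by linarith)
  have tEd (α) : jet X k (pder α E) y ≤ T := (jet_pder_le_J1 _ _ _ _ _).trans (by linarith)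
  have hS : 0 ≤ S := (J1_nonneg _ _ _ _).trans h1
  have hT0 : 0 ≤ T := (jet_nonneg _ _ _).trans tD
  have mm {f g : St → ℝ} (hf : ContDiff ℝ ∞ f) (hg : ContDiff ℝ ∞ g) {s : ℝ} (h1 : jet X k f y ≤ T)
      (h2 : jet X k g y ≤ s) : jet X k (fun y => f y * g y) y ≤ c * (s * T) := by
    refine (jet_mul_le hX k hf hg y).trans (mul_le_mul_of_nonneg_left ?_ hc0)
    rw [mul_comm s]
    exact mul_le_mul h1 h2 (jet_nonneg _ _ _) ((jet_nonneg _ _ _).trans h1)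
  have e1 : (fun y => Fu p v y - Fu p b y) = fun y =>
      p.M1 * (E y * (v y * v y + (v y * b y + b y * b y))) +
        ∑ α, 2 * p.P α * (E y * pder α v y + pder α E y * b y) := by
    funext y
    have : ∑ α, 2 * p.P α * (E y * pder α v y + pder α E y * b y) =
        (∑ α, 2 * p.P α * (v y * pder α v y)) - ∑ α, 2 * p.P α * (b y * pder α b y) := by
      rw [← Finset.sum_sub_distrib]
      refine Finset.sum_congr rfl fun α _ => ?_
      rw [hE, pder_sub hv hb]
      ring
    rw [this, Fu_eq p hv, Fu_eq p hb, hE]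
    ring
  have e2 : (fun y => Fv p u v y - Fv p a b y) = fun y =>
      (p.N1 * (pder 0 D y * (pder 0 u y + pder 0 a y)) +
        p.N2 * (D y * (u y * u y + (u y * a y + a y * a y)))) +
        p.N3 * (D y * v y + E y * a y) := by
    funext y
    rw [hD, hE, pder_sub hu ha]
    simp only [Fv]
    ring
  have du := pder_smooth hu 0
  have da := pder_smooth ha 0
  have dD := pder_smooth sD 0
  have q1 : ContDiff ℝ ∞ fun y => v y * v y + (v y * b y + b y * b y) :=
    (hv.mul hv).add ((hv.mul hb).add (hb.mul hb))
  have q2 : ContDiff ℝ ∞ fun y => u y * u y + (u y * a y + a y * a y) :=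
    (hu.mul hu).add ((hu.mul ha).add (ha.mul ha))
  have jv := (jet_le_J1 X k v y).trans h2
  have ju := (jet_le_J1 X k u y).trans h1
  have ja := (jet_le_J1 X k a y).trans h3
  have jb := (jet_le_J1 X k b y).trans h4
  have g1 := mm sE q1 tE (jet_quad_le hX k hv hb jv jb)
  have g2 := mm sD q2 tD (jet_quad_le hX k hu ha ju ja)
  have s3 (α : Fin 4) : ContDiff ℝ ∞ fun y => E y * pder α v y + pder α E y * b y :=
    (sE.mul (pder_smooth hv α)).add ((pder_smooth sE α).mul hb)
  have g3 (α : Fin 4) : jet X k (fun y => 2 * p.P α * (E y * pder α v y + pder α E y * b y)) y ≤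
      (2 * p.P α) ^ 2 * (4 * (c * (S * T))) := by
    rw [jet_const_mul hX _ k (s3 α)]
    refine mul_le_mul_of_nonneg_left ?_ (sq_nonneg _)
    have r0 := jet_add_le hX k (sE.mul (pder_smooth hv α)) ((pder_smooth sE α).mul hb) y
    have r1 := mm sE (pder_smooth hv α) tE ((jet_pder_le_J1 X k v y α).trans h2)
    have r2 := mm (pder_smooth sE α) hb (tEd α) jb
    linarith
  have g4 : jet X k (fun y => pder 0 D y * (pder 0 u y + pder 0 a y)) y ≤ c * (4 * S * T) := by
    refine mm dD (du.add da) (tDd 0) ?_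
    have r0 := jet_add_le hX k du da y
    have r1 := (jet_pder_le_J1 X k u y 0).trans h1
    have r2 := (jet_pder_le_J1 X k a y 0).trans h3
    linarith
  have g5 : jet X k (fun y => D y * v y + E y * a y) y ≤ 4 * (c * (S * T)) := by
    have r0 := jet_add_le hX k (sD.mul hv) (sE.mul ha) y
    have r1 := mm sD hv tD jv
    have r2 := mm sE ha tE ja
    linarith
  have f1 : jet X k (fun y => Fu p v y - Fu p b y) y ≤
      2 * (p.M1 ^ 2 * (c * (10 * (c * S ^ 2) * T))) + 2 * (4 * (Ps * (4 * (c * (S * T))))) := by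
    rw [e1]
    have hsum : ContDiff ℝ ∞ fun y => ∑ α, 2 * p.P α * (E y * pder α v y + pder α E y * b y) :=
      ContDiff.sum fun α _ => contDiff_const (c := 2 * p.P α).mul (s3 α)
    have r1 := jet_add_le hX k (contDiff_const (c := p.M1).mul (sE.mul q1)) hsum y
    have r2 := jet_sum_le hX k (fun α => contDiff_const (c := 2 * p.P α).mul (s3 α)) y
    have r3 := Finset.sum_le_sum fun α (_ : α ∈ Finset.univ) => g3 α
    rw [← Finset.sum_mul] at r3
    rw [jet_const_mul hX _ k (sE.mul q1)] at r1
    have r4 := mul_le_mul_of_nonneg_left g1 (sq_nonneg p.M1)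
    push_cast at r2
    linarith
  have f2 : jet X k (fun y => Fv p u v y - Fv p a b y) y ≤
      2 * (2 * (p.N1 ^ 2 * (c * (4 * S * T))) + 2 * (p.N2 ^ 2 * (c * (10 * (c * S ^ 2) * T)))) +
        2 * (p.N3 ^ 2 * (4 * (c * (S * T)))) := by
    rw [e2]
    have s1 := dD.mul (du.add da)
    have s5 := (sD.mul hv).add (sE.mul ha)
    have r1 := jet_add_le hX k ((contDiff_const (c := p.N1).mul s1).add
      (contDiff_const (c := p.N2).mul (sD.mul q2))) (contDiff_const (c := p.N3).mul s5) y
    have r2 := jet_add_le hX k (contDiff_const (c := p.N1).mul s1)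
      (contDiff_const (c := p.N2).mul (sD.mul q2)) y
    rw [jet_const_mul hX _ k s5] at r1
    rw [jet_const_mul hX _ k s1, jet_const_mul hX _ k (sD.mul q2)] at r2
    have r4 := mul_le_mul_of_nonneg_left g4 (sq_nonneg p.N1)
    have r5 := mul_le_mul_of_nonneg_left g2 (sq_nonneg p.N2)
    have r6 := mul_le_mul_of_nonneg_left g5 (sq_nonneg p.N3)
    linarith
  have z1 : 0 ≤ (32 * Ps * c + 16 * p.N1 ^ 2 * c + 8 * p.N3 ^ 2 * c) * S ^ 2 * T := by positivity
  have z2 : 0 ≤ (2 * p.M1 ^ 2 * (c * (10 * c)) + 4 * p.N2 ^ 2 * (c * (10 * c))) * S * T := by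
    positivity
  linarith

end Diff

section Data

lemma pderx_smooth {f : Sp → ℝ} (hf : ContDiff ℝ ∞ f) (a : Fin 3) : ContDiff ℝ ∞ (pderx a f) :=
  vf_smooth (X := fun _ => Pi.single a 1) contDiff_const hf

lemma pderx_comm {f : Sp → ℝ} (hf : ContDiff ℝ ∞ f) (a b : Fin 3) :
    pderx a (pderx b f) = pderx b (pderx a f) := by
  have hl : ContDiff ℝ ∞ fun y : St => f (xs y) := hf.comp xs_smooth
  have e (g : Sp → ℝ) : (fun x => (fun y : St => g (xs y)) (spt 0 x)) = g := rfl
  have h (g : Sp → ℝ) (hg : ContDiff ℝ ∞ g) (a : Fin 3) : pder a.succ (fun y : St => g (xs y)) =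
      fun y => pderx a g (xs y) := by
    funext y
    have := hasFDerivAt_spt_right ((hg.comp xs_smooth).differentiable (by simp)) (y 0) (xs y) a
    rw [spt_xs] at this
    exact this.symm
  funext x
  have := congrFun (pder_comm hl a.succ b.succ) (spt 0 x)
  rw [h f hf, h f hf, h _ (pderx_smooth hf b), h _ (pderx_smooth hf a)] at this
  exact this

lemma pderx_iterate_smooth {f : Sp → ℝ} (hf : ContDiff ℝ ∞ f) (a : Fin 3) (n : ℕ) :
    ContDiff ℝ ∞ ((pderx a)^[n] f) := by
  induction n with
  | zero => exact hf
  | succ n ih => rw [Function.iterate_succ_apply']; exact pderx_smooth ih a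

lemma pderx_iterate_comm {f : Sp → ℝ} (hf : ContDiff ℝ ∞ f) (a b : Fin 3) (n : ℕ) :
    pderx a ((pderx b)^[n] f) = (pderx b)^[n] (pderx a f) := by
  induction n with
  | zero => rfl
  | succ n ih =>
    rw [Function.iterate_succ_apply', pderx_comm (pderx_iterate_smooth hf b n), ih,
      Function.iterate_succ_apply']

lemma pderx_pderxIter {f : Sp → ℝ} (hf : ContDiff ℝ ∞ f) (a : Fin 3) (ν : Fin 3 → ℕ) :
    pderx a (pderxIter ν f) = pderxIter (Function.update ν a (ν a + 1)) f := by
  have h2 := pderx_iterate_smooth hf 2 (ν 2)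
  have h1 := pderx_iterate_smooth h2 1 (ν 1)
  fin_cases a
  · simp only [pderxIter]
    simp [Function.iterate_succ_apply']
  · simp only [pderxIter]
    simp [Function.iterate_succ_apply', pderx_iterate_comm h1]
  · simp only [pderxIter]
    simp [Function.iterate_succ_apply', pderx_iterate_comm h1, pderx_iterate_comm h2]

lemma L2normSq_nonneg (g : Sp → ℝ) : 0 ≤ L2normSq g := integral_nonneg fun _ => sq_nonneg _

lemma sobNormSq_nonneg (N : ℕ) (g : Sp → ℝ) : 0 ≤ sobNormSq N g :=
  Finset.sum_nonneg fun _ _ => L2normSq_nonneg _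

lemma L2normSq_pderxIter_le {N : ℕ} (f : Sp → ℝ) {ν : Fin 3 → ℕ} (h : ∑ i, ν i ≤ N) :
    L2normSq (pderxIter ν f) ≤ sobNormSq N f := by
  have hi (i : Fin 3) : ν i < N + 1 :=
    Nat.lt_succ_of_le ((Finset.single_le_sum (fun _ _ => Nat.zero_le _) (Finset.mem_univ i)).trans h)
  exact Finset.single_le_sum
    (f := fun k : Fin 3 → Fin (N + 1) => L2normSq (pderxIter (fun i => (k i : ℕ)) f))
    (fun _ _ => L2normSq_nonneg _)
    (Finset.mem_filter.2 ⟨Finset.mem_univ (fun i => (⟨ν i, hi i⟩ : Fin (N + 1))), h⟩)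

lemma integral_jet_data_le {N : ℕ} {f : Sp → ℝ} (hf : ContDiff ℝ ∞ f) (k : ℕ) {ψ : St → ℝ}
    (hψ : ContDiff ℝ ∞ ψ) {t : ℝ} (ν : Fin 3 → ℕ) (h : ∀ x, ψ (spt t x) = pderxIter ν f x)
    (hν : ∑ i, ν i + k ≤ N) :
    jsum dx k (fun g => ∫ x, g (spt t x) ^ 2) ψ ≤ 4 ^ k * sobNormSq N f := by
  have hb : ∫ x, ψ (spt t x) ^ 2 ≤ sobNormSq N f := by
    simp only [h]
    exact L2normSq_pderxIter_le f (by omega)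
  induction k generalizing ψ ν with
  | zero => simpa [jsum] using hb
  | succ k ih =>
    have hs (a : Fin 3) : jsum dx k (fun g => ∫ x, g (spt t x) ^ 2) (vf (dx a) ψ) ≤
        4 ^ k * sobNormSq N f := by
      have he : ∀ x, vf (dx a) ψ (spt t x) = pderxIter (Function.update ν a (ν a + 1)) f x := by
        intro x
        rw [← pderx_pderxIter hf, ← pder_succ_slice hψ h]
        rfl
      have hsum : ∑ i, Function.update ν a (ν a + 1) i = ∑ i, ν i + 1 := by
        fin_cases a <;> simp [Fin.sum_univ_three, Function.update] <;> omega
      refine ih (vf_smooth (dx_smooth a) hψ) _ he (by omega) ?_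
      simp only [he]
      exact L2normSq_pderxIter_le f (by omega)
    have := Finset.sum_le_card_nsmul Finset.univ _ _ fun a _ => hs a
    simp only [Finset.card_univ, Fintype.card_fin, nsmul_eq_mul] at this
    push_cast at this
    have h4 : (1 : ℝ) ≤ 4 ^ k := one_le_pow₀ (by norm_num)
    have := sobNormSq_nonneg N f
    rw [jsum, show (4 : ℝ) ^ (k + 1) = 4 ^ k * 4 from pow_succ _ _]
    nlinarith

/-- The energy of the data. -/
lemma QE_data_le {k N : ℕ} (hk : k ≤ N) {φ : St → ℝ} (hφ : Sm φ) {f0 f1 : Sp → ℝ}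
    (h0 : ContDiff ℝ ∞ f0) (h1 : ContDiff ℝ ∞ f1) (e0 : ∀ x, φ (spt 2 x) = f0 x)
    (e1 : ∀ x, pder 0 φ (spt 2 x) = f1 x) :
    QE k 2 φ ≤ 4 ^ (k + 2) * (sobNormSq (N + 1) f0 + sobNormSq N f1) := by
  have a0 := integral_jet_data_le (N := N + 1) h0 k hφ.1 0 e0 (by simp; omega)
  have a1 := integral_jet_data_le (N := N) h1 k (hφ.pder 0).1 0 e1 (by simpa using hk)
  have a2 (a : Fin 3) : jsum dx k (fun g => ∫ x, g (spt 2 x) ^ 2) (pder a.succ φ) ≤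
      4 ^ k * sobNormSq (N + 1) f0 := by
    refine integral_jet_data_le h0 k (hφ.pder _).1 (Function.update 0 a 1) (fun x => ?_) ?_
    · have := pderx_pderxIter h0 a 0
      simp only [Pi.zero_apply, zero_add] at this
      rw [← this]
      exact pder_succ_slice hφ.1 e0 a x
    · rw [Finset.sum_update_of_mem (Finset.mem_univ a)]
      simp; omega
  have := Finset.sum_le_card_nsmul Finset.univ _ _ fun a _ => a2 a
  simp only [Finset.card_univ, Fintype.card_fin, nsmul_eq_mul] at this
  push_cast at this
  rw [QE_eq hφ, Fin.sum_univ_succ, integral_jet_flat hφ, integral_jet_flat (hφ.pder 0)]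
  simp only [integral_jet_flat (hφ.pder (Fin.succ _))]
  have p0 := sobNormSq_nonneg (N + 1) f0
  have p1 := sobNormSq_nonneg N f1
  have p4 : (0 : ℝ) ≤ 4 ^ k := by positivity
  have := mul_nonneg p4 p0
  have := mul_nonneg p4 p1
  rw [pow_add]
  linarith

end Data

lemma J1_mono {ι : Type} [Fintype ι] {X : ι → St → St} {k l : ℕ} (h : k ≤ l) (f : St → ℝ) (y : St) :
    J1 X k f y ≤ J1 X l f y :=
  add_le_add (jet_mono h f y) (Finset.sum_le_sum fun _ _ => jet_mono h _ y)

lemma J1_dx_le (k : ℕ) (f : St → ℝ) (y : St) :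
    jet dx (k + 1) f y + jet dx k (pder 0 f) y ≤ J1 dx k f y := by
  have h := jsum_base_le (X := dx) (A := fun g => g y ^ 2) (fun _ => sq_nonneg _) k f
  rw [jet_succ, J1, Fin.sum_univ_succ (n := 3)]
  change f y ^ 2 ≤ jet dx k f y at h
  change f y ^ 2 + ∑ i : Fin 3, jet dx k (pder i.succ f) y + _ ≤ _
  linarith

lemma QE_mono {k l : ℕ} (h : k ≤ l) (t : ℝ) (f : St → ℝ) : QE k t f ≤ QE l t f :=
  jsum_mono (X := dx) (fun g => integral_nonneg fun x => en_nonneg g (spt t x)) h f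

lemma isOpen_time (a : ℝ) : IsOpen {y : St | a < y 0} :=
  isOpen_lt continuous_const (continuous_apply 0)

lemma jet_dx_slice_congr {f h : St → ℝ} (hf : ContDiff ℝ ∞ f) (hh : ContDiff ℝ ∞ h) {t : ℝ}
    (e : ∀ x, f (spt t x) = h (spt t x)) (k : ℕ) (x : Sp) :
    jet dx k f (spt t x) = jet dx k h (spt t x) := by
  induction k generalizing f h x with
  | zero => simp [jet_zero, e]
  | succ k ih =>
    rw [jet_succ, jet_succ, e]
    congr 1
    refine Finset.sum_congr rfl fun a _ => ih (vf_smooth (dx_smooth a) hf)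
      (vf_smooth (dx_smooth a) hh) (fun x => ?_) x
    have e1 := pder_succ_slice hf e a x
    have e2 := pder_succ_slice hh (c := fun x => h (spt t x)) (fun x => rfl) a x
    exact e1.trans e2.symm

lemma jet_const_zero {ι : Type} [Fintype ι] {X : ι → St → St} (hX : ∀ i, ContDiff ℝ ∞ (X i))
    (k : ℕ) (y : St) : jet X k (fun _ => 0) y = 0 := by
  have := jet_const_mul hX 0 k (contDiff_const (c := (0 : ℝ)) (n := ∞)) y
  simpa using this

lemma jet_dx_slice_zero {f : St → ℝ} (hf : ContDiff ℝ ∞ f) {t : ℝ}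
    (e : ∀ x, f (spt t x) = 0) (k : ℕ) (x : Sp) : jet dx k f (spt t x) = 0 := by
  rw [jet_dx_slice_congr hf (h := fun _ => 0) contDiff_const e, jet_const_zero dx_smooth]

/-- The spacetime jets of a solution in terms of the spatial ones. -/
lemma jet_pd_of_eq (k : ℕ) : ∃ C : ℝ, 0 ≤ C ∧ ∀ m ∈ Set.Icc (0 : ℝ) 1, ∀ f F : St → ℝ,
    ContDiff ℝ ∞ f → (∀ y, 3 / 2 < y 0 → KG m f y = F y) → ∀ y, 3 / 2 < y 0 →
      jet pd (k + 1) f y ≤ C * (J1 dx k f y + jetPred k F y) := by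
  obtain ⟨C, hC, h⟩ := jet_pd_le k
  refine ⟨C, hC, fun m hm f F hf e y hy => (h m hm f hf y).trans
    (mul_le_mul_of_nonneg_left (add_le_add (J1_dx_le k f y) (le_of_eq ?_)) hC)⟩
  cases k with
  | zero => rfl
  | succ k => exact jet_congr (isOpen_time (3 / 2)) e k hy

/-- Energy estimate for a pair of solutions whose sources are dominated by another pair. -/
lemma flat_pair {m : ℝ} (hm : m ∈ Set.Icc (0 : ℝ) 1) (k : ℕ) {f g u v F H : St → ℝ} (hf : Sm f)
    (hg : Sm g) (hu : Sm u) (hv : Sm v) {a b A B l : ℝ} (ha : 3 / 2 < a) (hA : 0 ≤ A) (hB : 0 ≤ B)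
    (hl : 2 < l) (h2 : (2 : ℝ) ∈ Set.Icc a b) (hF : ∀ y, 3 / 2 < y 0 → KG m f y = F y)
    (hH : ∀ y, 3 / 2 < y 0 → KG 1 g y = H y)
    (hs : ∀ y : St, y 0 ∈ Set.Icc a b → jet dx k F y + jet dx k H y ≤
      A * (J1 dx k u y + J1 dx k v y))
    (hq : ∀ t ∈ Set.Icc a b, QE k t u + QE k t v ≤ B * exp (l * |t - 2|)) {t : ℝ}
    (ht : t ∈ Set.Icc a b) :
    QE k t f + QE k t g ≤ (QE k 2 f + QE k 2 g + 2 * (A * B / (l - 2))) * exp (l * |t - 2|) := by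
  have iJ {w : St → ℝ} (hw : Sm w) (t : ℝ) : Integrable fun x => J1 dx k w (spt t x) :=
    ((hw.jet dx_smooth k).flat_integrable t).add
      (integrable_finsetSum _ fun α _ => ((hw.pder α).jet dx_smooth k).flat_integrable t)
  have key {w W : St → ℝ} {μ : ℝ} (hμ : μ ∈ Set.Icc (0 : ℝ) 1) (hw : Sm w)
      (e : ∀ y, 3 / 2 < y 0 → KG μ w y = W y)
      (hW : ∀ y : St, y 0 ∈ Set.Icc a b → jet dx k W y ≤ A * (J1 dx k u y + J1 dx k v y)) :
      QE k t w ≤ (QE k 2 w + A * B / (l - 2)) * exp (l * |t - 2|) := by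
    refine flat_energy hw hμ k (mul_nonneg hA hB) hl (fun s hs => ?_) h2 ht
    calc ∫ x, jet dx k (KG μ w) (spt s x)
        ≤ ∫ x, A * (J1 dx k u (spt s x) + J1 dx k v (spt s x)) := by
          refine integral_mono_of_nonneg (Filter.Eventually.of_forall fun x => jet_nonneg _ _ _)
            (((iJ hu s).add (iJ hv s)).const_mul A) (Filter.Eventually.of_forall fun x => ?_)
          have h1 : (spt s x) 0 ∈ Set.Icc a b := hs
          have := jet_congr (X := dx) (isOpen_time (3 / 2)) (f := KG μ w) (g := W) e k
            (y := spt s x) (lt_of_lt_of_le ha h1.1)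
          exact this.le.trans (hW _ h1)
      _ = A * (QE k s u + QE k s v) := by
          rw [integral_const_mul, integral_add (iJ hu s) (iJ hv s), QE_eq_J1 hu, QE_eq_J1 hv]
      _ ≤ A * (B * exp (l * |s - 2|)) := mul_le_mul_of_nonneg_left (hq s hs) hA
      _ = A * B * exp (l * |s - 2|) := by ring
  have h1 := key hm hf hF fun y hy =>
    (le_add_of_nonneg_right (jet_nonneg _ _ _)).trans (hs y hy)
  have h2 := key ⟨zero_le_one, le_rfl⟩ hg hH fun y hy =>
    (le_add_of_nonneg_left (jet_nonneg _ _ _)).trans (hs y hy)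
  linarith

/-- The size of the data. -/
def datE (N : ℕ) (d : Dat) : ℝ :=
  sobNormSq (N + 1) d.u0 + sobNormSq N d.u1 + (sobNormSq (N + 1) d.v0 + sobNormSq N d.v1)

lemma datE_nonneg (N : ℕ) (d : Dat) : 0 ≤ datE N d :=
  add_nonneg (add_nonneg (sobNormSq_nonneg _ _) (sobNormSq_nonneg _ _))
    (add_nonneg (sobNormSq_nonneg _ _) (sobNormSq_nonneg _ _))

/-- The Picard iterates. -/
structure Iter (p : Par) (m : ℝ) (d : Dat) (U V G : ℕ → St → ℝ) (W : ℕ → Fin 4 → St → ℝ) :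
    Prop where
  u0 : U 0 = fun _ => 0
  v0 : V 0 = fun _ => 0
  step : ∀ n, StepRel p m d (U n) (V n) (U (n + 1)) (V (n + 1)) (G n) (W n)

lemma exists_iter (p : Par) (m : ℝ) (d : Dat) : ∃ U V G W, Iter p m d U V G W := by
  have h (q : {q : (St → ℝ) × (St → ℝ) // Sm q.1 ∧ Sm q.2}) :
      ∃ (r : {q : (St → ℝ) × (St → ℝ) // Sm q.1 ∧ Sm q.2}) (g : St → ℝ) (w : Fin 4 → St → ℝ),
        StepRel p m d q.1.1 q.1.2 r.1.1 r.1.2 g w := by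
    obtain ⟨u', v', g, w, h⟩ := exists_step p m d q.2.1 q.2.2
    exact ⟨⟨(u', v'), h.smu, h.smv⟩, g, w, h⟩
  choose r g w hr using h
  let q : ℕ → {q : (St → ℝ) × (St → ℝ) // Sm q.1 ∧ Sm q.2} := fun n =>
    Nat.rec ⟨(fun _ => 0, fun _ => 0), Sm.zero, Sm.zero⟩ (fun _ q => r q) n
  exact ⟨fun n => (q n).1.1, fun n => (q n).1.2, fun n => g (q n), fun n => w (q n), rfl, rfl,
    fun n => hr (q n)⟩

lemma QE_zero (k : ℕ) (t : ℝ) : QE k t (fun _ => 0) = 0 := by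
  have h (α : Fin 4) : pder α (fun _ => (0 : ℝ)) = fun _ => 0 := by funext y; simp [pder]
  rw [QE_eq Sm.zero]
  simp [h, jet_const_zero dx_smooth]

namespace Iter
variable {p : Par} {m : ℝ} {d : Dat} {U V G : ℕ → St → ℝ} {W : ℕ → Fin 4 → St → ℝ}

lemma smu (h : Iter p m d U V G W) : ∀ n, Sm (U n)
  | 0 => by rw [h.u0]; exact Sm.zero
  | n + 1 => (h.step n).smu

lemma smv (h : Iter p m d U V G W) : ∀ n, Sm (V n)
  | 0 => by rw [h.v0]; exact Sm.zero
  | n + 1 => (h.step n).smv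

lemma equ (h : Iter p m d U V G W) (n : ℕ) (y : St) (hy : 3 / 2 < y 0) :
    KG m (U (n + 1)) y = Fu p (V n) y := (h.step n).equ (h.smv n) hy

lemma eqv (h : Iter p m d U V G W) (n : ℕ) (y : St) (_ : 3 / 2 < y 0) :
    KG 1 (V (n + 1)) y = Fv p (U n) (V n) y := congrFun (h.step n).eqv y

lemma QE2 (h : Iter p m d U V G W) {k N : ℕ} (hk : k ≤ N) (n : ℕ) :
    QE k 2 (U n) + QE k 2 (V n) ≤ 4 ^ (k + 2) * datE N d := by
  have hd := datE_nonneg N d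
  cases n with
  | zero => rw [h.u0, h.v0, QE_zero]; simp; positivity
  | succ n =>
    have s := h.step n
    have h1 := QE_data_le hk s.smu d.hu0.1 d.hu1.1 s.u2 s.du2
    have h2 := QE_data_le hk s.smv d.hv0.1 d.hv1.1 s.v2 s.dv2
    rw [datE]
    linarith

/-- Pointwise control of all derivatives of the iterates. -/
lemma jet_pd (p : Par) (k : ℕ) (K : ℝ) : ∃ C : ℝ, 0 ≤ C ∧ ∀ {m d U V G W}, Iter p m d U V G W →
    m ∈ Set.Icc (0 : ℝ) 1 → ∀ y : St, 3 / 2 < y 0 → ∀ q ≤ K,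
      (∀ n, J1 dx k (U n) y + J1 dx k (V n) y ≤ q) →
        ∀ n, jet pd (k + 1) (U n) y + jet pd (k + 1) (V n) y ≤ C * q := by
  induction k with
  | zero =>
    obtain ⟨C, hC, h0⟩ := jet_pd_of_eq 0
    refine ⟨C, hC, fun {m d U V G W} h hm y hy q hq hn n => ?_⟩
    have hq0 := (add_nonneg (J1_nonneg dx 0 (U 0) y) (J1_nonneg dx 0 (V 0) y)).trans (hn 0)
    cases n with
    | zero => rw [h.u0, h.v0, jet_const_zero pd_smooth]; simp; positivity
    | succ n =>
      have h1 := h0 m hm _ _ (h.smu _).1 (h.equ n) y hy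
      have h2 := h0 1 ⟨zero_le_one, le_rfl⟩ _ _ (h.smv _).1 (h.eqv n) y hy
      have h3 := mul_le_mul_of_nonneg_left (hn (n + 1)) hC
      simp only [jetPred, add_zero] at h1 h2
      linarith
  | succ k ih =>
    obtain ⟨C, hC, h0⟩ := jet_pd_of_eq (k + 1)
    obtain ⟨D, hD, h1⟩ := ih
    obtain ⟨A, hA, h2⟩ := jet_source_tame pd_smooth p k
    have hK0 : 0 ≤ |K| := abs_nonneg K
    refine ⟨C * (1 + A * (5 * D * |K| + (5 * D * |K|) ^ 2) * (5 * D)), by positivity,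
      fun {m d U V G W} h hm y hy q hq hn n => ?_⟩
    have hq0 := (add_nonneg (J1_nonneg dx _ (U 0) y) (J1_nonneg dx _ (V 0) y)).trans (hn 0)
    have hqK : q ≤ |K| := hq.trans (le_abs_self K)
    cases n with
    | zero => rw [h.u0, h.v0, jet_const_zero pd_smooth]; simp; positivity
    | succ n =>
      have g1 := h0 m hm _ _ (h.smu _).1 (h.equ n) y hy
      have g2 := h0 1 ⟨zero_le_one, le_rfl⟩ _ _ (h.smv _).1 (h.eqv n) y hy
      have g3 := mul_le_mul_of_nonneg_left (hn (n + 1)) hC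
      have g4 := h1 h hm y hy q hq (fun n => (add_le_add (J1_mono (Nat.le_succ k) _ y)
        (J1_mono (Nat.le_succ k) _ y)).trans (hn n)) n
      have g5 := h2 (U n) (V n) (h.smu n).1 (h.smv n).1 y
      have b1 : J1 pd k (U n) y + J1 pd k (V n) y ≤ 5 * D * q := by
        linarith [J1_pd_le k (U n) y, J1_pd_le k (V n) y]
      have b0 : J1 pd (k / 2) (U n) y + J1 pd (k / 2) (V n) y ≤ 5 * D * |K| := by
        have c1 := J1_mono (X := pd) (Nat.div_le_self k 2) (U n) y
        have c2 := J1_mono (X := pd) (Nat.div_le_self k 2) (V n) y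
        have c3 : 5 * D * q ≤ 5 * D * |K| := mul_le_mul_of_nonneg_left hqK (by positivity)
        linarith
      have s0 := add_nonneg (J1_nonneg pd (k / 2) (U n) y) (J1_nonneg pd (k / 2) (V n) y)
      have b2 := mul_le_mul (mul_le_mul_of_nonneg_left (add_le_add b0 (pow_le_pow_left₀ s0 b0 2)) hA)
        b1 (add_nonneg (J1_nonneg _ _ _ _) (J1_nonneg _ _ _ _)) (by positivity)
      have b3 := mul_le_mul_of_nonneg_left (g5.trans b2) hC
      change _ ≤ C * (_ + jet pd k (Fu p (V n)) y) at g1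
      change _ ≤ C * (_ + jet pd k (Fv p (U n) (V n)) y) at g2
      linarith

end Iter

lemma integral_le_of_rad {F : Sp → ℝ} {B : ℝ} (h0 : ∀ x, 0 ≤ F x) (hB : ∀ x, F x ≤ B)
    (hs : ∀ x, 2 < rad x → F x = 0) : ∫ x, F x ≤ volume.real {x : Sp | rad x ≤ 2} * B := by
  rw [← setIntegral_eq_integral_of_forall_compl_eq_zero (s := {x : Sp | rad x ≤ 2})
    fun x hx => hs x (not_le.1 hx), mul_comm]
  exact (le_abs_self _).trans (norm_setIntegral_le_of_norm_le_const
    (isCompact_rad_le 2).measure_lt_top fun x _ => by rw [Real.norm_of_nonneg (h0 x)]; exact hB x)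

lemma slab_zero {f : St → ℝ} (hf : Sm f) {y : St} (h : y 0 ∈ Set.Icc (7 / 4 : ℝ) 3)
    (hy : y ∉ Metric.closedBall (0 : St) 3) : f y = 0 := by
  refine hf.2 y ?_
  rw [mem_closedBall_zero_iff, pi_norm_le_iff_of_nonneg (by norm_num)] at hy
  push Not at hy
  obtain ⟨i, hi⟩ := hy
  have h2 : |y 0 - 2| ≤ 1 := abs_le.2 ⟨by linarith [h.1], by linarith [h.2]⟩
  induction i using Fin.cases with
  | zero =>
    rw [Real.norm_of_nonneg (by linarith [h.1])] at hi
    exact absurd h.2 (not_le.2 hi)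
  | succ a =>
    have := abs_le_rad (xs y) a
    rw [Real.norm_eq_abs] at hi
    have e : xs y a = y a.succ := rfl
    rw [e] at this
    linarith

lemma jet_pd_bdd {φ : St → ℝ} (hφ : ContDiff ℝ ∞ φ) (k : ℕ) :
    ∃ C : ℝ, 0 ≤ C ∧ ∀ y ∈ Metric.closedBall (0 : St) 3, jet pd k φ y ≤ C := by
  obtain ⟨C, hC⟩ := ((isCompact_closedBall (0 : St) 3).bddAbove_image
    (jet_smooth pd_smooth k hφ).continuous.continuousOn)
  exact ⟨|C|, abs_nonneg C, fun y hy =>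
    (hC (Set.mem_image_of_mem _ hy)).trans (le_abs_self C)⟩

lemma jet_pd_mul_bdd {φ : St → ℝ} (hφ : ContDiff ℝ ∞ φ) (k : ℕ) : ∃ C : ℝ, 0 ≤ C ∧
    ∀ f : St → ℝ, ContDiff ℝ ∞ f → ∀ y ∈ Metric.closedBall (0 : St) 3,
      jet pd k (fun y => φ y * f y) y ≤ C * jet pd k f y := by
  obtain ⟨C, hC, h⟩ := jet_pd_bdd hφ k
  refine ⟨5 ^ k * (k + 1) * C, by positivity, fun f hf y hy => ?_⟩
  refine (jet_mul_le pd_smooth k hφ hf y).trans ?_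
  rw [mul_assoc (5 ^ k * ((k : ℝ) + 1))]
  have := mul_le_mul_of_nonneg_right (h y hy) (jet_nonneg (X := pd) k f y)
  exact mul_le_mul_of_nonneg_left this (by positivity)

section Transport

lemma transport_pder {c : ℕ} {g F : St → ℝ} (hg : ContDiff ℝ ∞ g)
    (h : ∀ y, 3 / 2 < y 0 → Sc g y + c * g y = F y) (α : Fin 4) (y : St) (hy : 3 / 2 < y 0) :
    Sc (pder α g) y + (c + 1 : ℕ) * pder α g y = pder α F y := by
  have e : (fun y => Sc g y + c * g y) =ᶠ[nhds y] F :=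
    Filter.eventually_of_mem ((isOpen_time (3 / 2)).mem_nhds hy) h
  have h1 : pder α (fun y => Sc g y + c * g y) y = pder α F y := by
    rw [pder, pder, e.fderiv_eq]
  rw [pder_add (Sc_smooth hg) (contDiff_const.mul hg), pder_Sc hg, pder_const_mul _ hg] at h1
  push_cast
  linarith

lemma transport_ray {c : ℕ} {g F : St → ℝ} (hg : ContDiff ℝ ∞ g)
    (h : ∀ y, 3 / 2 < y 0 → Sc g y + (c + 1 : ℕ) * g y = F y) {A B : ℝ}
    (hA : ∀ x, g (spt 2 x) ^ 2 ≤ A) (hB : ∀ y : St, y 0 ∈ Set.Icc (7 / 4 : ℝ) 3 → F y ^ 2 ≤ B)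
    {y : St} (hy : y 0 ∈ Set.Icc (7 / 4 : ℝ) 3) : g y ^ 2 ≤ 2 * 4 ^ (c + 1) * (A + B) := by
  have hy0 : 0 < y 0 := by linarith [hy.1]
  have hs : ∀ s ∈ Set.uIcc 1 (2 / y 0), s * y 0 ∈ Set.Icc (7 / 4 : ℝ) 3 ∧ s ∈ Set.Icc 0 2 := by
    intro s hs
    rw [Set.mem_uIcc] at hs
    have e : 2 / y 0 * y 0 = 2 := by field_simp
    rcases hs with ⟨a, b⟩ | ⟨a, b⟩
    · have h1 := mul_le_mul_of_nonneg_right a hy0.le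
      have h2 := mul_le_mul_of_nonneg_right b hy0.le
      refine ⟨⟨by linarith [hy.1], by linarith⟩, by linarith, ?_⟩
      exact b.trans (by rw [div_le_iff₀ hy0]; linarith [hy.1])
    · have h1 := mul_le_mul_of_nonneg_right a hy0.le
      have h2 := mul_le_mul_of_nonneg_right b hy0.le
      exact ⟨⟨by linarith, by linarith [hy.2]⟩, (by positivity : 0 ≤ 2 / y 0).trans a, by linarith⟩
  have hB0 : 0 ≤ B := (sq_nonneg _).trans (hB y hy)
  have hA0 : 0 ≤ A := (sq_nonneg _).trans (hA 0)
  have hd : ∀ s ∈ Set.uIcc 1 (2 / y 0), HasDerivWithinAt (fun s : ℝ => s ^ (c + 1) * g (s • y))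
      (s ^ c * F (s • y)) (Set.uIcc 1 (2 / y 0)) s := by
    intro s hs1
    have d1 : HasDerivAt (fun s : ℝ => s • y) y s := by
      simpa using (hasDerivAt_id s).smul_const y
    have d2 := (smooth_diff hg (s • y)).hasFDerivAt.comp_hasDerivAt s d1
    have d3 := (hasDerivAt_pow (c + 1) s).mul d2
    refine (d3.congr_deriv ?_).hasDerivWithinAt
    have := h (s • y) (by
      have := (hs s hs1).1.1
      simp only [Pi.smul_apply, smul_eq_mul]; linarith)
    rw [← this, Sc_eq_fderiv, map_smul, smul_eq_mul]
    simp only [Function.comp_apply, Nat.add_sub_cancel]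
    ring
  have hb : ∀ s ∈ Set.uIcc 1 (2 / y 0), ‖s ^ c * F (s • y)‖ ≤ 2 ^ (c + 1) * √B := by
    intro s hs1
    have hs2 := hs s hs1
    rw [norm_mul, norm_pow, Real.norm_of_nonneg hs2.2.1, Real.norm_eq_abs]
    refine mul_le_mul ((pow_le_pow_left₀ hs2.2.1 hs2.2.2 c).trans
      (pow_le_pow_right₀ (by norm_num) c.le_succ)) ?_ (abs_nonneg _) (by positivity)
    exact Real.abs_le_sqrt (hB _ (by simpa using hs2.1))
  have hm := Convex.norm_image_sub_le_of_norm_hasDerivWithin_le hd hb (convex_uIcc 1 (2 / y 0))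
    Set.right_mem_uIcc Set.left_mem_uIcc
  have hlen : ‖1 - 2 / y 0‖ ≤ 1 := by
    rw [Real.norm_eq_abs, abs_le]
    have := (hs _ Set.right_mem_uIcc).2
    constructor <;> linarith [this.1, this.2]
  have e2 : (2 / y 0) • y = spt 2 (fun a => 2 / y 0 * y a.succ) := by
    funext i
    refine Fin.cases ?_ (fun a => rfl) i
    change 2 / y 0 * y 0 = 2
    field_simp
  have h3 : |(2 / y 0) ^ (c + 1) * g ((2 / y 0) • y)| ≤ 2 ^ (c + 1) * √A := by
    have hs2 := (hs _ Set.right_mem_uIcc).2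
    rw [abs_mul, abs_pow, abs_of_nonneg hs2.1, e2]
    exact mul_le_mul (pow_le_pow_left₀ hs2.1 hs2.2 _) (Real.abs_le_sqrt (hA _)) (abs_nonneg _)
      (by positivity)
  rw [Real.norm_eq_abs, one_pow, one_mul, one_smul] at hm
  have h4 : |g y| ≤ 2 ^ (c + 1) * √A + 2 ^ (c + 1) * √B := by
    have h5 : 2 ^ (c + 1) * √B * ‖1 - 2 / y 0‖ ≤ 2 ^ (c + 1) * √B * 1 :=
      mul_le_mul_of_nonneg_left hlen (by positivity)
    have := abs_sub_abs_le_abs_sub (g y) ((2 / y 0) ^ (c + 1) * g ((2 / y 0) • y))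
    linarith
  calc g y ^ 2 = |g y| ^ 2 := (sq_abs _).symm
    _ ≤ (2 ^ (c + 1) * √A + 2 ^ (c + 1) * √B) ^ 2 := pow_le_pow_left₀ (abs_nonneg _) h4 2
    _ = (2 ^ 2) ^ (c + 1) * (√A + √B) ^ 2 := by rw [← pow_mul, mul_comm 2, pow_mul]; ring
    _ ≤ (2 ^ 2) ^ (c + 1) * (2 * (A + B)) := by
        refine mul_le_mul_of_nonneg_left ?_ (by positivity)
        nlinarith [sq_nonneg (√A - √B), Real.sq_sqrt hA0, Real.sq_sqrt hB0]
    _ = 2 * 4 ^ (c + 1) * (A + B) := by norm_num; ring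

lemma transport_jet_dx (k c : ℕ) : ∃ C : ℝ, 0 ≤ C ∧ ∀ g F : St → ℝ, ContDiff ℝ ∞ g →
    (∀ y, 3 / 2 < y 0 → Sc g y + (c + 1 : ℕ) * g y = F y) → ∀ A B : ℝ,
    (∀ x, jet dx k g (spt 2 x) ≤ A) → (∀ y : St, y 0 ∈ Set.Icc (7 / 4 : ℝ) 3 → jet dx k F y ≤ B) →
    ∀ y : St, y 0 ∈ Set.Icc (7 / 4 : ℝ) 3 → jet dx k g y ≤ C * (A + B) := by
  induction k generalizing c with
  | zero => exact ⟨2 * 4 ^ (c + 1), by positivity, fun g F hg h A B hA hB y hy =>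
      transport_ray hg h hA hB hy⟩
  | succ k ih =>
    obtain ⟨C, hC, h1⟩ := ih (c + 1)
    refine ⟨2 * 4 ^ (c + 1) + 3 * C, by positivity, fun g F hg h A B hA hB y hy => ?_⟩
    have b0 := transport_ray hg h (fun x => (jsum_base_le (X := dx) (A := fun g => g (spt 2 x) ^ 2)
      (fun _ => sq_nonneg _) (k + 1) g).trans (hA x)) (fun y hy => (jsum_base_le (X := dx)
      (A := fun g => g y ^ 2) (fun _ => sq_nonneg _) (k + 1) F).trans (hB y hy)) hy
    have b1 (a : Fin 3) : jet dx k (vf (dx a) g) y ≤ C * (A + B) :=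
      h1 _ (pder a.succ F) (vf_smooth (dx_smooth a) hg)
        (fun y hy => transport_pder hg h a.succ y hy) A B
        (fun x => (jsum_vf_le (X := dx) (A := fun g => g (spt 2 x) ^ 2) (fun _ => sq_nonneg _)
          k g a).trans (hA x))
        (fun y hy => (jsum_vf_le (X := dx) (A := fun g => g y ^ 2) (fun _ => sq_nonneg _)
          k F a).trans (hB y hy)) y hy
    have := Finset.sum_le_card_nsmul Finset.univ _ _ fun a _ => b1 a
    simp only [Finset.card_univ, Fintype.card_fin, nsmul_eq_mul] at this
    push_cast at this
    rw [jet_succ]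
    linarith

lemma transport_jet_pd (k c : ℕ) : ∃ C : ℝ, 0 ≤ C ∧ ∀ g F : St → ℝ, ContDiff ℝ ∞ g →
    ContDiff ℝ ∞ F → (∀ y, 3 / 2 < y 0 → Sc g y + c * g y = F y) →
    ∀ y ∈ Metric.closedBall (0 : St) 3, 3 / 2 < y 0 →
      jet pd k g y ≤ C * (jet dx k g y + jet pd k F y) := by
  induction k generalizing c with
  | zero => exact ⟨1, zero_le_one, fun g F _ _ _ y _ _ => by
      simp only [jet_zero]; nlinarith [sq_nonneg (F y)]⟩
  | succ k ih =>
    obtain ⟨C, hC, h0⟩ := ih c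
    obtain ⟨D, hD, h1⟩ := ih (c + 1)
    let ψ : St → ℝ := fun y => (posId (y 0))⁻¹
    have sψ : ContDiff ℝ ∞ ψ := (posId_smooth.comp (coord_smooth 0)).inv fun y => (posId_pos _).ne'
    obtain ⟨A1, hA1, a1⟩ := jet_pd_mul_bdd sψ k
    obtain ⟨A2, hA2, a2⟩ := jet_pd_mul_bdd (φ := fun y => -c * ψ y) (contDiff_const.mul sψ) k
    choose A3 hA3 a3 using fun a : Fin 3 => jet_pd_mul_bdd (φ := fun y => -y a.succ * ψ y)
      ((coord_smooth a.succ).neg.mul sψ) k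
    set A := A3 0 + A3 1 + A3 2 with hA
    have hA0 : 0 ≤ A := by linarith [hA3 0, hA3 1, hA3 2]
    have hle : ∀ a, A3 a ≤ A := by
      intro a; fin_cases a <;> simp <;> linarith [hA3 0, hA3 1, hA3 2]
    refine ⟨1 + 3 * D + 2 * A1 + 4 * A2 * C + 36 * A * D, by positivity,
      fun g F hg hF h y hy hy0 => ?_⟩
    set J := jet dx (k + 1) g y + jet pd (k + 1) F y with hJ
    have b0 : jet pd k g y ≤ C * J := (h0 g F hg hF h y hy hy0).trans
      (mul_le_mul_of_nonneg_left (add_le_add (jet_mono k.le_succ _ _) (jet_mono k.le_succ _ _)) hC)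
    have b1 (a : Fin 3) : jet pd k (pder a.succ g) y ≤ D * J := by
      refine (h1 _ _ (pder_smooth hg a.succ) (pder_smooth hF a.succ)
        (transport_pder hg h a.succ) y hy hy0).trans (mul_le_mul_of_nonneg_left (add_le_add ?_
          (jet_pd_pder_le _ _ _ _)) hD)
      exact jsum_vf_le (X := dx) (A := fun g => g y ^ 2) (fun _ => sq_nonneg _) k g a
    have bF : jet pd k F y ≤ J :=
      (jet_mono k.le_succ _ _).trans (le_add_of_nonneg_left (jet_nonneg _ _ _))
    have b00 : g y ^ 2 ≤ J := (jsum_base_le (X := dx) (A := fun g => g y ^ 2)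
      (fun _ => sq_nonneg _) (k + 1) g).trans (le_add_of_nonneg_right (jet_nonneg _ _ _))
    have e : Set.EqOn (pder 0 g) (fun y => ψ y * F y + (-c * ψ y * g y +
        ∑ a : Fin 3, -y a.succ * ψ y * pder a.succ g y)) {y | 3 / 2 < y 0} := by
      intro z hz
      have hz' : (3 : ℝ) / 2 < z 0 := hz
      have h2 := h z hz
      have h3 : ψ z * z 0 = 1 := by
        change (posId (z 0))⁻¹ * z 0 = 1
        rw [posId_eq (by linarith)]
        exact inv_mul_cancel₀ (by linarith)
      rw [Sc, Fin.sum_univ_succ] at h2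
      change pder 0 g z = _
      simp only [← h2]
      simp only [Fin.sum_univ_three]
      linear_combination -(pder 0 g z) * h3
    have s2 : ContDiff ℝ ∞ fun y => -c * ψ y * g y := (contDiff_const.mul sψ).mul hg
    have s3 (a : Fin 3) : ContDiff ℝ ∞ fun y => -y a.succ * ψ y * pder a.succ g y :=
      ((coord_smooth a.succ).neg.mul sψ).mul (pder_smooth hg a.succ)
    have s4 : ContDiff ℝ ∞ fun y => ∑ a : Fin 3, -y a.succ * ψ y * pder a.succ g y :=
      ContDiff.sum fun a _ => s3 a
    have e2 : jet pd k (pder 0 g) y ≤ (2 * A1 + 4 * A2 * C + 36 * A * D) * J := by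
      rw [jet_congr (isOpen_time (3 / 2)) e k hy0]
      have r1 := jet_add_le pd_smooth k (sψ.mul hF) (s2.add s4) y
      have r2 := jet_add_le pd_smooth k s2 s4 y
      have r3 := jet_sum_le pd_smooth k s3 y
      have r4 (a : Fin 3) : jet pd k (fun y => -y a.succ * ψ y * pder a.succ g y) y ≤
          A * (D * J) := (a3 a _ (pder_smooth hg a.succ) y hy).trans
            (mul_le_mul (hle a) (b1 a) (jet_nonneg _ _ _) hA0)
      have r5 := Finset.sum_le_card_nsmul Finset.univ _ _ fun a _ => r4 a
      simp only [Finset.card_univ, Fintype.card_fin, nsmul_eq_mul] at r5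
      push_cast at r3 r5
      have r6 := (a1 F hF y hy).trans (mul_le_mul_of_nonneg_left bF hA1)
      have r7 := (a2 g hg y hy).trans (mul_le_mul_of_nonneg_left b0 hA2)
      linarith
    have := Finset.sum_le_card_nsmul Finset.univ _ _ fun a _ => b1 a
    simp only [Finset.card_univ, Fintype.card_fin, nsmul_eq_mul] at this
    push_cast at this
    rw [jet_succ, Fin.sum_univ_succ]
    change g y ^ 2 + (jet pd k (pder 0 g) y + ∑ a : Fin 3, jet pd k (pder a.succ g) y) ≤ _
    linarith

end Transport

lemma jet_pow_two_le {ι : Type} [Fintype ι] {X : ι → St → St} (hX : ∀ i, ContDiff ℝ ∞ (X i))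
    (k : ℕ) {f : St → ℝ} (hf : ContDiff ℝ ∞ f) (y : St) :
    jet X k (fun y => f y ^ 2) y ≤ 5 ^ k * (k + 1) * jet X k f y ^ 2 := by
  simp only [sq]
  exact jet_mul_le hX k hf hf y

lemma jet_pow_three_le {ι : Type} [Fintype ι] {X : ι → St → St} (hX : ∀ i, ContDiff ℝ ∞ (X i))
    (k : ℕ) {f : St → ℝ} (hf : ContDiff ℝ ∞ f) (y : St) :
    jet X k (fun y => f y ^ 3) y ≤ (5 ^ k * (k + 1)) ^ 2 * jet X k f y ^ 3 := by
  simp only [pow_succ _ 2]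
  refine (jet_mul_le hX k (hf.pow 2) hf y).trans ?_
  have := mul_le_mul_of_nonneg_right (jet_pow_two_le hX k hf y) (jet_nonneg (X := X) k f y)
  have := mul_le_mul_of_nonneg_left this (by positivity : (0 : ℝ) ≤ 5 ^ k * (k + 1))
  linarith

/-- The time slab on which the flat foliation is used. -/
def slab : Set St := {y | y 0 ∈ Set.Icc (7 / 4 : ℝ) 3}

lemma jet_slab_zero {ι : Type} [Fintype ι] {X : ι → St → St} (hX : ∀ i, ContDiff ℝ ∞ (X i)) (k : ℕ)
    {f : St → ℝ} (hf : Sm f) {y : St} (h : y ∈ slab) (hy : y ∉ Metric.closedBall (0 : St) 3) :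
    jet X k f y = 0 := slab_zero (hf.jet hX k) h hy

lemma integral_slab_le {F : St → ℝ} (hF : Sm F) (h0 : ∀ y, 0 ≤ F y) {B : ℝ}
    (hB : ∀ y ∈ slab, F y ≤ B) {t : ℝ} (ht : t ∈ Set.Icc (7 / 4 : ℝ) 3) :
    ∫ x, F (spt t x) ≤ volume.real {x : Sp | rad x ≤ 2} * B := by
  refine integral_le_of_rad (fun x => h0 _) (fun x => hB _ ht) fun x hx => hF.2 _ ?_
  have : |t - 2| ≤ 1 := abs_le.2 ⟨by linarith [ht.1], by linarith [ht.2]⟩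
  rw [spt_zero, xs_spt]
  linarith

lemma abs_slab {t : ℝ} (ht : t ∈ Set.Icc (7 / 4 : ℝ) 3) : exp (3 * |t - 2|) ≤ exp 3 := by
  have : |t - 2| ≤ 1 := abs_le.2 ⟨by linarith [ht.1], by linarith [ht.2]⟩
  exact exp_le_exp.2 (by linarith)

namespace StepRel
variable {p : Par} {m : ℝ} {d : Dat} {u v u' v' g : St → ℝ} {w : Fin 4 → St → ℝ}

lemma slab_g (p : Par) (K : ℝ) : ∃ C : ℝ, 0 ≤ C ∧ ∀ {m d u v u' v' g w},
    StepRel p m d u v u' v' g w → Sm v → ∀ S ≤ K, (∀ y ∈ slab, jet pd 10 v y ≤ S) →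
      (∀ y ∈ slab, jet pd 10 u' y ≤ S) → ∀ y ∈ slab, jet pd 9 g y ≤ C * S := by
  obtain ⟨Cx, hCx, hx⟩ := transport_jet_dx 9 3
  obtain ⟨Cp, hCp, hp⟩ := transport_jet_pd 9 4
  set c : ℝ := 5 ^ 9 * ((9 : ℕ) + 1) with hc
  have hc0 : 0 ≤ c := by positivity
  set B : ℝ := p.M1 ^ 2 * (c ^ 2 * K ^ 2) with hB
  have hB0 : 0 ≤ B := by positivity
  refine ⟨Cp * (Cx * (1 + p.P 0 ^ 2 * (c * |K|) + B) + B), by positivity,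
    fun {m d u v u' v' g w} h hv S hS h1 h2 y hy => ?_⟩
  have hS0 : 0 ≤ S := (jet_nonneg _ _ _).trans (h1 y hy)
  have sF : ContDiff ℝ ∞ fun y => p.M1 * v y ^ 3 := contDiff_const.mul (hv.1.pow 3)
  have h1' : ∀ y ∈ slab, jet pd 9 v y ≤ S := fun y hy => (jet_mono (by norm_num) _ _).trans (h1 y hy)
  have hSK : S ^ 2 ≤ K ^ 2 := pow_le_pow_left₀ hS0 hS 2
  have bF : ∀ y ∈ slab, jet pd 9 (fun y => p.M1 * v y ^ 3) y ≤ B * S := by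
    intro y hy
    rw [jet_const_mul pd_smooth _ 9 (hv.1.pow 3)]
    have a1 := jet_pow_three_le pd_smooth 9 hv.1 y
    rw [hB, mul_assoc]
    refine mul_le_mul_of_nonneg_left (a1.trans ?_) (sq_nonneg _)
    rw [mul_assoc (c ^ 2)]
    refine mul_le_mul_of_nonneg_left ?_ (sq_nonneg _)
    have := pow_le_pow_left₀ (jet_nonneg _ _ _) (h1' y hy) 3
    nlinarith
  by_cases hyb : y ∈ Metric.closedBall (0 : St) 3
  swap
  · rw [jet_slab_zero pd_smooth 9 h.smg hy hyb]
    positivity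
  have hy0 : (7 / 4 : ℝ) ≤ y 0 := hy.1
  have eq : ∀ y, 3 / 2 < y 0 → Sc g y + (4 : ℕ) * g y = p.M1 * v y ^ 3 := h.eqg
  have s1 : ContDiff ℝ ∞ fun y => 1 / 2 * pder 0 u' y := contDiff_const.mul (h.smu.pder 0).1
  have s2 : ContDiff ℝ ∞ fun y => -p.P 0 / 2 * v y ^ 2 := contDiff_const.mul (hv.1.pow 2)
  have bs (x : Sp) : jet dx 9 g (spt 2 x) ≤ (1 + p.P 0 ^ 2 * (c * |K|)) * S := by
    rw [jet_dx_slice_congr h.smg.1 (s1.add s2) fun x => ?_]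
    · have hx2 : spt 2 x ∈ slab := show (2 : ℝ) ∈ Set.Icc (7 / 4 : ℝ) 3 by norm_num
      refine (jet_dx_le_pd _ _ _).trans ((jet_add_le pd_smooth 9 s1 s2 _).trans ?_)
      rw [jet_const_mul pd_smooth _ 9 (h.smu.pder 0).1, jet_const_mul pd_smooth _ 9 (hv.1.pow 2)]
      have b1 := (jet_pd_pder_le 9 u' (spt 2 x) 0).trans (h2 _ hx2)
      have b2 := jet_pow_two_le pd_smooth 9 hv.1 (spt 2 x)
      have b3 := pow_le_pow_left₀ (jet_nonneg _ _ _) (h1' _ hx2) 2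
      have b4 : S ^ 2 ≤ |K| * S := by
        rw [sq]; exact mul_le_mul_of_nonneg_right (hS.trans (le_abs_self K)) hS0
      have b5 : jet pd 9 (fun y => v y ^ 2) (spt 2 x) ≤ c * (|K| * S) :=
        b2.trans (mul_le_mul_of_nonneg_left (b3.trans b4) hc0)
      have b6 := mul_le_mul_of_nonneg_left b5 (sq_nonneg (p.P 0))
      have b7 : 0 ≤ p.P 0 ^ 2 * (c * (|K| * S)) := by positivity
      clear_value c
      generalize jet pd 9 (fun y => v y ^ 2) (spt 2 x) = j at b6 ⊢
      rw [show (-p.P 0 / 2) ^ 2 * j = p.P 0 ^ 2 * j / 4 by ring]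
      linarith
    · rw [h.g2, h.du2]; ring
  have r1 := hx g _ h.smg.1 eq _ _ bs (fun y hy => (jet_dx_le_pd _ _ _).trans (bF y hy)) y hy
  have r2 := hp g _ h.smg.1 sF eq y hyb (by linarith)
  refine r2.trans ?_
  have := mul_le_mul_of_nonneg_left (add_le_add r1 (bF y hy)) hCp
  linarith

lemma slab_w (p : Par) (K : ℝ) : ∃ C : ℝ, 0 ≤ C ∧ ∀ {m d u v u' v' g w},
    StepRel p m d u v u' v' g w → m ∈ Set.Icc (0 : ℝ) 1 → Sm v → ∀ S ≤ K,
      (∀ y ∈ slab, jet pd 10 v y ≤ S) →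
      (∀ y ∈ slab, jet pd 10 u' y ≤ S) → ∀ α, ∀ y ∈ slab, jet pd 7 (w α) y ≤ C * S := by
  obtain ⟨Cg, hCg, hg⟩ := slab_g p K
  choose Cα hCα hα using fun α : Fin 4 => jet_pd_mul_bdd (coord_smooth α) 9
  obtain ⟨Ck, hCk, hk⟩ := jet_pd_of_eq 6
  set c : ℝ := 5 ^ 9 * ((9 : ℕ) + 1) with hc
  have hc0 : 0 ≤ c := by positivity
  set V := volume.real {x : Sp | rad x ≤ 2} with hV
  have hV0 : 0 ≤ V := measureReal_nonneg
  set B : ℝ := ∑ α, (2 * (p.P α ^ 2 * (c * |K|)) + 2 * (Cα α * Cg)) with hB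
  have hBα (α : Fin 4) : 0 ≤ 2 * (p.P α ^ 2 * (c * |K|)) + 2 * (Cα α * Cg) := by
    have := hCα α; positivity
  have hB0 : 0 ≤ B := Finset.sum_nonneg fun α _ => hBα α
  have hBle (α : Fin 4) : 2 * (p.P α ^ 2 * (c * |K|)) + 2 * (Cα α * Cg) ≤ B :=
    Finset.single_le_sum (fun α _ => hBα α) (Finset.mem_univ α)
  refine ⟨Ck * (216 * 7 * ((V + V * B) * exp 3) + B), by positivity,
    fun {m d u v u' v' g w} h hm hv S hS h1 h2 α y hy => ?_⟩
  have hS0 : 0 ≤ S := (jet_nonneg _ _ _).trans (h1 y hy)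
  have h1' : ∀ y ∈ slab, jet pd 9 v y ≤ S := fun y hy => (jet_mono (by norm_num) _ _).trans (h1 y hy)
  have hG := hg h hv S hS h1 h2
  have t1 : Sm fun y => p.P α * v y ^ 2 := (hv.pow two_ne_zero).const_mul _
  have t2 : Sm fun y => y α * g y := h.smg.smul (coord_smooth α)
  have bS : ∀ y ∈ slab, jet pd 9 (fun y => p.P α * v y ^ 2 + y α * g y) y ≤ B * S := by
    intro y hy
    by_cases hyb : y ∈ Metric.closedBall (0 : St) 3
    swap
    · rw [jet_slab_zero pd_smooth 9 (t1.add t2) hy hyb]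
      positivity
    refine le_trans ?_ (mul_le_mul_of_nonneg_right (hBle α) hS0)
    have r1 := jet_add_le pd_smooth 9 t1.1 t2.1 y
    rw [jet_const_mul pd_smooth _ 9 (hv.1.pow 2)] at r1
    have r2 := (hα α g h.smg.1 y hyb).trans (mul_le_mul_of_nonneg_left (hG y hy) (hCα α))
    have b2 := jet_pow_two_le pd_smooth 9 hv.1 y
    have b3 := pow_le_pow_left₀ (jet_nonneg _ _ _) (h1' _ hy) 2
    have b4 : S ^ 2 ≤ |K| * S := by
      rw [sq]; exact mul_le_mul_of_nonneg_right (hS.trans (le_abs_self K)) hS0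
    have b5 := b2.trans (mul_le_mul_of_nonneg_left (b3.trans b4) hc0)
    have b6 := mul_le_mul_of_nonneg_left b5 (sq_nonneg (p.P α))
    linarith
  have q0 : QE 9 2 (w α) ≤ V * S := by
    rw [QE_eq_J1 (h.smw α)]
    have hs2 : (2 : ℝ) ∈ Set.Icc (7 / 4 : ℝ) 3 := by norm_num
    refine integral_le_of_rad (fun x => J1_nonneg _ _ _ _) (fun x => ?_) fun x hx => ?_
    · rw [J1, jet_dx_slice_zero (h.smw α).1 (h.w2 α), Fin.sum_univ_succ (n := 3), zero_add,
        Finset.sum_eq_zero, add_zero]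
      · by_cases hα0 : α = 0
        · rw [jet_dx_slice_congr ((h.smw α).pder 0).1 h.smu.1
            fun x => by rw [h.dw2, if_pos hα0, h.u2]]
          exact (jet_dx_le_pd _ _ _).trans ((jet_mono (by norm_num) _ _).trans (h2 _ hs2))
        · rw [jet_dx_slice_zero ((h.smw α).pder 0).1 fun x => by rw [h.dw2, if_neg hα0]]
          exact hS0
      · intro a _
        exact jet_dx_slice_zero ((h.smw α).pder _).1
          (pder_succ_slice_zero (h.smw α).1 (h.w2 α) a) 9 x
    · have hz : 1 + |(spt 2 x) 0 - 2| < rad (xs (spt 2 x)) := by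
        rw [spt_zero, xs_spt]; norm_num; linarith
      simp only [J1, ((h.smw α).jet dx_smooth 9).2 _ hz,
        fun β => (((h.smw α).pder β).jet dx_smooth 9).2 _ hz]
      simp
  have q1 : QE 9 (y 0) (w α) ≤ (V * S + V * B * S) * exp 3 := by
    have := flat_energy (h.smw α) hm 9 (a := 7 / 4) (b := 3) (B := V * (B * S)) (l := 3)
      (by positivity) (by norm_num) (fun t ht => ?_) (by norm_num) hy
    · refine this.trans (mul_le_mul ?_ (abs_slab hy) (exp_pos _).le (by positivity))
      norm_num
      linarith
    · have b0 : ∫ x, jet dx 9 (KG m (w α)) (spt t x) ≤ V * (B * S) := by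
        rw [h.eqw α]
        exact integral_slab_le ((t1.add t2).jet dx_smooth 9) (fun y => jet_nonneg _ _ _)
          (fun y hy => (jet_dx_le_pd _ _ _).trans (bS y hy)) ht
      refine b0.trans (le_mul_of_one_le_right (by positivity) (one_le_exp (by positivity)))
  have r := hk m hm (w α) _ (h.smw α).1 (fun y _ => congrFun (h.eqw α) y) y
    (by linarith [hy.1] : (3 / 2 : ℝ) < y 0)
  have r1 := sup_QE 6 (h.smw α) y
  change J1 dx 6 (w α) y ≤ _ at r1
  refine r.trans ?_
  rw [mul_assoc Ck]
  refine mul_le_mul_of_nonneg_left ?_ hCk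
  have r2 := (jet_mono (X := pd) (by norm_num : 5 ≤ 9) _ y).trans (bS y hy)
  change J1 dx 6 (w α) y + jet pd 5 _ y ≤ _
  have r3 := mul_le_mul_of_nonneg_left q1 (by norm_num : (0 : ℝ) ≤ 216 * 7)
  norm_num at r1
  linarith

end StepRel

namespace Iter

lemma slab_QE (p : Par) (k : ℕ) (hk : k / 2 + 3 ≤ k) : ∃ C : ℝ, 1 ≤ C ∧ ∀ {m d U V G W},
    Iter p m d U V G W → m ∈ Set.Icc (0 : ℝ) 1 → ∀ {N}, k ≤ N → ∀ e, datE N d ≤ e →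
      4 * C ^ 2 * e ≤ 1 →
      ∀ n, ∀ t ∈ Set.Icc (7 / 4 : ℝ) 3, QE k t (U n) + QE k t (V n) ≤ 2 * C * e := by
  obtain ⟨A0, hA0, h0⟩ := jet_source_tame dx_smooth p k
  set c : ℝ := 216 * ((k / 2 : ℕ) + 1) with hc
  set A1 := A0 * (c + c ^ 2) with hA1
  have hA1' : 0 ≤ A1 := by positivity
  have hE : 1 ≤ exp 3 := one_le_exp (by norm_num)
  obtain ⟨D, hD⟩ : ∃ D : ℝ, D = 4 ^ (k + 2) := ⟨_, rfl⟩
  have hD1 : 1 ≤ D := hD ▸ one_le_pow₀ (by norm_num)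
  refine ⟨(D + 2 * A1) * exp 3, by nlinarith,
    fun {m d U V G W} h hm {N} hN e he hsm n => ?_⟩
  set C := (D + 2 * A1) * exp 3 with hC
  have he0 : 0 ≤ e := (datE_nonneg _ _).trans he
  have hC1 : 1 ≤ C := by rw [hC]; nlinarith
  set q := 2 * C * e with hq
  have hq0 : 0 ≤ q := by positivity
  have hq1 : q ≤ 1 := by nlinarith [mul_nonneg (by linarith : 0 ≤ C) he0]
  have hqq : q * q ≤ e := by
    have := mul_le_mul_of_nonneg_right hsm he0
    rw [hq]; linarith
  induction n with
  | zero => intro t _; rw [h.u0, h.v0, QE_zero, add_zero]; exact hq0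
  | succ n ih =>
    intro t ht
    have hs (y : St) (hy : y 0 ∈ Set.Icc (7 / 4 : ℝ) 3) :
        jet dx k (Fu p (V n)) y + jet dx k (Fv p (U n) (V n)) y ≤
          A1 * q * (J1 dx k (U n) y + J1 dx k (V n) y) := by
      refine (h0 _ _ (h.smu n).1 (h.smv n).1 y).trans (mul_le_mul_of_nonneg_right ?_
        (add_nonneg (J1_nonneg _ _ _ _) (J1_nonneg _ _ _ _)))
      have r1 : J1 dx (k / 2) (U n) y ≤ c * QE (k / 2 + 3) (y 0) (U n) := sup_QE _ (h.smu n) y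
      have r2 : J1 dx (k / 2) (V n) y ≤ c * QE (k / 2 + 3) (y 0) (V n) := sup_QE _ (h.smv n) y
      have hc0 : 0 ≤ c := by positivity
      have r3 := mul_le_mul_of_nonneg_left (QE_mono hk (y 0) (U n)) hc0
      have r4 := mul_le_mul_of_nonneg_left (QE_mono hk (y 0) (V n)) hc0
      have r5 := mul_le_mul_of_nonneg_left (ih _ hy) hc0
      have hb : J1 dx (k / 2) (U n) y + J1 dx (k / 2) (V n) y ≤ c * q := by linarith
      have hb0 := add_nonneg (J1_nonneg dx (k / 2) (U n) y) (J1_nonneg dx (k / 2) (V n) y)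
      have hb2 := pow_le_pow_left₀ hb0 hb 2
      have : (c * q) ^ 2 ≤ c ^ 2 * q := by
        rw [mul_pow, sq q]
        exact mul_le_mul_of_nonneg_left (mul_le_of_le_one_left hq0 hq1) (by positivity)
      rw [hA1, mul_assoc A0]
      exact mul_le_mul_of_nonneg_left (by linarith) hA0
    have hA1q : 0 ≤ A1 * q := mul_nonneg hA1' hq0
    have ih' (t : ℝ) (ht : t ∈ Set.Icc (7 / 4 : ℝ) 3) :
        QE k t (U n) + QE k t (V n) ≤ q * exp (3 * |t - 2|) := (ih t ht).trans
      (le_mul_of_one_le_right hq0 (one_le_exp (mul_nonneg (by norm_num) (abs_nonneg _))))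
    have r := flat_pair hm k (h.smu (n + 1)) (h.smv (n + 1)) (h.smu n) (h.smv n) (a := 7 / 4)
      (b := 3) (A := A1 * q) (B := q) (l := 3) (by norm_num) hA1q hq0 (by norm_num)
      (by norm_num) (h.equ n) (h.eqv n) hs ih' ht
    have r2 := h.QE2 hN (n + 1)
    rw [← hD] at r2
    have r3 : D * datE N d ≤ D * e := mul_le_mul_of_nonneg_left he (by linarith)
    have r4 : 2 * (A1 * q * q / (3 - 2)) ≤ 2 * A1 * e := by
      have := mul_le_mul_of_nonneg_left hqq hA1'
      rw [show (3 : ℝ) - 2 = 1 by norm_num, div_one]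
      linarith
    have r5 : (QE k 2 (U (n + 1)) + QE k 2 (V (n + 1)) + 2 * (A1 * q * q / (3 - 2))) *
        exp (3 * |t - 2|) ≤ (D * e + 2 * A1 * e) * exp 3 :=
      mul_le_mul (by linarith) (abs_slab ht) (exp_pos _).le (by positivity)
    have r6 : (D * e + 2 * A1 * e) * exp 3 = C * e := by rw [hC]; ring
    have r7 : 0 ≤ C * e := by positivity
    linarith

/-- Bounds on the initial slab. -/
theorem slab_bound (p : Par) : ∃ C E : ℝ, 0 ≤ C ∧ 0 < E ∧ ∀ {m d U V G W},
    Iter p m d U V G W → m ∈ Set.Icc (0 : ℝ) 1 → ∀ {N}, 14 ≤ N → ∀ e, datE N d ≤ e → e ≤ E →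
      ∀ n, ∀ y ∈ slab, jet pd 10 (U n) y + jet pd 10 (V n) y ≤ C * e ∧ jet pd 7 (G n) y ≤ C * e ∧
        ∀ α, jet pd 7 (W n α) y ≤ C * e := by
  obtain ⟨C1, hC1, h1⟩ := slab_QE p 14 (by norm_num)
  obtain ⟨C2, hC2, h2⟩ := jet_pd p 9 (216 * 10)
  set K := C2 * (216 * 10 * (2 * C1)) with hK
  have hK0 : 0 ≤ K := by positivity
  obtain ⟨C3, hC3, h3⟩ := StepRel.slab_g p K
  obtain ⟨C4, hC4, h4⟩ := StepRel.slab_w p K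
  refine ⟨K * (1 + C3 + C4), min 1 (1 / (4 * C1 ^ 2)), by positivity, by positivity,
    fun {m d U V G W} h hm {N} hN e he heE n => ?_⟩
  have he0 : 0 ≤ e := (datE_nonneg _ _).trans he
  have he1 := heE.trans (min_le_left _ _)
  have he2 : 4 * C1 ^ 2 * e ≤ 1 := by
    have := heE.trans (min_le_right _ _)
    rwa [le_div_iff₀ (by positivity), mul_comm] at this
  have hq1 : 2 * C1 * e ≤ 1 := by nlinarith [mul_nonneg (by linarith : 0 ≤ C1) he0]
  have key : ∀ n, ∀ y ∈ slab, jet pd 10 (U n) y + jet pd 10 (V n) y ≤ K * e := by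
    intro n y hy
    have := h2 h hm y (by linarith [hy.1] : (3 / 2 : ℝ) < y 0) (216 * 10 * (2 * C1 * e))
      (by linarith) (fun n => ?_) n
    · rw [hK]; linarith
    · have r1 := sup_QE 9 (h.smu n) y
      have r2 := sup_QE 9 (h.smv n) y
      have r3 := QE_mono (by norm_num : 9 + 3 ≤ 14) (y 0) (U n)
      have r4 := QE_mono (by norm_num : 9 + 3 ≤ 14) (y 0) (V n)
      have r5 := h1 h hm hN e he he2 n _ hy
      change J1 dx 9 (U n) y ≤ _ at r1
      change J1 dx 9 (V n) y ≤ _ at r2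
      norm_num at r1 r2 r3 r4 ⊢
      linarith
  have kv : ∀ n, ∀ y ∈ slab, jet pd 10 (V n) y ≤ K * e := fun n y hy =>
    (le_add_of_nonneg_left (jet_nonneg _ _ _)).trans (key n y hy)
  have ku : ∀ n, ∀ y ∈ slab, jet pd 10 (U n) y ≤ K * e := fun n y hy =>
    (le_add_of_nonneg_right (jet_nonneg _ _ _)).trans (key n y hy)
  have hS : K * e ≤ K := mul_le_of_le_one_right hK0 he1
  have hKe : 0 ≤ K * e := mul_nonneg hK0 he0
  have p3 := mul_nonneg hC3 hKe
  have p4 := mul_nonneg hC4 hKe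
  intro y hy
  refine ⟨(key n y hy).trans (by linarith), ?_, fun α => ?_⟩
  · refine (jet_mono (by norm_num : 7 ≤ 9) _ _).trans ?_
    exact (h3 (h.step n) (h.smv n) _ hS (kv n) (ku (n + 1)) y hy).trans (by linarith)
  · exact (h4 (h.step n) hm (h.smv n) _ hS (kv n) (ku (n + 1)) α y hy).trans (by linarith)

end Iter

lemma sup_hyp_jet (k : ℕ) {f : St → ℝ} (hf : Sm f) {W : Sp → ℝ} {σ : ℝ} (hW : ContDiff ℝ ∞ W)
    (hW0 : ∀ x, 0 ≤ W x) (hW1 : ∀ a x, |htime σ x * pderx a W x| ≤ 2 * W x) (x : Sp) :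
    htime σ x ^ 3 * (W x * jet Zf k f (hyp σ x)) ≤
      216 * (k + 1) * ∫ x, W x * jet Zf (k + 3) f (hyp σ x) := by
  have h1 : jsum Zf k (fun g => htime σ x ^ 3 * W x * g (hyp σ x) ^ 2) f ≤
      jsum Zf k (fun g => 216 * ∫ x, W x * jet Zf 3 g (hyp σ x)) f :=
    jsum_le_jsum (stable_Sm Zf_smooth) (fun g hg => sup_hyp hg hW hW0 hW1 x) k hf
  rw [jsum_const_mul, jsum_const_mul] at h1
  have h2 := jsum_congr (stable_Sm Zf_smooth)
    (fun g hg => integral_jet_hyp hg 3 σ hW.continuous) k hf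
  rw [h2] at h1
  have h3 := jsum_jsum_le (X := Zf) (A := fun g => ∫ x, W x * g (hyp σ x) ^ 2)
    (fun g => integral_nonneg fun x => mul_nonneg (hW0 x) (sq_nonneg _)) k 3 f
  rw [integral_jet_hyp hf _ _ hW.continuous]
  change htime σ x ^ 3 * W x * jet Zf k f (hyp σ x) ≤ _ at h1
  nlinarith

/-- The square of the ratio of the hyperbolic to the Minkowski time. -/
def rh (σ : ℝ) (x : Sp) : ℝ := (exp σ / htime σ x) ^ 2

lemma rh_nonneg (σ : ℝ) (x : Sp) : 0 ≤ rh σ x := sq_nonneg _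

lemma rh_smooth (σ : ℝ) : ContDiff ℝ ∞ (rh σ) :=
  (contDiff_const.div (htime_smooth_right σ) fun x => (htime_pos σ x).ne').pow 2

lemma rh_mul (σ : ℝ) (x : Sp) : rh σ x * htime σ x ^ 2 = exp σ ^ 2 := by
  have := (htime_pos σ x).ne'
  rw [rh]; field_simp

lemma rh_pder (σ : ℝ) (a : Fin 3) (x : Sp) : |htime σ x * pderx a (rh σ) x| ≤ 2 * rh σ x := by
  have ht := htime_pos σ x
  have h1 := (smooth_diff (htime_smooth_right σ) x).hasFDerivAt
  have h2 := (((hasDerivAt_inv ht.ne').const_mul (exp σ)).pow 2).comp_hasFDerivAt x h1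
  have e : rh σ = ((fun y => exp σ * y⁻¹) ^ 2) ∘ htime σ := by
    funext x; simp [rh, div_eq_mul_inv]
  have h3 : pderx a (rh σ) x = -2 * rh σ x * (pderx a (htime σ) x / htime σ x) := by
    rw [e, pderx, h2.fderiv]
    simp only [pderx, Function.comp, Pi.pow_apply, smul_eq_mul, smul_apply]
    norm_num
    field_simp
  have h4 : |pderx a (htime σ) x| ≤ 1 := by
    rw [pderx_htime, abs_div, abs_of_pos ht, div_le_one ht]
    exact (abs_le_rad x a).trans (rad_lt_htime σ x).le
  have h5 : htime σ x * pderx a (rh σ) x = -(2 * rh σ x) * pderx a (htime σ) x := by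
    rw [h3]; field_simp
  rw [h5, abs_mul, abs_neg, abs_of_nonneg (by have := rh_nonneg σ x; positivity)]
  exact mul_le_of_le_one_right (by have := rh_nonneg σ x; positivity) h4

/-- The energy density of the pair `(u, v)` on the hyperboloids. -/
def ed (k : ℕ) (m δ σ : ℝ) (u v : St → ℝ) (x : Sp) : ℝ :=
  rh σ x * J1 Zf k u (hyp σ x) + m ^ 2 * jet Zf k u (hyp σ x) + exp (-(2 * δ * σ)) *
    (jet Zf k v (hyp σ x) + rh σ x * ∑ α, jet Zf k (pder α v) (hyp σ x))

/-- The energy of the pair `(u, v)` on the hyperboloids. -/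
def En (m δ σ : ℝ) (u v : St → ℝ) : ℝ := ∫ x, ed 6 m δ σ u v x

lemma J1_smooth {u : St → ℝ} (hu : Sm u) (k : ℕ) : Sm (J1 Zf k u) :=
  (hu.jet Zf_smooth k).add (Sm.sum fun α => (hu.pder α).jet Zf_smooth k)

lemma ed_int {u v : St → ℝ} (hu : Sm u) (hv : Sm v) (k : ℕ) (m δ σ : ℝ) :
    Integrable (ed k m δ σ u v) ∧ ∫ x, ed k m δ σ u v x =
      (∫ x, rh σ x * J1 Zf k u (hyp σ x)) + m ^ 2 * (∫ x, jet Zf k u (hyp σ x)) +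
      exp (-(2 * δ * σ)) * ((∫ x, jet Zf k v (hyp σ x)) +
        ∫ x, rh σ x * ∑ α, jet Zf k (pder α v) (hyp σ x)) := by
  have i1 : Integrable fun x => rh σ x * J1 Zf k u (hyp σ x) :=
    hyp_int (J1_smooth hu k) σ (rh_smooth σ).continuous
  have i2 := ((hu.jet Zf_smooth k).hyp_integrable σ).const_mul (m ^ 2)
  have i3 := (hv.jet Zf_smooth k).hyp_integrable σ
  have i4 : Integrable fun x => rh σ x * ∑ α, jet Zf k (pder α v) (hyp σ x) :=
    hyp_int (Sm.sum fun α => (hv.pder α).jet Zf_smooth k) σ (rh_smooth σ).continuous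
  have i12 : Integrable fun x => rh σ x * J1 Zf k u (hyp σ x) + m ^ 2 * jet Zf k u (hyp σ x) :=
    i1.add i2
  have i34 := (i3.add i4).const_mul (exp (-(2 * δ * σ)))
  refine ⟨i12.add i34, ?_⟩
  rw [← integral_const_mul, ← integral_add i1 i2, ← integral_add i3 i4, ← integral_const_mul]
  exact integral_add i12 i34

lemma int_rh_sum {f : Fin 4 → St → ℝ} (hf : ∀ α, Sm (f α)) (k : ℕ) (σ : ℝ) :
    ∫ x, rh σ x * ∑ α, jet Zf k (f α) (hyp σ x) =
      ∑ α, ∫ x, rh σ x * jet Zf k (f α) (hyp σ x) := by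
  simp only [Finset.mul_sum]
  exact integral_finsetSum _ fun α _ =>
    hyp_int ((hf α).jet Zf_smooth k) σ (rh_smooth σ).continuous

lemma int_rh_J1 {f : St → ℝ} (hf : Sm f) (k : ℕ) (σ : ℝ) :
    ∫ x, rh σ x * J1 Zf k f (hyp σ x) = (∫ x, rh σ x * jet Zf k f (hyp σ x)) +
      ∑ α, ∫ x, rh σ x * jet Zf k (pder α f) (hyp σ x) := by
  simp only [J1, mul_add]
  rw [integral_add (hyp_int (hf.jet Zf_smooth k) σ (rh_smooth σ).continuous)
    (hyp_int (Sm.sum fun α => (hf.pder α).jet Zf_smooth k) σ (rh_smooth σ).continuous),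
    int_rh_sum fun α => hf.pder α]

lemma ed_sup {u v : St → ℝ} (hu : Sm u) (hv : Sm v) (m δ σ : ℝ) (x : Sp) :
    htime σ x ^ 3 * ed 3 m δ σ u v x ≤ 864 * En m δ σ u v := by
  have r {f : St → ℝ} (hf : Sm f) : htime σ x ^ 3 * (rh σ x * jet Zf 3 f (hyp σ x)) ≤
      864 * ∫ x, rh σ x * jet Zf 6 f (hyp σ x) := by
    have := sup_hyp_jet 3 hf (rh_smooth σ) (rh_nonneg σ) (rh_pder σ) x
    norm_num at this
    exact this
  have o {f : St → ℝ} (hf : Sm f) : htime σ x ^ 3 * jet Zf 3 f (hyp σ x) ≤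
      864 * ∫ x, jet Zf 6 f (hyp σ x) := by
    have := sup_hyp_jet 3 hf (W := fun _ => 1) (σ := σ) contDiff_const (fun _ => zero_le_one)
      (fun a x => by simp [pderx]) x
    norm_num at this
    exact this
  have rs {f : Fin 4 → St → ℝ} (hf : ∀ α, Sm (f α)) :
      htime σ x ^ 3 * (rh σ x * ∑ α, jet Zf 3 (f α) (hyp σ x)) ≤
      864 * ∫ x, rh σ x * ∑ α, jet Zf 6 (f α) (hyp σ x) := by
    rw [int_rh_sum hf, Finset.mul_sum, Finset.mul_sum, Finset.mul_sum]
    exact Finset.sum_le_sum fun α _ => r (hf α)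
  have m2 := mul_le_mul_of_nonneg_left (o hu) (sq_nonneg m)
  have m3 := mul_le_mul_of_nonneg_left (add_le_add (o hv) (rs fun α => hv.pder α))
    (exp_pos (-(2 * δ * σ))).le
  have m1 := r hu
  have m4 := rs fun α => hu.pder α
  rw [En, (ed_int hu hv 6 m δ σ).2, int_rh_J1 hu, ← int_rh_sum fun α => hu.pder α, ed, J1]
  linarith

lemma source_algebra {t s X ρ E S ju Ju jd Jd jv Jv je Je : ℝ} (hs : 1 ≤ s) (hst : s ≤ t)
    (hts : t ≤ s ^ 2) (hX : 0 < X) (hsX : 1 ≤ s * X) (hρ : ρ * t ^ 2 = s ^ 2)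
    (hE : 0 ≤ E) (hS : 0 ≤ S)
    (n1 : 0 ≤ ju) (n2 : 0 ≤ Ju) (n3 : 0 ≤ jd) (n4 : 0 ≤ Jd) (n5 : 0 ≤ jv) (n6 : 0 ≤ Jv)
    (n7 : 0 ≤ je) (n8 : 0 ≤ Je)
    (h1 : t ^ 3 * (ρ * ju) ≤ S) (h2 : t ^ 3 * (ρ * jd) ≤ S) (h3 : t ^ 3 * (X * jv) ≤ S)
    (h4 : t ^ 3 * (X * (ρ * je)) ≤ S)
    (k1 : ρ * Ju ≤ E) (k2 : ρ * Jd ≤ E) (k3 : X * Jv ≤ E) (k4 : X * (ρ * Je) ≤ E) :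
    s ^ 2 * (jd * Jd + ju ^ 2 * Ju + (ju * Jv + Ju * jv)) ≤ (3 * S + S ^ 2) * E ∧
    s ^ 3 * X ^ 2 * (jv ^ 2 * Jv) ≤ S ^ 2 * E ∧
    s ^ 3 * X ^ 2 * (jv * Je + Jv * je) ≤ 2 * S * E ∧ s ^ 3 * X ^ 2 * (jv * Jv) ≤ S * E ∧
    s ^ 4 * X ^ 3 * (t ^ 2 * (jv ^ 2 * Jv)) ≤ S ^ 2 * E := by
  have ht : 0 < t := by linarith
  have hs0 : 0 < s := by linarith
  have ht1 : 1 ≤ t := hs.trans hst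
  have hρe : ρ = s ^ 2 / t ^ 2 := by field_simp; linarith
  have a1 : t * s ^ 2 * ju ≤ S := by
    have : t ^ 3 * (ρ * ju) = t * s ^ 2 * ju := by rw [hρe]; field_simp
    linarith
  have a2 : t * s ^ 2 * jd ≤ S := by
    have : t ^ 3 * (ρ * jd) = t * s ^ 2 * jd := by rw [hρe]; field_simp
    linarith
  have a4 : t * s ^ 2 * (X * je) ≤ S := by
    have : t ^ 3 * (X * (ρ * je)) = t * s ^ 2 * (X * je) := by rw [hρe]; field_simp
    linarith
  have d {J : ℝ} (h : ρ * J ≤ E) : s ^ 2 * J ≤ t ^ 2 * E := by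
    have := mul_le_mul_of_nonneg_left h (sq_nonneg t)
    rw [← mul_assoc, mul_comm _ ρ, hρ] at this
    exact this
  have b1 := d k1
  have b2 := d k2
  have b4 : s ^ 2 * (X * Je) ≤ t ^ 2 * E := d (by linarith)
  have a3 : t ^ 3 * X * jv ≤ S := by linarith
  have hSE : 0 ≤ S * E := mul_nonneg hS hE
  have hSSE : 0 ≤ S ^ 2 * E := by positivity
  have P {a b c e : ℝ} (h : a ≤ c) (h' : b ≤ e) (hb : 0 ≤ b) (hc : 0 ≤ c) : a * b ≤ c * e :=
    mul_le_mul h h' hb hc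
  have s2 : s ^ 2 ≤ t ^ 2 := by gcongr
  -- a product bound `κ * A ≤ μ * B` with `λ * μ ≤ κ` gives `λ * A ≤ B`
  have R {κ μ l A B : ℝ} (h : κ * A ≤ μ * B) (hμ : 0 < μ) (hl : l * μ ≤ κ) (hA : 0 ≤ A) :
      l * A ≤ B := by
    have := mul_le_mul_of_nonneg_right hl hA
    refine le_of_mul_le_mul_left ?_ hμ
    linarith
  have c1 : s ^ 2 * (jd * Jd) ≤ S * E := by
    refine R (κ := t * s ^ 2 * s ^ 2) (μ := t ^ 2) ?_ (by positivity) ?_ (by positivity)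
    · have := P a2 b2 (by positivity) hS
      linarith
    · have := mul_le_mul_of_nonneg_left hts (by positivity : 0 ≤ s ^ 2 * t)
      linarith
  have c2 : s ^ 2 * (ju ^ 2 * Ju) ≤ S ^ 2 * E := by
    refine R (κ := (t * s ^ 2) ^ 2 * s ^ 2) (μ := t ^ 2) ?_ (by positivity) ?_ (by positivity)
    · have := P (pow_le_pow_left₀ (by positivity) a1 2) b1 (by positivity) (sq_nonneg S)
      linarith
    · have := one_le_pow₀ hs (n := 4)
      have := mul_le_mul_of_nonneg_left this (by positivity : 0 ≤ s ^ 2 * t ^ 2)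
      linarith
  have c3 : s ^ 2 * (ju * Jv) ≤ S * E := by
    refine R (κ := t * s ^ 2 * X) (μ := 1) ?_ one_pos ?_ (by positivity)
    · have := P a1 k3 (by positivity) hS
      linarith
    · have : 1 ≤ t * X := hsX.trans (by gcongr)
      have := mul_le_mul_of_nonneg_left this (by positivity : 0 ≤ s ^ 2)
      linarith
  have c4 : s ^ 2 * (Ju * jv) ≤ S * E := by
    refine R (κ := t ^ 3 * X * s ^ 2) (μ := t ^ 2) ?_ (by positivity) ?_ (by positivity)
    · have := P a3 b1 (by positivity) hS
      linarith
    · have : 1 ≤ t * X := hsX.trans (by gcongr)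
      have := mul_le_mul_of_nonneg_left this (by positivity : 0 ≤ s ^ 2 * t ^ 2)
      linarith
  have x1 := P (pow_le_pow_left₀ (by positivity) a3 2) k3 (by positivity) (sq_nonneg S)
  have c5 : s ^ 4 * X ^ 3 * (t ^ 2 * (jv ^ 2 * Jv)) ≤ S ^ 2 * E := by
    refine R (κ := t ^ 4 * X ^ 3) (μ := 1) ?_ one_pos ?_ (by positivity)
    · linarith
    · rw [mul_one]; gcongr
  refine ⟨by linarith, ?_, ?_, ?_, c5⟩
  · refine R (κ := t ^ 6 * X ^ 3) (μ := 1) ?_ one_pos ?_ (by positivity)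
    · linarith
    · have h6 : s ^ 2 * s ^ 4 ≤ t ^ 2 * t ^ 4 := by gcongr
      have : 1 ≤ s ^ 3 * X := by
        have := one_le_pow₀ hs (n := 2)
        nlinarith [mul_nonneg hs0.le hX.le]
      have h7 := mul_le_mul_of_nonneg_left this (by positivity : 0 ≤ s ^ 3 * X ^ 2)
      have h8 := mul_le_mul_of_nonneg_right h6 (by positivity : 0 ≤ X ^ 3)
      linarith
  · have y1 : s ^ 3 * X ^ 2 * (jv * Je) ≤ S * E := by
      refine R (κ := t ^ 3 * X * (s ^ 2 * X)) (μ := t ^ 2) ?_ (by positivity) ?_ (by positivity)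
      · have := P a3 b4 (by positivity) hS
        linarith
      · have := mul_le_mul_of_nonneg_left hst (by positivity : 0 ≤ s ^ 2 * X ^ 2 * t ^ 2)
        linarith
    have y2 : s ^ 3 * X ^ 2 * (Jv * je) ≤ S * E := by
      refine R (κ := t * s ^ 2 * X * X) (μ := 1) ?_ one_pos ?_ (by positivity)
      · have := P a4 k3 (by positivity) hS
        linarith
      · have := mul_le_mul_of_nonneg_left hst (by positivity : 0 ≤ s ^ 2 * X ^ 2)
        linarith
    linarith
  · refine R (κ := t ^ 3 * X * X) (μ := 1) ?_ one_pos ?_ (by positivity)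
    · have := P a3 k3 (by positivity) hS
      linarith
    · have : s ^ 3 ≤ t ^ 3 := by gcongr
      have := mul_le_mul_of_nonneg_right this (by positivity : 0 ≤ X ^ 2)
      linarith

lemma int_le_of_pointwise {F : St → ℝ} (hF : Sm F) {w e : Sp → ℝ} (hw : Continuous w)
    (he : Integrable e) (he0 : ∀ x, 0 ≤ e x) {σ a c q : ℝ} (hc : 0 ≤ c)
    (h : ∀ x, rad x ≤ 1 + |htime σ x - 2| → a * (w x * F (hyp σ x)) ≤ c * e x)
    (hq : ∫ x, e x ≤ q) : a * ∫ x, w x * F (hyp σ x) ≤ c * q := by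
  refine le_trans ?_ (mul_le_mul_of_nonneg_left hq hc)
  rw [← integral_const_mul, ← integral_const_mul]
  refine integral_mono ((hyp_int hF σ hw).const_mul a) (he.const_mul c) fun x => ?_
  rcases le_or_gt (rad x) (1 + |htime σ x - 2|) with h1 | h1
  · exact h x h1
  · have : F (hyp σ x) = 0 := hF.2 _ (by rwa [hyp_zero, xs_hyp])
    simp only [this, mul_zero]
    exact mul_nonneg hc (he0 x)

lemma ed_nonneg (k : ℕ) (m δ σ : ℝ) (u v : St → ℝ) (x : Sp) : 0 ≤ ed k m δ σ u v x := by
  have h0 : ∀ (f : St → ℝ) y, 0 ≤ jet Zf k f y := fun f y => jet_nonneg _ _ _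
  have h1 := rh_nonneg σ x
  have h2 := J1_nonneg Zf k u (hyp σ x)
  have h3 : 0 ≤ ∑ α, jet Zf k (pder α v) (hyp σ x) := Finset.sum_nonneg fun α _ => h0 _ _
  have h4 := h0 u (hyp σ x)
  have h5 := h0 v (hyp σ x)
  rw [ed]
  positivity

lemma ed_parts (k : ℕ) (m δ σ : ℝ) (u v : St → ℝ) (x : Sp) :
    rh σ x * jet Zf k u (hyp σ x) ≤ ed k m δ σ u v x ∧
    rh σ x * jet Zf k (pder 0 u) (hyp σ x) ≤ ed k m δ σ u v x ∧
    m ^ 2 * jet Zf k u (hyp σ x) ≤ ed k m δ σ u v x ∧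
    exp (-(2 * δ * σ)) * jet Zf k v (hyp σ x) ≤ ed k m δ σ u v x ∧
    exp (-(2 * δ * σ)) * (rh σ x * ∑ α, jet Zf k (pder α v) (hyp σ x)) ≤ ed k m δ σ u v x := by
  have h0 : ∀ (f : St → ℝ) y, 0 ≤ jet Zf k f y := fun f y => jet_nonneg _ _ _
  have h1 := rh_nonneg σ x
  have h3 : 0 ≤ ∑ α, jet Zf k (pder α v) (hyp σ x) := Finset.sum_nonneg fun α _ => h0 _ _
  have h4 := h0 u (hyp σ x)
  have h5 := h0 v (hyp σ x)
  have h6 := exp_pos (-(2 * δ * σ))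
  have h7 := Finset.single_le_sum (f := fun α => jet Zf k (pder α u) (hyp σ x))
    (fun α _ => h0 _ _) (Finset.mem_univ 0)
  have h8 := h0 (pder 0 u) (hyp σ x)
  have e1 := mul_nonneg h1 h4
  have e2 := mul_nonneg h1 h8
  have e3 := mul_le_mul_of_nonneg_left h7 h1
  have e4 := mul_nonneg (sq_nonneg m) h4
  have e5 := mul_nonneg h6.le h5
  have e6 := mul_nonneg h6.le (mul_nonneg h1 h3)
  rw [ed, J1]
  refine ⟨?_, ?_, ?_, ?_, ?_⟩ <;> linarith

lemma source_int (p : Par) : ∃ C : ℝ, 0 ≤ C ∧ ∀ {u v : St → ℝ}, Sm u → Sm v →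
    ∀ {m δ σ q : ℝ}, δ ∈ Set.Icc (0 : ℝ) (1 / 2) → 2 ≤ exp σ → q ≤ 1 → En m δ σ u v ≤ q →
      exp σ ^ 2 * (∫ x, jet Zf 6 (Fv p u v) (hyp σ x)) ≤ C * q ^ 2 ∧
      exp σ ^ 3 * exp (-(2 * δ * σ)) ^ 2 * (∫ x, jet Zf 6 (Fu p v) (hyp σ x)) ≤ C * q ^ 2 ∧
      exp σ ^ 3 * exp (-(2 * δ * σ)) ^ 2 * (∫ x, jet Zf 6 (fun y => v y ^ 2) (hyp σ x)) ≤
        C * q ^ 2 ∧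
      exp σ ^ 4 * exp (-(2 * δ * σ)) ^ 3 *
        (∫ x, htime σ x ^ 2 * jet Zf 6 (fun y => v y ^ 3) (hyp σ x)) ≤ C * q ^ 2 := by
  obtain ⟨C1, hC1, h1⟩ := jet_Fu_le Zf_smooth p 6
  obtain ⟨C2, hC2, h2⟩ := jet_Fv_le Zf_smooth p 6
  obtain ⟨C3, hC3, h3⟩ := jet_cube_tame Zf_smooth 6
  obtain ⟨C4, hC4⟩ : ∃ C : ℝ, C = 5 ^ 6 * ((6 : ℕ) + 1) := ⟨_, rfl⟩
  have hC4' : 0 ≤ C4 := by rw [hC4]; positivity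
  obtain ⟨c, hc⟩ : ∃ c : ℝ, c = 864 := ⟨_, rfl⟩
  have hc0 : 0 ≤ c := by rw [hc]; norm_num
  refine ⟨(C1 + C2 + C3 + 2 * C4) * (3 * c + c ^ 2), by positivity,
    fun {u v} hu hv {m δ σ q} hδ hs hq hE => ?_⟩
  have hq0 : 0 ≤ q := (integral_nonneg fun x => ed_nonneg _ _ _ _ _ _ _).trans hE
  have hc2 : 3 * (c * q) + (c * q) ^ 2 ≤ (3 * c + c ^ 2) * q := by
    have := mul_le_mul_of_nonneg_left (mul_le_of_le_one_left hq0 hq) (sq_nonneg c)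
    linarith
  have key (x : Sp) (hx : rad x ≤ 1 + |htime σ x - 2|) := by
    have ht := exp_le_htime σ x
    have ht2 := htime_le_of_supp hx (hs.trans ht)
    have e2 : exp (2 * σ) = exp σ ^ 2 := by rw [← exp_nat_mul]; norm_num
    rw [e2] at ht2
    have hσ : 0 ≤ σ := by
      by_contra hn
      linarith [exp_le_one_iff.2 (not_le.1 hn).le]
    have hsX : 1 ≤ exp σ * exp (-(2 * δ * σ)) := by
      rw [← exp_add]
      exact one_le_exp (by nlinarith [mul_le_mul_of_nonneg_right hδ.2 hσ])
    have sup := (ed_sup hu hv m δ σ x).trans (mul_le_mul_of_nonneg_left hE (by norm_num))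
    rw [← hc] at sup
    have l := fun {a : ℝ} (h : a ≤ ed 3 m δ σ u v x) =>
      (mul_le_mul_of_nonneg_left h (pow_nonneg (htime_pos σ x).le 3)).trans sup
    obtain ⟨a1, a2, -, a4, a5⟩ := ed_parts 3 m δ σ u v x
    obtain ⟨b1, b2, -, b4, b5⟩ := ed_parts 6 m δ σ u v x
    exact source_algebra (by linarith) ht (by nlinarith) (exp_pos _) hsX (rh_mul σ x)
      (ed_nonneg 6 m δ σ u v x) (mul_nonneg hc0 hq0) (jet_nonneg _ _ _) (jet_nonneg _ _ _)
      (jet_nonneg _ _ _) (jet_nonneg _ _ _) (jet_nonneg _ _ _) (jet_nonneg _ _ _)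
      (Finset.sum_nonneg fun α _ => jet_nonneg _ _ _)
      (Finset.sum_nonneg fun α _ => jet_nonneg _ _ _) (l a1) (l a2) (l a4) (l a5) b1 b2 b4 b5
  have hi := (ed_int hu hv 6 m δ σ).1
  have h0 := ed_nonneg 6 m δ σ u v
  have hcq : 0 ≤ c * q := mul_nonneg hc0 hq0
  have hcq2 := sq_nonneg (c * q)
  have fin {F : St → ℝ} (hF : Sm F) {w : Sp → ℝ} (hw : Continuous w) {a B D : ℝ} (hB : 0 ≤ B)
      (hD : 0 ≤ D) (hBC : B ≤ C1 + C2 + C3 + 2 * C4) (hDC : D ≤ 3 * (c * q) + (c * q) ^ 2)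
      (h : ∀ x, rad x ≤ 1 + |htime σ x - 2| → a * (w x * F (hyp σ x)) ≤
        B * D * ed 6 m δ σ u v x) :
      a * ∫ x, w x * F (hyp σ x) ≤ (C1 + C2 + C3 + 2 * C4) * (3 * c + c ^ 2) * q ^ 2 := by
    refine (int_le_of_pointwise hF hw hi h0 (mul_nonneg hB hD) h hE).trans ?_
    have := mul_le_mul hBC (hDC.trans hc2) hD (by positivity)
    have := mul_le_mul_of_nonneg_right this hq0
    linarith
  have fin1 {F : St → ℝ} (hF : Sm F) {a B D : ℝ} (hB : 0 ≤ B)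
      (hD : 0 ≤ D) (hBC : B ≤ C1 + C2 + C3 + 2 * C4) (hDC : D ≤ 3 * (c * q) + (c * q) ^ 2)
      (h : ∀ x, rad x ≤ 1 + |htime σ x - 2| → a * F (hyp σ x) ≤ B * D * ed 6 m δ σ u v x) :
      a * ∫ x, F (hyp σ x) ≤ (C1 + C2 + C3 + 2 * C4) * (3 * c + c ^ 2) * q ^ 2 := by
    have := fin hF (w := fun _ => 1) continuous_const hB hD hBC hDC (a := a)
      (fun x hx => by rw [one_mul]; exact h x hx)
    simpa only [one_mul] using this
  have hs0 := (exp_pos σ).le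
  have hX0 := (exp_pos (-(2 * δ * σ))).le
  refine ⟨?_, ?_, ?_, ?_⟩
  · refine fin1 ((hu.Fv hv p).jet Zf_smooth 6) hC2 (by positivity) (by linarith) le_rfl fun x hx => ?_
    have r := mul_le_mul_of_nonneg_left (h2 u v hu.1 hv.1 (hyp σ x)) (pow_nonneg hs0 2)
    have r2 := mul_le_mul_of_nonneg_left (key x hx).1 hC2
    norm_num at r
    linarith
  · refine fin1 ((hv.Fu p).jet Zf_smooth 6) (D := (c * q) ^ 2 + 2 * (c * q)) hC1 (by positivity)
      (by linarith) (by linarith) fun x hx => ?_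
    have r := mul_le_mul_of_nonneg_left (h1 v hv.1 (hyp σ x))
      (mul_nonneg (pow_nonneg hs0 3) (pow_nonneg hX0 2))
    have r2 := mul_le_mul_of_nonneg_left (add_le_add (key x hx).2.1 (key x hx).2.2.1) hC1
    rw [Finset.sum_add_distrib, ← Finset.mul_sum, ← Finset.mul_sum] at r
    norm_num at r
    linarith
  · refine fin1 ((hv.pow two_ne_zero).jet Zf_smooth 6) (B := 2 * C4) (D := c * q) (by positivity)
      hcq (by linarith) (by linarith) fun x hx => ?_
    have r0 := jet_mul_tame Zf_smooth 6 hv.1 hv.1 (hyp σ x)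
    rw [← hC4] at r0
    have r := mul_le_mul_of_nonneg_left r0 (mul_nonneg (pow_nonneg hs0 3) (pow_nonneg hX0 2))
    have r2 := mul_le_mul_of_nonneg_left (key x hx).2.2.2.1 hC4'
    simp only [sq (v _)]
    norm_num at r
    linarith
  · refine fin ((hv.pow three_ne_zero).jet Zf_smooth 6) (D := (c * q) ^ 2)
      ((htime_smooth_right σ).continuous.pow 2) hC3 (by positivity) (by linarith) (by linarith)
      fun x hx => ?_
    have r := mul_le_mul_of_nonneg_left (h3 v hv.1 (hyp σ x))
      (mul_nonneg (mul_nonneg (pow_nonneg hs0 4) (pow_nonneg hX0 3)) (sq_nonneg (htime σ x)))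
    have r2 := mul_le_mul_of_nonneg_left (key x hx).2.2.2.2 hC3
    norm_num at r
    rw [Pi.pow_apply]
    linarith

lemma decay_bound {f S : ℝ → ℝ} {s B e : ℝ} (hs : 0 ≤ s) (hB : 0 ≤ B) (h0 : 0 ≤ f s) (he : f s ≤ e)
    (hd : ∀ t, s ≤ t → ∃ D, HasDerivAt f D t ∧ ∀ κ : ℝ, 0 < κ → D ≤ κ * f t + S t / κ)
    (hS : ∀ t, s ≤ t → S t ≤ B * exp (-(1 / 5) * t)) {t : ℝ} (ht : s ≤ t) :
    f t ≤ exp 10 * (e + 10 * B) := by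
  choose! D hD using hd
  have := gronwall_decay (f' := D) (T := t) (k := 1) (b := B) (c := 1 / 10) hs
    (fun r hr => (hD r hr.1).1) (fun r hr => ?_) (by norm_num) zero_le_one hB h0 ⟨ht, le_rfl⟩
  · refine this.trans ?_
    rw [show B / (1 / 10) = 10 * B by ring, show (1 : ℝ) / (1 / 10) = 10 by norm_num]
    gcongr
  · refine ((hD r hr.1).2 _ (exp_pos (-(1 / 10) * r))).trans ?_
    rw [one_mul]
    refine add_le_add le_rfl ((div_le_iff₀ (exp_pos _)).2 ((hS r hr.1).trans_eq ?_))
    rw [mul_assoc, ← exp_add]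
    ring_nf

lemma growth_bound {f S : ℝ → ℝ} {s B e δ : ℝ} (hs : 0 ≤ s) (hδ : 0 < δ) (hB : 0 ≤ B) (h0 : 0 ≤ f s)
    (he : f s ≤ e)
    (hd : ∀ t, s ≤ t → ∃ D, HasDerivAt f D t ∧ ∀ κ : ℝ, 0 < κ → D ≤ κ * f t + S t / κ)
    (hS : ∀ t, s ≤ t → S t ≤ B) {t : ℝ} (ht : s ≤ t) :
    f t ≤ (e + B / δ ^ 2) * exp (2 * δ * t) := by
  choose! D hD using hd
  have := gronwall_exp (f := fun r => f (s + r)) (f' := fun r => D (s + r)) (T := t - s) (a := δ)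
    (b := B / δ) (l := 2 * δ) (fun r hr => ((hD (s + r) (by linarith [hr.1])).1.comp_const_add s r))
    (fun r hr => ?_) (by linarith) (by positivity) (by simpa using h0) (t := t - s)
    ⟨by linarith, le_rfl⟩
  · simp only [add_zero, add_sub_cancel] at this
    refine this.trans (mul_le_mul ?_ (exp_le_exp.2 (by nlinarith)) (exp_pos _).le
      (add_nonneg (h0.trans he) (by positivity)))
    rw [show 2 * δ - δ = δ by ring, div_div, ← sq]
    linarith
  · have h1 := hS (s + r) (by linarith [hr.1])
    have h2 : S (s + r) / δ ≤ B / δ := by gcongr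
    have h3 : B / δ ≤ B / δ * exp (2 * δ * r) := le_mul_of_one_le_right (by positivity)
      (one_le_exp (by have := hr.1; positivity))
    linarith [(hD (s + r) (by linarith [hr.1])).2 δ hδ]

lemma exp_weight {σ δ a B I : ℝ} {n j : ℕ} (h : exp σ ^ n * exp (-(2 * δ * σ)) ^ j * I ≤ B)
    (hI : 0 ≤ I) (he : (a + 1 / 5) * σ ≤ n * σ - j * (2 * δ * σ)) :
    exp (a * σ) * I ≤ B * exp (-(1 / 5) * σ) := by
  have h1 : exp (a * σ) ≤ exp σ ^ n * exp (-(2 * δ * σ)) ^ j * exp (-(1 / 5) * σ) := by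
    rw [← exp_nat_mul, ← exp_nat_mul, ← exp_add, ← exp_add]
    exact exp_le_exp.2 (by linarith)
  have h2 := mul_le_mul_of_nonneg_right h1 hI
  have h3 := mul_le_mul_of_nonneg_right h (exp_pos (-(1 / 5) * σ)).le
  linarith

lemma coord_sq_le (σ : ℝ) (x : Sp) (hs : 1 ≤ exp σ) : 1 + ∑ β, hyp σ x β ^ 2 ≤ 3 * htime σ x ^ 2 := by
  have h1 := one_le_pow₀ (hs.trans (exp_le_htime σ x)) (n := 2)
  rw [Fin.sum_univ_succ]
  simp only [hyp_zero, hyp_succ]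
  have := htime_sq σ x
  have := exp_pos (2 * σ)
  linarith

lemma two_le_exp {σ : ℝ} (h : log 2 ≤ σ) : 2 ≤ exp σ := (log_le_iff_le_exp two_pos).1 h

namespace StepRel

lemma energy (p : Par) {δ : ℝ} (hδ : 0 < δ) (hδ' : δ < 1 / 10) : ∃ C : ℝ, 0 ≤ C ∧
    ∀ {m d u v u' v' g w}, StepRel p m d u v u' v' g w → m ∈ Set.Icc (0 : ℝ) 1 → Sm u → Sm v →
      ∀ {q e : ℝ}, q ≤ 1 → (∀ σ, log 2 ≤ σ → En m δ σ u v ≤ q) → TE 6 (log 2) g ≤ e →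
        (∀ α, HE m 6 (log 2) (w α) ≤ e) → HE m 6 (log 2) u' ≤ e → HE 1 6 (log 2) v' ≤ e →
          ∀ σ, log 2 ≤ σ → En m δ σ u' v' ≤ C * (e + q ^ 2) := by
  obtain ⟨C0, hC0, hsrc⟩ := source_int p
  obtain ⟨Ch, hCh, hco⟩ := HE_coercive 6
  obtain ⟨L, hL⟩ : ∃ L : ℝ, L = log 2 := ⟨_, rfl⟩
  have hL0 : 0 ≤ L := by rw [hL]; exact log_nonneg (by norm_num)
  obtain ⟨E, hE⟩ : ∃ E : ℝ, E = exp 10 := ⟨_, rfl⟩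
  have hE1 : 1 ≤ E := hE ▸ one_le_exp (by norm_num)
  obtain ⟨c, hc⟩ : ∃ c : ℝ, c = 5 ^ 6 * ((6 : ℕ) + 1) * (8 ^ 6 * 3) := ⟨_, rfl⟩
  have hc0 : 0 ≤ c := by rw [hc]; positivity
  set A1 := E * (1 + 10 * (p.M1 ^ 2 * C0)) with hA1
  have hA1' : 0 ≤ A1 := by positivity
  set B : Fin 4 → ℝ := fun α => p.P α ^ 2 * C0 + c * A1 with hB
  have hB0 : ∀ α, 0 ≤ B α := fun α => by positivity
  have hsum : 0 ≤ ∑ α, Ch * (E * (1 + 10 * B α)) := Finset.sum_nonneg fun α _ => by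
    have := hB0 α
    positivity
  refine ⟨4 * ∑ α, Ch * (E * (1 + 10 * B α)) + Ch * (E * (1 + 10 * C0)) + Ch * (1 + C0 / δ ^ 2),
    by positivity,
    fun {m d u v u' v' g w} h hm hu hv {q e} hq hen hg hw hu' hv' => ?_⟩
  rw [← hL] at hen hg hw hu' hv' ⊢
  have he0 : 0 ≤ e := (TE_nonneg _ _ _).trans hg
  set Q := e + q ^ 2 with hQ
  have hqQ : q ^ 2 ≤ Q := by rw [hQ]; linarith
  have heQ : e ≤ Q := by rw [hQ]; nlinarith
  have hQ0 : 0 ≤ Q := he0.trans heQ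
  have two {σ : ℝ} (hσ : L ≤ σ) : 2 ≤ exp σ := two_le_exp (hL ▸ hσ)
  have src {σ : ℝ} (hσ : L ≤ σ) :=
    hsrc hu hv (σ := σ) (q := q) ⟨hδ.le, by linarith⟩ (two hσ) hq (hen σ hσ)
  have J0 {f : St → ℝ} {σ : ℝ} : 0 ≤ ∫ x, jet Zf 6 f (hyp σ x) :=
    integral_nonneg fun x => jet_nonneg _ _ _
  have gT (σ : ℝ) (hσ : L ≤ σ) : TE 6 σ g ≤ A1 * Q := by
    refine (decay_bound (S := fun σ => exp (3 * σ) * ∫ x, htime σ x ^ 2 *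
      jet Zf 6 (fun y => p.M1 * v y ^ 3) (hyp σ x)) (B := p.M1 ^ 2 * (C0 * q ^ 2)) (f := fun σ => TE 6 σ g)
      hL0 (by positivity) (TE_nonneg _ _ _) hg (fun σ hσ => ?_) (fun σ hσ => ?_) hσ).trans ?_
    · obtain ⟨D, h1, h2⟩ := TE_deriv 6 h.smg ((hv.pow three_ne_zero).const_mul p.M1) le_rfl h.eqg
        (σ := σ) (by linarith [two hσ])
      refine ⟨D, h1, fun κ hκ => (h2 κ hκ).trans_eq ?_⟩
      ring
    · have e1 : ∫ x, htime σ x ^ 2 * jet Zf 6 (fun y => p.M1 * v y ^ 3) (hyp σ x) =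
          p.M1 ^ 2 * ∫ x, htime σ x ^ 2 * jet Zf 6 (fun y => v y ^ 3) (hyp σ x) := by
        rw [← integral_const_mul]
        refine integral_congr_ae (.of_forall fun x => ?_)
        simp only [jet_const_mul Zf_smooth p.M1 6 (hv.1.pow 3)]
        ring
      have e2 := exp_weight (a := 3) (src hσ).2.2.2
        (integral_nonneg fun x => mul_nonneg (sq_nonneg _) (jet_nonneg _ _ _))
        (by norm_num; nlinarith)
      have e3 := mul_le_mul_of_nonneg_left e2 (sq_nonneg p.M1)
      simp only [e1]
      linarith
    · rw [hA1, ← hE]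
      have := mul_le_mul_of_nonneg_left hqQ (by positivity : 0 ≤ E * (10 * (p.M1 ^ 2 * C0)))
      have := mul_le_mul_of_nonneg_left heQ (by linarith : 0 ≤ E)
      linarith
  have wT (α : Fin 4) (σ : ℝ) (hσ : L ≤ σ) : HE m 6 σ (w α) ≤ E * (1 + 10 * B α) * Q := by
    refine (decay_bound (S := fun σ => exp (2 * σ) / 2 * ∫ x, jet Zf 6 (KG m (w α)) (hyp σ x))
      (B := B α * Q) (f := fun σ => HE m 6 σ (w α)) hL0 (mul_nonneg (hB0 α) hQ0)
      (HE_nonneg _ _ _ _) (hw α) (fun σ hσ => ?_) (fun σ hσ => ?_) hσ).trans ?_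
    · obtain ⟨D, h1, h2⟩ := HE_deriv (h.smw α) m 6 σ
      refine ⟨D, h1, fun κ hκ => (h2 κ hκ).trans_eq ?_⟩
      field_simp
    · have hσ0 : 0 ≤ σ := hL0.trans hσ
      have s1 : Sm fun y => v y ^ 2 := hv.pow two_ne_zero
      have i2 : Integrable fun x => htime σ x ^ 2 * jet Zf 6 g (hyp σ x) :=
        hyp_int (h.smg.jet Zf_smooth 6) σ ((htime_smooth_right σ).continuous.pow 2)
      have i1 := (s1.jet Zf_smooth 6).hyp_integrable σ
      have e1 : ∫ x, jet Zf 6 (KG m (w α)) (hyp σ x) ≤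
          2 * p.P α ^ 2 * (∫ x, jet Zf 6 (fun y => v y ^ 2) (hyp σ x)) +
          2 * c * ∫ x, htime σ x ^ 2 * jet Zf 6 g (hyp σ x) := by
        rw [← integral_const_mul, ← integral_const_mul, ← integral_add (i1.const_mul _) (i2.const_mul _),
          h.eqw α]
        refine integral_mono ((((s1.const_mul (p.P α)).add (h.smg.smul (coord_smooth α))).jet
          Zf_smooth 6).hyp_integrable σ) ((i1.const_mul _).add (i2.const_mul _)) fun x => ?_
        have r1 := jet_add_le Zf_smooth 6 (s1.const_mul (p.P α)).1
          (h.smg.smul (coord_smooth α)).1 (hyp σ x)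
        rw [jet_const_mul Zf_smooth _ 6 s1.1] at r1
        have r2 := jet_mul_le Zf_smooth 6 (coord_smooth α) h.smg.1 (hyp σ x)
        have r3 := (jet_coord_le 6 α (hyp σ x)).trans (mul_le_mul_of_nonneg_left
          (coord_sq_le σ x (by linarith [two hσ])) (by positivity))
        have r4 := mul_le_mul_of_nonneg_right r3 (jet_nonneg (X := Zf) 6 g (hyp σ x))
        have r5 := mul_le_mul_of_nonneg_left r4 (by positivity : (0 : ℝ) ≤ 5 ^ 6 * ((6 : ℕ) + 1))
        have r6 : jet Zf 6 (fun y => y α * g y) (hyp σ x) ≤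
            c * (htime σ x ^ 2 * jet Zf 6 g (hyp σ x)) := by rw [hc]; linarith
        simp only
        linarith
      have e2 := exp_weight (a := 2) (src hσ).2.2.1 J0 (by norm_num; nlinarith)
      have e3 : exp (2 * σ) * (∫ x, htime σ x ^ 2 * jet Zf 6 g (hyp σ x)) ≤
          A1 * Q * exp (-(1 / 5) * σ) := by
        refine exp_weight (n := 3) (j := 0) (δ := 0) ?_
          (integral_nonneg fun x => mul_nonneg (sq_nonneg _) (jet_nonneg _ _ _)) (by norm_num; linarith)
        have := gT σ hσ
        rw [TE_eq h.smg] at this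
        rw [pow_zero, mul_one, ← exp_nat_mul]
        exact_mod_cast this
      have e4 := mul_le_mul_of_nonneg_left e1 (by positivity : 0 ≤ exp (2 * σ) / 2)
      have e5 := mul_le_mul_of_nonneg_left e2 (sq_nonneg (p.P α))
      have e6 := mul_le_mul_of_nonneg_left e3 hc0
      have e7 := mul_le_mul_of_nonneg_left hqQ
        (by positivity : 0 ≤ p.P α ^ 2 * C0 * exp (-(1 / 5) * σ))
      simp only [hB]
      linarith
    · rw [← hE]
      have := mul_le_mul_of_nonneg_left heQ (by linarith : 0 ≤ E)
      linarith
  have uT (σ : ℝ) (hσ : L ≤ σ) : HE m 6 σ u' ≤ E * (1 + 10 * C0) * Q := by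
    refine (decay_bound (S := fun σ => exp (2 * σ) / 2 * ∫ x, jet Zf 6 (KG m u') (hyp σ x))
      (B := C0 * Q) (f := fun σ => HE m 6 σ u') hL0 (by positivity)
      (HE_nonneg _ _ _ _) hu' (fun σ hσ => ?_) (fun σ hσ => ?_) hσ).trans ?_
    · obtain ⟨D, h1, h2⟩ := HE_deriv h.smu m 6 σ
      refine ⟨D, h1, fun κ hκ => (h2 κ hκ).trans_eq ?_⟩
      field_simp
    · have hσ0 : 0 ≤ σ := hL0.trans hσ
      have e1 : ∫ x, jet Zf 6 (KG m u') (hyp σ x) = ∫ x, jet Zf 6 (Fu p v) (hyp σ x) := by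
        refine integral_congr_ae (.of_forall fun x => ?_)
        refine jet_congr (isOpen_time (3 / 2)) (fun y hy => h.equ hv hy) 6 ?_
        have := exp_le_htime σ x
        have := two hσ
        change 3 / 2 < htime σ x
        linarith
      have e2 := exp_weight (a := 2) (src hσ).2.1 J0 (by norm_num; nlinarith)
      have e7 := mul_le_mul_of_nonneg_left hqQ (by positivity : 0 ≤ C0 * exp (-(1 / 5) * σ))
      have e8 : 0 ≤ C0 * Q * exp (-(1 / 5) * σ) := by positivity
      simp only [e1]
      linarith
    · rw [← hE]
      have := mul_le_mul_of_nonneg_left heQ (by linarith : 0 ≤ E)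
      linarith
  have vT (σ : ℝ) (hσ : L ≤ σ) : HE 1 6 σ v' ≤ (1 + C0 / δ ^ 2) * Q * exp (2 * δ * σ) := by
    refine (growth_bound (S := fun σ => exp (2 * σ) / 2 * ∫ x, jet Zf 6 (KG 1 v') (hyp σ x))
      (B := C0 * Q) (f := fun σ => HE 1 6 σ v') hL0 hδ (by positivity)
      (HE_nonneg _ _ _ _) hv' (fun σ hσ => ?_) (fun σ hσ => ?_) hσ).trans ?_
    · obtain ⟨D, h1, h2⟩ := HE_deriv h.smv 1 6 σ
      refine ⟨D, h1, fun κ hκ => (h2 κ hκ).trans_eq ?_⟩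
      field_simp
    · have e2 := (src hσ).1
      have e3 : exp (2 * σ) = exp σ ^ 2 := by rw [← exp_nat_mul]; norm_num
      have e7 := mul_le_mul_of_nonneg_left hqQ hC0
      have e8 : 0 ≤ C0 * Q := by positivity
      simp only [h.eqv, e3]
      linarith
    · refine mul_le_mul_of_nonneg_right ?_ (exp_pos _).le
      rw [add_mul, one_mul, mul_div_right_comm]
      linarith
  intro σ hσ
  have hr := (rh_smooth σ).continuous
  have hu1 : ∫ x, rh σ x * jet Zf 6 u' (hyp σ x) ≤
      4 * ∑ α, ∫ x, rh σ x * jet Zf 6 (pder α (w α)) (hyp σ x) := by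
    rw [← int_rh_sum fun α => (h.smw α).pder α, ← integral_const_mul]
    refine integral_mono (hyp_int (h.smu.jet Zf_smooth 6) σ hr) ((hyp_int (Sm.sum fun α =>
      ((h.smw α).pder α).jet Zf_smooth 6) σ hr).const_mul 4) fun x => ?_
    have := jet_sum_le Zf_smooth 6 (fun α => ((h.smw α).pder α).1) (hyp σ x)
    push_cast at this
    rw [h.equ']
    have := mul_le_mul_of_nonneg_left this (rh_nonneg σ x)
    simp only
    linarith
  have nn {f : St → ℝ} : 0 ≤ ∫ x, rh σ x * jet Zf 6 f (hyp σ x) :=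
    integral_nonneg fun x => mul_nonneg (rh_nonneg _ _) (jet_nonneg _ _ _)
  have hw1 : ∑ α, ∫ x, rh σ x * jet Zf 6 (pder α (w α)) (hyp σ x) ≤
      ∑ α, Ch * (E * (1 + 10 * B α)) * Q := by
    refine Finset.sum_le_sum fun α _ => ?_
    have r1 := hco (w α) (h.smw α) m σ
    have r2 := Finset.single_le_sum (f := fun β => ∫ x, rh σ x * jet Zf 6 (pder β (w α)) (hyp σ x))
      (fun β _ => nn) (Finset.mem_univ α)
    have r3 := mul_le_mul_of_nonneg_left (wT α σ hσ) hCh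
    have r4 := mul_nonneg (sq_nonneg m) (J0 (f := w α) (σ := σ))
    change (∑ β, ∫ x, rh σ x * jet Zf 6 (pder β (w α)) (hyp σ x)) + _ ≤ _ at r1
    linarith
  have r1 := hco u' h.smu m σ
  have r2 := hco v' h.smv 1 σ
  change (∑ β, ∫ x, rh σ x * jet Zf 6 (pder β u') (hyp σ x)) + _ ≤ _ at r1
  change (∑ β, ∫ x, rh σ x * jet Zf 6 (pder β v') (hyp σ x)) + _ ≤ _ at r2
  have r3 := mul_le_mul_of_nonneg_left (uT σ hσ) hCh
  have r4 := mul_le_mul_of_nonneg_left (vT σ hσ) hCh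
  have r5 := mul_le_mul_of_nonneg_left (r2.trans r4) (exp_pos (-(2 * δ * σ))).le
  have r6 : exp (-(2 * δ * σ)) * (Ch * ((1 + C0 / δ ^ 2) * Q * exp (2 * δ * σ))) =
      Ch * (1 + C0 / δ ^ 2) * Q := by
    have : exp (-(2 * δ * σ)) * exp (2 * δ * σ) = 1 := by rw [← exp_add]; simp
    linear_combination Ch * (1 + C0 / δ ^ 2) * Q * this
  rw [En, (ed_int h.smu h.smv 6 m δ σ).2, int_rh_J1 h.smu, int_rh_sum fun α => h.smv.pder α]
  rw [← Finset.sum_mul] at hw1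
  linarith

end StepRel

lemma hyp_mem_slab {x : Sp} (h : rad x ≤ 1 + |htime (log 2) x - 2|) :
    hyp (log 2) x ∈ slab ∧ rad x ≤ 2 ∧ htime (log 2) x ≤ 5 / 2 := by
  have h1 := exp_le_htime (log 2) x
  rw [exp_log two_pos] at h1
  have h2 := htime_le_of_supp h h1
  rw [two_mul (log 2), exp_add, exp_log two_pos] at h2
  rw [abs_of_nonneg (by linarith)] at h
  refine ⟨⟨?_, ?_⟩, by linarith, by linarith⟩ <;> rw [hyp_zero] <;> linarith

/-- The initial hyperboloid meets the light cone inside the slab. -/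
lemma integral_hyp_slab : ∃ C : ℝ, 0 ≤ C ∧ ∀ f, Sm f → ∀ B, (∀ y ∈ slab, jet pd 7 f y ≤ B) →
    ∫ x, htime (log 2) x ^ 2 * jet Zf 7 f (hyp (log 2) x) ≤ C * B := by
  obtain ⟨C, hC, h⟩ := jet_Zf_le 7
  refine ⟨volume.real {x : Sp | rad x ≤ 2} * (7 * (C * 20 ^ 7)), by positivity, fun f hf B hB => ?_⟩
  have hB0 : 0 ≤ B := (jet_nonneg _ _ _).trans (hB (spt 2 0) (show (2 : ℝ) ∈ Set.Icc (7 / 4) 3 by norm_num))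
  have hz : ∀ x, ¬ rad x ≤ 1 + |htime (log 2) x - 2| → jet Zf 7 f (hyp (log 2) x) = 0 := fun x hx =>
    (hf.jet Zf_smooth 7).supp _ (not_le.1 hx)
  have := integral_le_of_rad (F := fun x => htime (log 2) x ^ 2 * jet Zf 7 f (hyp (log 2) x))
    (B := 7 * (C * 20 ^ 7) * B) (fun x => mul_nonneg (sq_nonneg _) (jet_nonneg _ _ _)) (fun x => ?_)
    (fun x hx => ?_)
  · linarith
  · by_cases hx : rad x ≤ 1 + |htime (log 2) x - 2|
    · obtain ⟨h1, -, h3⟩ := hyp_mem_slab hx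
      have h4 : htime (log 2) x ^ 2 ≤ 25 / 4 := by nlinarith [htime_pos (log 2) x]
      have h5 : 1 + ∑ β, hyp (log 2) x β ^ 2 ≤ 20 :=
        (coord_sq_le _ x (by rw [exp_log two_pos]; norm_num)).trans (by linarith)
      have h6 : 0 ≤ 1 + ∑ β, hyp (log 2) x β ^ 2 := by positivity
      calc _ ≤ 7 * (C * 20 ^ 7 * B) := mul_le_mul (by linarith) ((h f hf.1 _).trans
            (mul_le_mul (by gcongr) (hB _ h1) (jet_nonneg _ _ _) (by positivity)))
            (jet_nonneg _ _ _) (by norm_num)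
        _ = _ := by ring
    · simp only [hz x hx, mul_zero]
      positivity
  · rw [hz x fun h => absurd (hyp_mem_slab h).2.1 (not_le.2 hx), mul_zero]

lemma pder_zero_fun (α : Fin 4) : pder α (fun _ => 0) = fun _ => 0 := by
  funext y
  simp [pder]

lemma En_zero (m δ σ : ℝ) : En m δ σ (fun _ => 0) (fun _ => 0) = 0 := by
  simp [En, ed, J1, pder_zero_fun, jet_const_zero Zf_smooth]

namespace Iter

lemma initial (p : Par) : ∃ C E : ℝ, 0 ≤ C ∧ 0 < E ∧ ∀ {m d U V G W}, Iter p m d U V G W →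
    m ∈ Set.Icc (0 : ℝ) 1 → ∀ {N : ℕ}, 14 ≤ N → ∀ e, datE N d ≤ e → e ≤ E → ∀ n,
      TE 6 (log 2) (G n) ≤ C * e ∧ (∀ α, HE m 6 (log 2) (W n α) ≤ C * e) ∧
        HE m 6 (log 2) (U n) ≤ C * e ∧ HE 1 6 (log 2) (V n) ≤ C * e := by
  obtain ⟨C0, E, hC0, hE, hb⟩ := slab_bound p
  obtain ⟨C1, hC1, hi⟩ := integral_hyp_slab
  refine ⟨14 * (C1 * C0), E, by positivity, hE, fun {m d U V G W} h hm {N} hN e he heE n => ?_⟩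
  have hb' := fun y hy => hb h hm hN e he heE n y hy
  have he0 : 0 ≤ C1 * C0 * e := mul_nonneg (by positivity) ((datE_nonneg N d).trans he)
  have key {f : St → ℝ} (hf : Sm f) (hfb : ∀ y ∈ slab, jet pd 7 f y ≤ C0 * e) {M : ℝ}
      (hM : M ∈ Set.Icc (0 : ℝ) 1) : HE M 6 (log 2) f ≤ 14 * (C1 * C0) * e := by
    refine (HE_le hf hM 6 _).trans ?_
    have h2 : ∫ x, jet Zf (6 + 1) f (hyp (log 2) x) ≤
        ∫ x, htime (log 2) x ^ 2 * jet Zf 7 f (hyp (log 2) x) := by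
      refine integral_mono ((hf.jet Zf_smooth 7).hyp_integrable _) (hyp_int (hf.jet Zf_smooth 7) _
        ((htime_smooth_right _).continuous.pow 2)) fun x => le_mul_of_one_le_left (jet_nonneg _ _ _) ?_
      have h1 := exp_le_htime (log 2) x
      rw [exp_log two_pos] at h1
      exact one_le_pow₀ (by linarith)
    have := hi f hf _ hfb
    push_cast
    linarith
  have hU : ∀ y ∈ slab, jet pd 7 (U n) y ≤ C0 * e ∧ jet pd 7 (V n) y ≤ C0 * e := fun y hy => by
    have h1 := (hb' y hy).1
    have h2 := jet_mono (X := pd) (show 7 ≤ 10 by norm_num) (U n) y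
    have h3 := jet_mono (X := pd) (show 7 ≤ 10 by norm_num) (V n) y
    have h4 := jet_nonneg (X := pd) 10 (U n) y
    have h5 := jet_nonneg (X := pd) 10 (V n) y
    exact ⟨by linarith, by linarith⟩
  refine ⟨?_, fun α => key ((h.step n).smw α) (fun y hy => (hb' y hy).2.2 α) hm,
    key (h.smu n) (fun y hy => (hU y hy).1) hm,
    key (h.smv n) (fun y hy => (hU y hy).2) (by norm_num)⟩
  have hG := (h.step n).smg
  have hw := (htime_smooth_right (log 2)).continuous.pow 2
  rw [TE_eq hG, show 3 * log 2 = log 2 + log 2 + log 2 by ring, exp_add, exp_add, exp_log two_pos]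
  have h1 : ∫ x, htime (log 2) x ^ 2 * jet Zf 6 (G n) (hyp (log 2) x) ≤
      ∫ x, htime (log 2) x ^ 2 * jet Zf 7 (G n) (hyp (log 2) x) :=
    integral_mono (hyp_int (hG.jet Zf_smooth 6) _ hw) (hyp_int (hG.jet Zf_smooth 7) _ hw) fun x =>
      mul_le_mul_of_nonneg_left (jet_mono (by norm_num) _ _) (sq_nonneg _)
  have := hi _ hG _ fun y hy => (hb' y hy).2.1
  linarith

/-- Uniform energy bound on all hyperboloids for the iterates. -/
lemma energy (p : Par) {δ : ℝ} (hδ : 0 < δ) (hδ' : δ < 1 / 10) : ∃ C E : ℝ, 0 ≤ C ∧ 0 < E ∧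
    ∀ {m d U V G W}, Iter p m d U V G W → m ∈ Set.Icc (0 : ℝ) 1 → ∀ {N : ℕ}, 14 ≤ N →
      ∀ e, datE N d ≤ e → e ≤ E → ∀ n σ, log 2 ≤ σ → En m δ σ (U n) (V n) ≤ C * e := by
  obtain ⟨C0, E, hC0, hE, hi⟩ := initial p
  obtain ⟨C1, hC1, hs⟩ := StepRel.energy p hδ hδ'
  obtain ⟨K, hK⟩ : ∃ K, K = C1 * (C0 + 1) := ⟨_, rfl⟩
  have hK0 : 0 ≤ K := by rw [hK]; positivity
  have hKp : 0 < K ^ 2 + K + 1 := by positivity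
  refine ⟨K, min E (1 / (K ^ 2 + K + 1)), hK0, by positivity,
    fun {m d U V G W} h hm {N} hN e he heE n => ?_⟩
  have he0 := (datE_nonneg N d).trans he
  have h1 := (le_div_iff₀ hKp).1 (heE.trans (min_le_right _ _))
  have hKe : 0 ≤ K * e := by positivity
  have hKe2 : 0 ≤ K ^ 2 * e := by positivity
  have hinit := hi h hm hN e he (heE.trans (min_le_left _ _))
  induction n with
  | zero =>
    intro σ _
    rw [h.u0, h.v0, En_zero]
    positivity
  | succ n ih =>
    intro σ hσ
    have := hs (h.step n) hm (h.smu n) (h.smv n) (by linarith) ih (hinit n).1 (hinit n).2.1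
      (hinit (n + 1)).2.2.1 (hinit (n + 1)).2.2.2 σ hσ
    refine this.trans ?_
    have h2 : (K * e) ^ 2 ≤ e := by
      have := mul_le_mul_of_nonneg_right (by linarith : K ^ 2 * e ≤ 1) he0
      linarith
    have := mul_le_mul_of_nonneg_left h2 hC1
    rw [hK]
    rw [hK] at this
    linarith

end Iter

lemma exists_hyp {y : St} (h : 5 / 2 ≤ y 0) (hr : rad (xs y) ≤ 1 + |y 0 - 2|) :
    ∃ σ, log 2 ≤ σ ∧ hyp σ (xs y) = y ∧ 2 * y 0 - 1 ≤ exp σ ^ 2 ∧ exp σ ≤ y 0 := by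
  rw [abs_of_nonneg (by linarith)] at hr
  have h1 := rad_nonneg (xs y)
  obtain ⟨S, hS⟩ : ∃ S, S = y 0 ^ 2 - rad (xs y) ^ 2 := ⟨_, rfl⟩
  have h2 : 2 * y 0 - 1 ≤ S := by rw [hS]; nlinarith
  have h3 : 0 < S := by linarith
  have h4 : exp (log √S) = √S := exp_log (sqrt_pos.2 h3)
  have h5 : htime (log √S) (xs y) = y 0 := by
    rw [htime, two_mul, exp_add, h4, mul_self_sqrt h3.le, ← rad_sq, hS, sub_add_cancel]
    exact sqrt_sq (by linarith)
  refine ⟨log √S, log_le_log two_pos (le_sqrt_of_sq_le (by linarith)), ?_, ?_, ?_⟩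
  · rw [hyp, h5, spt_xs]
  · rwa [h4, sq_sqrt h3.le]
  · rw [← h5]
    exact exp_le_htime _ _

lemma J1_dx_le_Zf (k : ℕ) (f : St → ℝ) (y : St) : J1 dx k f y ≤ J1 Zf k f y := by
  have h (f : St → ℝ) : jet dx k f y ≤ jet Zf k f y :=
    jsum_subfamily (X := dx) (Y := Zf) (e := Sum.inl ∘ Fin.succ) (Sum.inl_injective.comp (Fin.succ_injective 3))
      (fun _ => rfl) (A := fun g => g y ^ 2) (fun _ => sq_nonneg _) k f
  exact add_le_add (h f) (Finset.sum_le_sum fun α _ => h _)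

lemma En_nonneg (m δ σ : ℝ) (u v : St → ℝ) : 0 ≤ En m δ σ u v :=
  integral_nonneg fun _ => ed_nonneg _ _ _ _ _ _ _

/-- Decay away from the initial slab. -/
lemma point_decay {u v : St → ℝ} (hu : Sm u) (hv : Sm v) {m δ q : ℝ} (hδ : δ ∈ Set.Icc (0 : ℝ) (1 / 2))
    (hq : ∀ σ, log 2 ≤ σ → En m δ σ u v ≤ q) {y : St} (hy : 5 / 2 ≤ y 0) :
    J1 dx 3 u y + J1 dx 3 v y ≤ 1728 * q ∧ y 0 ^ 2 * u y ^ 2 ≤ 864 * q ∧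
      m ^ 2 * (y 0 ^ 3 * u y ^ 2) ≤ 864 * q ∧ y 0 ^ 3 * v y ^ 2 ≤ 864 * q * y 0 ^ (2 * δ) := by
  have hq0 : 0 ≤ q := (En_nonneg _ _ _ _ _).trans (hq (log 2) le_rfl)
  have ht : 0 < y 0 := by linarith
  by_cases hr : 1 + |y 0 - 2| < rad (xs y)
  · have z {f : St → ℝ} (hf : Sm f) : J1 dx 3 f y = 0 :=
      ((hf.jet dx_smooth 3).add (Sm.sum fun α => (hf.pder α).jet dx_smooth 3)).supp y hr
    rw [z hu, z hv, hu.supp y hr, hv.supp y hr]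
    refine ⟨?_, ?_, ?_, ?_⟩ <;> norm_num <;> positivity
  obtain ⟨σ, hσ, hy1, h1, h2⟩ := exists_hyp hy (not_lt.1 hr)
  have e1 := (ed_sup hu hv m δ σ (xs y)).trans (mul_le_mul_of_nonneg_left (hq σ hσ) (by norm_num))
  obtain ⟨T, hT⟩ : ∃ T, T = y 0 := ⟨_, rfl⟩
  have hh : htime σ (xs y) = T := by rw [← hyp_zero, hy1, hT]
  obtain ⟨X, hX⟩ : ∃ X, X = exp (-(2 * δ * σ)) := ⟨_, rfl⟩
  have hX0 : 0 < X := hX ▸ exp_pos _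
  obtain ⟨R, hR⟩ : ∃ R, R = rh σ (xs y) := ⟨_, rfl⟩
  have hR2 : R * T ^ 2 = exp σ ^ 2 := by rw [hR, ← hh, rh_mul]
  rw [← hT] at hy ht h1 h2 ⊢
  have hR0 : 0 ≤ R := hR ▸ rh_nonneg _ _
  have hR1 : R ≤ 1 := by
    have : exp σ ^ 2 ≤ T ^ 2 := by gcongr
    nlinarith [pow_pos ht 2]
  have hσ0 : 0 ≤ σ := (log_nonneg (by norm_num)).trans hσ
  have hXT : 1 ≤ X * T ^ (2 * δ) := by
    have : exp (2 * δ * σ) ≤ T ^ (2 * δ) := by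
      rw [mul_comm, exp_mul]
      exact rpow_le_rpow (exp_pos _).le h2 (by linarith [hδ.1])
    have := mul_le_mul_of_nonneg_left this hX0.le
    rwa [hX, ← exp_add, neg_add_cancel, exp_zero, ← hX] at this
  have hXT1 : 1 ≤ X * T := hXT.trans <| mul_le_mul_of_nonneg_left ((rpow_le_rpow_of_exponent_le
    (by linarith) (by linarith [hδ.2])).trans_eq (rpow_one T)) hX0.le
  have e2 : T ^ 3 * (R * J1 Zf 3 u y + m ^ 2 * jet Zf 3 u y + X * (jet Zf 3 v y + R *
      ∑ α, jet Zf 3 (pder α v) y)) ≤ 864 * q := by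
    rw [ed, hy1, hh, ← hX, ← hR] at e1
    exact e1
  have hs : 0 ≤ ∑ α, jet Zf 3 (pder α v) y := Finset.sum_nonneg fun _ _ => jet_nonneg _ _ _
  have ju := jet_nonneg (X := Zf) 3 u y
  have jv := jet_nonneg (X := Zf) 3 v y
  have Ju := J1_nonneg Zf 3 u y
  have T3 : 0 ≤ T ^ 3 := by positivity
  have a1 : 0 ≤ T ^ 3 * (R * J1 Zf 3 u y) := by positivity
  have a2 : 0 ≤ T ^ 3 * (m ^ 2 * jet Zf 3 u y) := by positivity
  have a3 : 0 ≤ T ^ 3 * (X * jet Zf 3 v y) := by positivity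
  have a4 : 0 ≤ T ^ 3 * (X * (R * ∑ α, jet Zf 3 (pder α v) y)) := by positivity
  have su : u y ^ 2 ≤ jet Zf 3 u y := sq_le_jet _ _ _
  have sv : v y ^ 2 ≤ jet Zf 3 v y := sq_le_jet _ _ _
  have su1 : u y ^ 2 ≤ J1 Zf 3 u y := su.trans (jet_le_J1 _ _ _ _)
  have R1 : 1 ≤ R * T ^ 2 := by rw [hR2]; linarith
  have R2 : T ≤ R * T ^ 2 := by rw [hR2]; linarith
  refine ⟨?_, ?_, ?_, ?_⟩
  · have b1 := J1_dx_le_Zf 3 u y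
    have b2 := J1_dx_le_Zf 3 v y
    have b3 : J1 Zf 3 u y ≤ R * T ^ 2 * T * J1 Zf 3 u y :=
      le_mul_of_one_le_left Ju (by nlinarith)
    have b4 : jet Zf 3 v y ≤ X * T * T ^ 2 * jet Zf 3 v y :=
      le_mul_of_one_le_left jv (by nlinarith)
    have b5 := le_mul_of_one_le_left hs (show 1 ≤ X * T * (R * T ^ 2) by nlinarith)
    have b6 : J1 Zf 3 v y = jet Zf 3 v y + ∑ α, jet Zf 3 (pder α v) y := rfl
    linarith
  · have b1 := mul_le_mul_of_nonneg_left su1 (by positivity : 0 ≤ T ^ 3 * R)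
    have b2 := mul_le_mul_of_nonneg_right R2 (by positivity : 0 ≤ T * u y ^ 2)
    linarith
  · have b1 := mul_le_mul_of_nonneg_left su (by positivity : 0 ≤ T ^ 3 * m ^ 2)
    linarith
  · have b1 := mul_le_mul_of_nonneg_left sv (by positivity : 0 ≤ T ^ 3 * X)
    have b2 := le_mul_of_one_le_left (by positivity : 0 ≤ T ^ 3 * v y ^ 2) hXT
    have b3 := mul_le_mul_of_nonneg_right (show T ^ 3 * X * v y ^ 2 ≤ 864 * q by linarith)
      (rpow_nonneg ht.le (2 * δ))
    linarith

lemma KG_sub (m : ℝ) {f g : St → ℝ} (hf : ContDiff ℝ ∞ f) (hg : ContDiff ℝ ∞ g) (y : St) :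
    KG m (fun y => f y - g y) y = KG m f y - KG m g y := by
  have e : (fun y => f y - g y) = fun y => f y + -1 * g y := by
    funext y
    ring
  rw [e, KG_add m hf (contDiff_const.mul hg), KG_const_mul m _ hg]
  ring

lemma QE_slice_zero {f : St → ℝ} (hf : Sm f) (h0 : ∀ x, f (spt 2 x) = 0)
    (h1 : ∀ x, pder 0 f (spt 2 x) = 0) (k : ℕ) : QE k 2 f = 0 := by
  have h (α : Fin 4) (x : Sp) : jet dx k (pder α f) (spt 2 x) = 0 := by
    refine jet_dx_slice_zero (hf.pder α).1 (fun x => ?_) k x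
    exact Fin.cases (h1 x) (fun a => pder_succ_slice_zero hf.1 h0 a x) α
  rw [QE_eq_J1 hf]
  simp [J1, h, jet_dx_slice_zero hf.1 h0]

namespace Iter
variable {p : Par} {m : ℝ} {d : Dat} {U V G : ℕ → St → ℝ} {W : ℕ → Fin 4 → St → ℝ}

lemma QE_bdd (h : Iter p m d U V G W) (hm : m ∈ Set.Icc (0 : ℝ) 1) {T : ℝ} (hT : 2 ≤ T) (k : ℕ) {K : ℝ}
    (hK : ∀ n y, y 0 ∈ Set.Icc (7 / 4) T → J1 dx (k / 2) (U n) y + J1 dx (k / 2) (V n) y ≤ K) :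
    ∃ B : ℝ, 0 ≤ B ∧ ∀ n t, t ∈ Set.Icc (7 / 4) T → QE k t (U n) + QE k t (V n) ≤ B := by
  obtain ⟨C, hC, hs⟩ := jet_source_tame dx_smooth p k
  have h2 : (2 : ℝ) ∈ Set.Icc (7 / 4) T := ⟨by norm_num, hT⟩
  have hK0 : 0 ≤ K := (add_nonneg (J1_nonneg _ _ _ _) (J1_nonneg _ _ _ _)).trans (hK 0 (spt 2 0) h2)
  obtain ⟨A, hA⟩ : ∃ A, A = C * (K + K ^ 2) := ⟨_, rfl⟩
  have hA0 : 0 ≤ A := by rw [hA]; positivity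
  obtain ⟨Q, hQ⟩ : ∃ Q, Q = 4 ^ (k + 2) * datE k d := ⟨_, rfl⟩
  have hQ0 : 0 ≤ Q := by rw [hQ]; exact mul_nonneg (by positivity) (datE_nonneg _ _)
  have key (n : ℕ) : ∀ t ∈ Set.Icc (7 / 4) T,
      QE k t (U n) + QE k t (V n) ≤ 2 * Q * exp ((4 * A + 3) * |t - 2|) := by
    induction n with
    | zero =>
      intro t _
      rw [h.u0, h.v0, QE_zero, add_zero]
      positivity
    | succ n ih =>
      intro t ht
      refine (flat_pair hm k (h.smu _) (h.smv _) (h.smu n) (h.smv n) (by norm_num) hA0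
        (by positivity) (by linarith) h2 (h.equ n) (h.eqv n) (fun y hy => (hs _ _ (h.smu n).1
        (h.smv n).1 y).trans ?_) ih ht).trans (mul_le_mul_of_nonneg_right ?_ (exp_pos _).le)
      · have a1 := hK n y hy
        have a2 := add_nonneg (J1_nonneg dx (k / 2) (U n) y) (J1_nonneg dx (k / 2) (V n) y)
        have a3 := add_nonneg (J1_nonneg dx k (U n) y) (J1_nonneg dx k (V n) y)
        rw [hA]
        gcongr
      · have a1 := h.QE2 (le_refl k) (n + 1)
        have a2 : A * (2 * Q) / (4 * A + 3 - 2) ≤ Q / 2 := by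
          rw [div_le_iff₀ (by linarith)]
          linarith
        linarith
  refine ⟨2 * Q * exp ((4 * A + 3) * T), by positivity, fun n t ht => (key n t ht).trans ?_⟩
  have : |t - 2| ≤ T := abs_le.2 ⟨by linarith [ht.1], by linarith [ht.2]⟩
  gcongr

lemma J1_bdd (h : Iter p m d U V G W) (hm : m ∈ Set.Icc (0 : ℝ) 1) {T : ℝ} (hT : 2 ≤ T) {K : ℝ}
    (hK : ∀ n y, y 0 ∈ Set.Icc (7 / 4) T → J1 dx 3 (U n) y + J1 dx 3 (V n) y ≤ K) (k : ℕ) :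
    ∃ K : ℝ, ∀ n y, y 0 ∈ Set.Icc (7 / 4) T → J1 dx (k + 3) (U n) y + J1 dx (k + 3) (V n) y ≤ K := by
  induction k with
  | zero => exact ⟨K, hK⟩
  | succ k ih =>
    obtain ⟨S, hS⟩ := ih
    obtain ⟨B, -, hB⟩ := h.QE_bdd hm hT (k + 7) (K := S) fun n y hy => by
      have hk : (k + 7) / 2 ≤ k + 3 := by omega
      exact (add_le_add (J1_mono hk _ _) (J1_mono hk _ _)).trans (hS n y hy)
    refine ⟨216 * ((k + 4 : ℕ) + 1) * B, fun n y hy => ?_⟩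
    have h1 : J1 dx (k + 4) (U n) y ≤ _ := sup_QE (k + 4) (h.smu n) y
    have h2 : J1 dx (k + 4) (V n) y ≤ _ := sup_QE (k + 4) (h.smv n) y
    have h3 := mul_le_mul_of_nonneg_left (hB n _ hy)
      (by positivity : (0 : ℝ) ≤ 216 * ((k + 4 : ℕ) + 1))
    rw [show k + 1 + 3 = k + 4 by ring]
    linarith

lemma diff_J1 (h : Iter p m d U V G W) (hm : m ∈ Set.Icc (0 : ℝ) 1) {T : ℝ} (hT : 2 ≤ T)
    (hJ : ∀ k, ∃ K : ℝ, ∀ n y, y 0 ∈ Set.Icc (7 / 4) T → J1 dx k (U n) y + J1 dx k (V n) y ≤ K) (k : ℕ) :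
    ∃ B : ℝ, 0 ≤ B ∧ ∀ n y, y 0 ∈ Set.Icc (7 / 4) T → J1 dx k (fun y => U (n + 1) y - U n y) y +
      J1 dx k (fun y => V (n + 1) y - V n y) y ≤ B * (1 / 4) ^ n := by
  have h2 : (2 : ℝ) ∈ Set.Icc (7 / 4) T := ⟨by norm_num, hT⟩
  obtain ⟨l, hl⟩ : ∃ l, l = k + 3 := ⟨_, rfl⟩
  obtain ⟨C, hC, hs⟩ := jet_source_diff dx_smooth p l
  obtain ⟨S, hS⟩ := hJ l
  have hS0 : 0 ≤ S := (add_nonneg (J1_nonneg _ _ _ _) (J1_nonneg _ _ _ _)).trans (hS 0 (spt 2 0) h2)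
  obtain ⟨A, hA⟩ : ∃ A, A = C * (S + S ^ 2) := ⟨_, rfl⟩
  have hA0 : 0 ≤ A := by rw [hA]; positivity
  obtain ⟨R, hR⟩ := hJ (l / 2)
  obtain ⟨Q, hQ0, hQ⟩ := h.QE_bdd hm hT l hR
  have bd (n : ℕ) {y : St} (hy : y 0 ∈ Set.Icc (7 / 4) T) : J1 dx l (U n) y ≤ S ∧ J1 dx l (V n) y ≤ S := by
    have := hS n y hy
    have := J1_nonneg dx l (U n) y
    have := J1_nonneg dx l (V n) y
    exact ⟨by linarith, by linarith⟩
  have key (n : ℕ) : ∀ t ∈ Set.Icc (7 / 4) T, QE l t (fun y => U (n + 1) y - U n y) +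
      QE l t (fun y => V (n + 1) y - V n y) ≤ Q * (1 / 4) ^ n * exp ((8 * A + 3) * |t - 2|) := by
    induction n with
    | zero =>
      intro t ht
      simp only [zero_add, h.u0, h.v0, sub_zero, pow_zero, mul_one]
      exact (hQ 1 t ht).trans (le_mul_of_one_le_right hQ0 (one_le_exp (by positivity)))
    | succ n ih =>
      intro t ht
      have su := h.step n
      have su' := h.step (n + 1)
      have z1 := QE_slice_zero ((h.smu (n + 2)).sub (h.smu (n + 1))) (fun x => by rw [su.u2, su'.u2, sub_self])
        (fun x => (congrFun (vf_sub (X := pd 0) (h.smu (n + 2)).1 (h.smu (n + 1)).1) _).trans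
          (sub_eq_zero.2 ((su'.du2 x).trans (su.du2 x).symm))) l
      have z2 := QE_slice_zero ((h.smv (n + 2)).sub (h.smv (n + 1))) (fun x => by rw [su.v2, su'.v2, sub_self])
        (fun x => (congrFun (vf_sub (X := pd 0) (h.smv (n + 2)).1 (h.smv (n + 1)).1) _).trans
          (sub_eq_zero.2 ((su'.dv2 x).trans (su.dv2 x).symm))) l
      refine (flat_pair hm l ((h.smu (n + 2)).sub (h.smu (n + 1))) ((h.smv (n + 2)).sub (h.smv (n + 1)))
        ((h.smu (n + 1)).sub (h.smu n)) ((h.smv (n + 1)).sub (h.smv n)) (by norm_num) hA0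
        (by positivity) (by linarith) h2 (fun y hy => ?_) (fun y hy => ?_) (fun y hy =>
          (hs _ _ _ _ (h.smu (n + 1)).1 (h.smv (n + 1)).1 (h.smu n).1 (h.smv n).1 y S
          (bd _ hy).1 (bd _ hy).2 (bd _ hy).1 (bd _ hy).2).trans_eq (by rw [hA])) ih ht).trans
        (mul_le_mul_of_nonneg_right ?_ (exp_pos _).le)
      · rw [KG_sub m (h.smu _).1 (h.smu _).1, h.equ _ y hy, h.equ _ y hy]
      · rw [KG_sub 1 (h.smv _).1 (h.smv _).1, h.eqv _ y hy, h.eqv _ y hy]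
      · have a0 : 0 ≤ Q * (1 / 4) ^ n := by positivity
        have a2 : A * (Q * (1 / 4) ^ n) / (8 * A + 3 - 2) ≤ Q * (1 / 4) ^ n / 8 := by
          rw [div_le_iff₀ (by linarith)]
          linarith
        rw [z1, z2, pow_succ]
        linarith
  refine ⟨216 * (k + 1) * (Q * exp ((8 * A + 3) * T)), by positivity, fun n y hy => ?_⟩
  have s1 : J1 dx k _ y ≤ _ := sup_QE k ((h.smu (n + 1)).sub (h.smu n)) y
  have s2 : J1 dx k _ y ≤ _ := sup_QE k ((h.smv (n + 1)).sub (h.smv n)) y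
  rw [← hl] at s1 s2
  have hty : |y 0 - 2| ≤ T := abs_le.2 ⟨by linarith [hy.1], by linarith [hy.2]⟩
  have s3 : Q * (1 / 4) ^ n * exp ((8 * A + 3) * |y 0 - 2|) ≤
      Q * (1 / 4) ^ n * exp ((8 * A + 3) * T) := by gcongr
  have s4 := mul_le_mul_of_nonneg_left ((key n _ hy).trans s3) (by positivity : (0 : ℝ) ≤ 216 * (k + 1))
  linarith

lemma diff_pd (h : Iter p m d U V G W) (hm : m ∈ Set.Icc (0 : ℝ) 1) {T : ℝ} (hT : 2 ≤ T)
    (hJ : ∀ k, ∃ K : ℝ, ∀ n y, y 0 ∈ Set.Icc (7 / 4) T → J1 dx k (U n) y + J1 dx k (V n) y ≤ K) (k : ℕ) :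
    ∃ B : ℝ, 0 ≤ B ∧ ∀ n y, y 0 ∈ Set.Icc (7 / 4) T → jet pd k (fun y => U (n + 1) y - U n y) y +
      jet pd k (fun y => V (n + 1) y - V n y) y ≤ B * (1 / 4) ^ n := by
  have h2 : (2 : ℝ) ∈ Set.Icc (7 / 4) T := ⟨by norm_num, hT⟩
  have hpd (k : ℕ) : ∃ C : ℝ, 0 ≤ C ∧ ∀ n y, y 0 ∈ Set.Icc (7 / 4) T →
      jet pd (k + 1) (U n) y + jet pd (k + 1) (V n) y ≤ C := by
    obtain ⟨K, hK⟩ := hJ k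
    obtain ⟨C, hC, hj⟩ := Iter.jet_pd p k K
    have hK0 : 0 ≤ K := (add_nonneg (J1_nonneg _ _ _ _) (J1_nonneg _ _ _ _)).trans (hK 0 (spt 2 0) h2)
    exact ⟨C * K, by positivity, fun n y hy => hj h hm y (by linarith [hy.1]) K le_rfl
      (fun n => hK n y hy) n⟩
  induction k with
  | zero =>
    obtain ⟨B, hB, hb⟩ := h.diff_J1 hm hT hJ 0
    exact ⟨B, hB, fun n y hy => (add_le_add (jet_le_J1 dx 0 _ _) (jet_le_J1 dx 0 _ _)).trans (hb n y hy)⟩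
  | succ k ih =>
    obtain ⟨B, hB, hb⟩ := ih
    obtain ⟨D, hD, hd⟩ := h.diff_J1 hm hT hJ k
    obtain ⟨P, hP, hp⟩ := hpd k
    obtain ⟨C, hC, hj⟩ := jet_pd_of_eq k
    obtain ⟨E, hE, he⟩ : ∃ E : ℝ, 0 ≤ E ∧ ∀ n y, y 0 ∈ Set.Icc (7 / 4) T →
        jetPred k (fun y => Fu p (V (n + 1)) y - Fu p (V n) y) y +
        jetPred k (fun y => Fv p (U (n + 1)) (V (n + 1)) y - Fv p (U n) (V n) y) y ≤ E * (1 / 4) ^ n := by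
      cases k with
      | zero => exact ⟨0, le_rfl, fun n y _ => by simp [jetPred]⟩
      | succ k =>
        obtain ⟨M, hM, hs⟩ := jet_source_diff pd_smooth p k
        obtain ⟨S, hS, hS'⟩ := hpd k
        refine ⟨M * (5 * S + (5 * S) ^ 2) * (5 * B), by positivity, fun n y hy => ?_⟩
        have bd (n : ℕ) : J1 pd k (U n) y ≤ 5 * S ∧ J1 pd k (V n) y ≤ 5 * S := by
          have := hS' n y hy
          have := jet_nonneg (X := pd) (k + 1) (U n) y
          have := jet_nonneg (X := pd) (k + 1) (V n) y
          have := J1_pd_le k (U n) y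
          have := J1_pd_le k (V n) y
          exact ⟨by linarith, by linarith⟩
        refine (hs _ _ _ _ (h.smu (n + 1)).1 (h.smv (n + 1)).1 (h.smu n).1 (h.smv n).1 y _
          (bd _).1 (bd _).2 (bd _).1 (bd _).2).trans ?_
        rw [mul_assoc (M * _)]
        refine mul_le_mul_of_nonneg_left ?_ (by positivity)
        have := J1_pd_le k (fun y => U (n + 1) y - U n y) y
        have := J1_pd_le k (fun y => V (n + 1) y - V n y) y
        have := hb n y hy
        linarith
    refine ⟨P + C * (D + E) * 4, by positivity, fun n y hy => ?_⟩
    have hy' : 3 / 2 < y 0 := by linarith [hy.1]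
    cases n with
    | zero =>
      have := hp 1 y hy
      simp only [zero_add, h.u0, h.v0, sub_zero, pow_zero, mul_one]
      have : 0 ≤ C * (D + E) * 4 := by positivity
      linarith
    | succ n =>
      have j1 := hj m hm _ (fun y => Fu p (V (n + 1)) y - Fu p (V n) y)
        ((h.smu (n + 2)).sub (h.smu (n + 1))).1 (fun y hy => by
          rw [KG_sub m (h.smu _).1 (h.smu _).1, h.equ _ y hy, h.equ _ y hy]) y hy'
      have j2 := hj 1 ⟨zero_le_one, le_rfl⟩ _ (fun y =>
        Fv p (U (n + 1)) (V (n + 1)) y - Fv p (U n) (V n) y) ((h.smv (n + 2)).sub (h.smv (n + 1))).1 (fun y hy => by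
          rw [KG_sub 1 (h.smv _).1 (h.smv _).1, h.eqv _ y hy, h.eqv _ y hy]) y hy'
      have j3 := mul_le_mul_of_nonneg_left (add_le_add (hd (n + 1) y hy) (he n y hy)) hC
      have j4 : 0 ≤ P * (1 / 4) ^ (n + 1) := by positivity
      have j5 : 0 ≤ C * D * (1 / 4) ^ n := by positivity
      rw [pow_succ] at j3 j4 ⊢
      linarith

end Iter
open Filter Topology

/-- Smooth functions on spacetime all of whose derivatives converge geometrically, locally uniformly
in time. -/
def Geo (f : ℕ → St → ℝ) : Prop :=
  (∀ n, ContDiff ℝ ∞ (f n)) ∧ ∀ k T, ∃ C, ∀ n y, y 0 ∈ Set.Icc (7 / 4) T →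
    jet pd k (fun y => f (n + 1) y - f n y) y ≤ C * (1 / 4) ^ n

/-- The pointwise limit. -/
def lim (f : ℕ → St → ℝ) (y : St) : ℝ := limUnder atTop fun n => f n y

namespace Geo
variable {f : ℕ → St → ℝ}

lemma deriv (hf : Geo f) (α : Fin 4) : Geo fun n => pder α (f n) := by
  refine ⟨fun n => pder_smooth (hf.1 n) α, fun k T => ?_⟩
  obtain ⟨C, hC⟩ := hf.2 (k + 1) T
  refine ⟨C, fun n y hy => le_trans ?_ (hC n y hy)⟩
  rw [← pder_sub (hf.1 (n + 1)) (hf.1 n)]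
  exact jet_vf_le (X := pd) k _ y α

lemma rate (hf : Geo f) (T : ℝ) : ∃ C, ∀ y : St, y 0 ∈ Set.Icc (7 / 4) T → ∀ n,
    dist (f n y) (f (n + 1) y) ≤ C * (1 / 2) ^ n := by
  obtain ⟨C, hC⟩ := hf.2 0 T
  refine ⟨√C, fun y hy n => ?_⟩
  have h := hC n y hy
  rw [jet_zero] at h
  rw [dist_comm, Real.dist_eq]
  refine (abs_le_sqrt h).trans_eq ?_
  rw [sqrt_mul' _ (by positivity), show (1 / 4 : ℝ) = (1 / 2) ^ 2 by norm_num, pow_right_comm,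
    sqrt_sq (by positivity)]

lemma tendsto (hf : Geo f) {y : St} (hy : 7 / 4 ≤ y 0) :
    Tendsto (fun n => f n y) atTop (𝓝 (lim f y)) := by
  obtain ⟨C, hC⟩ := hf.rate (y 0)
  exact (cauchySeq_of_le_geometric _ _ (by norm_num) (hC y ⟨hy, le_rfl⟩)).tendsto_limUnder

lemma uniform (hf : Geo f) : TendstoLocallyUniformlyOn f (lim f) atTop {y | 7 / 4 < y 0} := by
  rw [Metric.tendstoLocallyUniformlyOn_iff]
  intro ε hε x hx
  obtain ⟨C, hC⟩ := hf.rate (x 0 + 1)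
  have ht : Tendsto (fun n : ℕ => C * (1 / 2 : ℝ) ^ n / (1 - 1 / 2)) atTop (𝓝 0) := by
    simpa using ((tendsto_pow_atTop_nhds_zero_of_lt_one (by norm_num) (by norm_num :
      (1 / 2 : ℝ) < 1)).const_mul C).div_const (1 - 1 / 2)
  refine ⟨{y | 7 / 4 < y 0} ∩ {y | y 0 < x 0 + 1}, inter_mem self_mem_nhdsWithin
    (mem_nhdsWithin_of_mem_nhds ((isOpen_lt (continuous_apply 0) continuous_const).mem_nhds
      (lt_add_one (x 0)))), ?_⟩
  filter_upwards [ht.eventually (gt_mem_nhds hε)] with n hn y hy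
  rw [dist_comm]
  exact (dist_le_of_le_geometric_of_tendsto _ _ (by norm_num) (hC y ⟨hy.1.le, hy.2.le⟩)
    (hf.tendsto hy.1.le) n).trans_lt hn

lemma hasFDerivAt (hf : Geo f) {y : St} (hy : 7 / 4 < y 0) : HasFDerivAt (lim f)
    (∑ α, lim (fun n => pder α (f n)) y •
      ContinuousLinearMap.proj (R := ℝ) (φ := fun _ : Fin 4 => ℝ) α) y := by
  have h (α : Fin 4) := ((ContinuousLinearMap.toSpanSingleton ℝ
    (ContinuousLinearMap.proj (R := ℝ) (φ := fun _ : Fin 4 => ℝ) α)).uniformContinuous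
      ).comp_tendstoLocallyUniformlyOn (hf.deriv α).uniform
  refine hasFDerivAt_of_tendstoLocallyUniformlyOn (isOpen_time (7 / 4))
    (f' := fun n y => ∑ α, pder α (f n) y •
      ContinuousLinearMap.proj (R := ℝ) (φ := fun _ : Fin 4 => ℝ) α) (g' := fun y => ∑ α,
      lim (fun n => pder α (f n)) y • ContinuousLinearMap.proj (R := ℝ) (φ := fun _ => ℝ) α)
      ?_ (fun n y _ => ?_) (fun y hy => hf.tendsto (le_of_lt hy)) hy
  · simp only [Fin.sum_univ_four]
    exact (((h 0).add (h 1)).add (h 2)).add (h 3)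
  · refine (smooth_diff (hf.1 n) y).hasFDerivAt.congr_fderiv ?_
    ext v
    rw [fderiv_eq_sum_pder]
    simp [mul_comm]

lemma pder_lim (hf : Geo f) (α : Fin 4) {y : St} (hy : 7 / 4 < y 0) :
    pder α (lim f) y = lim (fun n => pder α (f n)) y := by
  rw [pder, (hf.hasFDerivAt hy).fderiv]
  simp [Pi.single_apply]

lemma pder_pder_lim (hf : Geo f) (α β : Fin 4) {y : St} (hy : 7 / 4 < y 0) :
    pder α (pder β (lim f)) y = lim (fun n => pder α (pder β (f n))) y := by
  rw [← (hf.deriv β).pder_lim α hy, pder, pder, Filter.EventuallyEq.fderiv_eq]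
  filter_upwards [(isOpen_time (7 / 4)).mem_nhds hy] with z hz using hf.pder_lim β hz

lemma contDiffOn (hf : Geo f) : ContDiffOn ℝ ∞ (lim f) {y | 2 ≤ y 0} := by
  refine (contDiffOn_infty.2 fun k => ?_ : ContDiffOn ℝ ∞ (lim f) {y | 7 / 4 < y 0}).mono
    fun y (hy : 2 ≤ y 0) => show 7 / 4 < y 0 by linarith
  induction k generalizing f with
  | zero => exact contDiffOn_zero.2 fun y hy => (hf.hasFDerivAt hy).continuousAt.continuousWithinAt
  | succ k ih =>
    push_cast
    refine (contDiffOn_succ_iff_fderiv_of_isOpen (isOpen_time _)).2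
      ⟨fun y hy => (hf.hasFDerivAt hy).differentiableAt.differentiableWithinAt, by simp, ?_⟩
    exact (ContDiffOn.sum fun α _ => (ih (hf.deriv α)).smul contDiffOn_const).congr
      fun y hy => (hf.hasFDerivAt hy).fderiv

lemma tendsto_pder (hf : Geo f) (α : Fin 4) {y : St} (hy : 7 / 4 < y 0) :
    Tendsto (fun n => pder α (f n) y) atTop (𝓝 (pder α (lim f) y)) := by
  rw [hf.pder_lim α hy]
  exact (hf.deriv α).tendsto hy.le

lemma tendsto_KG (hf : Geo f) (m : ℝ) {y : St} (hy : 7 / 4 < y 0) :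
    Tendsto (fun n => KG m (f n) y) atTop (𝓝 (KG m (lim f) y)) := by
  have h (α : Fin 4) : Tendsto (fun n => pder α (pder α (f n)) y) atTop
      (𝓝 (pder α (pder α (lim f)) y)) := by
    rw [hf.pder_pder_lim α α hy]
    exact ((hf.deriv α).deriv α).tendsto hy.le
  exact (((h 0).neg.add (tendsto_finsetSum _ fun a _ => h (Fin.succ a))).neg).add
    ((hf.tendsto hy.le).const_mul _)

lemma tendsto_Fu (hf : Geo f) (p : Par) {y : St} (hy : 7 / 4 < y 0) :
    Tendsto (fun n => Fu p (f n) y) atTop (𝓝 (Fu p (lim f) y)) := by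
  have e (α : Fin 4) : pder α (fun z => lim f z ^ 2) y = 2 * lim f y * pder α (lim f) y := by
    rw [pder, ((hf.hasFDerivAt hy).differentiableAt.hasFDerivAt.pow 2).fderiv]
    simp [pder]
  simp only [Fu, e, pder_sq (hf.1 _)]
  exact (((hf.tendsto hy.le).pow 3).const_mul _).add (tendsto_finsetSum _ fun α _ =>
    (((hf.tendsto hy.le).const_mul 2).mul (hf.tendsto_pder α hy)).const_mul _)

lemma tendsto_Fv (hf : Geo f) {g : ℕ → St → ℝ} (hg : Geo g) (p : Par) {y : St} (hy : 7 / 4 < y 0) :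
    Tendsto (fun n => Fv p (f n) (g n) y) atTop (𝓝 (Fv p (lim f) (lim g) y)) :=
  ((((hf.tendsto_pder 0 hy).pow 2).const_mul _).add (((hf.tendsto hy.le).pow 3).const_mul _)).add
    (((hf.tendsto hy.le).const_mul _).mul (hg.tendsto hy.le))

end Geo

namespace Iter
variable {p : Par} {m : ℝ} {d : Dat} {U V G : ℕ → St → ℝ} {W : ℕ → Fin 4 → St → ℝ}

lemma geo (h : Iter p m d U V G W) (hm : m ∈ Set.Icc (0 : ℝ) 1) {K : ℝ}
    (hK : ∀ n y, 7 / 4 ≤ y 0 → J1 dx 3 (U n) y + J1 dx 3 (V n) y ≤ K) : Geo U ∧ Geo V := by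
  have key (k : ℕ) (T : ℝ) : ∃ B : ℝ, 0 ≤ B ∧ ∀ n y, y 0 ∈ Set.Icc (7 / 4) T →
      jet pd k (fun y => U (n + 1) y - U n y) y +
      jet pd k (fun y => V (n + 1) y - V n y) y ≤ B * (1 / 4) ^ n := by
    have hT : 2 ≤ max T 2 := le_max_right _ _
    obtain ⟨B, hB, hb⟩ := h.diff_pd hm hT (fun k => by
      obtain ⟨K, hK⟩ := h.J1_bdd hm hT (fun n y hy => hK n y hy.1) k
      exact ⟨K, fun n y hy => (add_le_add (J1_mono (by lia) _ _)
        (J1_mono (by lia) _ _)).trans (hK n y hy)⟩) k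
    exact ⟨B, hB, fun n y hy => hb n y ⟨hy.1, hy.2.trans (le_max_left _ _)⟩⟩
  refine ⟨⟨fun n => (h.smu n).1, fun k T => ?_⟩, ⟨fun n => (h.smv n).1, fun k T => ?_⟩⟩ <;>
    obtain ⟨B, hB, hb⟩ := key k T <;> refine ⟨B, fun n y hy => le_trans ?_ (hb n y hy)⟩
  · exact le_add_of_nonneg_right (jet_nonneg _ _ _)
  · exact le_add_of_nonneg_left (jet_nonneg _ _ _)

/-- Uniform bounds on the iterates. -/
lemma decay (p : Par) {δ : ℝ} (hδ : 0 < δ) (hδ' : δ < 1 / 10) : ∃ A E : ℝ, 0 ≤ A ∧ 0 < E ∧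
    ∀ {m d U V G W}, Iter p m d U V G W → m ∈ Set.Icc (0 : ℝ) 1 → ∀ {N : ℕ}, 14 ≤ N →
      datE N d ≤ E → ∀ n y, 7 / 4 ≤ y 0 → J1 dx 3 (U n) y + J1 dx 3 (V n) y ≤ A ∧
        (2 ≤ y 0 → y 0 ^ 2 * U n y ^ 2 ≤ A ∧ m ^ 2 * (y 0 ^ 3 * U n y ^ 2) ≤ A ∧
          y 0 ^ 3 * V n y ^ 2 ≤ A * y 0 ^ (2 * δ)) := by
  obtain ⟨C1, E1, hC1, hE1, h1⟩ := slab_bound p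
  obtain ⟨C2, E2, hC2, hE2, h2⟩ := energy p hδ hδ'
  obtain ⟨K, hK⟩ : ∃ K, K = C1 * min E1 E2 := ⟨_, rfl⟩
  obtain ⟨q, hq⟩ : ∃ q, q = C2 * min E1 E2 := ⟨_, rfl⟩
  have hK0 : 0 ≤ K := by rw [hK]; positivity
  have hq0 : 0 ≤ q := by rw [hq]; positivity
  refine ⟨27 * K + 1728 * q, min E1 E2, by positivity, lt_min hE1 hE2,
    fun {m d U V G W} h hm {N} hN hd n y hy => ?_⟩
  by_cases hy' : y 0 ≤ 5 / 2
  · have hb := (h1 h hm hN _ hd (min_le_left _ _) n y ⟨hy, by linarith⟩).1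
    rw [← hK] at hb
    have ju := jet_nonneg (X := pd) 10 (U n) y
    have jv := jet_nonneg (X := pd) 10 (V n) y
    refine ⟨?_, fun h2 => ?_⟩
    · have e {f : St → ℝ} : J1 dx 3 f y ≤ 5 * jet pd 10 f y :=
        (add_le_add (jet_dx_le_pd 3 f y) (Finset.sum_le_sum fun _ _ => jet_dx_le_pd 3 _ y)).trans
          ((J1_pd_le 3 f y).trans (by gcongr; exact jet_mono (by norm_num) f y))
      have := e (f := U n)
      have := e (f := V n)
      linarith
    · have su : U n y ^ 2 ≤ K := (sq_le_jet (X := pd) 10 (U n) y).trans (by linarith)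
      have sv : V n y ^ 2 ≤ K := (sq_le_jet (X := pd) 10 (V n) y).trans (by linarith)
      have m2 : m ^ 2 ≤ 1 := pow_le_one₀ hm.1 hm.2
      have t2 : y 0 ^ 2 ≤ 27 := by nlinarith
      have t3 : y 0 ^ 3 ≤ 27 := (pow_le_pow_left₀ (by linarith) (by linarith : y 0 ≤ 3) 3).trans_eq
        (by norm_num)
      have p3 : 0 ≤ y 0 ^ 3 := by positivity
      have a1 := mul_le_mul t2 su (sq_nonneg _) (by norm_num)
      have a2 := mul_le_mul t3 su (sq_nonneg _) (by norm_num)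
      have a3 := mul_le_mul t3 sv (sq_nonneg _) (by norm_num)
      have a4 := mul_le_of_le_one_left (mul_nonneg p3 (sq_nonneg (U n y))) m2
      have a5 := le_mul_of_one_le_right (by positivity : 0 ≤ 27 * K + 1728 * q)
        (one_le_rpow (by linarith : 1 ≤ y 0) (by linarith : 0 ≤ 2 * δ))
      exact ⟨by linarith, by linarith, by linarith⟩
  · obtain ⟨a1, a2, a3, a4⟩ := point_decay (h.smu n) (h.smv n) ⟨hδ.le, by linarith⟩
      (h2 h hm hN _ hd (min_le_right _ _) n) (not_le.1 hy').le
    rw [← hq] at a1 a2 a3 a4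
    exact ⟨by linarith, fun _ => ⟨by linarith, by linarith, a4.trans (by gcongr; linarith)⟩⟩

end Iter

lemma abs_le_of_decay {A m t u : ℝ} (hm : 0 ≤ m) (ht : 2 ≤ t) (h1 : t ^ 2 * u ^ 2 ≤ A)
    (h2 : m ^ 2 * (t ^ 3 * u ^ 2) ≤ A) : |u| ≤ (2 * √A + 1) / (t + m * t ^ ((3 : ℝ) / 2)) := by
  have ht0 : 0 < t := by linarith
  have e : (t ^ ((3 : ℝ) / 2)) ^ 2 = t ^ 3 := by
    rw [← rpow_natCast, ← rpow_mul ht0.le, ← rpow_natCast]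
    norm_num
  have a1 : |t * u| ≤ √A := abs_le_sqrt (by rwa [mul_pow])
  have a2 : |m * t ^ ((3 : ℝ) / 2) * u| ≤ √A := abs_le_sqrt (by
    rwa [mul_pow, mul_pow, e, mul_assoc])
  rw [abs_mul, abs_of_nonneg (by positivity)] at a1 a2
  rw [le_div_iff₀ (by positivity)]
  linarith

lemma abs_le_of_decay' {A δ t v : ℝ} (hA : 0 ≤ A) (ht : 2 ≤ t) (h : t ^ 3 * v ^ 2 ≤ A * t ^ (2 * δ)) :
    |v| ≤ (2 * √A + 1) * t ^ (-(3 : ℝ) / 2 + δ) := by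
  have ht0 : 0 < t := by linarith
  obtain ⟨w, hw⟩ : ∃ w, w = t ^ (-(3 : ℝ) / 2 + δ) := ⟨_, rfl⟩
  have hw0 : 0 < w := by rw [hw]; positivity
  have e : t ^ (2 * δ) = t ^ 3 * w ^ 2 := by
    rw [hw, ← rpow_natCast, ← rpow_natCast, ← rpow_mul ht0.le, ← rpow_add ht0]
    congr 1
    push_cast
    ring
  rw [e, mul_left_comm, mul_le_mul_iff_right₀ (by positivity)] at h
  rw [← hw]
  refine (abs_le_sqrt h).trans ?_
  rw [sqrt_mul hA, sqrt_sq hw0.le]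
  gcongr
  linarith [sqrt_nonneg A]

lemma datE_le {N : ℕ} {d : Dat} {ε : ℝ} (h : sobNorm (N + 1) d.u0 + sobNorm (N + 1) d.v0 +
    sobNorm N d.u1 + sobNorm N d.v1 ≤ ε) : datE N d ≤ ε ^ 2 := by
  have s (k : ℕ) (g : Sp → ℝ) : 0 ≤ sobNorm k g ∧ sobNorm k g ^ 2 = sobNormSq k g :=
    ⟨sqrt_nonneg _, sq_sqrt (sobNormSq_nonneg k g)⟩
  obtain ⟨a, a'⟩ := s (N + 1) d.u0
  obtain ⟨b, b'⟩ := s (N + 1) d.v0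
  obtain ⟨c, c'⟩ := s N d.u1
  obtain ⟨e, e'⟩ := s N d.v1
  refine le_trans ?_ (pow_le_pow_left₀ (by positivity) h 2)
  rw [datE, ← a', ← b', ← c', ← e']
  nlinarith [mul_nonneg a b, mul_nonneg a c, mul_nonneg a e, mul_nonneg b c, mul_nonneg b e,
    mul_nonneg c e]

/-- Global existence of solutions with small data. -/
theorem exists_global_solution (p : Par) {δ : ℝ} (hδ : 0 < δ) (hδ' : δ < 1 / 10) : ∃ C E : ℝ, 0 < C ∧ 0 < E ∧
    ∀ {m : ℝ}, m ∈ Set.Icc (0 : ℝ) 1 → ∀ {N : ℕ}, 14 ≤ N → ∀ d, datE N d ≤ E → ∃ u v : St → ℝ,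
      ContDiffOn ℝ ∞ u {y | 2 ≤ y 0} ∧ ContDiffOn ℝ ∞ v {y | 2 ≤ y 0} ∧
      (∀ y, 2 < y 0 → KG m u y = Fu p v y) ∧ (∀ y, 2 < y 0 → KG 1 v y = Fv p u v y) ∧
      (∀ x, u (spt 2 x) = d.u0 x) ∧ (∀ x, v (spt 2 x) = d.v0 x) ∧
      (∀ x, pder 0 u (spt 2 x) = d.u1 x) ∧ (∀ x, pder 0 v (spt 2 x) = d.v1 x) ∧
      ∀ y, 2 ≤ y 0 → |u y| ≤ C / (y 0 + m * y 0 ^ ((3 : ℝ) / 2)) ∧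
        |v y| ≤ C * y 0 ^ (-(3 : ℝ) / 2 + δ) := by
  obtain ⟨A, E, hA, hE, hd⟩ := Iter.decay p hδ hδ'
  refine ⟨2 * √A + 1, E, by positivity, hE, fun {m} hm {N} hN d hdE => ?_⟩
  obtain ⟨U, V, G, W, h⟩ := exists_iter p m d
  have hb := hd h hm hN hdE
  obtain ⟨gu, gv⟩ := h.geo hm fun n y hy => (hb n y hy).1
  have slice {f : ℕ → St → ℝ} {y : St} {c l : ℝ} (hf : Tendsto (fun n => f n y) atTop (𝓝 l))
      (h : ∀ n, f (n + 1) y = c) : l = c :=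
    tendsto_nhds_unique (hf.comp (tendsto_add_atTop_nat 1)) (tendsto_const_nhds.congr fun n => (h n).symm)
  have h2 (x : Sp) : 7 / 4 < spt 2 x 0 := by
    change (7 / 4 : ℝ) < 2
    norm_num
  refine ⟨lim U, lim V, gu.contDiffOn, gv.contDiffOn, fun y hy => ?_, fun y hy => ?_,
    fun x => slice (gu.tendsto (h2 x).le) fun n => (h.step n).u2 x,
    fun x => slice (gv.tendsto (h2 x).le) fun n => (h.step n).v2 x,
    fun x => slice (gu.tendsto_pder 0 (h2 x)) fun n => (h.step n).du2 x,
    fun x => slice (gv.tendsto_pder 0 (h2 x)) fun n => (h.step n).dv2 x, fun y hy => ?_⟩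
  · exact tendsto_nhds_unique ((gu.tendsto_KG m (by linarith)).comp (tendsto_add_atTop_nat 1))
      ((gv.tendsto_Fu p (by linarith)).congr fun n =>
        (h.equ n y (by linarith)).symm)
  · exact tendsto_nhds_unique ((gv.tendsto_KG 1 (by linarith)).comp (tendsto_add_atTop_nat 1))
      ((gu.tendsto_Fv gv p (by linarith)).congr fun n =>
        (h.eqv n y (by linarith)).symm)
  · have hy' : 7 / 4 ≤ y 0 := by linarith
    have tu := (gu.tendsto hy').pow 2
    have tv := (gv.tendsto hy').pow 2
    exact ⟨abs_le_of_decay hm.1 hy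
      (le_of_tendsto' (tu.const_mul _) fun n => ((hb n y hy').2 hy).1)
      (le_of_tendsto' ((tu.const_mul _).const_mul _) fun n => ((hb n y hy').2 hy).2.1),
      abs_le_of_decay' hA hy (le_of_tendsto' (tv.const_mul _) fun n => ((hb n y hy').2 hy).2.2)⟩

end WKG

/-- Global existence and unified decay for the wave–Klein-Gordon system
`-□u + m²u = M₁v³ + Pᵅ∂_α(v²)`, `-□v + v = N₁(∂ₜu)² + N₂u³ + N₃uv` with mass `m ∈ [0,1]`. -/
theorem zero_mass_global_existence_unified_decay
    (N : ℕ) (hN : 14 ≤ N) (δ : ℝ) (hδ₁ : 0 < δ) (hδ₂ : δ < 1/10)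
    (M₁ N₁ N₂ N₃ : ℝ) (P : Fin 4 → ℝ) :
    ∃ ε₀ C : ℝ, 0 < ε₀ ∧ 0 < C ∧
      ∀ m : ℝ, m ∈ Set.Icc (0:ℝ) 1 →
      ∀ ε : ℝ, ε ∈ Set.Ioo 0 ε₀ →
      ∀ u₀ v₀ u₁ v₁ : (Fin 3 → ℝ) → ℝ,
        ContDiff ℝ (⊤ : ℕ∞) u₀ → ContDiff ℝ (⊤ : ℕ∞) v₀ →
        ContDiff ℝ (⊤ : ℕ∞) u₁ → ContDiff ℝ (⊤ : ℕ∞) v₁ →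
        (∀ x, 1 < rad x → u₀ x = 0) → (∀ x, 1 < rad x → v₀ x = 0) →
        (∀ x, 1 < rad x → u₁ x = 0) → (∀ x, 1 < rad x → v₁ x = 0) →
        sobNorm (N+1) u₀ + sobNorm (N+1) v₀ + sobNorm N u₁ + sobNorm N v₁ ≤ ε →
        ∃ u v : (Fin 4 → ℝ) → ℝ,
          ContDiffOn ℝ (⊤ : ℕ∞) u {y | 2 ≤ y 0} ∧ ContDiffOn ℝ (⊤ : ℕ∞) v {y | 2 ≤ y 0} ∧
          (∀ y : Fin 4 → ℝ, 2 < y 0 →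
            - Box u y + m^2 * u y
              = M₁ * (v y)^3 + ∑ α : Fin 4, P α * pder α (fun z => (v z)^2) y) ∧
          (∀ y : Fin 4 → ℝ, 2 < y 0 →
            - Box v y + v y
              = N₁ * (pder 0 u y)^2 + N₂ * (u y)^3 + N₃ * (u y) * (v y)) ∧
          (∀ x, u (spt 2 x) = u₀ x) ∧ (∀ x, v (spt 2 x) = v₀ x) ∧
          (∀ x, pder 0 u (spt 2 x) = u₁ x) ∧ (∀ x, pder 0 v (spt 2 x) = v₁ x) ∧
          (∀ y : Fin 4 → ℝ, 2 ≤ y 0 →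
            |u y| ≤ C / (y 0 + m * (y 0) ^ ((3:ℝ)/2)) ∧
            |v y| ≤ C * (y 0) ^ (-(3:ℝ)/2 + δ)) := by
  obtain ⟨C, E, hC, hE, h⟩ := WKG.exists_global_solution ⟨M₁, N₁, N₂, N₃, P⟩ hδ₁ hδ₂
  refine ⟨√E, C, sqrt_pos.2 hE, hC, fun m hm ε hε u₀ v₀ u₁ v₁ hu₀ hv₀ hu₁ hv₁ su₀ sv₀ su₁ sv₁ hs => ?_⟩
  have hεE : ε ^ 2 ≤ E := (le_sqrt hε.1.le hE.le).1 hε.2.le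
  obtain ⟨u, v, su, sv, eu, ev, hd⟩ := h hm hN ⟨u₀, v₀, u₁, v₁, ⟨hu₀, su₀⟩, ⟨hv₀, sv₀⟩, ⟨hu₁, su₁⟩,
    ⟨hv₁, sv₁⟩⟩ ((WKG.datE_le (d := ⟨u₀, v₀, u₁, v₁, ⟨hu₀, su₀⟩, ⟨hv₀, sv₀⟩, ⟨hu₁, su₁⟩,
    ⟨hv₁, sv₁⟩⟩) hs).trans hεE)
  refine ⟨u, v, su, sv, eu, fun y hy => ?_, hd⟩
  have := ev y hy
  rwa [WKG.KG, one_pow, one_mul] at this
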